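/- Let a, b > 0 be constants with a + b < 1/2. Then there exist a constant C > 0 and a threshold N₀ such that for all positive integers m, s, n, t with m, n ≥ N₀, ms = nt, λ = s/n = t/m satisfying ((1+2λ)²/(4λ(1+λ)))·(1 + 5m/(6n) + 5n/(6m)) ≤ a·log n and additionally mn/λ² ≤ 1, one has M(m,s;n,t) = (λ + 1/2)^{(m−1)(n−1)} · (mn)! / ( (m!)^n (n!)^m ) · exp(1/2 + E) with |E| ≤ C·(mn/λ² + n^{−b}). -/

import Mathlib

open Real

/-- `M(m,s;n,t)`: the number of `m × n` matrices with nonnegative integer entries whose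
rows each sum to `s` and whose columns each sum to `t`. -/
noncomputable def matCount (m s n t : ℕ) : ℕ :=
  Nat.card {A : Fin m → Fin n → ℕ // (∀ j, ∑ k, A j k = s) ∧ (∀ k, ∑ j, A j k = t)}

section FourierIdentity

open MeasureTheory Filter Topology Finset

instance instProbUnitAddCircle : IsProbabilityMeasure (volume : Measure UnitAddCircle) :=
  ⟨UnitAddCircle.measure_univ⟩

lemma integral_fourier_unit (k : ℤ) :
    ∫ x : UnitAddCircle, fourier k x = if k = 0 then (1 : ℂ) else 0 := by
  by_cases hk : k = 0
  · subst hk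
    simp
  · rw [if_neg hk]
    have h := integral_eq_zero_of_add_right_eq_neg (μ := (volume : Measure UnitAddCircle))
      (f := fun x => fourier k x) (g := ((1 / 2 / k : ℝ) : UnitAddCircle)) ?_
    · exact h
    · intro x
      have := fourier_add_half_inv_index (T := 1) (n := k) hk one_pos x
      simpa using this

lemma fourier_one_pow (a : ℕ) (x : UnitAddCircle) :
    (fourier 1 x : ℂ) ^ a = fourier (a : ℤ) x := by
  induction a with
  | zero => simp
  | succ a ih => rw [pow_succ, ih, ← fourier_add]; push_cast; rfl

lemma matCount_eq_card_filter (m s n t K : ℕ) (hK : s < K) :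
    matCount m s n t = #{A ∈ Fintype.piFinset (fun _ : Fin m × Fin n => Finset.range K) |
      (∀ j, ∑ k, A (j, k) = s) ∧ (∀ k, ∑ j, A (j, k) = t)} := by
  classical
  unfold matCount
  rw [← Nat.card_eq_finsetCard]
  refine Nat.card_congr ((Equiv.curry (Fin m) (Fin n) ℕ).symm.subtypeEquiv ?_)
  intro A
  simp only [Equiv.curry_symm_apply, Finset.mem_filter, Fintype.mem_piFinset, Finset.mem_range,
    Function.uncurry_apply_pair]
  constructor
  · intro h
    refine ⟨fun p => ?_, h⟩
    have : A p.1 p.2 ≤ s := by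
      rw [← h.1 p.1]
      exact Finset.single_le_sum (f := fun k => A p.1 k) (fun _ _ => Nat.zero_le _)
        (Finset.mem_univ p.2)
    exact lt_of_le_of_lt this hK
  · exact fun h => h.2

lemma truncated_fourier_identity (m s n t K : ℕ) (hK : s < K) (q : ℂ) :
    ∫ p : (Fin m → UnitAddCircle) × (Fin n → UnitAddCircle),
      (∏ i : Fin m × Fin n, ∑ a ∈ Finset.range K, (q * fourier 1 (p.1 i.1 + p.2 i.2)) ^ a) *
        ((∏ j, fourier (-(s : ℤ)) (p.1 j)) * ∏ k, fourier (-(t : ℤ)) (p.2 k)) =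
    matCount m s n t * q ^ (m * s) := by
  classical
  have key : ∀ p : (Fin m → UnitAddCircle) × (Fin n → UnitAddCircle),
      (∏ i : Fin m × Fin n, ∑ a ∈ Finset.range K, (q * fourier 1 (p.1 i.1 + p.2 i.2)) ^ a) *
        ((∏ j, fourier (-(s : ℤ)) (p.1 j)) * ∏ k, fourier (-(t : ℤ)) (p.2 k)) =
      ∑ A ∈ Fintype.piFinset (fun _ : Fin m × Fin n => Finset.range K),
        q ^ (∑ i, A i) * ((∏ j, fourier (((∑ k, A (j, k) : ℕ) : ℤ) - s) (p.1 j)) *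
          ∏ k, fourier (((∑ j, A (j, k) : ℕ) : ℤ) - t) (p.2 k)) := by
    intro p
    rw [Finset.prod_univ_sum, Finset.sum_mul]
    refine Finset.sum_congr rfl fun A _ => ?_
    have h1 : ∀ i : Fin m × Fin n, (q * fourier 1 (p.1 i.1 + p.2 i.2) : ℂ) ^ A i =
        q ^ A i * (fourier 1 (p.1 i.1) ^ A i * fourier 1 (p.2 i.2) ^ A i) := by
      intro i
      rw [mul_pow, ← mul_pow (fourier 1 (p.1 i.1) : ℂ)]
      congr 2
      simp [fourier_apply, AddCircle.toCircle_add]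
    simp_rw [h1]
    rw [Finset.prod_mul_distrib, Finset.prod_mul_distrib, Finset.prod_pow_eq_pow_sum]
    have h2 : ∏ i : Fin m × Fin n, (fourier 1 (p.1 i.1) : ℂ) ^ A i =
        ∏ j, fourier ((∑ k, A (j, k) : ℕ) : ℤ) (p.1 j) := by
      rw [Fintype.prod_prod_type]
      refine Finset.prod_congr rfl fun j _ => ?_
      simp only
      rw [Finset.prod_pow_eq_pow_sum, fourier_one_pow]
    have h3 : ∏ i : Fin m × Fin n, (fourier 1 (p.2 i.2) : ℂ) ^ A i =
        ∏ k, fourier ((∑ j, A (j, k) : ℕ) : ℤ) (p.2 k) := by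
      rw [Fintype.prod_prod_type_right]
      refine Finset.prod_congr rfl fun k _ => ?_
      simp only
      rw [Finset.prod_pow_eq_pow_sum, fourier_one_pow]
    rw [h2, h3]
    simp_rw [sub_eq_add_neg, fourier_add]
    rw [Finset.prod_mul_distrib, Finset.prod_mul_distrib]
    ring
  simp_rw [key]
  have hInt : ∀ A : Fin m × Fin n → ℕ, ∫ p : (Fin m → UnitAddCircle) × (Fin n → UnitAddCircle),
        q ^ (∑ i, A i) * ((∏ j, fourier (((∑ k, A (j, k) : ℕ) : ℤ) - s) (p.1 j)) *
          ∏ k, fourier (((∑ j, A (j, k) : ℕ) : ℤ) - t) (p.2 k)) =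
      if (∀ j, ∑ k, A (j, k) = s) ∧ (∀ k, ∑ j, A (j, k) = t) then q ^ (m * s) else 0 := by
    intro A
    rw [integral_const_mul]
    erw [integral_prod_mul (μ := (volume : Measure (Fin m → UnitAddCircle)))
      (ν := (volume : Measure (Fin n → UnitAddCircle)))
      (fun x => ∏ j, (fourier (((∑ k, A (j, k) : ℕ) : ℤ) - s) (x j) : ℂ))
      (fun y => ∏ k, (fourier (((∑ j, A (j, k) : ℕ) : ℤ) - t) (y k) : ℂ))]
    rw [integral_fintype_prod_volume_eq_prod
      (fun j (x : UnitAddCircle) => (fourier (((∑ k, A (j, k) : ℕ) : ℤ) - s) x : ℂ)),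
      integral_fintype_prod_volume_eq_prod
      (fun k (x : UnitAddCircle) => (fourier (((∑ j, A (j, k) : ℕ) : ℤ) - t) x : ℂ))]
    simp_rw [integral_fourier_unit, sub_eq_zero, Nat.cast_inj]
    rw [Finset.prod_ite_zero, Finset.prod_ite_zero]
    simp only [Finset.mem_univ, forall_const, Finset.prod_const_one]
    by_cases h1 : ∀ j, ∑ k, A (j, k) = s
    · by_cases h2 : ∀ k, ∑ j, A (j, k) = t
      · rw [if_pos h1, if_pos h2, if_pos ⟨h1, h2⟩]
        rw [Fintype.sum_prod_type]
        simp [h1]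
      · rw [if_neg h2, if_neg (mt And.right h2)]; simp
    · rw [if_neg h1, if_neg (mt And.left h1)]; simp
  rw [integral_finsetSum]
  · simp_rw [hInt]
    rw [← Finset.sum_filter, Finset.sum_const, matCount_eq_card_filter m s n t K hK, nsmul_eq_mul]
  · intro A _
    refine Continuous.integrable_of_hasCompactSupport ?_ (HasCompactSupport.of_compactSpace _)
    fun_prop

lemma fourier_one_norm (x : UnitAddCircle) : ‖(fourier 1 x : ℂ)‖ = 1 := by
  rw [fourier_apply]; exact Circle.norm_coe _

lemma fourier_identity_geom (m s n t : ℕ) (q : ℝ) (hq0 : 0 ≤ q) (hq1 : q < 1) :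
    ∫ p : (Fin m → UnitAddCircle) × (Fin n → UnitAddCircle),
      (∏ i : Fin m × Fin n, (1 - (q : ℂ) * fourier 1 (p.1 i.1 + p.2 i.2))⁻¹) *
        ((∏ j, fourier (-(s : ℤ)) (p.1 j)) * ∏ k, fourier (-(t : ℤ)) (p.2 k)) =
    matCount m s n t * (q : ℂ) ^ (m * s) := by
  have hn : ∀ x : UnitAddCircle, ‖(q : ℂ) * fourier 1 x‖ = q := by
    intro x
    rw [norm_mul, fourier_one_norm, mul_one, Complex.norm_real, Real.norm_of_nonneg hq0]
  refine tendsto_nhds_unique (l := atTop) (f := fun K : ℕ => 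
    ∫ p : (Fin m → UnitAddCircle) × (Fin n → UnitAddCircle),
      (∏ i : Fin m × Fin n, ∑ a ∈ Finset.range K, ((q : ℂ) * fourier 1 (p.1 i.1 + p.2 i.2)) ^ a) *
        ((∏ j, fourier (-(s : ℤ)) (p.1 j)) * ∏ k, fourier (-(t : ℤ)) (p.2 k))) ?_ ?_
  · refine tendsto_integral_of_dominated_convergence
      (fun _ => ∏ i : Fin m × Fin n, (1 - q)⁻¹) ?_ ?_ ?_ ?_
    · intro K
      refine Continuous.aestronglyMeasurable ?_
      fun_prop
    · exact integrable_const _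
    · intro K
      refine Eventually.of_forall fun p => ?_
      rw [norm_mul, norm_mul, norm_prod, norm_prod, norm_prod]
      have e1 : ∏ j, ‖(fourier (-(s : ℤ)) (p.1 j) : ℂ)‖ = 1 := by
        refine Finset.prod_eq_one fun j _ => ?_
        rw [fourier_apply]; exact Circle.norm_coe _
      have e2 : ∏ k, ‖(fourier (-(t : ℤ)) (p.2 k) : ℂ)‖ = 1 := by
        refine Finset.prod_eq_one fun j _ => ?_
        rw [fourier_apply]; exact Circle.norm_coe _
      rw [e1, e2, one_mul, mul_one]
      refine Finset.prod_le_prod (fun _ _ => norm_nonneg _) fun i _ => ?_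
      refine (norm_sum_le _ _).trans ?_
      simp_rw [norm_pow, hn]
      rw [← tsum_geometric_of_lt_one hq0 hq1]
      exact (summable_geometric_of_lt_one hq0 hq1).sum_le_tsum _ (fun _ _ => pow_nonneg hq0 _)
    · refine Eventually.of_forall fun p => ?_
      refine Tendsto.mul_const _ (tendsto_finsetProd _ fun i _ => ?_)
      exact (hasSum_geometric_of_norm_lt_one (by rw [hn]; exact hq1)).tendsto_sum_nat
  · refine tendsto_const_nhds.congr' ?_
    filter_upwards [eventually_gt_atTop s] with K hK
    rw [truncated_fourier_identity m s n t K hK]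

end FourierIdentity

section Tail

open MeasureTheory Filter Topology Finset
open scoped ENNReal NNReal

lemma lintegral_pi_insertNth {α : Type*} [MeasureSpace α] [SigmaFinite (volume : Measure α)]
    {n : ℕ} (k : Fin (n + 1)) (F : (Fin (n + 1) → α) → ℝ≥0∞) (hF : Measurable F) :
    ∫⁻ y, F y = ∫⁻ u : α, ∫⁻ y' : Fin n → α, F (k.insertNth u y') := by
  have h := (volume_preserving_piFinSuccAbove (fun _ : Fin (n + 1) => α) k).symm
  rw [← h.lintegral_comp_emb (MeasurableEquiv.measurableEmbedding _)]
  rw [Measure.volume_eq_prod, lintegral_prod]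
  · rfl
  · exact (hF.comp (MeasurableEquiv.measurable _)).aemeasurable

lemma lintegral_pi_fin_prod {α : Type*} [MeasureSpace α] [SigmaFinite (volume : Measure α)]
    {n : ℕ} (f : Fin n → α → ℝ≥0∞) (hf : ∀ j, Measurable (f j)) :
    ∫⁻ y : Fin n → α, ∏ j, f j (y j) = ∏ j, ∫⁻ u, f j u := by
  induction n with
  | zero => simp [volume_pi]
  | succ n ih =>
    rw [lintegral_pi_insertNth 0 _ (by fun_prop)]
    simp only [Fin.prod_univ_succ, Fin.insertNth_zero', Fin.cons_zero, Fin.cons_succ]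
    have : ∀ u : α, ∫⁻ y' : Fin n → α, f 0 u * ∏ j : Fin n, f j.succ (y' j) =
        f 0 u * ∏ j : Fin n, ∫⁻ v, f j.succ v := by
      intro u
      rw [lintegral_const_mul _ (by fun_prop), ih _ (fun j => hf _)]
    simp_rw [this]
    rw [lintegral_mul_const _ (hf 0)]

/-- The integral of `∏ g (x j + y k)` over the whole torus. -/
noncomputable def kernelInt (g : UnitAddCircle → ℝ≥0) (m n : ℕ) : ℝ≥0∞ :=
  ∫⁻ x : Fin m → UnitAddCircle, ∫⁻ y : Fin n → UnitAddCircle,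
    ∏ j, ∏ k, (g (x j + y k) : ℝ≥0∞)

/-- The part of the torus where all sums `x j + y k` are within `β` of `0`. -/
def torusBox (m n : ℕ) (β : ℝ) : Set ((Fin m → UnitAddCircle) × (Fin n → UnitAddCircle)) :=
  {p | ∀ j k, ‖p.1 j + p.2 k‖ ≤ β}

lemma measurableSet_torusBox (m n : ℕ) (β : ℝ) : MeasurableSet (torusBox m n β) := by
  have : torusBox m n β = ⋂ j, ⋂ k, {p | ‖p.1 j + p.2 k‖ ≤ β} := by
    ext p; simp [torusBox]
  rw [this]
  refine MeasurableSet.iInter fun j => MeasurableSet.iInter fun k => ?_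
  refine IsClosed.measurableSet ?_
  exact isClosed_le (by fun_prop) continuous_const

/-- The integral of `∏ g (x j + y k)` over the box. -/
noncomputable def boxInt (g : UnitAddCircle → ℝ≥0) (m n : ℕ) (β : ℝ) : ℝ≥0∞ :=
  ∫⁻ x : Fin m → UnitAddCircle, ∫⁻ y : Fin n → UnitAddCircle,
    (torusBox m n β).indicator (fun p => ∏ j, ∏ k, (g (p.1 j + p.2 k) : ℝ≥0∞)) (x, y)

/-- The integral of `∏ g (x j + y k)` off the box. -/
noncomputable def offBoxInt (g : UnitAddCircle → ℝ≥0) (m n : ℕ) (β : ℝ) : ℝ≥0∞ :=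
  ∫⁻ x : Fin m → UnitAddCircle, ∫⁻ y : Fin n → UnitAddCircle,
    (torusBox m n β)ᶜ.indicator (fun p => ∏ j, ∏ k, (g (p.1 j + p.2 k) : ℝ≥0∞)) (x, y)

variable {g : UnitAddCircle → ℝ≥0}

lemma kernelInt_eq_add (hg : Measurable g) (m n : ℕ) (β : ℝ) :
    kernelInt g m n = boxInt g m n β + offBoxInt g m n β := by
  unfold kernelInt boxInt offBoxInt
  have hF : Measurable (fun p : (Fin m → UnitAddCircle) × (Fin n → UnitAddCircle) =>
      ∏ j, ∏ k, (g (p.1 j + p.2 k) : ℝ≥0∞)) := by fun_prop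
  have hI := hF.indicator (measurableSet_torusBox m n β)
  rw [← lintegral_add_left hI.lintegral_prod_right']
  refine lintegral_congr fun x => ?_
  refine Eq.trans ?_ (lintegral_add_left (f := fun y => (torusBox m n β).indicator
    (fun p => ∏ j, ∏ k, (g (p.1 j + p.2 k) : ℝ≥0∞)) (x, y)) (hI.comp measurable_prodMk_left) _)
  refine lintegral_congr fun y => ?_
  exact (congrFun (Set.indicator_self_add_compl (torusBox m n β)
    (fun p => ∏ j, ∏ k, (g (p.1 j + p.2 k) : ℝ≥0∞))) (x, y)).symm

lemma kernelInt_comm (hg : Measurable g) (m n : ℕ) : kernelInt g m n = kernelInt g n m := by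
  unfold kernelInt
  rw [lintegral_lintegral_swap]
  · refine lintegral_congr fun y => lintegral_congr fun x => ?_
    rw [Finset.prod_comm]
    simp_rw [add_comm]
  · refine Measurable.aemeasurable ?_
    unfold Function.uncurry
    fun_prop

/-- If more than a quarter of the entries of a long column are small, then the column product is
tiny, with a square of an entry to spare. -/
lemma column_prod_le {m p : ℕ} (hm : 4 * (p + 1) ≤ m) (a : Fin m → ℝ≥0) (ha : ∀ j, a j ≤ 1)
    {δ : ℝ≥0} (S : Finset (Fin m)) (hS : ∀ j ∈ S, a j ≤ δ) (hc : m < 4 * #S) :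
    ∏ j, a j ≤ δ ^ p * ∑ j, a j ^ 2 := by
  classical
  have hSc : p + 2 ≤ #S := by omega
  obtain ⟨T, hTS, hT⟩ := Finset.exists_subset_card_eq hSc
  obtain ⟨U, hUT, hU⟩ := Finset.exists_subset_card_eq (show p ≤ #T by omega)
  have hV : #(T \ U) = 2 := by rw [Finset.card_sdiff_of_subset hUT]; omega
  obtain ⟨i, j, hij, hV⟩ := Finset.card_eq_two.1 hV
  have h1 : ∏ j, a j ≤ ∏ j ∈ T, a j :=
    Finset.prod_le_prod_of_subset_of_le_one' (Finset.subset_univ _) (fun j _ _ => ha j)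
  rw [← Finset.prod_sdiff hUT, hV, Finset.prod_pair hij] at h1
  have h2 : ∏ j ∈ U, a j ≤ δ ^ p := by
    rw [← hU, ← Finset.prod_const]
    exact Finset.prod_le_prod' fun j hj => hS j (hTS (hUT hj))
  have h3 : a i * a j ≤ ∑ j, a j ^ 2 := by
    rcases le_total (a i) (a j) with h | h
    · calc a i * a j ≤ a j ^ 2 := by rw [sq]; gcongr
        _ ≤ _ := Finset.single_le_sum (f := fun j => a j ^ 2) (fun _ _ => zero_le) (Finset.mem_univ j)
    · calc a i * a j ≤ a i ^ 2 := by rw [sq]; gcongr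
        _ ≤ _ := Finset.single_le_sum (f := fun j => a j ^ 2) (fun _ _ => zero_le) (Finset.mem_univ i)
  calc _ ≤ _ := h1
    _ ≤ _ := by rw [mul_comm]; gcongr

/-- Outside the box, some row or some column has many entries far from `0`. -/
lemma exists_bad_line {G : Type*} [SeminormedAddCommGroup G] {m n : ℕ} (x : Fin m → G)
    (y : Fin n → G) {d : ℝ} (h : ¬ ∀ j k, ‖x j + y k‖ ≤ 3 * d) :
    (∃ k, m < 4 * #{j | d < ‖x j + y k‖}) ∨ (∃ j, n < 4 * #{k | d < ‖x j + y k‖}) := by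
  classical
  by_contra! hcon
  obtain ⟨hcol, hrow⟩ := hcon
  apply h
  intro j k
  by_contra! hjk
  -- every pair of indices yields a path with a bad edge
  have hpath : ∀ j' k', d < ‖x j + y k'‖ ∨ d < ‖x j' + y k'‖ ∨ d < ‖x j' + y k‖ := by
    intro j' k'
    by_contra! hc
    obtain ⟨h1, h2, h3⟩ := hc
    have : x j + y k = (x j + y k') - (x j' + y k') + (x j' + y k) := by abel
    have h4 : ‖x j + y k‖ ≤ ‖x j + y k'‖ + ‖x j' + y k'‖ + ‖x j' + y k‖ := by
      rw [this]
      exact (norm_add_le _ _).trans (by gcongr; exact norm_sub_le _ _)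
    linarith
  have hsub : (Finset.univ : Finset (Fin m × Fin n)) ⊆
      (Finset.univ ×ˢ ({k' | d < ‖x j + y k'‖} : Finset (Fin n))) ∪
      (({j' | d < ‖x j' + y k‖} : Finset (Fin m)) ×ˢ Finset.univ) ∪
      Finset.univ.filter (fun q : Fin m × Fin n => d < ‖x q.1 + y q.2‖) := by
    intro q _
    simp only [Finset.mem_union, Finset.mem_product, Finset.mem_univ, Finset.mem_filter, true_and,
      and_true]
    rcases hpath q.1 q.2 with h | h | h <;> tauto
  have hcard := Finset.card_le_card hsub
  have h3 : 4 * #(Finset.univ.filter (fun q : Fin m × Fin n => d < ‖x q.1 + y q.2‖)) ≤ n * m := by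
    have : #(Finset.univ.filter (fun q : Fin m × Fin n => d < ‖x q.1 + y q.2‖)) =
        ∑ k, #{j | d < ‖x j + y k‖} := by
      simp_rw [Finset.card_filter]
      rw [Fintype.sum_prod_type_right]
    rw [this, Finset.mul_sum]
    calc _ ≤ ∑ k : Fin n, m := Finset.sum_le_sum fun k _ => hcol k
      _ = n * m := by simp
  have h1 := hrow j
  have h2 := hcol k
  have hu := Finset.card_union_le ((Finset.univ ×ˢ ({k' | d < ‖x j + y k'‖} : Finset (Fin n))) ∪
      (({j' | d < ‖x j' + y k‖} : Finset (Fin m)) ×ˢ Finset.univ))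
      (Finset.univ.filter (fun q : Fin m × Fin n => d < ‖x q.1 + y q.2‖))
  have hu' := Finset.card_union_le (Finset.univ ×ˢ ({k' | d < ‖x j + y k'‖} : Finset (Fin n)))
      (({j' | d < ‖x j' + y k‖} : Finset (Fin m)) ×ˢ Finset.univ)
  simp only [Finset.card_product, Finset.card_univ, Fintype.card_fin, Fintype.card_prod] at *
  have hm : 0 < m := j.pos
  have hn : 0 < n := k.pos
  have hmn : 0 < n * m := Nat.mul_pos hn hm
  have e1 : 4 * (m * #{k' | d < ‖x j + y k'‖}) ≤ n * m := by nlinarith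
  have e2 : 4 * (#{j' | d < ‖x j' + y k‖} * n) ≤ n * m := by nlinarith
  nlinarith

lemma lintegral_bad_column_le (hg : Measurable g) (hg1 : ∀ u, g u ≤ 1) {d : ℝ} {δ : ℝ≥0}
    (hδ : ∀ u, d < ‖u‖ → g u ≤ δ) {m p : ℕ} (hm : 4 * (p + 1) ≤ m) (x : Fin m → UnitAddCircle) :
    ∫⁻ u, (if m < 4 * #{j | d < ‖x j + u‖} then ∏ j, (g (x j + u) : ℝ≥0∞) else 0) ≤
      m * (δ : ℝ≥0∞) ^ p * ∫⁻ u, (g u : ℝ≥0∞) ^ 2 := by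
  calc ∫⁻ u, (if m < 4 * #{j | d < ‖x j + u‖} then ∏ j, (g (x j + u) : ℝ≥0∞) else 0)
      ≤ ∫⁻ u, (δ : ℝ≥0∞) ^ p * ∑ j, (g (u + x j) : ℝ≥0∞) ^ 2 := by
        refine lintegral_mono fun u => ?_
        dsimp only
        split_ifs with h
        · have := column_prod_le hm (fun j => g (x j + u)) (fun j => hg1 _) (δ := δ)
            {j | d < ‖x j + u‖} (fun j hj => hδ _ (by simpa using hj)) h
          simp_rw [add_comm u]
          exact_mod_cast this
        · exact zero_le
    _ = _ := by
        rw [lintegral_const_mul _ (by fun_prop), lintegral_finsetSum _ (fun j _ => by fun_prop)]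
        have : ∀ j, ∫⁻ u, (g (u + x j) : ℝ≥0∞) ^ 2 = ∫⁻ u, (g u : ℝ≥0∞) ^ 2 := fun j =>
          lintegral_add_right_eq_self (fun u => (g u : ℝ≥0∞) ^ 2) (x j)
        simp_rw [this]
        rw [Finset.sum_const, Finset.card_univ, Fintype.card_fin, nsmul_eq_mul]
        ring

lemma measurable_bad_column (hg : Measurable g) (d : ℝ) {m n : ℕ} (k : Fin n) {α : Type*}
    [MeasurableSpace α] (X : α → Fin m → UnitAddCircle) (Y : α → Fin n → UnitAddCircle)
    (hX : Measurable X) (hY : Measurable Y) :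
    Measurable (fun p : α => if m < 4 * #{j | d < ‖X p j + Y p k‖} then
      ∏ j, ∏ k, (g (X p j + Y p k) : ℝ≥0∞) else 0) := by
  refine Measurable.ite ?_ (by fun_prop) measurable_const
  have : Measurable (fun p : α => #{j | d < ‖X p j + Y p k‖}) := by
    simp_rw [Finset.card_filter]
    refine Finset.measurable_sum _ fun j _ => Measurable.ite ?_ measurable_const measurable_const
    exact measurableSet_lt measurable_const (by fun_prop)
  exact measurableSet_lt measurable_const (this.const_mul 4)

lemma measurable_bad_row (hg : Measurable g) (d : ℝ) {m n : ℕ} (j : Fin m) {α : Type*}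
    [MeasurableSpace α] (X : α → Fin m → UnitAddCircle) (Y : α → Fin n → UnitAddCircle)
    (hX : Measurable X) (hY : Measurable Y) :
    Measurable (fun p : α => if n < 4 * #{k | d < ‖X p j + Y p k‖} then
      ∏ j, ∏ k, (g (X p j + Y p k) : ℝ≥0∞) else 0) := by
  have := measurable_bad_column hg d j Y X hY hX
  simp_rw [add_comm (Y _ _)] at this
  simp_rw [Finset.prod_comm (s := (Finset.univ : Finset (Fin m)))]
  exact this

lemma lintegral_bad_columns_le (hg : Measurable g) (hg1 : ∀ u, g u ≤ 1) {d : ℝ} {δ : ℝ≥0}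
    (hδ : ∀ u, d < ‖u‖ → g u ≤ δ) {m n p : ℕ} (hm : 4 * (p + 1) ≤ m) (k : Fin (n + 1)) :
    ∫⁻ x : Fin m → UnitAddCircle, ∫⁻ y : Fin (n + 1) → UnitAddCircle,
      (if m < 4 * #{j | d < ‖x j + y k‖} then ∏ j, ∏ k, (g (x j + y k) : ℝ≥0∞) else 0) ≤
      m * (δ : ℝ≥0∞) ^ p * (∫⁻ u, (g u : ℝ≥0∞) ^ 2) * kernelInt g m n := by
  unfold kernelInt
  rw [← lintegral_const_mul]
  swap
  · exact Measurable.lintegral_prod_right' (f := fun q : (Fin m → UnitAddCircle) ×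
      (Fin n → UnitAddCircle) => ∏ j, ∏ k, (g (q.1 j + q.2 k) : ℝ≥0∞)) (by fun_prop)
  refine lintegral_mono fun x => ?_
  have hx : Measurable (fun y : Fin (n + 1) → UnitAddCircle =>
      if m < 4 * #{j | d < ‖x j + y k‖} then ∏ j, ∏ k, (g (x j + y k) : ℝ≥0∞) else 0) :=
    measurable_bad_column hg d k (fun _ => x) (fun y => y) measurable_const measurable_id
  rw [lintegral_pi_insertNth k _ hx]
  calc _ = ∫⁻ u, ∫⁻ y' : Fin n → UnitAddCircle,
        (if m < 4 * #{j | d < ‖x j + u‖} then ∏ j, (g (x j + u) : ℝ≥0∞) else 0) *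
          ∏ j, ∏ k, (g (x j + y' k) : ℝ≥0∞) := by
        refine lintegral_congr fun u => lintegral_congr fun y' => ?_
        simp only [Fin.insertNth_apply_same]
        split_ifs with h
        · rw [← Finset.prod_mul_distrib]
          refine Finset.prod_congr rfl fun j _ => ?_
          rw [Fin.prod_univ_succAbove _ k]
          simp
        · simp
    _ = (∫⁻ u, (if m < 4 * #{j | d < ‖x j + u‖} then ∏ j, (g (x j + u) : ℝ≥0∞) else 0)) *
          ∫⁻ y' : Fin n → UnitAddCircle, ∏ j, ∏ k, (g (x j + y' k) : ℝ≥0∞) := by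
        simp_rw [lintegral_const_mul _ (show Measurable (fun y' : Fin n → UnitAddCircle =>
          ∏ j, ∏ k, (g (x j + y' k) : ℝ≥0∞)) by fun_prop)]
        rw [lintegral_mul_const']
        refine ne_of_lt (lt_of_le_of_lt (lintegral_mono (g := fun _ => 1) fun y' => ?_) ?_)
        · refine Finset.prod_le_one' fun j _ => Finset.prod_le_one' fun k _ => ?_
          exact ENNReal.coe_le_one_iff.2 (hg1 _)
        · simp
    _ ≤ _ := by
        gcongr
        exact lintegral_bad_column_le hg hg1 hδ hm x

lemma offBoxInt_le (hg : Measurable g) (hg1 : ∀ u, g u ≤ 1) {d : ℝ} {δ : ℝ≥0}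
    (hδ : ∀ u, d < ‖u‖ → g u ≤ δ) {m n p : ℕ} (hm : 4 * (p + 1) ≤ m + 1)
    (hn : 4 * (p + 1) ≤ n + 1) :
    offBoxInt g (m + 1) (n + 1) (3 * d) ≤
      (m + 1) * (n + 1) * (δ : ℝ≥0∞) ^ p * (∫⁻ u, (g u : ℝ≥0∞) ^ 2) *
        (kernelInt g (m + 1) n + kernelInt g m (n + 1)) := by
  have hpt : ∀ (x : Fin (m + 1) → UnitAddCircle) (y : Fin (n + 1) → UnitAddCircle),
      (torusBox (m + 1) (n + 1) (3 * d))ᶜ.indicator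
        (fun p => ∏ j, ∏ k, (g (p.1 j + p.2 k) : ℝ≥0∞)) (x, y) ≤
      (∑ k, if m + 1 < 4 * #{j | d < ‖x j + y k‖} then ∏ j, ∏ k, (g (x j + y k) : ℝ≥0∞) else 0) +
      (∑ j, if n + 1 < 4 * #{k | d < ‖x j + y k‖} then ∏ j, ∏ k, (g (x j + y k) : ℝ≥0∞) else 0) := by
    intro x y
    by_cases h : (x, y) ∈ torusBox (m + 1) (n + 1) (3 * d)
    · rw [Set.indicator_of_notMem (by simpa using h)]
      exact zero_le
    · rw [Set.indicator_of_mem (by simpa using h)]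
      rcases exists_bad_line x y h with ⟨k, hk⟩ | ⟨j, hj⟩
      · refine le_trans ?_ le_self_add
        refine le_trans ?_ (Finset.single_le_sum (fun _ _ => zero_le) (Finset.mem_univ k))
        rw [if_pos hk]
      · refine le_trans ?_ le_add_self
        refine le_trans ?_ (Finset.single_le_sum (fun _ _ => zero_le) (Finset.mem_univ j))
        rw [if_pos hj]
  have hm1 := fun k : Fin (n + 1) => measurable_bad_column hg d (m := m + 1) k
    Prod.fst Prod.snd measurable_fst measurable_snd
  have hm2 := fun j : Fin (m + 1) => measurable_bad_row hg d (n := n + 1) j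
    Prod.fst Prod.snd measurable_fst measurable_snd
  calc offBoxInt g (m + 1) (n + 1) (3 * d)
      ≤ ∫⁻ x : Fin (m + 1) → UnitAddCircle, ∫⁻ y : Fin (n + 1) → UnitAddCircle,
        ((∑ k, if m + 1 < 4 * #{j | d < ‖x j + y k‖} then
          ∏ j, ∏ k, (g (x j + y k) : ℝ≥0∞) else 0) +
        (∑ j, if n + 1 < 4 * #{k | d < ‖x j + y k‖} then
          ∏ j, ∏ k, (g (x j + y k) : ℝ≥0∞) else 0)) :=
        lintegral_mono fun x => lintegral_mono fun y => hpt x y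
    _ = (∑ k, ∫⁻ x : Fin (m + 1) → UnitAddCircle, ∫⁻ y : Fin (n + 1) → UnitAddCircle,
          if m + 1 < 4 * #{j | d < ‖x j + y k‖} then
          ∏ j, ∏ k, (g (x j + y k) : ℝ≥0∞) else 0) +
        (∑ j, ∫⁻ x : Fin (m + 1) → UnitAddCircle, ∫⁻ y : Fin (n + 1) → UnitAddCircle,
          if n + 1 < 4 * #{k | d < ‖x j + y k‖} then
          ∏ j, ∏ k, (g (x j + y k) : ℝ≥0∞) else 0) := by
        rw [← lintegral_finsetSum _ (fun k _ => (hm1 k).lintegral_prod_right'),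
          ← lintegral_finsetSum _ (fun k _ => (hm2 k).lintegral_prod_right'),
          ← lintegral_add_left (Finset.measurable_sum _ fun k _ => (hm1 k).lintegral_prod_right')]
        refine lintegral_congr fun x => ?_
        have hx1 : ∀ k, Measurable (fun y : Fin (n + 1) → UnitAddCircle =>
            if m + 1 < 4 * #{j | d < ‖x j + y k‖} then
              ∏ j, ∏ k, (g (x j + y k) : ℝ≥0∞) else 0) :=
          fun k => measurable_bad_column hg d k (fun _ => x) (fun y => y) measurable_const
            measurable_id
        have hx2 : ∀ j, Measurable (fun y : Fin (n + 1) → UnitAddCircle =>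
            if n + 1 < 4 * #{k | d < ‖x j + y k‖} then
              ∏ j, ∏ k, (g (x j + y k) : ℝ≥0∞) else 0) :=
          fun j => measurable_bad_row hg d j (fun _ => x) (fun y => y) measurable_const
            measurable_id
        rw [← lintegral_finsetSum _ (fun k _ => hx1 k), ← lintegral_finsetSum _ (fun k _ => hx2 k)]
        exact lintegral_add_left (Finset.measurable_sum _ fun k _ => hx1 k) _
    _ ≤ (∑ k : Fin (n + 1), ((m + 1 : ℕ) : ℝ≥0∞) * (δ : ℝ≥0∞) ^ p *
          (∫⁻ u, (g u : ℝ≥0∞) ^ 2) * kernelInt g (m + 1) n) +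
        (∑ j : Fin (m + 1), ((n + 1 : ℕ) : ℝ≥0∞) * (δ : ℝ≥0∞) ^ p *
          (∫⁻ u, (g u : ℝ≥0∞) ^ 2) * kernelInt g (n + 1) m) := by
        refine add_le_add (Finset.sum_le_sum fun k _ => ?_) (Finset.sum_le_sum fun j _ => ?_)
        · exact lintegral_bad_columns_le hg hg1 hδ hm k
        · refine le_trans (le_of_eq ?_) (lintegral_bad_columns_le hg hg1 hδ hn j)
          rw [lintegral_lintegral_swap]
          · refine lintegral_congr fun y => lintegral_congr fun x => ?_
            rw [Finset.prod_comm]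
            simp_rw [add_comm]
          · exact (hm2 j).aemeasurable
    _ = _ := by
        rw [kernelInt_comm hg (n + 1) m]
        simp only [Finset.sum_const, Finset.card_univ, Fintype.card_fin, nsmul_eq_mul]
        push_cast
        ring

lemma exists_double_star_ge {m n : ℕ} (hm : 4 ≤ m) (hn : 4 ≤ n) (a : Fin m → Fin n → ℝ≥0)
    (ha : ∀ j k, a j k ≤ 1) :
    ∃ j₀ k₀, ∏ j, ∏ k, a j k ≤ (∏ k, a j₀ k ^ 2) * ∏ j, a j k₀ ^ 2 := by
  by_contra! hcon
  have hne : Nonempty (Fin m × Fin n) := ⟨(⟨0, by omega⟩, ⟨0, by omega⟩)⟩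
  set P := ∏ j, ∏ k, a j k with hP
  have hP1 : P ≤ 1 := Finset.prod_le_one' fun j _ => Finset.prod_le_one' fun k _ => ha j k
  have hP0 : 0 < P := lt_of_le_of_lt zero_le (hcon hne.some.1 hne.some.2)
  have ha0 : ∀ j k, 0 < a j k := by
    intro j k
    by_contra h
    have h0 : a j k = 0 := by simpa using h
    have : P = 0 := Finset.prod_eq_zero (Finset.mem_univ j)
      (Finset.prod_eq_zero (Finset.mem_univ k) h0)
    exact hP0.ne' this
  have hlt : ∏ i : Fin m × Fin n, ((∏ k, a i.1 k ^ 2) * ∏ j, a j i.2 ^ 2) <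
      ∏ _i : Fin m × Fin n, P := by
    refine Finset.prod_lt_prod_of_nonempty (fun i _ => ?_) (fun i _ => hcon i.1 i.2)
      Finset.univ_nonempty
    exact mul_pos (Finset.prod_pos fun k _ => pow_pos (ha0 _ _) 2)
      (Finset.prod_pos fun k _ => pow_pos (ha0 _ _) 2)
  have heq : ∏ i : Fin m × Fin n, ((∏ k, a i.1 k ^ 2) * ∏ j, a j i.2 ^ 2) = P ^ (2 * (m + n)) := by
    rw [Finset.prod_mul_distrib, Fintype.prod_prod_type, Fintype.prod_prod_type_right]
    simp only [Finset.prod_const, Finset.card_univ, Fintype.card_fin, Finset.prod_pow]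
    rw [← hP, Finset.prod_comm, ← hP, ← pow_mul, ← pow_mul, ← pow_add]
    congr 1
    ring
  rw [heq] at hlt
  simp only [Finset.prod_const, Finset.card_univ, Fintype.card_fin, Fintype.card_prod] at hlt
  exact absurd hlt (not_lt.2 (pow_le_pow_of_le_one zero_le hP1 (by nlinarith)))

lemma kernelInt_crude (hg : Measurable g) (hg1 : ∀ u, g u ≤ 1) {m n : ℕ} (hm : 4 ≤ m + 1)
    (hn : 4 ≤ n) :
    kernelInt g (m + 1) n ≤ (m + 1) * n * (∫⁻ u, (g u : ℝ≥0∞) ^ 2) ^ (m + n) := by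
  have hpt : ∀ (x : Fin (m + 1) → UnitAddCircle) (y : Fin n → UnitAddCircle),
      ∏ j, ∏ k, (g (x j + y k) : ℝ≥0∞) ≤ ∑ j₀, ∑ k₀,
        (∏ k, (g (x j₀ + y k) : ℝ≥0∞) ^ 2) *
          ∏ j : Fin m, (g (x (j₀.succAbove j) + y k₀) : ℝ≥0∞) ^ 2 := by
    intro x y
    obtain ⟨j₀, k₀, h⟩ := exists_double_star_ge hm hn (fun j k => g (x j + y k))
      (fun j k => hg1 _)
    have h' : ∏ j, ∏ k, (g (x j + y k) : ℝ≥0∞) ≤ (∏ k, (g (x j₀ + y k) : ℝ≥0∞) ^ 2) *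
          ∏ j : Fin m, (g (x (j₀.succAbove j) + y k₀) : ℝ≥0∞) ^ 2 := by
      have h2 : ∏ j, g (x j + y k₀) ^ 2 ≤ ∏ j : Fin m, g (x (j₀.succAbove j) + y k₀) ^ 2 := by
        rw [Fin.prod_univ_succAbove _ j₀]
        exact mul_le_of_le_one_left' (pow_le_one₀ zero_le (hg1 _))
      have h3 := h.trans (mul_le_mul_right h2 _)
      exact_mod_cast h3
    refine h'.trans ?_
    refine le_trans ?_ (Finset.single_le_sum (fun _ _ => zero_le) (Finset.mem_univ j₀))
    exact Finset.single_le_sum (f := fun k₀ => (∏ k, (g (x j₀ + y k) : ℝ≥0∞) ^ 2) *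
          ∏ j : Fin m, (g (x (j₀.succAbove j) + y k₀) : ℝ≥0∞) ^ 2)
          (fun _ _ => zero_le) (Finset.mem_univ k₀)
  have hmeas : ∀ (j₀ : Fin (m + 1)) (k₀ : Fin n),
      Measurable (fun p : (Fin (m + 1) → UnitAddCircle) × (Fin n → UnitAddCircle) =>
        (∏ k, (g (p.1 j₀ + p.2 k) : ℝ≥0∞) ^ 2) *
          ∏ j : Fin m, (g (p.1 (j₀.succAbove j) + p.2 k₀) : ℝ≥0∞) ^ 2) := by
    intro j₀ k₀
    fun_prop
  have hmeas2 : ∀ (x : Fin (m + 1) → UnitAddCircle) (j₀ : Fin (m + 1)) (k₀ : Fin n),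
      Measurable (fun y : Fin n → UnitAddCircle =>
        (∏ k, (g (x j₀ + y k) : ℝ≥0∞) ^ 2) *
          ∏ j : Fin m, (g (x (j₀.succAbove j) + y k₀) : ℝ≥0∞) ^ 2) := by
    intro x j₀ k₀
    fun_prop
  set z := ∫⁻ u, (g u : ℝ≥0∞) ^ 2 with hz
  have hsh : ∀ v : UnitAddCircle, ∫⁻ u, (g (u + v) : ℝ≥0∞) ^ 2 = z := fun v =>
    lintegral_add_right_eq_self (fun u => (g u : ℝ≥0∞) ^ 2) v
  have hsh' : ∀ v : UnitAddCircle, ∫⁻ u, (g (v + u) : ℝ≥0∞) ^ 2 = z := fun v =>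
    lintegral_add_left_eq_self (fun u => (g u : ℝ≥0∞) ^ 2) v
  have hInt : ∀ (j₀ : Fin (m + 1)) (k₀ : Fin n),
      ∫⁻ x : Fin (m + 1) → UnitAddCircle, ∫⁻ y : Fin n → UnitAddCircle,
        (∏ k, (g (x j₀ + y k) : ℝ≥0∞) ^ 2) *
          ∏ j : Fin m, (g (x (j₀.succAbove j) + y k₀) : ℝ≥0∞) ^ 2 = z ^ (m + n) := by
    intro j₀ k₀
    rw [lintegral_lintegral_swap (hmeas j₀ k₀).aemeasurable]
    have h1 : ∀ y : Fin n → UnitAddCircle, ∫⁻ x : Fin (m + 1) → UnitAddCircle,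
        (∏ k, (g (x j₀ + y k) : ℝ≥0∞) ^ 2) *
          ∏ j : Fin m, (g (x (j₀.succAbove j) + y k₀) : ℝ≥0∞) ^ 2 =
        (∫⁻ u, ∏ k, (g (u + y k) : ℝ≥0∞) ^ 2) * z ^ m := by
      intro y
      rw [lintegral_pi_insertNth j₀ _ (by fun_prop)]
      simp only [Fin.insertNth_apply_same, Fin.insertNth_apply_succAbove]
      rw [← lintegral_mul_const _ (by fun_prop)]
      refine lintegral_congr fun u => ?_
      rw [lintegral_const_mul _ (by fun_prop),
        lintegral_pi_fin_prod (fun _ v => (g (v + y k₀) : ℝ≥0∞) ^ 2) (fun _ => by fun_prop)]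
      simp [hsh]
    simp_rw [h1]
    have hm3 : Measurable (fun p : (Fin n → UnitAddCircle) × UnitAddCircle =>
        ∏ k, (g (p.2 + p.1 k) : ℝ≥0∞) ^ 2) := by fun_prop
    rw [lintegral_mul_const _ hm3.lintegral_prod_right', lintegral_lintegral_swap hm3.aemeasurable]
    have h2 : ∀ u : UnitAddCircle, ∫⁻ y : Fin n → UnitAddCircle,
        ∏ k, (g (u + y k) : ℝ≥0∞) ^ 2 = z ^ n := by
      intro u
      rw [lintegral_pi_fin_prod (fun _ v => (g (u + v) : ℝ≥0∞) ^ 2) (fun _ => by fun_prop)]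
      simp [hsh']
    simp_rw [h2]
    simp
    ring
  calc kernelInt g (m + 1) n ≤ ∫⁻ x : Fin (m + 1) → UnitAddCircle, ∫⁻ y : Fin n → UnitAddCircle,
        ∑ j₀, ∑ k₀, (∏ k, (g (x j₀ + y k) : ℝ≥0∞) ^ 2) *
          ∏ j : Fin m, (g (x (j₀.succAbove j) + y k₀) : ℝ≥0∞) ^ 2 :=
        lintegral_mono fun x => lintegral_mono fun y => hpt x y
    _ = ∑ j₀ : Fin (m + 1), ∑ k₀ : Fin n, z ^ (m + n) := by
        rw [Finset.sum_congr rfl fun j₀ _ => Finset.sum_congr rfl fun k₀ _ => (hInt j₀ k₀).symm,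
          ← Fintype.sum_prod_type', ← lintegral_finsetSum _ (fun i _ =>
          (hmeas i.1 i.2).lintegral_prod_right')]
        refine lintegral_congr fun x => ?_
        rw [← lintegral_finsetSum _ (fun i _ => hmeas2 x i.1 i.2)]
        refine lintegral_congr fun y => ?_
        rw [← Fintype.sum_prod_type']
    _ = _ := by
        simp only [Finset.sum_const, Finset.card_univ, Fintype.card_fin, nsmul_eq_mul]
        push_cast
        ring

/-- Control of the integral off the box by induction on the number of deleted lines. -/
theorem offBoxInt_le_of_boxInt_le (hg : Measurable g) (hg1 : ∀ u, g u ≤ 1) {d : ℝ} {δ : ℝ≥0}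
    (hδ : ∀ u, d < ‖u‖ → g u ≤ δ) {m n p R : ℕ} (hm : 4 * (p + 1) + R ≤ m)
    (hn : 4 * (p + 1) + R ≤ n) (hR : 1 ≤ R) (W w z : ℝ≥0∞) (hz : ∫⁻ u, (g u : ℝ≥0∞) ^ 2 ≤ z)
    (hbox : ∀ r ≤ R, ∀ m' n', m' ≤ m → n' ≤ n → m' + n' + r = m + n →
      boxInt g m' n' (3 * d) ≤ W * w ^ r)
    (hcrude : m * n * z ^ (m + n - R - 1) ≤ W * w ^ R)
    (hsmall : 4 * (m * n) * (δ : ℝ≥0∞) ^ p * z * w ≤ 1) :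
    offBoxInt g m n (3 * d) ≤ 4 * (m * n) * (δ : ℝ≥0∞) ^ p * z * w * W := by
  have hoff : ∀ m' n', 4 * (p + 1) ≤ m' + 1 → 4 * (p + 1) ≤ n' + 1 → m' + 1 ≤ m → n' + 1 ≤ n →
      offBoxInt g (m' + 1) (n' + 1) (3 * d) ≤ m * n * (δ : ℝ≥0∞) ^ p * z *
        (kernelInt g (m' + 1) n' + kernelInt g m' (n' + 1)) := by
    intro m' n' h1 h2 h3 h4
    refine (offBoxInt_le hg hg1 hδ h1 h2).trans ?_
    gcongr
    · exact_mod_cast h3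
    · exact_mod_cast h4
  have hmain : ∀ i ≤ R, ∀ m' n', m' ≤ m → n' ≤ n → m' + n' + (R - i) = m + n →
      kernelInt g m' n' ≤ 2 * (W * w ^ (R - i)) := by
    intro i
    induction i with
    | zero =>
      intro _ m' n' hm' hn' hs
      obtain ⟨m', rfl⟩ : ∃ m'', m' = m'' + 1 := ⟨m' - 1, by omega⟩
      have h1 : kernelInt g (m' + 1) n' ≤ W * w ^ R := by
        refine (kernelInt_crude hg hg1 (by omega) (by omega)).trans (le_trans ?_ hcrude)
        have : m' + n' = m + n - R - 1 := by omega
        rw [this]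
        gcongr
        exact_mod_cast hm'
      rw [Nat.sub_zero]
      refine h1.trans ?_
      rw [two_mul]
      exact le_self_add
    | succ i ih =>
      intro hi m' n' hm' hn' hs
      obtain ⟨m', rfl⟩ : ∃ m'', m' = m'' + 1 := ⟨m' - 1, by omega⟩
      obtain ⟨n', rfl⟩ : ∃ n'', n' = n'' + 1 := ⟨n' - 1, by omega⟩
      have hr : R - i = (R - (i + 1)) + 1 := by omega
      have i1 := ih (by omega) (m' + 1) n' hm' (by omega) (by omega)
      have i2 := ih (by omega) m' (n' + 1) (by omega) hn' (by omega)
      rw [hr] at i1 i2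
      set r := R - (i + 1)
      rw [kernelInt_eq_add hg _ _ (3 * d)]
      calc _ ≤ W * w ^ r + m * n * (δ : ℝ≥0∞) ^ p * z *
            (2 * (W * w ^ (r + 1)) + 2 * (W * w ^ (r + 1))) := by
            refine add_le_add (hbox r (by omega) _ _ hm' hn' hs) ?_
            refine (hoff m' n' (by omega) (by omega) hm' hn').trans ?_
            gcongr
        _ = W * w ^ r + (4 * (m * n) * (δ : ℝ≥0∞) ^ p * z * w) * (W * w ^ r) := by ring
        _ ≤ W * w ^ r + 1 * (W * w ^ r) := by gcongr
        _ = _ := by ring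
  obtain ⟨m', rfl⟩ : ∃ m'', m = m'' + 1 := ⟨m - 1, by omega⟩
  obtain ⟨n', rfl⟩ : ∃ n'', n = n'' + 1 := ⟨n - 1, by omega⟩
  refine (hoff m' n' (by omega) (by omega) le_rfl le_rfl).trans ?_
  have i1 := hmain (R - 1) (by omega) (m' + 1) n' le_rfl (by omega) (by omega)
  have i2 := hmain (R - 1) (by omega) m' (n' + 1) (by omega) le_rfl (by omega)
  have hr : R - (R - 1) = 1 := by omega
  rw [hr, pow_one] at i1 i2
  calc _ ≤ ((m' + 1 : ℕ) : ℝ≥0∞) * ((n' + 1 : ℕ) : ℝ≥0∞) * (δ : ℝ≥0∞) ^ p * z *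
        (2 * (W * w) + 2 * (W * w)) := by gcongr
    _ = _ := by ring

end Tail

section Gauge

open MeasureTheory Filter Topology Finset

lemma integral_skew {α V : Type*} [MeasureSpace α] [SFinite (volume : Measure α)]
    [MeasureSpace V] [SFinite (volume : Measure V)] (S T : α → V → V)
    (hS : Measurable (Function.uncurry S)) (hT : Measurable (Function.uncurry T))
    (hST : ∀ a v, S a (T a v) = v) (hTS : ∀ a v, T a (S a v) = v)
    (hp : ∀ a, MeasurePreserving (S a) volume volume) (h : α × V → ℂ) :
    ∫ p : α × V, h (p.1, S p.1 p.2) = ∫ p, h p := by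
  let e : α × V ≃ᵐ α × V :=
    { toFun := fun p => (p.1, S p.1 p.2)
      invFun := fun p => (p.1, T p.1 p.2)
      left_inv := fun p => by simp [hTS]
      right_inv := fun p => by simp [hST]
      measurable_toFun := by
        simp only [Equiv.coe_fn_mk]
        exact measurable_fst.prodMk hS
      measurable_invFun := by
        simp only [Equiv.coe_fn_symm_mk]
        exact measurable_fst.prodMk hT }
  have he : MeasurePreserving e volume volume :=
    MeasurePreserving.skew_product (μa := (volume : Measure α)) (μb := volume)
      (μc := (volume : Measure V)) (μd := volume) (f := id) (MeasurePreserving.id _)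
      (g := S) hS (Eventually.of_forall fun a => (hp a).map_eq)
  exact he.integral_comp' h

lemma integral_skew_pair {A : Type*} [AddCommGroup A] [MeasureSpace A] [MeasurableAdd₂ A]
    [MeasurableNeg A] [SigmaFinite (volume : Measure A)]
    [Measure.IsAddLeftInvariant (volume : Measure A)] {m n : ℕ}
    (h : A × ((Fin m → A) × (Fin n → A)) → ℂ) :
    ∫ p : A × ((Fin m → A) × (Fin n → A)),
      h (p.1, (fun j => p.1 + p.2.1 j), (fun k => -p.1 + p.2.2 k)) = ∫ p, h p := by
  refine integral_skew (fun (u : A) (p : (Fin m → A) × (Fin n → A)) =>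
      ((fun j => u + p.1 j), (fun k => -u + p.2 k)))
    (fun (u : A) (p : (Fin m → A) × (Fin n → A)) =>
      ((fun j => -u + p.1 j), (fun k => u + p.2 k))) ?_ ?_ ?_ ?_ ?_ h
  · unfold Function.uncurry
    fun_prop
  · unfold Function.uncurry
    fun_prop
  · intro a v; simp
  · intro a v; simp
  · intro a
    exact (volume_preserving_pi fun j => measurePreserving_add_left volume a).prod
      (volume_preserving_pi fun j => measurePreserving_add_left volume (-a))

lemma integral_prod_cons {X A : Type*} [MeasureSpace X] [SigmaFinite (volume : Measure X)]
    [MeasureSpace A] [SigmaFinite (volume : Measure A)] {n : ℕ}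
    (f : X × (Fin (n + 1) → A) → ℂ) :
    ∫ p, f p = ∫ q : A × (X × (Fin n → A)), f (q.2.1, Fin.cons q.1 q.2.2) := by
  have h1 : MeasurePreserving (MeasurableEquiv.prodCongr (MeasurableEquiv.refl X)
      (MeasurableEquiv.piFinSuccAbove (fun _ : Fin (n + 1) => A) 0).symm) volume volume :=
    (MeasurePreserving.id (volume : Measure X)).prod
      (volume_preserving_piFinSuccAbove (fun _ : Fin (n + 1) => A) 0).symm
  have h2 : MeasurePreserving (MeasurableEquiv.prodAssoc (α := A) (β := X) (γ := Fin n → A)).symm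
      volume volume := volume_preserving_prodAssoc.symm _
  have h3 : MeasurePreserving (MeasurableEquiv.prodCongr
      (MeasurableEquiv.prodComm (α := A) (β := X)) (MeasurableEquiv.refl (Fin n → A)))
      volume volume :=
    (Measure.measurePreserving_swap (μ := (volume : Measure A))
      (ν := (volume : Measure X))).prod (MeasurePreserving.id _)
  have h4 : MeasurePreserving (MeasurableEquiv.prodAssoc (α := X) (β := A) (γ := Fin n → A))
      volume volume := volume_preserving_prodAssoc
  rw [← h1.integral_comp', ← h4.integral_comp', ← h3.integral_comp', ← h2.integral_comp']
  refine integral_congr_ae (Eventually.of_forall fun q => ?_)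
  simp [MeasurableEquiv.prodCongr, MeasurableEquiv.prodAssoc, MeasurableEquiv.prodComm,
    MeasurableEquiv.piFinSuccAbove, MeasurableEquiv.refl]
  rfl

/-- Integrating out a gauge direction on a compact group. -/
lemma integral_gauge_torus {m n : ℕ}
    (h : (Fin m → UnitAddCircle) × (Fin (n + 1) → UnitAddCircle) → ℂ)
    (hinv : ∀ x y τ, h (fun j => x j + τ, fun k => y k - τ) = h (x, y)) :
    ∫ p, h p = ∫ p : (Fin m → UnitAddCircle) × (Fin n → UnitAddCircle), h (p.1, Fin.cons 0 p.2) := by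
  rw [integral_prod_cons]
  have h1 : ∀ q : UnitAddCircle × ((Fin m → UnitAddCircle) × (Fin n → UnitAddCircle)),
      h (q.2.1, Fin.cons q.1 q.2.2) =
      h ((fun j => q.1 + q.2.1 j), Fin.cons 0 (fun k => -q.1 + q.2.2 k)) := by
    intro q
    rw [← hinv _ _ q.1]
    simp only [add_comm]
    congr 1
    refine Prod.ext rfl ?_
    funext k
    refine Fin.cases ?_ (fun k => ?_) k
    · simp
    · simp [sub_eq_add_neg, add_comm]
  simp_rw [h1]
  rw [integral_skew_pair (fun r : UnitAddCircle × ((Fin m → UnitAddCircle) ×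
    (Fin n → UnitAddCircle)) => h (r.2.1, Fin.cons 0 r.2.2))]
  have := integral_fun_snd (μ := (volume : Measure UnitAddCircle))
    (ν := (volume : Measure ((Fin m → UnitAddCircle) × (Fin n → UnitAddCircle))))
    (fun p : (Fin m → UnitAddCircle) × (Fin n → UnitAddCircle) => h (p.1, Fin.cons 0 p.2))
  rw [Measure.volume_eq_prod]
  refine Eq.trans this ?_
  simp

/-- Restoring a gauge direction on the line with the help of a density `γ` for the mean. -/
lemma integral_gauge_real {m n : ℕ} (F : (Fin m → ℝ) × (Fin (n + 1) → ℝ) → ℂ)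
    (hinv : ∀ x y τ, F (fun j => x j + τ, fun k => y k - τ) = F (x, y)) (γ : ℝ → ℂ) :
    (∫ p : (Fin m → ℝ) × (Fin n → ℝ), F (p.1, Fin.cons 0 p.2)) * ∫ u, γ u =
      ∫ p : (Fin m → ℝ) × (Fin (n + 1) → ℝ),
        F (fun j => p.1 j - (∑ k, p.2 k) / (n + 1), p.2) * γ ((∑ k, p.2 k) / (n + 1)) := by
  have hn : (n + 1 : ℝ) ≠ 0 := by positivity
  have hA := integral_prod_mul (μ := (volume : Measure ((Fin m → ℝ) × (Fin n → ℝ))))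
    (ν := (volume : Measure ℝ)) (fun p => F (p.1, Fin.cons 0 p.2)) γ
  rw [← hA]
  have hB := integral_skew (α := (Fin m → ℝ) × (Fin n → ℝ)) (V := ℝ)
    (fun p u => (∑ k, p.2 k) / (n + 1) + u) (fun p u => -((∑ k, p.2 k) / (n + 1)) + u)
    (by unfold Function.uncurry; fun_prop) (by unfold Function.uncurry; fun_prop)
    (by simp) (by simp) (fun p => measurePreserving_add_left volume _)
    (fun q => F (q.1.1, Fin.cons 0 q.1.2) * γ q.2)
  rw [← Measure.volume_eq_prod, ← hB, Measure.volume_eq_prod, ← integral_prod_swap,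
    ← Measure.volume_eq_prod]
  have hC := integral_skew_pair (A := ℝ) (m := m) (n := n)
    (fun q => F (q.2.1, Fin.cons 0 q.2.2) * γ ((∑ k, q.2.2 k) / (n + 1) + q.1))
  simp only [Prod.fst_swap, Prod.snd_swap]
  rw [← hC]
  have hE := integral_skew (α := Fin (n + 1) → ℝ) (V := Fin m → ℝ)
    (fun y x j => -((∑ k, y k) / (n + 1)) + x j) (fun y x j => (∑ k, y k) / (n + 1) + x j)
    (by unfold Function.uncurry; fun_prop) (by unfold Function.uncurry; fun_prop)
    (by simp) (by simp) (fun y => volume_preserving_pi fun j => measurePreserving_add_left volume _)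
    (fun q => F (q.2, q.1) * γ ((∑ k, q.1 k) / (n + 1)))
  simp only [neg_add_eq_sub] at hE
  have hE' : ∫ p : (Fin m → ℝ) × (Fin (n + 1) → ℝ),
        F (fun j => p.1 j - (∑ k, p.2 k) / (n + 1), p.2) * γ ((∑ k, p.2 k) / (n + 1)) =
      ∫ p : (Fin m → ℝ) × (Fin (n + 1) → ℝ), F p * γ ((∑ k, p.2 k) / (n + 1)) := by
    have e1 := integral_prod_swap (μ := (volume : Measure (Fin m → ℝ)))
      (ν := (volume : Measure (Fin (n + 1) → ℝ))) (fun p : (Fin m → ℝ) × (Fin (n + 1) → ℝ) =>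
        F (fun j => p.1 j - (∑ k, p.2 k) / (n + 1), p.2) * γ ((∑ k, p.2 k) / (n + 1)))
    have e2 := integral_prod_swap (μ := (volume : Measure (Fin m → ℝ)))
      (ν := (volume : Measure (Fin (n + 1) → ℝ))) (fun p : (Fin m → ℝ) × (Fin (n + 1) → ℝ) =>
        F p * γ ((∑ k, p.2 k) / (n + 1)))
    exact e1.symm.trans (hE.trans e2)
  rw [hE', integral_prod_cons]
  refine integral_congr_ae (Eventually.of_forall fun q => ?_)
  simp only
  have hF : F (q.2.1, Fin.cons q.1 q.2.2) =
      F ((fun j => q.1 + q.2.1 j), Fin.cons 0 (fun k => -q.1 + q.2.2 k)) := by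
    rw [← hinv _ _ q.1]
    simp only [add_comm]
    congr 1
    refine Prod.ext rfl ?_
    funext k
    refine Fin.cases ?_ (fun k => ?_) k
    · simp
    · simp [sub_eq_add_neg, add_comm]
  rw [hF]
  congr 2
  simp only [Finset.sum_add_distrib, Fin.sum_univ_succ, Fin.cons_zero,
    Fin.cons_succ, Finset.sum_const, Finset.card_univ, Fintype.card_fin, nsmul_eq_mul]
  field_simp
  ring

lemma integral_torus_lift {m n : ℕ} (f : (Fin m → UnitAddCircle) × (Fin n → UnitAddCircle) → ℂ)
    (hf : Measurable f) :
    ∫ p, f p = ∫ p : (Fin m → ℝ) × (Fin n → ℝ) in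
      (Set.univ.pi fun _ => Set.Ioc (-1/2) (1/2)) ×ˢ (Set.univ.pi fun _ => Set.Ioc (-1/2) (1/2)),
        f ((fun j => (p.1 j : UnitAddCircle)), (fun k => (p.2 k : UnitAddCircle))) := by
  have h0 : MeasurePreserving (fun x : ℝ => (x : UnitAddCircle))
      (volume.restrict (Set.Ioc (-1/2) (1/2))) volume := by
    have := UnitAddCircle.measurePreserving_mk (-1/2)
    norm_num at this ⊢
    exact this
  have h1 : ∀ d : ℕ, MeasurePreserving (fun (x : Fin d → ℝ) j => (x j : UnitAddCircle))
      (volume.restrict (Set.univ.pi fun _ => Set.Ioc (-1/2) (1/2))) volume := by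
    intro d
    rw [volume_pi, Measure.restrict_pi_pi]
    exact measurePreserving_pi _ _ fun _ => h0
  have h2 := (h1 m).prod (h1 n)
  rw [Measure.prod_restrict] at h2
  rw [Measure.volume_eq_prod, ← h2.map_eq, integral_map h2.measurable.aemeasurable
    hf.aestronglyMeasurable]
  rfl

lemma integral_torus_eq_real {m n : ℕ} (hm : 0 < m) (K : UnitAddCircle → ℂ) (k : ℝ → ℂ)
    (hKm : Measurable K) {β : ℝ} (hβ : β < 1 / 4) (s t : ℕ) (hst : m * s = (n + 1) * t)
    (hK : ∀ r : ℝ, |r| ≤ β → K r = k r * Complex.exp (2 * Real.pi * Complex.I * (s / (n + 1) * r)))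
    (hK0 : ∀ u, β < ‖u‖ → K u = 0) (hk0 : ∀ r, β < |r| → k r = 0) :
    ∫ p : (Fin m → UnitAddCircle) × (Fin (n + 1) → UnitAddCircle),
      (∏ i : Fin m × Fin (n + 1), K (p.1 i.1 + p.2 i.2)) *
        ((∏ j, fourier (-(s : ℤ)) (p.1 j)) * ∏ k, fourier (-(t : ℤ)) (p.2 k)) =
    ∫ p : (Fin m → ℝ) × (Fin n → ℝ),
      ∏ i : Fin m × Fin (n + 1), k (p.1 i.1 + (Fin.cons 0 p.2 : Fin (n + 1) → ℝ) i.2) := by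
  rw [integral_gauge_torus]
  swap
  · intro x y τ
    have e1 : ∀ i : Fin m × Fin (n + 1), x i.1 + τ + (y i.2 - τ) = x i.1 + y i.2 := by
      intro i; abel
    simp only [e1]
    congr 1
    have a1 : ∀ (c : ℤ) (u v : UnitAddCircle), (fourier c (u + v) : ℂ) = fourier c u * fourier c v := by
      intro c u v
      simp [fourier_apply, AddCircle.toCircle_add, smul_add]
    have a2 : ∀ (c : ℤ) (u v : UnitAddCircle), (fourier c (u - v) : ℂ) =
        fourier c u * fourier (-c) v := by
      intro c u v
      rw [sub_eq_add_neg, a1]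
      simp [fourier_apply]
    simp only [a1, a2, Finset.prod_mul_distrib, Finset.prod_const, Finset.card_univ,
      Fintype.card_fin, neg_neg]
    have a3 : (fourier (-(s : ℤ)) τ : ℂ) ^ m * (fourier (t : ℤ) τ : ℂ) ^ (n + 1) = 1 := by
      have a4 : ∀ (c : ℤ) (d : ℕ), (fourier c τ : ℂ) ^ d = fourier (d * c) τ := by
        intro c d
        induction d with
        | zero => simp
        | succ d ih =>
          rw [pow_succ, ih, ← fourier_add]
          congr 2
          push_cast; ring
      rw [a4, a4, ← fourier_add]
      have : ((m : ℤ) * (-(s : ℤ)) + ((n + 1 : ℕ) : ℤ) * (t : ℤ)) = 0 := by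
        have : (m : ℤ) * s = (n + 1 : ℕ) * t := by exact_mod_cast hst
        linarith
      rw [this, fourier_zero]
    linear_combination ((∏ j, (fourier (-(s : ℤ)) (x j) : ℂ)) *
      ∏ k, (fourier (-(t : ℤ)) (y k) : ℂ)) * a3
  have hcons : Measurable fun p : (Fin m → UnitAddCircle) × (Fin n → UnitAddCircle) =>
      (Fin.cons 0 p.2 : Fin (n + 1) → UnitAddCircle) := by
    refine measurable_pi_lambda _ fun k => ?_
    refine Fin.cases ?_ (fun k => ?_) k
    · simp
    · simp only [Fin.cons_succ]; fun_prop
  rw [integral_torus_lift _ ?_]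
  swap
  · have hc : ∀ k, Measurable fun p : (Fin m → UnitAddCircle) × (Fin n → UnitAddCircle) =>
        (Fin.cons 0 p.2 : Fin (n + 1) → UnitAddCircle) k := fun k =>
      (measurable_pi_apply k).comp hcons
    have hx : ∀ j, Measurable fun p : (Fin m → UnitAddCircle) × (Fin n → UnitAddCircle) =>
        p.1 j := fun j => (measurable_pi_apply j).comp measurable_fst
    refine Measurable.mul ?_ (Measurable.mul ?_ ?_)
    · exact Finset.measurable_fun_prod _ fun i _ => hKm.comp ((hx i.1).add (hc i.2))
    · exact Finset.measurable_fun_prod _ fun j _ => (fourier _).continuous.measurable.comp (hx j)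
    · exact Finset.measurable_fun_prod _ fun k _ => (fourier _).continuous.measurable.comp (hc k)
  have hKr : ∀ r : ℝ, |r| < 3 / 4 →
      K r = k r * Complex.exp (2 * Real.pi * Complex.I * (s / (n + 1) * r)) := by
    intro r hr
    by_cases h : |r| ≤ β
    · exact hK r h
    · push Not at h
      rw [hk0 r h, zero_mul]
      apply hK0
      rw [UnitAddCircle.norm_eq]
      have hr' := abs_lt.1 hr
      have h1 : round r = 0 ∨ 1 / 4 < |r - round r| := by
        by_cases h0 : round r = 0
        · exact Or.inl h0
        · right
          have : (1 : ℝ) ≤ |(round r : ℝ)| := by exact_mod_cast Int.one_le_abs h0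
          have h3 := abs_sub_abs_le_abs_sub (round r : ℝ) r
          rw [abs_sub_comm]
          linarith
      rcases h1 with h1 | h1
      · simpa [h1] using h
      · linarith
  have hin : ∀ p ∈ (Set.univ.pi fun _ : Fin m => Set.Ioc (-1/2 : ℝ) (1/2)) ×ˢ
      (Set.univ.pi fun _ : Fin n => Set.Ioc (-1/2 : ℝ) (1/2)),
      (∏ i : Fin m × Fin (n + 1), K (((p.1 i.1 : ℝ) : UnitAddCircle) +
          (Fin.cons 0 (fun k => (p.2 k : UnitAddCircle)) : Fin (n + 1) → UnitAddCircle) i.2)) *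
        ((∏ j, fourier (-(s : ℤ)) (p.1 j : UnitAddCircle)) *
          ∏ k, fourier (-(t : ℤ)) ((Fin.cons 0 (fun k => (p.2 k : UnitAddCircle)) :
            Fin (n + 1) → UnitAddCircle) k)) =
      ∏ i : Fin m × Fin (n + 1), k (p.1 i.1 + (Fin.cons 0 p.2 : Fin (n + 1) → ℝ) i.2) := by
    intro p hp
    have hp1 : ∀ j, |p.1 j| ≤ 1 / 2 := fun j => by
      have := hp.1 j trivial
      exact abs_le.2 ⟨by linarith [this.1], this.2⟩
    have hp2 : ∀ k, |p.2 k| ≤ 1 / 2 := fun j => by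
      have := hp.2 j trivial
      exact abs_le.2 ⟨by linarith [this.1], this.2⟩
    by_cases hx : ∀ j, |p.1 j| ≤ β
    · have hc : ∀ k, (Fin.cons 0 (fun k => (p.2 k : UnitAddCircle)) :
          Fin (n + 1) → UnitAddCircle) k =
          (((Fin.cons 0 p.2 : Fin (n + 1) → ℝ) k : ℝ) : UnitAddCircle) := by
        intro k
        refine Fin.cases ?_ (fun k => ?_) k <;> simp
      simp only [hc, ← AddCircle.coe_add]
      have hy : ∀ k, |(Fin.cons 0 p.2 : Fin (n + 1) → ℝ) k| ≤ 1 / 2 := by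
        intro k
        refine Fin.cases ?_ (fun k => ?_) k
        · simp
        · simpa using hp2 k
      rw [Finset.prod_congr rfl fun i _ => hKr _ (by
        have := abs_add_le (p.1 i.1) ((Fin.cons 0 p.2 : Fin (n + 1) → ℝ) i.2)
        linarith [hx i.1, hy i.2])]
      rw [Finset.prod_mul_distrib, mul_assoc]
      conv_rhs => rw [← mul_one (∏ i : Fin m × Fin (n + 1), _)]
      congr 1
      simp only [fourier_coe_apply, ← Complex.exp_sum, ← Complex.exp_add]
      refine Eq.trans (congrArg Complex.exp ?_) Complex.exp_zero
      set y := (Fin.cons 0 p.2 : Fin (n + 1) → ℝ)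
      rw [Fintype.sum_prod_type]
      have hn : (n + 1 : ℂ) ≠ 0 := by exact_mod_cast Nat.succ_ne_zero n
      have hst' : (t : ℂ) = s / (n + 1) * m := by
        field_simp
        have : (m * s : ℂ) = (n + 1) * t := by exact_mod_cast hst
        linear_combination -this
      simp only [Complex.ofReal_add, mul_add, Finset.sum_add_distrib, Finset.sum_const,
        Finset.card_univ, Fintype.card_fin, nsmul_eq_mul, ← Finset.mul_sum]
      push_cast
      simp only [div_one, mul_assoc, ← Finset.mul_sum]
      rw [hst']
      field_simp
      ring
    · push Not at hx
      obtain ⟨j, hj⟩ := hx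
      have z1 : K (((p.1 j : ℝ) : UnitAddCircle) +
          (Fin.cons 0 (fun k => (p.2 k : UnitAddCircle)) : Fin (n + 1) → UnitAddCircle) 0) = 0 := by
        simp only [Fin.cons_zero, add_zero]
        rw [hKr _ (by linarith [hp1 j]), hk0 _ hj, zero_mul]
      rw [Finset.prod_eq_zero (Finset.mem_univ ((j, 0) : Fin m × Fin (n + 1))) z1, zero_mul]
      symm
      apply Finset.prod_eq_zero (Finset.mem_univ ((j, 0) : Fin m × Fin (n + 1)))
      simpa using hk0 _ hj
  have hmeas : MeasurableSet ((Set.univ.pi fun _ : Fin m => Set.Ioc (-1/2 : ℝ) (1/2)) ×ˢ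
      (Set.univ.pi fun _ : Fin n => Set.Ioc (-1/2 : ℝ) (1/2))) :=
    (MeasurableSet.univ_pi fun _ => measurableSet_Ioc).prod
      (MeasurableSet.univ_pi fun _ => measurableSet_Ioc)
  rw [setIntegral_congr_fun hmeas hin]
  refine setIntegral_eq_integral_of_forall_compl_eq_zero fun p hp => ?_
  have hI : ∀ r : ℝ, r ∉ Set.Ioc (-1/2 : ℝ) (1/2) → 1 / 2 ≤ |r| := by
    intro r hr
    by_contra h
    push Not at h
    have := abs_lt.1 h
    exact hr ⟨by linarith, by linarith⟩
  by_cases hx : ∃ j, β < |p.1 j|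
  · obtain ⟨j, hj⟩ := hx
    apply Finset.prod_eq_zero (Finset.mem_univ ((j, 0) : Fin m × Fin (n + 1)))
    simpa using hk0 _ hj
  · push Not at hx
    have : ∃ k, p.2 k ∉ Set.Ioc (-1/2 : ℝ) (1/2) := by
      by_contra h
      push Not at h
      refine hp ⟨fun j _ => ?_, fun k _ => h k⟩
      by_contra h'
      linarith [hI _ h', hx j]
    obtain ⟨k', hk'⟩ := this
    apply Finset.prod_eq_zero (Finset.mem_univ ((⟨0, hm⟩, k'.succ) : Fin m × Fin (n + 1)))
    apply hk0
    simp only [Fin.cons_succ]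
    have h1 := abs_sub_abs_le_abs_sub (p.2 k') (-(p.1 ⟨0, hm⟩))
    rw [abs_neg, sub_neg_eq_add, add_comm (p.2 k')] at h1
    linarith [hI _ hk', hx ⟨0, hm⟩]

end Gauge

section GaussianScaling

open MeasureTheory Filter Topology Finset

lemma integral_prod_smul_smul {m n : ℕ} {a b : ℝ} (ha : 0 < a) (hb : 0 < b)
    (f : (Fin m → ℝ) × (Fin n → ℝ) → ℂ) :
    ∫ p, f p = ((a ^ m * b ^ n : ℝ) : ℂ) * ∫ p : (Fin m → ℝ) × (Fin n → ℝ), f (a • p.1, b • p.2) := by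
  have h1 : ∀ (d : ℕ) (c : ℝ), 0 < c → Measure.map (fun x : Fin d → ℝ => c • x) volume =
      ENNReal.ofReal ((c ^ d)⁻¹) • (volume : Measure (Fin d → ℝ)) := by
    intro d c hc
    rw [Measure.map_addHaar_smul _ hc.ne']
    simp [abs_of_pos hc]
  have hemb : MeasurableEmbedding (Prod.map (fun x : Fin m → ℝ => a • x)
      (fun x : Fin n → ℝ => b • x)) :=
    (measurableEmbedding_const_smul₀ ha.ne').prodMap (measurableEmbedding_const_smul₀ hb.ne')
  have h2 : Measure.map (Prod.map (fun x : Fin m → ℝ => a • x) (fun x : Fin n → ℝ => b • x))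
      volume = ENNReal.ofReal ((a ^ m * b ^ n)⁻¹) •
        (volume : Measure ((Fin m → ℝ) × (Fin n → ℝ))) := by
    rw [Measure.volume_eq_prod, ← Measure.map_prod_map _ _ (measurable_const_smul a)
      (measurable_const_smul b), h1 m a ha, h1 n b hb, Measure.prod_smul_left,
      Measure.prod_smul_right, smul_smul, mul_inv, ENNReal.ofReal_mul (by positivity)]
  have h3 := hemb.integral_map (μ := volume) f
  rw [h2, integral_smul_measure, ENNReal.toReal_ofReal (by positivity)] at h3
  have h4 : ((a ^ m * b ^ n : ℝ) : ℂ) ≠ 0 := by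
    exact_mod_cast (by positivity : (a ^ m * b ^ n : ℝ) ≠ 0)
  have h5 : ∫ p : (Fin m → ℝ) × (Fin n → ℝ), f (a • p.1, b • p.2) =
      ((a ^ m * b ^ n)⁻¹ : ℝ) • ∫ p, f p := h3.symm
  rw [h5, Complex.real_smul, Complex.ofReal_inv, ← mul_assoc, mul_inv_cancel₀ h4, one_mul]

lemma integral_gauge_scaled {m n : ℕ} (hm : 0 < m) (κ : ℝ → ℂ) {σ : ℝ} (hσ : 0 < σ)
    (γ : ℝ → ℂ) :
    (∫ p : (Fin m → ℝ) × (Fin n → ℝ),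
      ∏ i : Fin m × Fin (n + 1), κ (σ * (p.1 i.1 + (Fin.cons 0 p.2 : Fin (n + 1) → ℝ) i.2))) *
        ∫ u, γ u =
    ((σ * (((σ * √(n + 1 : ℝ))⁻¹) ^ m * ((σ * √m)⁻¹) ^ (n + 1)) : ℝ) : ℂ) *
      ∫ p : (Fin m → ℝ) × (Fin (n + 1) → ℝ),
        (∏ i : Fin m × Fin (n + 1), κ (p.1 i.1 / √(n + 1 : ℝ) +
          (p.2 i.2 - (∑ k, p.2 k) / (n + 1)) / √m)) * γ ((∑ k, p.2 k) / (n + 1) / √m) := by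
  have hm' : (0 : ℝ) < √m := Real.sqrt_pos.2 (by exact_mod_cast hm)
  have hn' : (0 : ℝ) < √(n + 1 : ℝ) := Real.sqrt_pos.2 (by positivity)
  have h1 : ∫ u, γ u = σ * ∫ u, γ (σ * u) := by
    have := Measure.integral_comp_mul_left γ σ
    rw [this, abs_of_pos (by positivity), Complex.real_smul, ← mul_assoc, ← Complex.ofReal_mul,
      mul_inv_cancel₀ hσ.ne', Complex.ofReal_one, one_mul]
  have h2 := integral_gauge_real (m := m) (n := n) (fun p =>
      ∏ i : Fin m × Fin (n + 1), κ (σ * (p.1 i.1 + p.2 i.2)))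
    (by intro x y τ; refine Finset.prod_congr rfl fun i _ => ?_; congr 2; ring)
    (fun u => γ (σ * u))
  rw [h1, mul_left_comm, h2, integral_prod_smul_smul (a := (σ * √(n + 1 : ℝ))⁻¹)
    (b := (σ * √m)⁻¹) (by positivity) (by positivity), ← mul_assoc, ← Complex.ofReal_mul]
  congr 1
  refine integral_congr_ae (Eventually.of_forall fun p => ?_)
  simp only [Pi.smul_apply, smul_eq_mul, ← Finset.mul_sum]
  congr 1
  · refine Finset.prod_congr rfl fun i _ => ?_
    congr 1
    field_simp
    ring
  · congr 1
    field_simp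

/-- The domain on which all arguments of the kernel and the mean are at most `β`. -/
def gaussDomain (m n : ℕ) (β : ℝ) : Set ((Fin m → ℝ) × (Fin n → ℝ)) :=
  {p | (∀ j k, |p.1 j / √n + (p.2 k - (∑ k, p.2 k) / n) / √m| ≤ β) ∧
    |(∑ k, p.2 k) / n / √m| ≤ β}

lemma measurableSet_gaussDomain (m n : ℕ) (β : ℝ) : MeasurableSet (gaussDomain m n β) := by
  refine MeasurableSet.inter ?_ ?_
  · have : {p : (Fin m → ℝ) × (Fin n → ℝ) |
        ∀ j k, |p.1 j / √n + (p.2 k - (∑ k, p.2 k) / n) / √m| ≤ β} =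
        ⋂ j, ⋂ k, {p | |p.1 j / √n + (p.2 k - (∑ k, p.2 k) / n) / √m| ≤ β} := by
      ext p; simp
    change MeasurableSet {p : (Fin m → ℝ) × (Fin n → ℝ) |
        ∀ j k, |p.1 j / √n + (p.2 k - (∑ k, p.2 k) / n) / √m| ≤ β}
    rw [this]
    refine MeasurableSet.iInter fun j => MeasurableSet.iInter fun k => ?_
    exact (isClosed_le (by fun_prop) continuous_const).measurableSet
  · change MeasurableSet {p : (Fin m → ℝ) × (Fin n → ℝ) | |(∑ k, p.2 k) / n / √m| ≤ β}
    exact (isClosed_le (by fun_prop) continuous_const).measurableSet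

lemma sum_sq_gauge {m n : ℕ} (hn : 0 < n) (x : Fin m → ℝ) (y : Fin n → ℝ) :
    ∑ i : Fin m × Fin n, (x i.1 + (y i.2 - (∑ k, y k) / n)) ^ 2 +
      m * n * ((∑ k, y k) / n) ^ 2 = n * ∑ j, x j ^ 2 + m * ∑ k, y k ^ 2 := by
  have hn' : (n : ℝ) ≠ 0 := by exact_mod_cast hn.ne'
  rw [Fintype.sum_prod_type]
  set v := (∑ k, y k) / n with hv
  have hs : ∑ k, y k = n * v := by rw [hv]; field_simp
  have h1 : ∀ j, ∑ k, (x j + (y k - v)) ^ 2 = n * x j ^ 2 + ∑ k, y k ^ 2 - n * v ^ 2 := by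
    intro j
    have : ∀ k, (x j + (y k - v)) ^ 2 = x j ^ 2 + y k ^ 2 + v ^ 2 + 2 * (x j - v) * y k
        - 2 * x j * v := by intro k; ring
    simp only [this, Finset.sum_add_distrib, Finset.sum_sub_distrib, Finset.sum_const,
      Finset.card_univ, Fintype.card_fin, nsmul_eq_mul, ← Finset.mul_sum, hs]
    ring
  simp only [h1, Finset.sum_sub_distrib, Finset.sum_add_distrib, Finset.sum_const,
    Finset.card_univ, Fintype.card_fin, nsmul_eq_mul, ← Finset.mul_sum]
  ring

/-- Reduction of a product-kernel integral on a slice to a Gaussian integral. -/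
lemma integral_eq_gaussian {m n : ℕ} (hm : 0 < m) (k κ : ℝ → ℂ) {σ β : ℝ} (hσ : 0 < σ)
    (hk : ∀ r, k r = if |σ * r| ≤ β then Complex.exp (-(σ * r : ℝ) ^ 2 / 2) * κ (σ * r) else 0) :
    (∫ p : (Fin m → ℝ) × (Fin n → ℝ),
      ∏ i : Fin m × Fin (n + 1), k (p.1 i.1 + (Fin.cons 0 p.2 : Fin (n + 1) → ℝ) i.2)) *
        ((∫ u in Set.Icc (-β) β, Real.exp (-(m * (n + 1)) * u ^ 2 / 2) : ℝ) : ℂ) =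
    ((σ * (((σ * √(n + 1 : ℝ))⁻¹) ^ m * ((σ * √m)⁻¹) ^ (n + 1)) : ℝ) : ℂ) *
      ∫ p : (Fin m → ℝ) × (Fin (n + 1) → ℝ), (gaussDomain m (n + 1) β).indicator (fun p =>
        (∏ j, Complex.exp (-(p.1 j : ℂ) ^ 2 / 2)) * (∏ k, Complex.exp (-(p.2 k : ℂ) ^ 2 / 2)) *
        ∏ i : Fin m × Fin (n + 1), κ (p.1 i.1 / √(n + 1 : ℝ) +
          (p.2 i.2 - (∑ k, p.2 k) / (n + 1)) / √m)) p := by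
  have hm0 : (0 : ℝ) < m := by exact_mod_cast hm
  have hm' : (0 : ℝ) < √m := Real.sqrt_pos.2 hm0
  have hn' : (0 : ℝ) < √(n + 1 : ℝ) := Real.sqrt_pos.2 (by positivity)
  have h1 := integral_gauge_scaled (n := n) hm (fun y => if |y| ≤ β then
    Complex.exp (-(y : ℂ) ^ 2 / 2) * κ y else 0) hσ
    (fun u => ((Set.Icc (-β) β).indicator
      (fun u => Real.exp (-(m * (n + 1)) * u ^ 2 / 2)) u : ℝ))
  rw [integral_complex_ofReal, integral_indicator measurableSet_Icc] at h1
  simp only [hk]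
  rw [h1]
  congr 1
  refine integral_congr_ae (Eventually.of_forall fun p => ?_)
  simp only
  by_cases hp : p ∈ gaussDomain m (n + 1) β
  · rw [Set.indicator_of_mem hp]
    obtain ⟨hp1, hp2⟩ := hp
    push_cast at hp1 hp2
    rw [Set.indicator_of_mem (show _ ∈ Set.Icc (-β) β from abs_le.1 hp2)]
    have e1 : ∀ i : Fin m × Fin (n + 1), (if |p.1 i.1 / √(n + 1 : ℝ) +
          (p.2 i.2 - (∑ k, p.2 k) / (n + 1)) / √m| ≤ β then
          Complex.exp (-((p.1 i.1 / √(n + 1 : ℝ) +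
          (p.2 i.2 - (∑ k, p.2 k) / (n + 1)) / √m : ℝ) : ℂ) ^ 2 / 2) * κ (p.1 i.1 / √(n + 1 : ℝ) +
          (p.2 i.2 - (∑ k, p.2 k) / (n + 1)) / √m) else 0) =
        ((Real.exp (-(p.1 i.1 / √(n + 1 : ℝ) +
          (p.2 i.2 - (∑ k, p.2 k) / (n + 1)) / √m) ^ 2 / 2) : ℝ) : ℂ) *
          κ (p.1 i.1 / √(n + 1 : ℝ) + (p.2 i.2 - (∑ k, p.2 k) / (n + 1)) / √m) := by
      intro i
      rw [if_pos (hp1 i.1 i.2)]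
      push_cast
      rfl
    simp only [e1, Finset.prod_mul_distrib]
    have e2 : ∀ x : ℝ, Complex.exp (-(x : ℂ) ^ 2 / 2) = (Real.exp (-x ^ 2 / 2) : ℝ) := by
      intro x; push_cast; rfl
    simp only [e2, ← Complex.ofReal_prod, ← Real.exp_sum]
    rw [mul_right_comm, ← Complex.ofReal_mul, ← Real.exp_add, ← Complex.ofReal_mul, ← Real.exp_add]
    congr 3
    have h3 := sum_sq_gauge (m := m) (n := n + 1) (Nat.succ_pos n)
      (fun j => p.1 j / √(n + 1 : ℝ)) (fun k => p.2 k / √m)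
    have e3 : ∀ i : Fin m × Fin (n + 1), (p.2 i.2 - (∑ k, p.2 k) / (n + 1)) / √m =
        p.2 i.2 / √m - (∑ k, p.2 k / √m) / ((n + 1 : ℕ) : ℝ) := by
      intro i
      rw [← Finset.sum_div]
      push_cast
      field_simp
    have e4 : (∑ k, p.2 k) / (n + 1) / √m = (∑ k, p.2 k / √m) / ((n + 1 : ℕ) : ℝ) := by
      rw [← Finset.sum_div]
      push_cast
      field_simp
    simp only [e3, e4]
    simp only [neg_div, Finset.sum_neg_distrib, ← Finset.sum_div]
    simp only [← Finset.sum_div, div_pow, Real.sq_sqrt hm0.le,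
      Real.sq_sqrt (show (0 : ℝ) ≤ n + 1 by positivity)] at h3 ⊢
    push_cast at h3 ⊢
    have h5 : ((n : ℝ) + 1) * ((∑ j, p.1 j ^ 2) / (n + 1)) = ∑ j, p.1 j ^ 2 := by field_simp
    have h6 : (m : ℝ) * ((∑ j, p.2 j ^ 2) / m) = ∑ j, p.2 j ^ 2 := by field_simp
    rw [h5, h6] at h3
    linear_combination (-1 / 2) * h3
  · rw [Set.indicator_of_notMem hp]
    by_cases hp2 : |(∑ k, p.2 k) / (n + 1) / √m| ≤ β
    · have : ∃ j k, β < |p.1 j / √(n + 1 : ℝ) + (p.2 k - (∑ k, p.2 k) / (n + 1)) / √m| := by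
        by_contra h
        push Not at h
        refine hp ⟨fun j k => ?_, ?_⟩
        · have := h j k
          push_cast
          exact this
        · push_cast
          exact hp2
      obtain ⟨j, k', hjk⟩ := this
      rw [Finset.prod_eq_zero (Finset.mem_univ ((j, k') : Fin m × Fin (n + 1))), zero_mul]
      exact if_neg (not_le.2 hjk)
    · rw [Set.indicator_of_notMem (show _ ∉ Set.Icc (-β) β from fun h => hp2 (abs_le.2 h))]
      simp

end GaussianScaling

section KernelExpansion

open Complex

lemma norm_sub_pow_le {R : Type*} [NormedCommRing R] [NormOneClass R] {w p : R} {d : ℝ}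
    (hw : ‖w‖ ≤ 1) (hp : ‖p‖ ≤ 1) (h : ‖w - p‖ ≤ d) (k : ℕ) : ‖w ^ k - p ^ k‖ ≤ k * d := by
  induction k with
  | zero => simp
  | succ k ih =>
    have e : w ^ (k + 1) - p ^ (k + 1) = w * (w ^ k - p ^ k) + (w - p) * p ^ k := by ring
    have hd : 0 ≤ d := (norm_nonneg _).trans h
    rw [e]
    calc ‖w * (w ^ k - p ^ k) + (w - p) * p ^ k‖
        ≤ ‖w‖ * ‖w ^ k - p ^ k‖ + ‖w - p‖ * ‖p ^ k‖ :=
          (norm_add_le _ _).trans (add_le_add (norm_mul_le _ _) (norm_mul_le _ _))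
      _ ≤ 1 * (k * d) + d * 1 := by
          have : ‖p ^ k‖ ≤ 1 := (norm_pow_le p k).trans (pow_le_one₀ (norm_nonneg _) hp)
          gcongr
      _ = (k + 1 : ℕ) * d := by push_cast; ring

lemma log_one_sub_expansion {w : ℂ} (hw : ‖w‖ ≤ 1 / 2) :
    ‖-Complex.log (1 - w) - (w + w ^ 2 / 2 + w ^ 3 / 3 + w ^ 4 / 4)‖ ≤ ‖w‖ ^ 5 := by
  have h := Complex.norm_log_sub_logTaylor_le 4 (z := -w) (by rw [norm_neg]; linarith)
  simp only [Complex.logTaylor, Finset.sum_range_succ, Finset.sum_range_zero] at h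
  norm_num at h
  have e : -Complex.log (1 - w) - (w + w ^ 2 / 2 + w ^ 3 / 3 + w ^ 4 / 4) =
      -(Complex.log (1 + -w) - (-w + -(-w) ^ 2 / 2 + (-w) ^ 3 / 3 + -(-w) ^ 4 / 4)) := by
    rw [sub_eq_add_neg 1 w]; ring
  rw [e, norm_neg]
  refine le_trans (le_of_eq ?_) (h.trans ?_)
  · congr 1; ring
  · have h1 : (1 - ‖w‖)⁻¹ ≤ 2 := by
      rw [inv_le_comm₀ (by linarith) (by norm_num)]; linarith
    have h2 : 0 ≤ ‖w‖ ^ 5 := by positivity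
    nlinarith

lemma kernel_expansion {lam X y : ℝ} (hlam : 1 ≤ lam) (hy : y = √(lam * (1 + lam)) * X)
    (hy1 : |y| ≤ 1 / 2) :
    ∃ E : ℂ, ‖E‖ ≤ 20 * (|y| ^ 5 + |y| ^ 3 / √(lam * (1 + lam))) ∧
      (1 + lam - lam * Complex.exp (X * I))⁻¹ * Complex.exp (-(lam * X) * I) =
        Complex.exp (-(y : ℂ) ^ 2 / 2 - I * y ^ 3 / 3 + y ^ 4 / 4 + E) := by
  set L := lam * (1 + lam) with hL
  have hL1 : lam ^ 2 ≤ L := by rw [hL]; nlinarith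
  have hL2 : 1 ≤ L := by nlinarith
  set S := √L with hS
  have hSS : S * S = L := Real.mul_self_sqrt (by linarith)
  have hlS : lam ≤ S := by
    rw [hS]; exact Real.le_sqrt_of_sq_le hL1
  have hS1 : 1 ≤ S := hlam.trans hlS
  have hYy : lam * |X| ≤ |y| := by
    rw [hy, abs_mul, abs_of_nonneg (by linarith : 0 ≤ S)]
    gcongr
  set Y := lam * |X| with hY
  have hY0 : 0 ≤ Y := by positivity
  have hX1 : |X| ≤ Y := by rw [hY]; nlinarith [abs_nonneg X]
  set x : ℂ := X * I with hx
  have hxn : ‖x‖ = |X| := by simp [hx]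
  have hxle : ‖x‖ ≤ 1 := by rw [hxn]; linarith
  set P : ℂ := x + x ^ 2 / 2 + x ^ 3 / 6 + x ^ 4 / 24 with hP
  set e1 : ℂ := Complex.exp x - 1 - P with he1
  have he1n : ‖e1‖ ≤ |X| ^ 5 / 100 := by
    have := Complex.exp_bound hxle (n := 5) (by norm_num)
    simp only [Finset.sum_range_succ, Finset.sum_range_zero, Nat.factorial] at this
    norm_num at this
    rw [he1, hP]
    rw [hxn] at this
    refine le_trans (le_of_eq ?_) (this.trans (le_of_eq (by ring)))
    congr 1
    ring
  set w : ℂ := lam * (Complex.exp x - 1) with hw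
  have hwn : ‖w‖ ≤ Y := by
    rw [hw, norm_mul, Complex.norm_real, Real.norm_of_nonneg (by linarith), hY]
    have := Real.norm_exp_I_mul_ofReal_sub_one_le (x := X)
    rw [Real.norm_eq_abs, mul_comm] at this
    gcongr
  have hw2 : ‖w‖ ≤ 1 / 2 := by linarith
  have hpow : ∀ k : ℕ, 1 ≤ k → k ≤ 5 → ‖(lam : ℂ) ^ k * x ^ 5‖ ≤ Y ^ 5 := by
    intro k _ hk5
    rw [norm_mul, norm_pow, norm_pow, Complex.norm_real, Real.norm_of_nonneg (by linarith), hxn,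
      hY, mul_pow]
    gcongr
  set p : ℂ := lam * P with hp
  have hwp : ‖w - p‖ ≤ Y ^ 5 / 100 := by
    have : w - p = lam * e1 := by rw [hw, hp, he1]; ring
    rw [this, norm_mul, Complex.norm_real, Real.norm_of_nonneg (by linarith)]
    calc lam * ‖e1‖ ≤ lam * (|X| ^ 5 / 100) := by gcongr
      _ ≤ lam ^ 5 * (|X| ^ 5 / 100) := by
          gcongr
          exact le_self_pow₀ hlam (by norm_num)
      _ = Y ^ 5 / 100 := by rw [hY]; ring
  have hY5 : Y ^ 5 ≤ 1 := pow_le_one₀ hY0 (by linarith)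
  have hY50 : 0 ≤ Y ^ 5 := by positivity
  have hpn : ‖p‖ ≤ 1 := by
    have : ‖p‖ ≤ ‖w‖ + ‖w - p‖ := by
      have := norm_sub_le w (w - p)
      rwa [sub_sub_cancel] at this
    linarith
  have hwd := fun k => norm_sub_pow_le (by linarith) hpn hwp k
  set e2 : ℂ := -Complex.log (1 - w) - (w + w ^ 2 / 2 + w ^ 3 / 3 + w ^ 4 / 4) with he2
  have he2n : ‖e2‖ ≤ Y ^ 5 := (log_one_sub_expansion hw2).trans (by gcongr)
  have hpw : ∀ k, ‖x ^ k‖ ≤ 1 := fun k => (norm_pow_le x k).trans (pow_le_one₀ (norm_nonneg _) hxle)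
  set E : ℂ := -Complex.log (1 - w) - lam * x - (-(y : ℂ) ^ 2 / 2 - I * y ^ 3 / 3 + y ^ 4 / 4) with hE
  refine ⟨E, ?_, ?_⟩
  · have hyc : (y : ℂ) = S * X := by rw [hy]; push_cast; rfl
    have hSSc : (S : ℂ) * S = lam * (1 + lam) := by
      rw [← Complex.ofReal_mul, hSS, hL]; push_cast; ring
    have hI3 : (I : ℂ) ^ 3 = -I := by rw [pow_succ, I_sq]; ring
    have hI4 : (I : ℂ) ^ 4 = 1 := I_pow_four
    have q1 : ∃ B2 B3 B4 : ℂ, ‖B2‖ ≤ 3 ∧ ‖B3‖ ≤ 3 ∧ ‖B4‖ ≤ 12 ∧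
        P ^ 2 = x ^ 2 + x ^ 3 + 7 / 12 * x ^ 4 + x ^ 5 * B2 ∧
        P ^ 3 = x ^ 3 + 3 / 2 * x ^ 4 + x ^ 5 * B3 ∧ P ^ 4 = x ^ 4 + x ^ 5 * B4 := by
      set Q : ℂ := 1 / 2 + x / 6 + x ^ 2 / 24 with hQ
      have hQn : ‖Q‖ ≤ 1 := by
        have h1 := hpw 2
        calc ‖Q‖ ≤ ‖(1 / 2 : ℂ)‖ + ‖x / 6‖ + ‖x ^ 2 / 24‖ := norm_add₃_le
          _ = 1 / 2 + ‖x‖ / 6 + ‖x ^ 2‖ / 24 := by norm_num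
          _ ≤ 1 := by linarith
      set Q2 : ℂ := 1 / 6 + x / 24 with hQ2
      have hQ2n : ‖Q2‖ ≤ 1 := by
        calc ‖Q2‖ ≤ ‖(1 / 6 : ℂ)‖ + ‖x / 24‖ := norm_add_le _ _
          _ = 1 / 6 + ‖x‖ / 24 := by norm_num
          _ ≤ 1 := by linarith
      have hm : ∀ {a b : ℂ} {c d : ℝ}, ‖a‖ ≤ c → ‖b‖ ≤ d → ‖a * b‖ ≤ c * d := by
        intro a b c d h1 h2
        rw [norm_mul]
        exact mul_le_mul h1 h2 (norm_nonneg _) ((norm_nonneg _).trans h1)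
      have ha : ∀ {a b : ℂ} {c d : ℝ}, ‖a‖ ≤ c → ‖b‖ ≤ d → ‖a + b‖ ≤ c + d :=
        fun h1 h2 => (norm_add_le _ _).trans (add_le_add h1 h2)
      have hpP : P = x + x ^ 2 * Q := by rw [hP, hQ]; ring
      have hQ' : Q = 1 / 2 + x * Q2 := by rw [hQ, hQ2]; ring
      have hQ2s : ‖Q ^ 2‖ ≤ 1 := (norm_pow_le _ _).trans (pow_le_one₀ (norm_nonneg _) hQn)
      have hQ3s : ‖Q ^ 3‖ ≤ 1 := (norm_pow_le _ _).trans (pow_le_one₀ (norm_nonneg _) hQn)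
      have hQ4s : ‖Q ^ 4‖ ≤ 1 := (norm_pow_le _ _).trans (pow_le_one₀ (norm_nonneg _) hQn)
      refine ⟨2 * (1 / 24) + Q2 * (1 + x * Q2), 3 * Q2 + 3 * Q ^ 2 + x * Q ^ 3,
        4 * Q + 6 * x * Q ^ 2 + 4 * x ^ 2 * Q ^ 3 + x ^ 3 * Q ^ 4, ?_, ?_, ?_, ?_, ?_, ?_⟩
      · have h1 : ‖x * Q2‖ ≤ 1 * 1 := hm hxle hQ2n
        have h2 : ‖1 + x * Q2‖ ≤ 1 + 1 * 1 := ha (by simp) h1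
        have h3 := hm hQ2n h2
        have h4 : ‖(2 * (1 / 24) : ℂ)‖ ≤ 1 := by norm_num
        exact (ha h4 h3).trans (by norm_num)
      · have h3 : ‖(3 : ℂ)‖ ≤ 3 := by norm_num
        have hQ2n' : ‖Q2‖ ≤ 5 / 24 := by
          calc ‖Q2‖ ≤ ‖(1 / 6 : ℂ)‖ + ‖x / 24‖ := norm_add_le _ _
            _ = 1 / 6 + ‖x‖ / 24 := by norm_num
            _ ≤ 5 / 24 := by linarith
        have hQn' : ‖Q‖ ≤ 17 / 24 := by
          have h1 := hpw 2
          calc ‖Q‖ ≤ ‖(1 / 2 : ℂ)‖ + ‖x / 6‖ + ‖x ^ 2 / 24‖ := norm_add₃_le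
            _ = 1 / 2 + ‖x‖ / 6 + ‖x ^ 2‖ / 24 := by norm_num
            _ ≤ 17 / 24 := by linarith
        have hQs : ‖Q ^ 2‖ ≤ (17 / 24) ^ 2 := (norm_pow_le _ _).trans (by gcongr)
        have hQs3 : ‖Q ^ 3‖ ≤ (17 / 24) ^ 3 := (norm_pow_le _ _).trans (by gcongr)
        exact (ha (ha (hm h3 hQ2n') (hm h3 hQs)) (hm hxle hQs3)).trans (by norm_num)
      · have hQn' : ‖Q‖ ≤ 17 / 24 := by
          have h1 := hpw 2
          calc ‖Q‖ ≤ ‖(1 / 2 : ℂ)‖ + ‖x / 6‖ + ‖x ^ 2 / 24‖ := norm_add₃_le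
            _ = 1 / 2 + ‖x‖ / 6 + ‖x ^ 2‖ / 24 := by norm_num
            _ ≤ 17 / 24 := by linarith
        have hQs : ‖Q ^ 2‖ ≤ (17 / 24) ^ 2 := (norm_pow_le _ _).trans (by gcongr)
        have hQs3 : ‖Q ^ 3‖ ≤ (17 / 24) ^ 3 := (norm_pow_le _ _).trans (by gcongr)
        have h4 : ‖(4 : ℂ)‖ ≤ 4 := by norm_num
        have h6 : ‖(6 : ℂ)‖ ≤ 6 := by norm_num
        exact (ha (ha (ha (hm h4 hQn') (hm (hm h6 hxle) hQs)) (hm (hm h4 (hpw 2)) hQs3))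
          (hm (hpw 3) hQ4s)).trans (by norm_num)
      · rw [hpP, hQ', hQ2]; ring
      · rw [hpP]
        have : (x + x ^ 2 * Q) ^ 3 = x ^ 3 + 3 * x ^ 4 * Q + 3 * x ^ 5 * Q ^ 2 + x ^ 6 * Q ^ 3 := by
          ring
        rw [this]
        nth_rewrite 1 [hQ']
        ring
      · rw [hpP]; ring
    obtain ⟨B2, B3, B4, hB2, hB3, hB4, hP2, hP3, hP4⟩ := q1
    have key : E = e2 + (w - p) + (w ^ 2 - p ^ 2) / 2 + (w ^ 3 - p ^ 3) / 3 +
        (w ^ 4 - p ^ 4) / 4 + (lam ^ 2 * x ^ 5 * (B2 / 2) + lam ^ 3 * x ^ 5 * (B3 / 3) +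
        lam ^ 4 * x ^ 5 * (B4 / 4)) +
        ((L * X ^ 3 * (2 * S - (1 + 2 * lam)) / 6 : ℝ) * I + (L * X ^ 4 / 24 : ℝ)) := by
      have hx2 : x ^ 2 = -(X : ℂ) ^ 2 := by rw [hx, mul_pow, I_sq]; ring
      have hx3 : x ^ 3 = -(X : ℂ) ^ 3 * I := by rw [hx, mul_pow, hI3]; ring
      have hx4 : x ^ 4 = (X : ℂ) ^ 4 := by rw [hx, mul_pow, hI4]; ring
      have hp2 : p ^ 2 = lam ^ 2 * (x ^ 2 + x ^ 3 + 7 / 12 * x ^ 4 + x ^ 5 * B2) := by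
        rw [hp, mul_pow, hP2]
      have hp3 : p ^ 3 = lam ^ 3 * (x ^ 3 + 3 / 2 * x ^ 4 + x ^ 5 * B3) := by
        rw [hp, mul_pow, hP3]
      have hp4 : p ^ 4 = lam ^ 4 * (x ^ 4 + x ^ 5 * B4) := by
        rw [hp, mul_pow, hP4]
      have hp1 : p = lam * x + lam * x ^ 2 / 2 + lam * x ^ 3 / 6 + lam * x ^ 4 / 24 := by
        rw [hp, hP]; ring
      have hy2 : (y : ℂ) ^ 2 = lam * (1 + lam) * X ^ 2 := by rw [hyc, mul_pow, sq (S : ℂ), hSSc]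
      have hy3 : (y : ℂ) ^ 3 = lam * (1 + lam) * S * X ^ 3 := by
        rw [hyc]; linear_combination (S : ℂ) * X ^ 3 * hSSc
      have hy4 : (y : ℂ) ^ 4 = (lam * (1 + lam)) ^ 2 * X ^ 4 := by
        rw [show (y : ℂ) ^ 4 = (y ^ 2) ^ 2 by ring, hy2]; ring
      rw [hE, he2, hp2, hp3, hp4, hp1, hy2, hy3, hy4, hx2, hx3, hx4, hL]
      push_cast
      ring
    have b3 : ‖((L * X ^ 3 * (2 * S - (1 + 2 * lam)) / 6 : ℝ) * I + (L * X ^ 4 / 24 : ℝ) : ℂ)‖ ≤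
        |y| ^ 3 / S := by
      have hSpos : 0 < S := by linarith
      have hyX : |X| = |y| / S := by
        rw [hy, abs_mul, abs_of_pos hSpos]; field_simp
      have f1 : |2 * S - (1 + 2 * lam)| ≤ 1 := by
        rw [abs_le]; constructor
        · linarith
        · nlinarith
      have f2 : L * |X| ^ 3 = |y| ^ 3 / S := by
        rw [hyX, ← hSS]; field_simp
      have f3 : L * |X| ^ 4 ≤ |y| ^ 3 / S := by
        calc L * |X| ^ 4 = L * |X| ^ 3 * |X| := by ring
          _ ≤ L * |X| ^ 3 * 1 := by gcongr; linarith
          _ = _ := by rw [mul_one, f2]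
      refine (norm_add_le _ _).trans ?_
      rw [norm_mul, Complex.norm_I, mul_one, Complex.norm_real, Complex.norm_real,
        Real.norm_eq_abs, Real.norm_eq_abs, abs_div, abs_mul (L * X ^ 3), abs_mul L, abs_div,
        abs_mul L, abs_pow, abs_pow, abs_of_nonneg (by linarith : 0 ≤ L), f2]
      have f4 : |y| ^ 3 / S * |2 * S - (1 + 2 * lam)| ≤ |y| ^ 3 / S * 1 := by gcongr
      have f5 : 0 ≤ |y| ^ 3 / S := by positivity
      norm_num
      linarith
    have g : ∀ k : ℕ, 1 ≤ k → k ≤ 5 → ∀ {B : ℂ} {c : ℝ}, ‖B‖ ≤ c →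
        ‖(lam : ℂ) ^ k * x ^ 5 * B‖ ≤ Y ^ 5 * c := by
      intro k h1 h2 B c hB
      rw [norm_mul]
      exact mul_le_mul (hpow k h1 h2) hB (norm_nonneg _) hY50
    have g2 := g 2 (by norm_num) (by norm_num) (B := B2 / 2) (c := 3) (by
      rw [norm_div]; norm_num; linarith)
    have g3 := g 3 (by norm_num) (by norm_num) (B := B3 / 3) (c := 3) (by
      rw [norm_div]; norm_num; linarith)
    have g4 := g 4 (by norm_num) (by norm_num) (B := B4 / 4) (c := 3) (by
      rw [norm_div]; norm_num; linarith)
    have d2 : ‖(w ^ 2 - p ^ 2) / 2‖ ≤ Y ^ 5 := by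
      have := hwd 2
      rw [norm_div]; norm_num at this ⊢; linarith
    have d3 : ‖(w ^ 3 - p ^ 3) / 3‖ ≤ Y ^ 5 := by
      have := hwd 3
      rw [norm_div]; norm_num at this ⊢; linarith
    have d4 : ‖(w ^ 4 - p ^ 4) / 4‖ ≤ Y ^ 5 := by
      have := hwd 4
      rw [norm_div]; norm_num at this ⊢; linarith
    have hfin : ‖E‖ ≤ 20 * Y ^ 5 + |y| ^ 3 / S := by
      rw [key]
      refine (norm_add_le _ _).trans (add_le_add ?_ b3)
      refine (norm_add_le_of_le (norm_add_le_of_le (norm_add_le_of_le (norm_add_le_of_le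
        (norm_add_le_of_le he2n hwp) d2) d3) d4) (norm_add_le_of_le
        (norm_add_le_of_le g2 g3) g4)).trans ?_
      linarith
    have f5 : 0 ≤ |y| ^ 3 / S := by positivity
    have f6 : Y ^ 5 ≤ |y| ^ 5 := by gcongr
    linarith
  · have hne : (1 : ℂ) - w ≠ 0 := by
      intro h0
      have : w = 1 := (sub_eq_zero.1 h0).symm
      rw [this, norm_one] at hw2
      norm_num at hw2
    have e3 : (1 + lam - lam * Complex.exp x : ℂ) = 1 - w := by rw [hw]; ring
    rw [e3, hE, add_sub_cancel, sub_eq_add_neg (-Complex.log (1 - w)), Complex.exp_add,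
      Complex.exp_neg (Complex.log _),
      Complex.exp_log hne, hx]
    congr 2
    ring

end KernelExpansion

section OneDim

open MeasureTheory ProbabilityTheory

/-- The standard Gaussian measure. -/
noncomputable abbrev stdG : Measure ℝ := gaussianReal 0 1

/-- A dominating function for all one-dimensional estimates. -/
noncomputable def domG (z : ℝ) : ℝ := (1 + z ^ 12) * Real.exp (3 / 8 * z ^ 2)

lemma integral_stdG_eq {E : Type*} [NormedAddCommGroup E] [NormedSpace ℝ E] (f : ℝ → E) :
    ∫ z, f z ∂stdG = ∫ z, ((√(2 * Real.pi))⁻¹ * Real.exp (-z ^ 2 / 2)) • f z := by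
  rw [integral_gaussianReal_eq_integral_smul one_ne_zero]
  simp [gaussianPDFReal_def]

lemma integrable_stdG_iff (f : ℝ → ℝ) :
    Integrable f stdG ↔ Integrable (fun z => Real.exp (-z ^ 2 / 2) * f z) volume := by
  rw [stdG, gaussianReal_of_var_ne_zero 0 one_ne_zero,
    integrable_withDensity_iff_integrable_smul' (measurable_gaussianPDF _ _)
      (Filter.Eventually.of_forall fun _ => gaussianPDF_lt_top)]
  simp only [toReal_gaussianPDF, gaussianPDFReal_def, smul_eq_mul, sub_zero, NNReal.coe_one,
    mul_one, mul_assoc]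
  exact integrable_const_mul_iff (IsUnit.mk0 _ (by positivity)) _

lemma integrable_pow_mul_exp_stdG (k : ℕ) {c : ℝ} (hc : c < 1 / 2) :
    Integrable (fun z => z ^ k * Real.exp (c * z ^ 2)) stdG := by
  rw [integrable_stdG_iff]
  have h := integrable_rpow_mul_exp_neg_mul_sq (b := 1 / 2 - c) (by linarith) (s := k)
    (by have : (0 : ℝ) ≤ k := by positivity
        linarith)
  refine h.congr (Filter.Eventually.of_forall fun z => ?_)
  simp only [Real.rpow_natCast]
  rw [mul_left_comm, ← Real.exp_add]
  congr 2
  ring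

lemma integrable_pow_stdG (k : ℕ) : Integrable (fun z => z ^ k) stdG := by
  simpa using integrable_pow_mul_exp_stdG k (c := 0) (by norm_num)

lemma integrable_domG : Integrable domG stdG := by
  have h := (integrable_pow_mul_exp_stdG 0 (c := 3 / 8) (by norm_num)).add
    (integrable_pow_mul_exp_stdG 12 (c := 3 / 8) (by norm_num))
  refine h.congr (Filter.Eventually.of_forall fun z => ?_)
  simp only [domG, Pi.add_apply]
  ring

lemma integral_pow_stdG_succ (k : ℕ) :
    ∫ z, z ^ (k + 2) ∂stdG = (k + 1) * ∫ z, z ^ k ∂stdG := by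
  have hi : ∀ d : ℕ, Integrable (fun z : ℝ => Real.exp (-z ^ 2 / 2) * z ^ d) volume :=
    fun d => (integrable_stdG_iff _).1 (integrable_pow_stdG d)
  have h := integral_eq_zero_of_hasDerivAt_of_integrable
    (f := fun z : ℝ => Real.exp (-z ^ 2 / 2) * z ^ (k + 1))
    (f' := fun z : ℝ => (k + 1) * (Real.exp (-z ^ 2 / 2) * z ^ k) -
      Real.exp (-z ^ 2 / 2) * z ^ (k + 2)) (fun z => by
        have h1 : HasDerivAt (fun z : ℝ => -z ^ 2 / 2) (-z) z := by
          have := ((hasDerivAt_pow 2 z).neg.div_const 2)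
          refine this.congr_deriv ?_
          simp
          ring
        refine (h1.exp.mul (hasDerivAt_pow (k + 1) z)).congr_deriv ?_
        push_cast

        ring) (((hi k).const_mul _).sub (hi (k + 2))) (hi (k + 1))
  rw [integral_sub ((hi k).const_mul _) (hi (k + 2)), integral_const_mul] at h
  simp only [integral_stdG_eq, smul_eq_mul, mul_assoc, integral_const_mul]
  rw [← sub_eq_zero.1 h]
  ring

lemma integral_one_stdG : ∫ _z : ℝ, (1 : ℝ) ∂stdG = 1 := by simp

lemma integral_sq_stdG : ∫ z, z ^ 2 ∂stdG = 1 := by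
  have := integral_pow_stdG_succ 0
  simpa using this

lemma integral_pow_four_stdG : ∫ z, z ^ 4 ∂stdG = 3 := by
  have := integral_pow_stdG_succ 2
  rw [integral_sq_stdG] at this
  norm_num at this
  exact this

lemma integral_pow_six_stdG : ∫ z, z ^ 6 ∂stdG = 15 := by
  have := integral_pow_stdG_succ 4
  rw [integral_pow_four_stdG] at this
  norm_num at this
  exact this

lemma integral_odd_stdG {E : Type*} [NormedAddCommGroup E] [NormedSpace ℝ E] {f : ℝ → E}
    (hf : ∀ z, f (-z) = -f z) : ∫ z, f z ∂stdG = 0 := by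
  have h1 : ∫ z, f z ∂stdG = ∫ z, f (-z) ∂stdG := by
    simp only [integral_stdG_eq]
    rw [← integral_neg_eq_self]
    simp
  simp only [hf, integral_neg] at h1
  have h2 : (2 : ℝ) • ∫ z, f z ∂stdG = 0 := by
    rw [two_smul]
    nth_rewrite 1 [h1]
    simp
  exact (smul_eq_zero.1 h2).resolve_left two_ne_zero

/-- The truncated quartic tilt of the Gaussian. -/
noncomputable def quartW (N B z : ℝ) : ℝ := if |z| ≤ B then Real.exp (z ^ 4 / (4 * N)) else 0

lemma quartW_nonneg (N B z : ℝ) : 0 ≤ quartW N B z := by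
  unfold quartW; split_ifs <;> positivity

lemma measurable_quartW (N B : ℝ) : Measurable (quartW N B) := by
  unfold quartW
  exact Measurable.ite (measurableSet_le (by fun_prop) (by fun_prop)) (by fun_prop) (by fun_prop)

lemma quartW_neg (N B z : ℝ) : quartW N B (-z) = quartW N B z := by
  simp [quartW, show (-z) ^ 4 = z ^ 4 by ring]

lemma quartW_eq_zero {N B z : ℝ} (h : B < |z|) : quartW N B z = 0 := if_neg (not_le.2 h)

lemma exp_sub_one_le_mul_exp (u : ℝ) : Real.exp u - 1 ≤ u * Real.exp u := by
  have h := Real.add_one_le_exp (-u)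
  have h2 : Real.exp u * Real.exp (-u) = 1 := by rw [← Real.exp_add]; simp
  have h3 := Real.exp_pos u
  nlinarith

lemma abs_cos_sub_le (h : ℝ) : |Real.cos h - (1 - h ^ 2 / 2)| ≤ 3 * h ^ 4 := by
  rcases le_total |h| 1 with h1 | h1
  · refine (Real.cos_bound h1).trans ?_
    have : |h| ^ 4 = h ^ 4 := by rw [show 4 = 2 * 2 by norm_num, pow_mul, sq_abs, pow_mul]
    rw [this]
    nlinarith [sq_nonneg (h ^ 2)]
  · have h2 : 1 ≤ h ^ 2 := by rw [← sq_abs]; nlinarith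
    have h3 := Real.cos_le_one h
    have h4 := Real.neg_one_le_cos h
    rw [abs_le]
    constructor <;> nlinarith

lemma exp_quart_le {N B z : ℝ} (hN : 1 ≤ N) (hB : B ^ 2 ≤ N) (hz : |z| ≤ B) :
    z ^ 4 / (4 * N) ≤ z ^ 2 / 4 := by
  have h1 : z ^ 2 ≤ N := by rw [← sq_abs]; exact (by gcongr : |z| ^ 2 ≤ B ^ 2).trans hB
  rw [div_le_div_iff₀ (by positivity) (by norm_num)]
  nlinarith [mul_le_mul_of_nonneg_left h1 (sq_nonneg z)]

lemma even_pow_le_one_add (z : ℝ) {k : ℕ} (hk : k ≤ 6) : z ^ (2 * k) ≤ 1 + z ^ 12 := by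
  have h0 : 0 ≤ z ^ 2 := sq_nonneg z
  rw [pow_mul, show (12 : ℕ) = 2 * 6 by norm_num, pow_mul]
  rcases le_total (z ^ 2) 1 with h | h
  · have := pow_le_one₀ h0 h (n := k)
    have : 0 ≤ (z ^ 2) ^ 6 := by positivity
    linarith
  · have := pow_le_pow_right₀ h hk
    linarith

lemma one_le_exp_div {N B z : ℝ} (hN : 1 ≤ N) (hNB : N ^ 2 ≤ Real.exp (B ^ 2 / 4)) (hB : 0 ≤ B)
    (hz : B < |z|) : 1 ≤ Real.exp (3 / 8 * z ^ 2) / N ^ 2 := by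
  rw [le_div_iff₀ (by positivity), one_mul]
  refine hNB.trans (Real.exp_le_exp.2 ?_)
  have : B ^ 2 ≤ z ^ 2 := by rw [← sq_abs z]; gcongr
  nlinarith [sq_nonneg z]

lemma abs_exp_mul_cos_sub_le {u : ℝ} (hu0 : 0 ≤ u) (h : ℝ) :
    |Real.exp u * Real.cos h - (1 + u - h ^ 2 / 2)| ≤
      (u ^ 2 + 3 * h ^ 4 + u * h ^ 2 / 2) * Real.exp u := by
  have hx1 := exp_sub_one_le_mul_exp u
  have hx2 := Real.add_one_le_exp u
  have hx0 := Real.exp_pos u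
  have e2 : Real.exp u * Real.cos h - (1 + u - h ^ 2 / 2) = (Real.exp u - 1 - u) +
      Real.exp u * (Real.cos h - (1 - h ^ 2 / 2)) - (Real.exp u - 1) * (h ^ 2 / 2) := by ring
  rw [e2]
  have a1 : |Real.exp u - 1 - u| ≤ u ^ 2 * Real.exp u := by
    rw [abs_of_nonneg (by linarith)]; nlinarith
  have a2 : |Real.exp u * (Real.cos h - (1 - h ^ 2 / 2))| ≤ Real.exp u * (3 * h ^ 4) := by
    rw [abs_mul, abs_of_pos hx0]
    exact mul_le_mul_of_nonneg_left (abs_cos_sub_le h) hx0.le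
  have a3 : |(Real.exp u - 1) * (h ^ 2 / 2)| ≤ u * Real.exp u * (h ^ 2 / 2) := by
    rw [abs_mul, abs_of_nonneg (by linarith : 0 ≤ Real.exp u - 1),
      abs_of_nonneg (by positivity : 0 ≤ h ^ 2 / 2)]
    gcongr
  have := abs_sub (Real.exp u - 1 - u + Real.exp u * (Real.cos h - (1 - h ^ 2 / 2)))
    ((Real.exp u - 1) * (h ^ 2 / 2))
  have := abs_add_le (Real.exp u - 1 - u) (Real.exp u * (Real.cos h - (1 - h ^ 2 / 2)))
  linarith

lemma quart_err_bounds {N α z u H : ℝ} (hN : 1 ≤ N) (hu : u = z ^ 4 / (4 * N)) (hH0 : 0 ≤ H)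
    (hH : H ≤ 2 * (1 + α ^ 2) * (z ^ 6 + z ^ 2) / N) :
    u ^ 2 + 3 * H ^ 2 + u * H / 2 ≤ 400 * (1 + α ^ 4) / N ^ 2 * (1 + z ^ 12) ∧
      |1 + u - H / 2| ≤ 400 * (1 + α ^ 4) * (1 + z ^ 12) := by
  have hN0 : 0 < N := by linarith
  have p1 := even_pow_le_one_add z (k := 0) (by norm_num)
  have p4 := even_pow_le_one_add z (k := 2) (by norm_num)
  have p6 := even_pow_le_one_add z (k := 3) (by norm_num)
  have p2 := even_pow_le_one_add z (k := 1) (by norm_num)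
  have p8 := even_pow_le_one_add z (k := 4) (by norm_num)
  have p10 := even_pow_le_one_add z (k := 5) (by norm_num)
  have p12 : z ^ 12 ≤ 1 + z ^ 12 := by linarith
  norm_num only [Nat.reduceMul, mul_zero, pow_zero] at p1 p2 p4 p6 p8 p10
  have z2 : 0 ≤ z ^ 2 := by positivity
  have z4 : 0 ≤ z ^ 4 := by positivity
  have z6 : 0 ≤ z ^ 6 := by positivity
  have s1 : (z ^ 6 + z ^ 2) ^ 2 = z ^ 12 + 2 * z ^ 8 + z ^ 4 := by ring
  have s2 : z ^ 4 * (z ^ 6 + z ^ 2) = z ^ 10 + z ^ 6 := by ring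
  have s3 : (z ^ 4) ^ 2 = z ^ 8 := by ring
  have hu0 : 0 ≤ u := by rw [hu]; positivity
  set P := 1 + z ^ 12 with hP
  have hA1 : 1 ≤ 1 + α ^ 4 := by have : 0 ≤ α ^ 4 := by positivity
                                 linarith
  have hαA : 1 + α ^ 2 ≤ 2 * (1 + α ^ 4) := by nlinarith only [sq_nonneg (α ^ 2 - 1)]
  have hαA2 : (1 + α ^ 2) ^ 2 ≤ 2 * (1 + α ^ 4) := by nlinarith only [sq_nonneg (α ^ 2 - 1)]
  set A := 1 + α ^ 4 with hA
  have hP0 : 0 < P := by linarith only [p1]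
  have hA0 : 0 < A := by linarith only [hA1]
  have hPA : P ≤ A * P := by nlinarith only [hA1, hP0]
  constructor
  · have b1 : u ^ 2 ≤ A * P / N ^ 2 := by
      calc u ^ 2 = z ^ 8 / (16 * N ^ 2) := by rw [hu, ← s3]; ring
        _ ≤ (A * P) / (1 * N ^ 2) := by gcongr; exacts [p8.trans hPA, by norm_num]
        _ = _ := by rw [one_mul]
    have b2 : H ^ 2 ≤ 32 * (A * P / N ^ 2) := by
      calc H ^ 2 ≤ (2 * (1 + α ^ 2) * (z ^ 6 + z ^ 2) / N) ^ 2 := by gcongr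
        _ = 4 * (1 + α ^ 2) ^ 2 * (z ^ 6 + z ^ 2) ^ 2 / N ^ 2 := by ring
        _ ≤ 4 * (2 * A) * (4 * P) / N ^ 2 := by
          gcongr
          linarith only [s1, p12, p8, p4]
        _ = _ := by ring
    have b3 : u * H ≤ 4 * (A * P / N ^ 2) := by
      calc u * H ≤ u * (2 * (1 + α ^ 2) * (z ^ 6 + z ^ 2) / N) := by gcongr
        _ = (1 + α ^ 2) * (z ^ 4 * (z ^ 6 + z ^ 2)) / (2 * N ^ 2) := by
          rw [hu]; ring
        _ ≤ (2 * A) * (2 * P) / (1 * N ^ 2) := by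
          rw [s2]
          gcongr
          · linarith only [p10, p6]
          · norm_num
        _ = _ := by ring
    have e3 : 400 * A / N ^ 2 * P = 400 * (A * P / N ^ 2) := by ring
    rw [e3]
    have : 0 < A * P / N ^ 2 := by positivity
    linarith only [b1, b2, b3, this]
  · have b1 : u ≤ P := by
      rw [hu, div_le_iff₀ (by positivity)]
      nlinarith only [p4, hP0, hN]
    have b2 : H ≤ 8 * (A * P) := by
      refine hH.trans ?_
      rw [div_le_iff₀ hN0]
      have h1 : 2 * (1 + α ^ 2) * (z ^ 6 + z ^ 2) ≤ 2 * (2 * A) * (2 * P) := by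
        gcongr; linarith only [p6, p2]
      have h2 : 0 < A * P := by positivity
      nlinarith only [h1, h2, hN]
    have h2 : 0 < A * P := by positivity
    rw [abs_le]; constructor <;> nlinarith only [b1, b2, hPA, p1, hu0, hH0, h2]

lemma quartW_cos_pointwise {N B : ℝ} (hN : 1 ≤ N) (hB0 : 0 ≤ B) (hB : B ^ 2 ≤ N)
    (hNB : N ^ 2 ≤ Real.exp (B ^ 2 / 4)) (s α z : ℝ) (hs : s ^ 2 ≤ 1) :
    |quartW N B z * Real.cos (s * (z ^ 3 + 3 * α * z) / (3 * √N)) -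
      (1 + z ^ 4 / (4 * N) - (s * (z ^ 3 + 3 * α * z)) ^ 2 / (18 * N))| ≤
      400 * (1 + α ^ 4) / N ^ 2 * domG z := by
  set h := s * (z ^ 3 + 3 * α * z) / (3 * √N) with hh
  set u := z ^ 4 / (4 * N) with hu
  have hN0 : 0 < N := by linarith
  have hh2 : h ^ 2 = (s * (z ^ 3 + 3 * α * z)) ^ 2 / (9 * N) := by
    rw [hh, div_pow, mul_pow 3, Real.sq_sqrt hN0.le]; norm_num
  have e1 : (s * (z ^ 3 + 3 * α * z)) ^ 2 / (18 * N) = h ^ 2 / 2 := by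
    rw [hh2]; ring
  rw [e1]
  have z2 : 0 ≤ z ^ 2 := sq_nonneg z
  have z6 : 0 ≤ z ^ 6 := by positivity
  have hα2 : 0 ≤ α ^ 2 := sq_nonneg α
  have hb : h ^ 2 ≤ 2 * (1 + α ^ 2) * (z ^ 6 + z ^ 2) / N := by
    have : (s * (z ^ 3 + 3 * α * z)) ^ 2 ≤ 18 * (1 + α ^ 2) * (z ^ 6 + z ^ 2) := by
      rw [mul_pow]
      calc s ^ 2 * (z ^ 3 + 3 * α * z) ^ 2 ≤ 1 * (z ^ 3 + 3 * α * z) ^ 2 := by gcongr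
        _ ≤ 2 * (z ^ 6 + 9 * α ^ 2 * z ^ 2) := by
          nlinarith only [sq_nonneg (z ^ 3 - 3 * α * z)]
        _ ≤ _ := by nlinarith only [mul_nonneg hα2 z6, mul_nonneg hα2 z2, z2, z6]
    rw [hh2, div_le_div_iff₀ (by positivity) hN0]
    nlinarith only [this, hN0]
  obtain ⟨m2, m3⟩ := quart_err_bounds hN hu (sq_nonneg h) hb
  have hu0 : 0 ≤ u := by positivity
  unfold domG
  set P := 1 + z ^ 12 with hP
  by_cases hz : |z| ≤ B
  · have hw : quartW N B z = Real.exp u := if_pos hz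
    rw [hw]
    have hu4 : Real.exp u ≤ Real.exp (3 / 8 * z ^ 2) := by
      apply Real.exp_le_exp.2
      have := exp_quart_le hN hB hz
      linarith only [this, hu, z2]
    refine (abs_exp_mul_cos_sub_le hu0 h).trans ?_
    rw [← mul_assoc]
    have : u ^ 2 + 3 * h ^ 4 + u * h ^ 2 / 2 = u ^ 2 + 3 * (h ^ 2) ^ 2 + u * h ^ 2 / 2 := by ring
    rw [this]
    gcongr
  · push Not at hz
    rw [quartW_eq_zero hz, zero_mul, zero_sub, abs_neg]
    have h1 := one_le_exp_div hN hNB hB0 hz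
    calc |1 + u - h ^ 2 / 2| ≤ 400 * (1 + α ^ 4) * P * 1 := by rw [mul_one]; exact m3
      _ ≤ 400 * (1 + α ^ 4) * P * (Real.exp (3 / 8 * z ^ 2) / N ^ 2) := by gcongr
      _ = _ := by ring

end OneDim

section QuartMeasure

open MeasureTheory ProbabilityTheory

/-- The total mass of the dominating function. -/
noncomputable def cD : ℝ := ∫ z, domG z ∂stdG

lemma domG_nonneg (z : ℝ) : 0 ≤ domG z := by unfold domG; positivity

lemma one_le_domG (z : ℝ) : 1 ≤ domG z := by
  unfold domG
  have h1 : 0 ≤ z ^ 12 := by positivity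
  have h2 : 1 ≤ Real.exp (3 / 8 * z ^ 2) := Real.one_le_exp (by positivity)
  nlinarith

lemma one_le_cD : 1 ≤ cD := by
  have := integral_mono (μ := stdG) (integrable_const 1) integrable_domG one_le_domG
  simpa [cD] using this

/-- The parameters of the truncated quartic tilt are in the admissible range. -/
structure QuartOK (N B : ℝ) : Prop where
  one_le : 1 ≤ N
  nonneg : 0 ≤ B
  sq_le : B ^ 2 ≤ N
  sq_le_exp : N ^ 2 ≤ Real.exp (B ^ 2 / 4)

lemma quartW_le_exp {N B : ℝ} (h : QuartOK N B) (z : ℝ) :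
    quartW N B z ≤ Real.exp (1 / 4 * z ^ 2) := by
  unfold quartW
  split_ifs with hz
  · refine Real.exp_le_exp.2 ?_
    have := exp_quart_le h.one_le h.sq_le hz
    linarith
  · positivity

lemma integrable_exp_stdG {c : ℝ} (hc : c < 1 / 2) :
    Integrable (fun z : ℝ => Real.exp (c * z ^ 2)) stdG := by
  simpa using integrable_pow_mul_exp_stdG 0 hc

lemma integrable_quartW {N B : ℝ} (h : QuartOK N B) : Integrable (quartW N B) stdG := by
  refine (integrable_exp_stdG (c := 1 / 4) (by norm_num)).mono'
    (measurable_quartW N B).aestronglyMeasurable (Filter.Eventually.of_forall fun z => ?_)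
  rw [Real.norm_of_nonneg (quartW_nonneg N B z)]
  exact quartW_le_exp h z

lemma integral_quartW_cos {N B : ℝ} (h : QuartOK N B) (s α : ℝ) (hs : s ^ 2 ≤ 1) :
    |∫ z, quartW N B z * Real.cos (s * (z ^ 3 + 3 * α * z) / (3 * √N)) ∂stdG -
      (1 + (3 / 4 - s ^ 2 * (5 / 6 + α + α ^ 2 / 2)) / N)| ≤
      400 * (1 + α ^ 4) / N ^ 2 * cD := by
  have hN0 : 0 < N := by linarith [h.one_le]
  have i1 : Integrable (fun z => quartW N B z * Real.cos (s * (z ^ 3 + 3 * α * z) / (3 * √N)))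
      stdG := by
    refine (integrable_quartW h).mono ?_ (Filter.Eventually.of_forall fun z => ?_)
    · exact ((measurable_quartW N B).mul (by fun_prop)).aestronglyMeasurable
    · rw [norm_mul]
      exact mul_le_of_le_one_right (norm_nonneg _) (Real.abs_cos_le_one _)
  have j0 : Integrable (fun _ : ℝ => (1 : ℝ)) stdG := integrable_const 1
  have j2 := integrable_pow_stdG 2
  have j4 := integrable_pow_stdG 4
  have j6 := integrable_pow_stdG 6
  have e : (fun z : ℝ => 1 + z ^ 4 / (4 * N) - (s * (z ^ 3 + 3 * α * z)) ^ 2 / (18 * N)) =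
      fun z => 1 + (1 / (4 * N) - s ^ 2 * (6 * α) / (18 * N)) * z ^ 4 +
        (-(s ^ 2) / (18 * N)) * z ^ 6 + (-(s ^ 2 * (9 * α ^ 2)) / (18 * N)) * z ^ 2 := by
    funext z; ring
  have i2 : Integrable (fun z : ℝ => 1 + z ^ 4 / (4 * N) -
      (s * (z ^ 3 + 3 * α * z)) ^ 2 / (18 * N)) stdG := by
    rw [e]
    exact ((j0.add (j4.const_mul _)).add (j6.const_mul _)).add (j2.const_mul _)
  have v2 : ∫ z : ℝ, (1 + z ^ 4 / (4 * N) - (s * (z ^ 3 + 3 * α * z)) ^ 2 / (18 * N)) ∂stdG =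
      1 + (3 / 4 - s ^ 2 * (5 / 6 + α + α ^ 2 / 2)) / N := by
    rw [e]
    have k4 := j4.const_mul (1 / (4 * N) - s ^ 2 * (6 * α) / (18 * N))
    have k6 := j6.const_mul (-(s ^ 2) / (18 * N))
    have k2 := j2.const_mul (-(s ^ 2 * (9 * α ^ 2)) / (18 * N))
    have a1 := integral_add ((j0.add k4).add k6) k2
    have a2 := integral_add (j0.add k4) k6
    have a3 := integral_add j0 k4
    simp only [Pi.add_apply, integral_const_mul] at a1 a2 a3
    rw [a1, a2, a3, integral_one_stdG, integral_sq_stdG, integral_pow_four_stdG,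
      integral_pow_six_stdG]
    field_simp
    ring
  rw [← v2, ← integral_sub i1 i2, cD, ← integral_const_mul]
  refine (abs_integral_le_integral_abs).trans (integral_mono (i1.sub i2).abs
    (integrable_domG.const_mul _) fun z => ?_)
  exact quartW_cos_pointwise h.one_le h.nonneg h.sq_le h.sq_le_exp s α z hs

/-- The total mass of the truncated quartic tilt. -/
noncomputable def quartZ (N B : ℝ) : ℝ := ∫ z, quartW N B z ∂stdG

lemma quartZ_sub_le {N B : ℝ} (h : QuartOK N B) :
    |quartZ N B - (1 + 3 / 4 / N)| ≤ 400 / N ^ 2 * cD := by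
  have := integral_quartW_cos h 0 0 (by norm_num)
  simpa [quartZ] using this

lemma one_le_quartZ {N B : ℝ} (h : QuartOK N B) (hN : 600 * cD ≤ N) : 1 ≤ quartZ N B := by
  have h1 := (abs_le.1 (quartZ_sub_le h)).1
  have hN0 : 0 < N := by linarith [h.one_le]
  have h2 : 400 / N ^ 2 * cD ≤ 3 / 4 / N := by
    rw [div_mul_eq_mul_div, div_le_div_iff₀ (by positivity) hN0]
    nlinarith
  linarith

lemma integral_quartW_cexp {N B : ℝ} (h : QuartOK N B) (α : ℝ) :
    ‖∫ z, (quartW N B z : ℂ) *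
        Complex.exp (-((z ^ 3 + 3 * α * z) / (3 * √N) : ℝ) * Complex.I) ∂stdG -
      (1 + (-1 / 12 - α - α ^ 2 / 2 : ℝ) / N)‖ ≤ 400 * (1 + α ^ 4) / N ^ 2 * cD := by
  have e : ∀ z : ℝ, (quartW N B z : ℂ) *
        Complex.exp (-((z ^ 3 + 3 * α * z) / (3 * √N) : ℝ) * Complex.I) =
      ((quartW N B z * Real.cos (1 * (z ^ 3 + 3 * α * z) / (3 * √N)) : ℝ) : ℂ) +
      (-(quartW N B z * Real.sin ((z ^ 3 + 3 * α * z) / (3 * √N)) : ℝ)) * Complex.I := by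
    intro z
    rw [← Complex.ofReal_neg, Complex.exp_mul_I, ← Complex.ofReal_cos, ← Complex.ofReal_sin,
      Real.cos_neg, Real.sin_neg, one_mul]
    push_cast
    ring
  have i1 : Integrable (fun z => quartW N B z * Real.cos (1 * (z ^ 3 + 3 * α * z) / (3 * √N)))
      stdG := by
    refine (integrable_quartW h).mono ?_ (Filter.Eventually.of_forall fun z => ?_)
    · exact ((measurable_quartW N B).mul (by fun_prop)).aestronglyMeasurable
    · rw [norm_mul]
      exact mul_le_of_le_one_right (norm_nonneg _) (Real.abs_cos_le_one _)
  have i2 : Integrable (fun z => quartW N B z * Real.sin ((z ^ 3 + 3 * α * z) / (3 * √N)))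
      stdG := by
    refine (integrable_quartW h).mono ?_ (Filter.Eventually.of_forall fun z => ?_)
    · exact ((measurable_quartW N B).mul (by fun_prop)).aestronglyMeasurable
    · rw [norm_mul]
      exact mul_le_of_le_one_right (norm_nonneg _) (Real.abs_sin_le_one _)
  have o : ∫ z, quartW N B z * Real.sin ((z ^ 3 + 3 * α * z) / (3 * √N)) ∂stdG = 0 := by
    refine integral_odd_stdG fun z => ?_
    rw [quartW_neg, show ((-z) ^ 3 + 3 * α * (-z)) / (3 * √N) = -((z ^ 3 + 3 * α * z) / (3 * √N))
      by ring, Real.sin_neg, mul_neg]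
  simp_rw [e]
  rw [integral_add i1.ofReal ?_, integral_mul_const, integral_neg, integral_complex_ofReal,
    integral_complex_ofReal, o]
  · have := integral_quartW_cos h 1 α (by norm_num)
    rw [Complex.ofReal_zero, neg_zero, zero_mul, add_zero]
    rw [show (1 + ((-1 / 12 - α - α ^ 2 / 2 : ℝ) : ℂ) / (N : ℂ)) =
      ((1 + (3 / 4 - 1 ^ 2 * (5 / 6 + α + α ^ 2 / 2)) / N : ℝ) : ℂ) by push_cast; ring,
      ← Complex.ofReal_sub, Complex.norm_real]
    exact this
  · exact i2.ofReal.neg.mul_const _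

lemma abs_quartW_mul_sq_sub_one_le {N B : ℝ} (h : QuartOK N B) (z : ℝ) :
    |(quartW N B z - 1) * (z ^ 2 - 1)| ≤ 4 / N * domG z := by
  have hN := h.one_le
  have hN0 : 0 < N := by linarith
  have p2 := even_pow_le_one_add z (k := 1) (by norm_num)
  have p4 := even_pow_le_one_add z (k := 2) (by norm_num)
  have p6 := even_pow_le_one_add z (k := 3) (by norm_num)
  have p0 := even_pow_le_one_add z (k := 0) (by norm_num)
  norm_num only [Nat.reduceMul, mul_zero, pow_zero] at p0 p2 p4 p6
  have z2 : 0 ≤ z ^ 2 := by positivity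
  have hz1 : |z ^ 2 - 1| ≤ 1 + z ^ 2 := by rw [abs_le]; constructor <;> linarith
  rw [abs_mul]
  have hex : (0 : ℝ) < Real.exp (3 / 8 * z ^ 2) := Real.exp_pos _
  have key : |quartW N B z - 1| ≤ (z ^ 4 / 4 + 1) / N * Real.exp (3 / 8 * z ^ 2) := by
    by_cases hz : |z| ≤ B
    · have hw : quartW N B z = Real.exp (z ^ 4 / (4 * N)) := if_pos hz
      have hu0 : 0 ≤ z ^ 4 / (4 * N) := by positivity
      have h1 := exp_sub_one_le_mul_exp (z ^ 4 / (4 * N))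
      have h2 := Real.one_le_exp hu0
      have h3 := exp_quart_le hN h.sq_le hz
      rw [hw, abs_of_nonneg (by linarith)]
      refine h1.trans ?_
      have e1 : z ^ 4 / (4 * N) ≤ (z ^ 4 / 4 + 1) / N := by
        rw [← div_div]; gcongr; linarith
      have e2 : z ^ 4 / (4 * N) ≤ 3 / 8 * z ^ 2 := by linarith
      gcongr
    · push Not at hz
      rw [quartW_eq_zero hz, zero_sub, abs_neg, abs_one]
      have h1 := one_le_exp_div hN h.sq_le_exp h.nonneg hz
      refine h1.trans ?_
      have z4 : 0 ≤ z ^ 4 := by positivity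
      calc Real.exp (3 / 8 * z ^ 2) / N ^ 2 ≤ Real.exp (3 / 8 * z ^ 2) / N := by
            apply div_le_div_of_nonneg_left hex.le hN0 (by nlinarith)
        _ = 1 / N * Real.exp (3 / 8 * z ^ 2) := by ring
        _ ≤ (z ^ 4 / 4 + 1) / N * Real.exp (3 / 8 * z ^ 2) := by gcongr; linarith
  calc |quartW N B z - 1| * |z ^ 2 - 1|
      ≤ ((z ^ 4 / 4 + 1) / N * Real.exp (3 / 8 * z ^ 2)) * (1 + z ^ 2) := by gcongr
    _ = ((z ^ 4 / 4 + 1) * (1 + z ^ 2)) / N * Real.exp (3 / 8 * z ^ 2) := by ring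
    _ ≤ (4 * (1 + z ^ 12)) / N * Real.exp (3 / 8 * z ^ 2) := by
      have e6 : (z ^ 4 / 4 + 1) * (1 + z ^ 2) ≤ 4 * (1 + z ^ 12) := by
        have : (z ^ 4 / 4 + 1) * (1 + z ^ 2) = z ^ 4 / 4 + z ^ 6 / 4 + 1 + z ^ 2 := by ring
        linarith only [p0, p2, p4, p6, this]
      gcongr
    _ = _ := by unfold domG; ring

lemma integrable_quartW_mul {N B : ℝ} (h : QuartOK N B) {f : ℝ → ℝ} (hf : Continuous f) :
    Integrable (fun z => quartW N B z * f z) stdG := by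
  obtain ⟨C, hC⟩ := (isCompact_Icc (a := -B) (b := B)).exists_bound_of_continuousOn hf.continuousOn
  refine ((integrable_quartW h).mul_const (max C 0)).mono'
    ((measurable_quartW N B).mul hf.measurable).aestronglyMeasurable
    (Filter.Eventually.of_forall fun z => ?_)
  rw [norm_mul, Real.norm_of_nonneg (quartW_nonneg N B z)]
  by_cases hz : |z| ≤ B
  · exact mul_le_mul_of_nonneg_left ((hC z (abs_le.1 hz)).trans (le_max_left _ _))
      (quartW_nonneg N B z)
  · rw [quartW_eq_zero (not_le.1 hz)]
    simp

lemma integral_quartW_sq_sub_one {N B : ℝ} (h : QuartOK N B) :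
    |∫ z, quartW N B z * (z ^ 2 - 1) ∂stdG| ≤ 4 / N * cD := by
  have j : Integrable (fun z : ℝ => z ^ 2 - 1) stdG :=
    (integrable_pow_stdG 2).sub (integrable_const 1)
  have v : ∫ z : ℝ, (z ^ 2 - 1) ∂stdG = 0 := by
    rw [integral_sub (integrable_pow_stdG 2) (integrable_const 1), integral_sq_stdG]
    simp
  have i := integrable_quartW_mul h (f := fun z : ℝ => z ^ 2 - 1) (by fun_prop)
  have e : ∫ z, quartW N B z * (z ^ 2 - 1) ∂stdG =
      ∫ z, (quartW N B z - 1) * (z ^ 2 - 1) ∂stdG := by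
    rw [← sub_zero (∫ z, quartW N B z * (z ^ 2 - 1) ∂stdG), ← v, ← integral_sub i j]
    congr 1; funext z; ring
  have i' : Integrable (fun z => (quartW N B z - 1) * (z ^ 2 - 1)) stdG := by
    refine (i.sub j).congr (Filter.Eventually.of_forall fun z => ?_)
    simp only [Pi.sub_apply]; ring
  rw [e, cD, ← integral_const_mul]
  exact (abs_integral_le_integral_abs).trans (integral_mono i'.abs
    (integrable_domG.const_mul _) fun z => abs_quartW_mul_sq_sub_one_le h z)

lemma integral_quartW_tail {N B b : ℝ} (h : QuartOK N B) (hb : 0 ≤ b) :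
    ∫ z, {z : ℝ | b < |z|}.indicator (quartW N B) z ∂stdG ≤ Real.exp (-b ^ 2 / 8) * cD := by
  rw [cD, ← integral_const_mul]
  refine integral_mono ((integrable_quartW h).indicator
    (measurableSet_lt measurable_const (by fun_prop))) (integrable_domG.const_mul _) fun z => ?_
  by_cases hz : b < |z|
  · have h1 : b ^ 2 ≤ z ^ 2 := by rw [← sq_abs z]; gcongr
    simp only [Set.indicator, Set.mem_ofPred_eq, hz, if_true]
    refine (quartW_le_exp h z).trans ?_
    unfold domG
    calc Real.exp (1 / 4 * z ^ 2) ≤ Real.exp (-b ^ 2 / 8) * Real.exp (3 / 8 * z ^ 2) := by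
          rw [← Real.exp_add]; gcongr; linarith
      _ ≤ Real.exp (-b ^ 2 / 8) * ((1 + z ^ 12) * Real.exp (3 / 8 * z ^ 2)) := by
          gcongr
          have : 0 ≤ z ^ 12 := by positivity
          exact le_mul_of_one_le_left (by positivity) (by linarith)
  · simp only [Set.indicator, Set.mem_ofPred_eq, hz, if_false]
    exact mul_nonneg (by positivity) (domG_nonneg z)

lemma integral_trunc_exp_quart {A N B : ℝ} (hA : 0 ≤ A) (hN : 0 < N) (h : A * B ^ 2 ≤ N / 4) :
    ∫ z : ℝ, {z : ℝ | |z| ≤ B}.indicator (fun z => Real.exp (A * z ^ 4 / N)) z ∂stdG ≤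
      1 + A / N * cD := by
  have hpt : ∀ z : ℝ, {z : ℝ | |z| ≤ B}.indicator (fun z => Real.exp (A * z ^ 4 / N)) z ≤
      1 + A / N * domG z := by
    intro z
    by_cases hz : |z| ≤ B
    · simp only [Set.indicator, Set.mem_ofPred_eq, hz, if_true]
      have h1 := exp_sub_one_le_mul_exp (A * z ^ 4 / N)
      have h2 : z ^ 2 ≤ B ^ 2 := by rw [← sq_abs z]; gcongr
      have h3 : A * z ^ 4 / N ≤ 3 / 8 * z ^ 2 := by
        rw [div_le_iff₀ hN]
        have : A * z ^ 2 ≤ N / 4 := (mul_le_mul_of_nonneg_left h2 hA).trans h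
        have hz2 := sq_nonneg z
        nlinarith [mul_le_mul_of_nonneg_right this hz2]
      have p4 := even_pow_le_one_add z (k := 2) (by norm_num)
      norm_num only [Nat.reduceMul] at p4
      have h4 : A * z ^ 4 / N * Real.exp (A * z ^ 4 / N) ≤ A / N * domG z := by
        unfold domG
        rw [show A * z ^ 4 / N * Real.exp (A * z ^ 4 / N) =
          A / N * (z ^ 4 * Real.exp (A * z ^ 4 / N)) by ring]
        gcongr
      linarith
    · simp only [Set.indicator, Set.mem_ofPred_eq, hz, if_false]
      have := domG_nonneg z
      positivity
  have hi : Integrable (fun z => 1 + A / N * domG z) stdG :=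
    (integrable_const 1).add (integrable_domG.const_mul _)
  refine (integral_mono_of_nonneg (Filter.Eventually.of_forall fun z => ?_) hi
    (Filter.Eventually.of_forall hpt)).trans_eq ?_
  · exact Set.indicator_nonneg (fun z _ => (Real.exp_pos _).le) z
  · rw [integral_add (integrable_const 1) (integrable_domG.const_mul _), integral_const_mul, cD]
    simp

/-- The normalised truncated quartic tilt of the standard Gaussian. -/
noncomputable def qG (N B : ℝ) : Measure ℝ :=
  stdG.withDensity fun z => ENNReal.ofReal (quartW N B z / quartZ N B)

lemma integral_qG {E : Type*} [NormedAddCommGroup E] [NormedSpace ℝ E] {N B : ℝ} (f : ℝ → E) :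
    ∫ z, f z ∂(qG N B) = ∫ z, (quartW N B z / quartZ N B) • f z ∂stdG := by
  have h0 : ∀ z, 0 ≤ quartW N B z / quartZ N B := fun z =>
    div_nonneg (quartW_nonneg N B z) (integral_nonneg (quartW_nonneg N B))
  rw [qG, integral_withDensity_eq_integral_toReal_smul
    (((measurable_quartW N B).div_const _).ennreal_ofReal) (Filter.Eventually.of_forall fun z =>
      ENNReal.ofReal_lt_top)]
  simp only [ENNReal.toReal_ofReal (h0 _)]

lemma isProbabilityMeasure_qG {N B : ℝ} (h : QuartOK N B) (hN : 600 * cD ≤ N) :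
    IsProbabilityMeasure (qG N B) := by
  have hZ := one_le_quartZ h hN
  constructor
  rw [qG, withDensity_apply _ MeasurableSet.univ, Measure.restrict_univ,
    ← ofReal_integral_eq_lintegral_ofReal ((integrable_quartW h).div_const _)
      (Filter.Eventually.of_forall fun z => div_nonneg (quartW_nonneg N B z) (by linarith)),
    integral_div, ← quartZ, div_self (by linarith), ENNReal.ofReal_one]

lemma qG_ae_abs_le (N B : ℝ) : ∀ᵐ z ∂(qG N B), |z| ≤ B := by
  rw [qG, ae_withDensity_iff ((measurable_quartW N B).div_const _).ennreal_ofReal]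
  refine Filter.Eventually.of_forall fun z hz => ?_
  by_contra hB
  rw [quartW_eq_zero (not_le.1 hB)] at hz
  simp at hz

lemma qG_tail {N B b : ℝ} (h : QuartOK N B) (hN : 600 * cD ≤ N) (hb : 0 ≤ b) :
    (qG N B).real {z | b < |z|} ≤ Real.exp (-b ^ 2 / 8) * cD := by
  have hZ := one_le_quartZ h hN
  have hms : MeasurableSet {z : ℝ | b < |z|} := measurableSet_lt measurable_const (by fun_prop)
  have hi := integral_indicator_one (μ := qG N B) hms
  rw [← hi, integral_qG]
  refine le_trans ?_ (integral_quartW_tail h hb)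
  refine integral_mono_of_nonneg (Filter.Eventually.of_forall fun z => ?_)
    ((integrable_quartW h).indicator hms) (Filter.Eventually.of_forall fun z => ?_)
  · exact mul_nonneg (div_nonneg (quartW_nonneg N B z) (by linarith))
      (Set.indicator_nonneg (fun _ _ => zero_le_one) z)
  · by_cases hz : z ∈ {z : ℝ | b < |z|}
    · simp only [Set.indicator, hz, if_true, Pi.one_apply, smul_eq_mul, mul_one]
      exact div_le_self (quartW_nonneg N B z) hZ
    · simp [Set.indicator, hz]

lemma integral_qG_odd {N B : ℝ} {f : ℝ → ℝ} (hf : ∀ z, f (-z) = -f z) :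
    ∫ z, f z ∂(qG N B) = 0 := by
  rw [integral_qG]
  refine integral_odd_stdG fun z => ?_
  rw [quartW_neg, hf, smul_neg]

lemma integral_qG_sq_sub_one {N B : ℝ} (h : QuartOK N B) (hN : 600 * cD ≤ N) :
    |∫ z, (z ^ 2 - 1) ∂(qG N B)| ≤ 4 / N * cD := by
  have hZ := one_le_quartZ h hN
  rw [integral_qG]
  have e : ∀ z, (quartW N B z / quartZ N B) • (z ^ 2 - 1) =
      quartW N B z * (z ^ 2 - 1) / quartZ N B := fun z => by rw [smul_eq_mul]; ring
  simp only [e]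
  rw [integral_div, abs_div, abs_of_pos (by linarith : 0 < quartZ N B)]
  exact (div_le_self (abs_nonneg _) hZ).trans (integral_quartW_sq_sub_one h)

lemma integral_qG_cexp {N B : ℝ} (h : QuartOK N B) (hN : 600 * cD ≤ N) (α : ℝ) :
    ‖quartZ N B * ∫ z, Complex.exp (-((z ^ 3 + 3 * α * z) / (3 * √N) : ℝ) * Complex.I) ∂(qG N B) -
      (1 + (-1 / 12 - α - α ^ 2 / 2 : ℝ) / N)‖ ≤ 400 * (1 + α ^ 4) / N ^ 2 * cD := by
  have hZ := one_le_quartZ h hN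
  have hZ0 : (quartZ N B : ℂ) ≠ 0 := by exact_mod_cast (by linarith : quartZ N B ≠ 0)
  have := integral_quartW_cexp h α
  rw [integral_qG, ← integral_const_mul]
  have e : ∀ z : ℝ, (quartZ N B : ℂ) * ((quartW N B z / quartZ N B) •
        Complex.exp (-((z ^ 3 + 3 * α * z) / (3 * √N) : ℝ) * Complex.I)) =
      quartW N B z * Complex.exp (-((z ^ 3 + 3 * α * z) / (3 * √N) : ℝ) * Complex.I) := by
    intro z
    rw [Complex.real_smul, Complex.ofReal_div]
    field_simp
  simp only [e]
  exact this

end QuartMeasure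

section ProductMeasure

open MeasureTheory ProbabilityTheory

lemma hoeffding_pi {μ : Measure ℝ} [IsProbabilityMeasure μ] {F : ℝ → ℝ} (hF : Measurable F)
    {K : ℝ} (hK : 0 ≤ K) (hb : ∀ᵐ z ∂μ, |F z| ≤ K) (d : ℕ) {ε : ℝ} (hε : 0 ≤ ε) :
    (Measure.pi fun _ : Fin d => μ).real {z | ε < |∑ j, (F (z j) - ∫ x, F x ∂μ)|} ≤
      2 * Real.exp (-ε ^ 2 / (2 * (d * K ^ 2))) := by
  set P : Measure (Fin d → ℝ) := Measure.pi fun _ : Fin d => μ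
  have main : ∀ G : ℝ → ℝ, Measurable G → (∀ᵐ z ∂μ, |G z| ≤ K) →
      P.real {z | ε ≤ ∑ j, (G (z j) - ∫ x, G x ∂μ)} ≤
        Real.exp (-ε ^ 2 / (2 * (d * K ^ 2))) := by
    intro G hG hGb
    have hi : iIndepFun (fun (j : Fin d) (z : Fin d → ℝ) => G (z j) - ∫ x, G x ∂μ) P :=
      iIndepFun_pi (μ := fun _ : Fin d => μ) (X := fun _ x => G x - ∫ x, G x ∂μ)
        fun _ => (hG.sub_const _).aemeasurable
    have hs : ∀ j ∈ (Finset.univ : Finset (Fin d)), HasSubgaussianMGF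
        (fun z : Fin d → ℝ => G (z j) - ∫ x, G x ∂μ) ((‖K - -K‖₊ / 2) ^ 2) P := by
      intro j _
      have h1 := hasSubgaussianMGF_of_mem_Icc (μ := μ) hG.aemeasurable
        (hGb.mono fun z hz => abs_le.1 hz)
      have hmp : MeasurePreserving (fun z : Fin d → ℝ => z j) P μ :=
        measurePreserving_eval (fun _ : Fin d => μ) j
      rw [← hmp.map_eq] at h1
      have := h1.of_map hmp.measurable.aemeasurable
      rwa [hmp.map_eq] at this
    refine (HasSubgaussianMGF.measure_sum_ge_le_of_iIndepFun hi hs hε).trans_eq ?_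
    congr 3
    simp only [Finset.sum_const, Finset.card_univ, Fintype.card_fin, nsmul_eq_mul]
    push_cast
    rw [Real.norm_eq_abs, show K - -K = 2 * K by ring, abs_of_nonneg (by positivity)]
    ring
  have h1 := main F hF hb
  have h2 := main (fun z => -F z) hF.neg (hb.mono fun z hz => by rwa [abs_neg])
  refine le_trans (measureReal_mono (s₂ := {z | ε ≤ ∑ j, (F (z j) - ∫ x, F x ∂μ)} ∪
    {z | ε ≤ ∑ j, (-F (z j) - ∫ x, -F x ∂μ)}) ?_) ((measureReal_union_le _ _).trans (by linarith))
  intro z hz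
  rcases lt_abs.1 (show ε < |∑ j, (F (z j) - ∫ x, F x ∂μ)| from hz) with h | h
  · exact Or.inl h.le
  · refine Or.inr ?_
    show ε ≤ _
    rw [integral_neg, show ∑ j, (-F (z j) - -∫ x, F x ∂μ) = -∑ j, (F (z j) - ∫ x, F x ∂μ) by
      rw [← Finset.sum_neg_distrib]; exact Finset.sum_congr rfl fun j _ => by ring]
    exact h.le

lemma pi_withDensity_ofReal {μ : Measure ℝ} [SigmaFinite μ] {h : ℝ → ℝ}
    (h0 : ∀ x, 0 ≤ h x) (hi : Integrable h μ) (d : ℕ)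
    [SigmaFinite (μ.withDensity fun x => ENNReal.ofReal (h x))] :
    (Measure.pi fun _ : Fin d => μ.withDensity fun x => ENNReal.ofReal (h x)) =
      (Measure.pi fun _ : Fin d => μ).withDensity fun x => ENNReal.ofReal (∏ i, h (x i)) := by
  refine Measure.pi_eq fun s hs => ?_
  have hInt : ∀ i, Integrable ((s i).indicator h) μ := fun i => hi.indicator (hs i)
  have h0' : ∀ i x, 0 ≤ (s i).indicator h x := fun i x => Set.indicator_nonneg (fun x _ => h0 x) x
  have e1 : ∀ i, (μ.withDensity fun x => ENNReal.ofReal (h x)) (s i) =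
      ENNReal.ofReal (∫ x, (s i).indicator h x ∂μ) := by
    intro i
    rw [withDensity_apply _ (hs i), integral_indicator (hs i),
      ofReal_integral_eq_lintegral_ofReal hi.integrableOn (Filter.Eventually.of_forall h0)]
  have hms : MeasurableSet (Set.univ.pi s) := MeasurableSet.univ_pi hs
  rw [withDensity_apply _ hms, ← lintegral_indicator hms]
  simp only [e1]
  rw [← ENNReal.ofReal_prod_of_nonneg fun i _ => integral_nonneg (h0' i),
    ← integral_fintype_prod_eq_prod (fun i => (s i).indicator h),
    ofReal_integral_eq_lintegral_ofReal (Integrable.fintype_prod hInt)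
      (Filter.Eventually.of_forall fun x => Finset.prod_nonneg fun i _ => h0' i (x i))]
  refine lintegral_congr fun x => ?_
  by_cases hx : x ∈ Set.univ.pi s
  · rw [Set.indicator_of_mem hx]
    congr 1
    exact Finset.prod_congr rfl fun i _ => (Set.indicator_of_mem (hx i trivial) _).symm
  · rw [Set.indicator_of_notMem hx]
    have : ∃ i, x i ∉ s i := by
      by_contra hc
      push Not at hc
      exact hx fun i _ => hc i
    obtain ⟨i, hi'⟩ := this
    rw [Finset.prod_eq_zero (Finset.mem_univ i) (Set.indicator_of_notMem hi' _),
      ENNReal.ofReal_zero]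

/-- The Lebesgue density of `qG`. -/
noncomputable def qDens (N B z : ℝ) : ℝ :=
  (√(2 * Real.pi))⁻¹ * Real.exp (-z ^ 2 / 2) * (quartW N B z / quartZ N B)

lemma quartZ_nonneg (N B : ℝ) : 0 ≤ quartZ N B := integral_nonneg (quartW_nonneg N B)

lemma qDens_nonneg (N B z : ℝ) : 0 ≤ qDens N B z := by
  have := div_nonneg (quartW_nonneg N B z) (quartZ_nonneg N B)
  unfold qDens
  positivity

lemma measurable_qDens (N B : ℝ) : Measurable (qDens N B) := by
  unfold qDens
  have := measurable_quartW N B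
  fun_prop

lemma qG_eq_withDensity (N B : ℝ) :
    qG N B = (volume : Measure ℝ).withDensity fun z => ENNReal.ofReal (qDens N B z) := by
  rw [qG, stdG, gaussianReal_of_var_ne_zero 0 one_ne_zero, ← withDensity_mul _
    (measurable_gaussianPDF _ _) ((measurable_quartW N B).div_const _).ennreal_ofReal]
  congr 1
  funext z
  rw [Pi.mul_apply, gaussianPDF, ← ENNReal.ofReal_mul (gaussianPDFReal_nonneg _ _ _)]
  simp [qDens, gaussianPDFReal_def]

lemma integrable_qDens {N B : ℝ} (h : QuartOK N B) : Integrable (qDens N B) volume := by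
  have h1 := (integrable_stdG_iff _).1 ((integrable_quartW h).div_const (quartZ N B))
  refine (h1.const_mul (√(2 * Real.pi))⁻¹).congr (Filter.Eventually.of_forall fun z => ?_)
  simp only [qDens]
  ring

lemma integral_prod_qG {N B M' B' : ℝ} (h : QuartOK N B) (h' : QuartOK M' B')
    (hN : 600 * cD ≤ N) (hM : 600 * cD ≤ M') (m n : ℕ) (G : (Fin m → ℝ) × (Fin n → ℝ) → ℂ) :
    ∫ p, G p ∂((Measure.pi fun _ : Fin m => qG N B).prod (Measure.pi fun _ : Fin n => qG M' B')) =
      ∫ p : (Fin m → ℝ) × (Fin n → ℝ), (((∏ j, qDens N B (p.1 j)) * ∏ k, qDens M' B' (p.2 k) : ℝ) : ℂ) * G p := by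
  have := isProbabilityMeasure_qG h hN
  have := isProbabilityMeasure_qG h' hM
  rw [qG_eq_withDensity] at *
  rw [qG_eq_withDensity M' B'] at *
  have m1 := measurable_qDens N B
  have m2 := measurable_qDens M' B'
  rw [pi_withDensity_ofReal (qDens_nonneg N B) (integrable_qDens h) m,
    pi_withDensity_ofReal (qDens_nonneg M' B') (integrable_qDens h') n,
    prod_withDensity (by fun_prop) (by fun_prop),
    integral_withDensity_eq_integral_toReal_smul (by fun_prop) (Filter.Eventually.of_forall fun _ =>
      ENNReal.mul_lt_top ENNReal.ofReal_lt_top ENNReal.ofReal_lt_top)]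
  refine integral_congr_ae (Filter.Eventually.of_forall fun p => ?_)
  simp only
  rw [ENNReal.toReal_mul, ENNReal.toReal_ofReal (Finset.prod_nonneg fun _ _ => qDens_nonneg _ _ _),
    ENNReal.toReal_ofReal (Finset.prod_nonneg fun _ _ => qDens_nonneg _ _ _), Complex.real_smul]

end ProductMeasure

section ExponentAlgebra

lemma sum_add_cube {m n : ℕ} (θ : Fin m → ℝ) (w : Fin n → ℝ) (hw : ∑ k, w k = 0) :
    ∑ j, ∑ k, (θ j + w k) ^ 3 =
      n * ∑ j, θ j ^ 3 + 3 * (∑ j, θ j) * ∑ k, w k ^ 2 + m * ∑ k, w k ^ 3 := by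
  have e : ∀ j, ∑ k, (θ j + w k) ^ 3 =
      n * θ j ^ 3 + 3 * θ j * ∑ k, w k ^ 2 + ∑ k, w k ^ 3 := by
    intro j
    have : ∀ k, (θ j + w k) ^ 3 =
      θ j ^ 3 + 3 * θ j ^ 2 * w k + 3 * θ j * w k ^ 2 + w k ^ 3 := fun k => by ring
    simp only [this, Finset.sum_add_distrib, ← Finset.mul_sum, hw]
    simp
  simp only [e, Finset.sum_add_distrib, ← Finset.mul_sum, ← Finset.sum_mul]
  simp

lemma sum_add_four {m n : ℕ} (θ : Fin m → ℝ) (w : Fin n → ℝ) (hw : ∑ k, w k = 0) :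
    ∑ j, ∑ k, (θ j + w k) ^ 4 =
      n * ∑ j, θ j ^ 4 + 6 * (∑ j, θ j ^ 2) * (∑ k, w k ^ 2) + 4 * (∑ j, θ j) * (∑ k, w k ^ 3) +
        m * ∑ k, w k ^ 4 := by
  have e : ∀ j, ∑ k, (θ j + w k) ^ 4 =
      n * θ j ^ 4 + 6 * θ j ^ 2 * ∑ k, w k ^ 2 + 4 * θ j * ∑ k, w k ^ 3 + ∑ k, w k ^ 4 := by
    intro j
    have : ∀ k, (θ j + w k) ^ 4 = θ j ^ 4 + 4 * θ j ^ 3 * w k + 6 * θ j ^ 2 * w k ^ 2 +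
      4 * θ j * w k ^ 3 + w k ^ 4 := fun k => by ring
    simp only [this, Finset.sum_add_distrib, ← Finset.mul_sum, hw]
    simp
  simp only [e, Finset.sum_add_distrib, ← Finset.mul_sum, ← Finset.sum_mul]
  simp

/-- Power sums of `c • (x - mean)`. -/
lemma sum_centered {n : ℕ} (hn : 0 < n) (x : Fin n → ℝ) (c : ℝ) :
    (∑ k, (x k - (∑ i, x i) / n) / c = 0) ∧
    (∑ k, ((x k - (∑ i, x i) / n) / c) ^ 2 = (∑ k, x k ^ 2 - (∑ i, x i) ^ 2 / n) / c ^ 2) ∧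
    (∑ k, ((x k - (∑ i, x i) / n) / c) ^ 3 =
      (∑ k, x k ^ 3 - 3 * (∑ i, x i) / n * ∑ k, x k ^ 2 + 2 * (∑ i, x i) ^ 3 / n ^ 2) / c ^ 3) ∧
    (∑ k, ((x k - (∑ i, x i) / n) / c) ^ 4 =
      (∑ k, x k ^ 4 - 4 * (∑ i, x i) / n * ∑ k, x k ^ 3 + 6 * (∑ i, x i) ^ 2 / n ^ 2 * ∑ k, x k ^ 2
        - 3 * (∑ i, x i) ^ 4 / n ^ 3) / c ^ 4) := by
  set C := ∑ i, x i with hC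
  have hn' : (n : ℝ) ≠ 0 := by positivity
  set a := C / n with ha
  have hCa : C = n * a := by rw [ha]; field_simp
  refine ⟨?_, ?_, ?_, ?_⟩
  · rw [← Finset.sum_div, Finset.sum_sub_distrib, ← hC]
    simp [hCa]
  · have : ∀ k, ((x k - a) / c) ^ 2 = (x k ^ 2 - 2 * a * x k + a ^ 2) / c ^ 2 := fun k => by ring
    simp only [this, ← Finset.sum_div, Finset.sum_add_distrib, Finset.sum_sub_distrib,
      ← Finset.mul_sum, ← hC]
    simp only [Finset.sum_const, Finset.card_univ, Fintype.card_fin, nsmul_eq_mul, hCa]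
    congr 1; field_simp; ring
  · have : ∀ k, ((x k - a) / c) ^ 3 =
      (x k ^ 3 - 3 * a * x k ^ 2 + 3 * a ^ 2 * x k - a ^ 3) / c ^ 3 := fun k => by ring
    simp only [this, ← Finset.sum_div, Finset.sum_add_distrib, Finset.sum_sub_distrib,
      ← Finset.mul_sum, ← hC]
    simp only [Finset.sum_const, Finset.card_univ, Fintype.card_fin, nsmul_eq_mul, hCa]
    congr 1; field_simp; ring
  · have : ∀ k, ((x k - a) / c) ^ 4 =
      (x k ^ 4 - 4 * a * x k ^ 3 + 6 * a ^ 2 * x k ^ 2 - 4 * a ^ 3 * x k + a ^ 4) / c ^ 4 :=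
        fun k => by ring
    simp only [this, ← Finset.sum_div, Finset.sum_add_distrib, Finset.sum_sub_distrib,
      ← Finset.mul_sum, ← hC]
    simp only [Finset.sum_const, Finset.card_univ, Fintype.card_fin, nsmul_eq_mul, hCa]
    congr 1; field_simp; ring

/-- The matrix argument `y j k` in terms of the normalised gauge-fixed coordinates. -/
noncomputable def yArg {m n : ℕ} (p : (Fin m → ℝ) × (Fin n → ℝ)) (j : Fin m) (k : Fin n) : ℝ :=
  p.1 j / √n + (p.2 k - (∑ i, p.2 i) / n) / √m

lemma sum_yArg_cube {m n : ℕ} (hm : 0 < m) (hn : 0 < n) (p : (Fin m → ℝ) × (Fin n → ℝ))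
    {A1 C1 C2 : ℝ} (hA1 : A1 = ∑ j, p.1 j) (hC1 : C1 = ∑ k, p.2 k)
    (hC2 : C2 = ∑ k, (p.2 k ^ 2 - 1)) :
    ∑ j, ∑ k, yArg p j k ^ 3 =
      ∑ j, (p.1 j ^ 3 + 3 * ((n : ℝ) / m) * p.1 j) / √n + ∑ k, (p.2 k ^ 3 + 3 * (-1) * p.2 k) / √m +
      (3 * A1 * (C2 - C1 ^ 2 / n) / (m * √n) + (-3 * C1 * C2 / n + 2 * C1 ^ 3 / n ^ 2) / √m) := by
  obtain ⟨s1, s2, s3, s4⟩ := sum_centered hn p.2 (√m)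
  unfold yArg
  rw [sum_add_cube _ _ s1, s2, s3, ← hC1]
  have hS2 : ∑ k, p.2 k ^ 2 = n + C2 := by rw [hC2, Finset.sum_sub_distrib]; simp
  have e1 : ∑ j, (p.1 j / √n) ^ 3 = (∑ j, p.1 j ^ 3) / √n ^ 3 := by
    simp only [div_pow, Finset.sum_div]
  rw [← Finset.sum_div, ← Finset.sum_div, ← Finset.sum_div, Finset.sum_add_distrib,
    Finset.sum_add_distrib, ← Finset.mul_sum, ← Finset.mul_sum, ← hA1, ← hC1, hS2, e1]
  have hp : 0 < √(m : ℝ) := by positivity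
  have hq : 0 < √(n : ℝ) := by positivity
  have hp2 : (m : ℝ) = √m ^ 2 := (Real.sq_sqrt (by positivity)).symm
  have hq2 : (n : ℝ) = √n ^ 2 := (Real.sq_sqrt (by positivity)).symm
  generalize √(m : ℝ) = P at *
  generalize √(n : ℝ) = Q at *
  rw [hp2, hq2]
  field_simp
  ring

lemma sum_yArg_four {m n : ℕ} (hm : 0 < m) (hn : 0 < n) (p : (Fin m → ℝ) × (Fin n → ℝ))
    {A1 A2 C1 C2 C3 : ℝ} (hA1 : A1 = ∑ j, p.1 j) (hA2 : A2 = ∑ j, (p.1 j ^ 2 - 1))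
    (hC1 : C1 = ∑ k, p.2 k) (hC2 : C2 = ∑ k, (p.2 k ^ 2 - 1)) (hC3 : C3 = ∑ k, p.2 k ^ 3) :
    ∑ j, ∑ k, yArg p j k ^ 4 =
      ∑ j, p.1 j ^ 4 / n + ∑ k, p.2 k ^ 4 / m + 6 +
      (6 * ((1 + A2 / m) * (1 + C2 / n - C1 ^ 2 / n ^ 2) - 1) +
        4 * A1 / √n * (C3 - 3 * C1 - 3 * C1 * C2 / n + 2 * C1 ^ 3 / n ^ 2) / (m * √m) +
        (-4 * C1 * C3 / n + 6 * C1 ^ 2 * (n + C2) / n ^ 2 - 3 * C1 ^ 4 / n ^ 3) / m) := by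
  obtain ⟨s1, s2, s3, s4⟩ := sum_centered hn p.2 (√m)
  unfold yArg
  rw [sum_add_four _ _ s1, s2, s3, s4, ← hC1]
  have hS2 : ∑ k, p.2 k ^ 2 = n + C2 := by rw [hC2, Finset.sum_sub_distrib]; simp
  have hT2 : ∑ j, p.1 j ^ 2 = m + A2 := by rw [hA2, Finset.sum_sub_distrib]; simp
  have e1 : ∑ j, (p.1 j / √n) ^ 4 = (∑ j, p.1 j ^ 4) / √n ^ 4 := by
    simp only [div_pow, Finset.sum_div]
  have e2 : ∑ j, (p.1 j / √n) ^ 2 = (∑ j, p.1 j ^ 2) / √n ^ 2 := by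
    simp only [div_pow, Finset.sum_div]
  rw [← Finset.sum_div, ← Finset.sum_div, ← Finset.sum_div, ← hA1, hS2, e1, e2, hT2, ← hC3]
  have hp : 0 < √(m : ℝ) := by positivity
  have hq : 0 < √(n : ℝ) := by positivity
  have hp2 : (m : ℝ) = √m ^ 2 := (Real.sq_sqrt (by positivity)).symm
  have hq2 : (n : ℝ) = √n ^ 2 := (Real.sq_sqrt (by positivity)).symm
  generalize √(m : ℝ) = P at *
  generalize √(n : ℝ) = Q at *
  rw [hp2, hq2]
  field_simp
  ring

end ExponentAlgebra

section ExponentBounds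

lemma abs_mul_le_pow {a b T : ℝ} {i j : ℕ} (ha : |a| ≤ T ^ i) (hb : |b| ≤ T ^ j) :
    |a * b| ≤ T ^ (i + j) := by
  rw [abs_mul, pow_add]
  exact mul_le_mul ha hb (abs_nonneg _) ((abs_nonneg _).trans ha)

lemma abs_mul_le_of_le_one {a y M : ℝ} (ha : |a| ≤ M) (hy0 : 0 ≤ y) (hy : y ≤ 1) :
    |a * y| ≤ M := by
  rw [abs_mul, abs_of_nonneg hy0]
  exact (mul_le_of_le_one_right (abs_nonneg _) hy).trans ha

lemma abs_mul_le_mul {a y M : ℝ} (ha : |a| ≤ M) (hy0 : 0 ≤ y) : |a * y| ≤ M * y := by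
  rw [abs_mul, abs_of_nonneg hy0]
  gcongr

lemma cubic_remainder_bound {A1 C1 C2 P Q T : ℝ} (hT : 1 ≤ T) (hP : 1 ≤ P) (hQ : 1 ≤ Q)
    (hA1 : |A1| ≤ P * T) (hC1 : |C1| ≤ Q * T) (hC2 : |C2| ≤ Q * T) :
    |3 * A1 * (C2 - C1 ^ 2 / Q ^ 2) / (P ^ 2 * Q) +
      (-3 * C1 * C2 / Q ^ 2 + 2 * C1 ^ 3 / (Q ^ 2) ^ 2) / P| ≤ 11 * T ^ 3 / P := by
  have hP0 : 0 < P := by linarith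
  have hQ0 : 0 < Q := by linarith
  obtain ⟨a1, rfl⟩ : ∃ a, A1 = P * a := ⟨A1 / P, by field_simp⟩
  obtain ⟨c1, rfl⟩ : ∃ a, C1 = Q * a := ⟨C1 / Q, by field_simp⟩
  obtain ⟨c2, rfl⟩ : ∃ a, C2 = Q * a := ⟨C2 / Q, by field_simp⟩
  rw [abs_mul, abs_of_pos hP0] at hA1
  rw [abs_mul, abs_of_pos hQ0] at hC1 hC2
  have ha1 : |a1| ≤ T ^ 1 := by rw [pow_one]; exact le_of_mul_le_mul_left hA1 hP0
  have hc1 : |c1| ≤ T ^ 1 := by rw [pow_one]; exact le_of_mul_le_mul_left hC1 hQ0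
  have hc2 : |c2| ≤ T ^ 1 := by rw [pow_one]; exact le_of_mul_le_mul_left hC2 hQ0
  set y := 1 / Q with hy
  have hy0 : 0 ≤ y := by positivity
  have hy1 : y ≤ 1 := by rw [hy, div_le_one hQ0]; exact hQ
  have e : 3 * (P * a1) * (Q * c2 - (Q * c1) ^ 2 / Q ^ 2) / (P ^ 2 * Q) +
      (-3 * (Q * c1) * (Q * c2) / Q ^ 2 + 2 * (Q * c1) ^ 3 / (Q ^ 2) ^ 2) / P =
      (3 * (a1 * c2) - 3 * (a1 * (c1 * c1) * y) - 3 * (c1 * c2) + 2 * (c1 * (c1 * c1) * y)) / P := by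
    rw [hy]; field_simp; ring
  rw [e, abs_div, abs_of_pos hP0]
  have t23 : T ^ 2 ≤ T ^ 3 := pow_le_pow_right₀ hT (by norm_num)
  have b1 := abs_le.1 (abs_mul_le_pow ha1 hc2)
  have b2 := abs_le.1 (abs_mul_le_of_le_one (abs_mul_le_pow ha1 (abs_mul_le_pow hc1 hc1)) hy0 hy1)
  have b3 := abs_le.1 (abs_mul_le_pow hc1 hc2)
  have b4 := abs_le.1 (abs_mul_le_of_le_one (abs_mul_le_pow hc1 (abs_mul_le_pow hc1 hc1)) hy0 hy1)
  norm_num only [Nat.reduceAdd] at b1 b2 b3 b4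
  gcongr
  rw [abs_le]
  constructor <;> linarith

lemma quartic_remainder_bound {A1 A2 C1 C2 C3 P Q T : ℝ} (hT : 1 ≤ T) (hP : 1 ≤ P) (hQ : 1 ≤ Q)
    (hA1 : |A1| ≤ P * T) (hA2 : |A2| ≤ P * T) (hC1 : |C1| ≤ Q * T) (hC2 : |C2| ≤ Q * T)
    (hC3 : |C3| ≤ Q * T) :
    |6 * ((1 + A2 / P ^ 2) * (1 + C2 / Q ^ 2 - C1 ^ 2 / (Q ^ 2) ^ 2) - 1) +
        4 * A1 / Q * (C3 - 3 * C1 - 3 * C1 * C2 / Q ^ 2 + 2 * C1 ^ 3 / (Q ^ 2) ^ 2) / (P ^ 2 * P) +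
        (-4 * C1 * C3 / Q ^ 2 + 6 * C1 ^ 2 * (Q ^ 2 + C2) / (Q ^ 2) ^ 2 -
          3 * C1 ^ 4 / (Q ^ 2) ^ 3) / P ^ 2| ≤ 73 * T ^ 4 / P + 12 * T ^ 4 / Q := by
  have hP0 : 0 < P := by linarith
  have hQ0 : 0 < Q := by linarith
  obtain ⟨a1, rfl⟩ : ∃ a, A1 = P * a := ⟨A1 / P, by field_simp⟩
  obtain ⟨a2, rfl⟩ : ∃ a, A2 = P * a := ⟨A2 / P, by field_simp⟩
  obtain ⟨c1, rfl⟩ : ∃ a, C1 = Q * a := ⟨C1 / Q, by field_simp⟩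
  obtain ⟨c2, rfl⟩ : ∃ a, C2 = Q * a := ⟨C2 / Q, by field_simp⟩
  obtain ⟨c3, rfl⟩ : ∃ a, C3 = Q * a := ⟨C3 / Q, by field_simp⟩
  rw [abs_mul, abs_of_pos hP0] at hA1 hA2
  rw [abs_mul, abs_of_pos hQ0] at hC1 hC2 hC3
  have ha1 : |a1| ≤ T ^ 1 := by rw [pow_one]; exact le_of_mul_le_mul_left hA1 hP0
  have ha2 : |a2| ≤ T ^ 1 := by rw [pow_one]; exact le_of_mul_le_mul_left hA2 hP0
  have hc1 : |c1| ≤ T ^ 1 := by rw [pow_one]; exact le_of_mul_le_mul_left hC1 hQ0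
  have hc2 : |c2| ≤ T ^ 1 := by rw [pow_one]; exact le_of_mul_le_mul_left hC2 hQ0
  have hc3 : |c3| ≤ T ^ 1 := by rw [pow_one]; exact le_of_mul_le_mul_left hC3 hQ0
  set x := 1 / P with hx
  have hx0 : 0 ≤ x := by positivity
  have hx1 : x ≤ 1 := by rw [hx, div_le_one hP0]; exact hP
  set y := 1 / Q with hy
  have hy0 : 0 ≤ y := by positivity
  have hy1 : y ≤ 1 := by rw [hy, div_le_one hQ0]; exact hQ
  have e : 6 * ((1 + P * a2 / P ^ 2) * (1 + Q * c2 / Q ^ 2 - (Q * c1) ^ 2 / (Q ^ 2) ^ 2) - 1) +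
        4 * (P * a1) / Q * (Q * c3 - 3 * (Q * c1) - 3 * (Q * c1) * (Q * c2) / Q ^ 2 +
          2 * (Q * c1) ^ 3 / (Q ^ 2) ^ 2) / (P ^ 2 * P) +
        (-4 * (Q * c1) * (Q * c3) / Q ^ 2 + 6 * (Q * c1) ^ 2 * (Q ^ 2 + Q * c2) / (Q ^ 2) ^ 2 -
          3 * (Q * c1) ^ 4 / (Q ^ 2) ^ 3) / P ^ 2 =
      (6 * a2 + 6 * (a2 * c2 * y) - 6 * (a2 * (c1 * c1) * y * y) + 4 * (a1 * c3 * x)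
        - 12 * (a1 * c1 * x) - 12 * (a1 * (c1 * c2) * y * x) + 8 * (a1 * (c1 * (c1 * c1)) * y * y * x)
        - 4 * (c1 * c3 * x) + 6 * (c1 * c1 * x) + 6 * (c1 * c1 * c2 * y * x)
        - 3 * (c1 * c1 * (c1 * c1) * y * y * x)) * x + (6 * c2 - 6 * (c1 * c1 * y)) * y := by
    rw [hx, hy]; field_simp; ring
  rw [e]
  have t14 : T ^ 1 ≤ T ^ 4 := pow_le_pow_right₀ hT (by norm_num)
  have t24 : T ^ 2 ≤ T ^ 4 := pow_le_pow_right₀ hT (by norm_num)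
  have t34 : T ^ 3 ≤ T ^ 4 := pow_le_pow_right₀ hT (by norm_num)
  have g1 := abs_le.1 ha2
  have g2 := abs_le.1 (abs_mul_le_of_le_one (abs_mul_le_pow ha2 hc2) hy0 hy1)
  have hc11 := abs_mul_le_pow hc1 hc1
  have g3 := abs_le.1 (abs_mul_le_of_le_one (abs_mul_le_of_le_one (abs_mul_le_pow ha2 hc11)
    hy0 hy1) hy0 hy1)
  have g4 := abs_le.1 (abs_mul_le_of_le_one (abs_mul_le_pow ha1 hc3) hx0 hx1)
  have g5 := abs_le.1 (abs_mul_le_of_le_one (abs_mul_le_pow ha1 hc1) hx0 hx1)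
  have g6 := abs_le.1 (abs_mul_le_of_le_one (abs_mul_le_of_le_one (abs_mul_le_pow ha1
    (abs_mul_le_pow hc1 hc2)) hy0 hy1) hx0 hx1)
  have g7 := abs_le.1 (abs_mul_le_of_le_one (abs_mul_le_of_le_one (abs_mul_le_of_le_one
    (abs_mul_le_pow ha1 (abs_mul_le_pow hc1 hc11)) hy0 hy1) hy0 hy1) hx0 hx1)
  have g8 := abs_le.1 (abs_mul_le_of_le_one (abs_mul_le_pow hc1 hc3) hx0 hx1)
  have g9 := abs_le.1 (abs_mul_le_of_le_one hc11 hx0 hx1)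
  have g10 := abs_le.1 (abs_mul_le_of_le_one (abs_mul_le_of_le_one (abs_mul_le_pow hc11 hc2)
    hy0 hy1) hx0 hx1)
  have g11 := abs_le.1 (abs_mul_le_of_le_one (abs_mul_le_of_le_one (abs_mul_le_of_le_one
    (abs_mul_le_pow hc11 hc11) hy0 hy1) hy0 hy1) hx0 hx1)
  have g12 := abs_le.1 hc2
  have g13 := abs_le.1 (abs_mul_le_of_le_one hc11 hy0 hy1)
  norm_num only [Nat.reduceAdd] at g1 g2 g3 g4 g5 g6 g7 g8 g9 g10 g11 g12 g13 t14
  have f : 73 * T ^ 4 / P + 12 * T ^ 4 / Q = 73 * T ^ 4 * x + 12 * T ^ 4 * y := by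
    rw [hx, hy]; ring
  rw [f]
  refine (abs_add_le _ _).trans (add_le_add ?_ ?_)
  · refine abs_mul_le_mul ?_ hx0
    rw [abs_le]
    constructor <;> linarith
  · refine abs_mul_le_mul ?_ hy0
    rw [abs_le]
    constructor <;> linarith

end ExponentBounds

section Tails

open MeasureTheory ProbabilityTheory

lemma pi_sum_tail {μ : Measure ℝ} [IsProbabilityMeasure μ] {F : ℝ → ℝ} (hF : Measurable F)
    {K : ℝ} (hK : 0 < K) (hb : ∀ᵐ z ∂μ, |F z| ≤ K) {d : ℕ} (hd : 0 < d) {T : ℝ} (hT : 0 ≤ T)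
    (hmean : d * |∫ x, F x ∂μ| ≤ √d * T / 2) :
    (Measure.pi fun _ : Fin d => μ).real {z | √d * T < |∑ j, F (z j)|} ≤
      2 * Real.exp (-T ^ 2 / (8 * K ^ 2)) := by
  have hd0 : (0 : ℝ) < d := by positivity
  have h := hoeffding_pi hF hK.le hb d (ε := √d * T / 2) (by positivity)
  refine (measureReal_mono ?_).trans (h.trans_eq ?_)
  · intro z hz
    have hz' : √d * T < |∑ j, F (z j)| := hz
    rw [Set.mem_ofPred_eq]
    have e : ∑ j, (F (z j) - ∫ x, F x ∂μ) = ∑ j, F (z j) - d * ∫ x, F x ∂μ := by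
      rw [Finset.sum_sub_distrib]; simp
    rw [e]
    have h1 := abs_sub_abs_le_abs_sub (∑ j, F (z j)) (d * ∫ x, F x ∂μ)
    rw [abs_mul (d : ℝ), abs_of_pos hd0] at h1
    linarith
  · congr 2
    rw [div_pow, mul_pow, Real.sq_sqrt hd0.le]
    field_simp
    norm_num

lemma pi_coord_tail {μ : Measure ℝ} [IsProbabilityMeasure μ] {c ε : ℝ}
    (h : μ.real {z | c < |z|} ≤ ε) (d : ℕ) :
    (Measure.pi fun _ : Fin d => μ).real {z | ∃ j, c < |z j|} ≤ d * ε := by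
  have e : {z : Fin d → ℝ | ∃ j, c < |z j|} = ⋃ j, {z : Fin d → ℝ | c < |z j|} := by
    ext z; simp
  rw [e]
  refine (measureReal_iUnion_fintype_le _).trans ?_
  have : ∀ j : Fin d, (Measure.pi fun _ : Fin d => μ).real {z : Fin d → ℝ | c < |z j|} ≤ ε := by
    intro j
    have hmp := measurePreserving_eval (fun _ : Fin d => μ) j
    have hms : MeasurableSet {x : ℝ | c < |x|} := measurableSet_lt measurable_const (by fun_prop)
    have h2 := hmp.measureReal_preimage hms.nullMeasurableSet
    exact h2.trans_le h
  refine (Finset.sum_le_sum fun j _ => this j).trans_eq ?_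
  simp

lemma prod_real_fst {α β : Type*} [MeasurableSpace α] [MeasurableSpace β] (μ : Measure α)
    (ν : Measure β) [IsProbabilityMeasure μ] [IsProbabilityMeasure ν] {s : Set α}
    (hs : MeasurableSet s) : (μ.prod ν).real {p | p.1 ∈ s} = μ.real s :=
  (measurePreserving_fst (μ := μ) (ν := ν)).measureReal_preimage hs.nullMeasurableSet

lemma prod_real_snd {α β : Type*} [MeasurableSpace α] [MeasurableSpace β] (μ : Measure α)
    (ν : Measure β) [IsProbabilityMeasure μ] [IsProbabilityMeasure ν] {s : Set β}
    (hs : MeasurableSet s) : (μ.prod ν).real {p | p.2 ∈ s} = ν.real s :=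
  (measurePreserving_snd (μ := μ) (ν := ν)).measureReal_preimage hs.nullMeasurableSet

/-- The reference product measure. -/
noncomputable abbrev refM (m n : ℕ) (B : ℝ) : Measure ((Fin m → ℝ) × (Fin n → ℝ)) :=
  (Measure.pi fun _ : Fin m => qG n B).prod (Measure.pi fun _ : Fin n => qG m B)

/-- The event that one of the linear statistics is atypically large. -/
def badEvent (m n : ℕ) (T : ℝ) : Set ((Fin m → ℝ) × (Fin n → ℝ)) :=
  {p | p.1 ∈ {z : Fin m → ℝ | √m * T < |∑ j, z j|}} ∪
  {p | p.1 ∈ {z : Fin m → ℝ | √m * T < |∑ j, (z j ^ 2 - 1)|}} ∪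
  {p | p.2 ∈ {z : Fin n → ℝ | √n * T < |∑ j, z j|}} ∪
  {p | p.2 ∈ {z : Fin n → ℝ | √n * T < |∑ j, (z j ^ 2 - 1)|}} ∪
  {p | p.2 ∈ {z : Fin n → ℝ | √n * T < |∑ j, z j ^ 3|}}

lemma measurableSet_badEvent (m n : ℕ) (T : ℝ) : MeasurableSet (badEvent m n T) := by
  have a1 : MeasurableSet {z : Fin m → ℝ | √m * T < |∑ j, z j|} :=
    measurableSet_lt measurable_const (by fun_prop)
  have a2 : MeasurableSet {z : Fin m → ℝ | √m * T < |∑ j, (z j ^ 2 - 1)|} :=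
    measurableSet_lt measurable_const (by fun_prop)
  have a3 : MeasurableSet {z : Fin n → ℝ | √n * T < |∑ j, z j|} :=
    measurableSet_lt measurable_const (by fun_prop)
  have a4 : MeasurableSet {z : Fin n → ℝ | √n * T < |∑ j, (z j ^ 2 - 1)|} :=
    measurableSet_lt measurable_const (by fun_prop)
  have a5 : MeasurableSet {z : Fin n → ℝ | √n * T < |∑ j, z j ^ 3|} :=
    measurableSet_lt measurable_const (by fun_prop)
  exact ((((measurable_fst a1).union (measurable_fst a2)).union (measurable_snd a3)).union
    (measurable_snd a4)).union (measurable_snd a5)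

lemma refM_badEvent {m n : ℕ} {B T : ℝ} (hB : 1 ≤ B) (hm : QuartOK m B) (hn : QuartOK n B)
    (hmc : 600 * cD ≤ m) (hnc : 600 * cD ≤ n) (hT : 0 ≤ T)
    (h1 : 8 * cD * (m / n) ≤ T) (h2 : 8 * cD * (n / m) ≤ T) :
    (refM m n B).real (badEvent m n T) ≤ 10 * Real.exp (-T ^ 2 / (32 * B ^ 6)) := by
  have := isProbabilityMeasure_qG hm hmc
  have := isProbabilityMeasure_qG hn hnc
  have hcD := one_le_cD
  have hm1 := hm.one_le
  have hn1 := hn.one_le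
  have hm0 : 0 < m := by rcases Nat.eq_zero_or_pos m with h | h; (subst h; norm_num at hm1); exact h
  have hn0 : 0 < n := by rcases Nat.eq_zero_or_pos n with h | h; (subst h; norm_num at hn1); exact h
  have hB3 : 1 ≤ B ^ 3 := one_le_pow₀ hB
  have hB13 : B ≤ B ^ 3 := le_self_pow₀ hB (by norm_num)
  have hB23 : B ^ 2 ≤ B ^ 3 := pow_le_pow_right₀ hB (by norm_num)
  have ex : -T ^ 2 / (8 * (2 * B ^ 3) ^ 2) = -T ^ 2 / (32 * B ^ 6) := by congr 1; ring
  have hK : 0 < 2 * B ^ 3 := by positivity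
  have bd1 : ∀ N : ℝ, ∀ᵐ z ∂(qG N B), |z| ≤ 2 * B ^ 3 := fun N =>
    (qG_ae_abs_le N B).mono fun z hz => by linarith
  have bd2 : ∀ N : ℝ, ∀ᵐ z ∂(qG N B), |z ^ 2 - 1| ≤ 2 * B ^ 3 := fun N =>
    (qG_ae_abs_le N B).mono fun z hz => by
      have h3 : z ^ 2 ≤ B ^ 2 := by rw [← sq_abs]; gcongr
      rw [abs_le]; constructor <;> nlinarith [sq_nonneg z]
  have bd3 : ∀ N : ℝ, ∀ᵐ z ∂(qG N B), |z ^ 3| ≤ 2 * B ^ 3 := fun N =>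
    (qG_ae_abs_le N B).mono fun z hz => by
      have h3 : |z| ^ 3 ≤ B ^ 3 := by gcongr
      rw [abs_pow]; linarith
  have sm : 1 ≤ √(m : ℝ) := Real.one_le_sqrt.2 hm1
  have sn : 1 ≤ √(n : ℝ) := Real.one_le_sqrt.2 hn1
  have z1 : ∀ (d : ℕ) (N : ℝ), d * |∫ x, x ∂(qG N B)| ≤ √d * T / 2 := fun d N => by
    rw [integral_qG_odd (f := fun x => x) (fun z => rfl), abs_zero, mul_zero]; positivity
  have z3 : ∀ (d : ℕ) (N : ℝ), d * |∫ x, x ^ 3 ∂(qG N B)| ≤ √d * T / 2 := fun d N => by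
    rw [integral_qG_odd (f := fun x => x ^ 3) (fun z => by ring), abs_zero, mul_zero]; positivity
  have z2m : m * |∫ x, (x ^ 2 - 1) ∂(qG n B)| ≤ √m * T / 2 := by
    have h3 := integral_qG_sq_sub_one hn hnc
    calc m * |∫ x, (x ^ 2 - 1) ∂(qG n B)| ≤ m * (4 / n * cD) := by gcongr
      _ = (8 * cD * (m / n)) / 2 := by ring
      _ ≤ T / 2 := by gcongr
      _ ≤ √m * T / 2 := by gcongr; exact le_mul_of_one_le_left hT sm
  have z2n : n * |∫ x, (x ^ 2 - 1) ∂(qG m B)| ≤ √n * T / 2 := by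
    have h3 := integral_qG_sq_sub_one hm hmc
    calc n * |∫ x, (x ^ 2 - 1) ∂(qG m B)| ≤ n * (4 / m * cD) := by gcongr
      _ = (8 * cD * (n / m)) / 2 := by ring
      _ ≤ T / 2 := by gcongr
      _ ≤ √n * T / 2 := by gcongr; exact le_mul_of_one_le_left hT sn
  have t1 := pi_sum_tail (F := fun x => x) (by fun_prop) hK (bd1 n) hm0 hT (z1 m n)
  have t2 := pi_sum_tail (F := fun x => x ^ 2 - 1) (by fun_prop) hK (bd2 n) hm0 hT z2m
  have t3 := pi_sum_tail (F := fun x => x) (by fun_prop) hK (bd1 m) hn0 hT (z1 n m)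
  have t4 := pi_sum_tail (F := fun x => x ^ 2 - 1) (by fun_prop) hK (bd2 m) hn0 hT z2n
  have t5 := pi_sum_tail (F := fun x => x ^ 3) (by fun_prop) hK (bd3 m) hn0 hT (z3 n m)
  rw [ex] at t1 t2 t3 t4 t5
  unfold badEvent
  have u1 := measureReal_union_le (μ := refM m n B)
    ({p | p.1 ∈ {z : Fin m → ℝ | √m * T < |∑ j, z j|}} ∪
      {p | p.1 ∈ {z : Fin m → ℝ | √m * T < |∑ j, (z j ^ 2 - 1)|}} ∪
      {p | p.2 ∈ {z : Fin n → ℝ | √n * T < |∑ j, z j|}} ∪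
      {p | p.2 ∈ {z : Fin n → ℝ | √n * T < |∑ j, (z j ^ 2 - 1)|}})
    {p | p.2 ∈ {z : Fin n → ℝ | √n * T < |∑ j, z j ^ 3|}}
  have u2 := measureReal_union_le (μ := refM m n B)
    ({p | p.1 ∈ {z : Fin m → ℝ | √m * T < |∑ j, z j|}} ∪
      {p | p.1 ∈ {z : Fin m → ℝ | √m * T < |∑ j, (z j ^ 2 - 1)|}} ∪
      {p | p.2 ∈ {z : Fin n → ℝ | √n * T < |∑ j, z j|}})
    {p | p.2 ∈ {z : Fin n → ℝ | √n * T < |∑ j, (z j ^ 2 - 1)|}}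
  have u3 := measureReal_union_le (μ := refM m n B)
    ({p | p.1 ∈ {z : Fin m → ℝ | √m * T < |∑ j, z j|}} ∪
      {p | p.1 ∈ {z : Fin m → ℝ | √m * T < |∑ j, (z j ^ 2 - 1)|}})
    {p | p.2 ∈ {z : Fin n → ℝ | √n * T < |∑ j, z j|}}
  have u4 := measureReal_union_le (μ := refM m n B)
    {p | p.1 ∈ {z : Fin m → ℝ | √m * T < |∑ j, z j|}}
    {p | p.1 ∈ {z : Fin m → ℝ | √m * T < |∑ j, (z j ^ 2 - 1)|}}
  rw [prod_real_fst _ _ (measurableSet_lt measurable_const (by fun_prop)),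
    prod_real_fst _ _ (measurableSet_lt measurable_const (by fun_prop))] at u4
  rw [prod_real_snd _ _ (measurableSet_lt measurable_const (by fun_prop))] at u3 u2 u1
  linarith

lemma refM_compl_gaussDomain {m n : ℕ} {B b : ℝ} (hm : QuartOK m B) (hn : QuartOK n B)
    (hmc : 600 * cD ≤ m) (hnc : 600 * cD ≤ n) (hb : 0 ≤ b) :
    (refM m n B).real (gaussDomain m n (b / √n))ᶜ ≤
      m * (Real.exp (-(b / 4) ^ 2 / 8) * cD) + n * (Real.exp (-(√m * b / (4 * √n)) ^ 2 / 8) * cD) := by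
  have := isProbabilityMeasure_qG hm hmc
  have := isProbabilityMeasure_qG hn hnc
  have hm1 := hm.one_le
  have hn1 := hn.one_le
  have hm0 : (0 : ℝ) < m := by linarith
  have hn0 : (0 : ℝ) < n := by linarith
  have t1 := pi_coord_tail (qG_tail hn hnc (b := b / 4) (by positivity)) m
  have t2 := pi_coord_tail (qG_tail hm hmc (b := √m * b / (4 * √n)) (by positivity)) n
  have s1 : MeasurableSet {z : Fin m → ℝ | ∃ j, b / 4 < |z j|} := by
    have : {z : Fin m → ℝ | ∃ j, b / 4 < |z j|} = ⋃ j, {z | b / 4 < |z j|} := by ext; simp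
    rw [this]
    exact MeasurableSet.iUnion fun j => measurableSet_lt measurable_const (by fun_prop)
  have s2 : MeasurableSet {z : Fin n → ℝ | ∃ j, √m * b / (4 * √n) < |z j|} := by
    have : {z : Fin n → ℝ | ∃ j, √m * b / (4 * √n) < |z j|} =
      ⋃ j, {z | √m * b / (4 * √n) < |z j|} := by ext; simp
    rw [this]
    exact MeasurableSet.iUnion fun j => measurableSet_lt measurable_const (by fun_prop)
  rw [← prod_real_fst (Measure.pi fun _ : Fin m => qG n B) (Measure.pi fun _ : Fin n => qG m B) s1]
    at t1
  rw [← prod_real_snd (Measure.pi fun _ : Fin m => qG n B) (Measure.pi fun _ : Fin n => qG m B) s2]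
    at t2
  refine le_trans ?_ (add_le_add t1 t2)
  refine (measureReal_mono ?_).trans (measureReal_union_le _ _)
  intro p hp
  by_contra hc
  simp only [Set.mem_union, Set.mem_ofPred_eq, not_or, not_exists, not_lt] at hc
  obtain ⟨c1, c2⟩ := hc
  apply hp
  have sn : 0 < √(n : ℝ) := Real.sqrt_pos.2 hn0
  have sm : 0 < √(m : ℝ) := Real.sqrt_pos.2 hm0
  have hv : |(∑ k, p.2 k) / n| ≤ √m * b / (4 * √n) := by
    rw [abs_div, abs_of_pos hn0, div_le_iff₀ hn0]
    refine (Finset.abs_sum_le_sum_abs _ _).trans ((Finset.sum_le_sum fun k _ => c2 k).trans_eq ?_)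
    simp [mul_comm]
  have hv2 : √m * b / (4 * √n) / √m = b / √n / 4 := by field_simp
  have d2 : |(∑ k, p.2 k) / n / √m| ≤ b / √n / 4 := by
    rw [abs_div, abs_of_pos sm, ← hv2]; gcongr
  have hbs : 0 ≤ b / √n := by positivity
  refine ⟨fun j k => ?_, by linarith⟩
  have d1 : |p.1 j / √n| ≤ b / √n / 4 := by
    rw [abs_div, abs_of_pos sn, div_right_comm]; gcongr; exact c1 j
  have d3 : |p.2 k / √m| ≤ b / √n / 4 := by
    rw [abs_div, abs_of_pos sm, ← hv2]; gcongr; exact c2 k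
  rw [sub_div, abs_le]
  rw [abs_le] at d1 d2 d3
  constructor <;> linarith [d1.1, d1.2]

end Tails

section Comparison

open MeasureTheory ProbabilityTheory

/-- The oscillating factor attached to one coordinate. -/
noncomputable def cubicPhase (N α z : ℝ) : ℂ :=
  Complex.exp (-((z ^ 3 + 3 * α * z) / (3 * √N) : ℝ) * Complex.I)

lemma norm_cubicPhase (N α z : ℝ) : ‖cubicPhase N α z‖ = 1 := by
  rw [cubicPhase, ← Complex.ofReal_neg, Complex.norm_exp_ofReal_mul_I]

lemma measurable_cubicPhase (N α : ℝ) : Measurable (cubicPhase N α) := by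
  unfold cubicPhase; fun_prop

/-- The integrand of the box integral relative to the reference measure. -/
noncomputable def boxFactor (κ : ℝ → ℂ) (m n : ℕ) (b : ℝ) (p : (Fin m → ℝ) × (Fin n → ℝ)) : ℂ :=
  (gaussDomain m n (b / √n)).indicator (fun p => (∏ i : Fin m × Fin n, κ (yArg p i.1 i.2)) *
    Complex.exp (-(∑ j, p.1 j ^ 4 / (4 * n) + ∑ k, p.2 k ^ 4 / (4 * m) : ℝ))) p

lemma measurable_boxFactor {κ : ℝ → ℂ} (hκ : Measurable κ) (m n : ℕ) (b : ℝ) :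
    Measurable (boxFactor κ m n b) := by
  refine Measurable.indicator ?_ (measurableSet_gaussDomain _ _ _)
  refine Measurable.mul ?_ (by fun_prop)
  refine Finset.measurable_prod _ fun i _ => hκ.comp ?_
  unfold yArg
  fun_prop

lemma boxFactor_near {κ E : ℝ → ℂ} {m n : ℕ} {b T η : ℝ} (hm : 0 < m) (hn : 0 < n) (hT : 1 ≤ T)
    (hE : ∀ y, |y| ≤ b / √n → ‖E y‖ ≤ η)
    (hκ : ∀ y : ℝ, |y| ≤ b / √n →
      κ y = Complex.exp (-Complex.I * y ^ 3 / 3 + y ^ 4 / 4 + E y))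
    {δ : ℝ} (hδ : δ = 11 * T ^ 3 / √m / 3 + (73 * T ^ 4 / √m + 12 * T ^ 4 / √n) / 4 + m * n * η)
    (hδ1 : δ ≤ 1) {p : (Fin m → ℝ) × (Fin n → ℝ)} (hp : p ∈ gaussDomain m n (b / √n))
    (hb : p ∉ badEvent m n T) :
    ‖boxFactor κ m n b p - Real.exp (3 / 2) *
      ((∏ j, cubicPhase n ((n : ℝ) / m) (p.1 j)) * ∏ k, cubicPhase m (-1) (p.2 k))‖ ≤
      2 * Real.exp (3 / 2) * δ := by
  simp only [badEvent, Set.mem_union, Set.mem_ofPred_eq, not_or, not_lt] at hb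
  obtain ⟨⟨⟨⟨b1, b2⟩, b3⟩, b4⟩, b5⟩ := hb
  have hP : 1 ≤ √(m : ℝ) := Real.one_le_sqrt.2 (by exact_mod_cast hm)
  have hQ : 1 ≤ √(n : ℝ) := Real.one_le_sqrt.2 (by exact_mod_cast hn)
  have c := cubic_remainder_bound hT hP hQ b1 b3 b4
  have q := quartic_remainder_bound hT hP hQ b1 b2 b3 b4 b5
  have sP : √(m : ℝ) ^ 2 = m := Real.sq_sqrt (Nat.cast_nonneg _)
  have sQ : √(n : ℝ) ^ 2 = n := Real.sq_sqrt (Nat.cast_nonneg _)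
  rw [sP, sQ] at c q
  obtain ⟨A1, hA1⟩ : ∃ x, x = ∑ j, p.1 j := ⟨_, rfl⟩
  obtain ⟨A2, hA2⟩ : ∃ x, x = ∑ j, (p.1 j ^ 2 - 1) := ⟨_, rfl⟩
  obtain ⟨C1, hC1⟩ : ∃ x, x = ∑ k, p.2 k := ⟨_, rfl⟩
  obtain ⟨C2, hC2⟩ : ∃ x, x = ∑ k, (p.2 k ^ 2 - 1) := ⟨_, rfl⟩
  obtain ⟨C3, hC3⟩ : ∃ x, x = ∑ k, p.2 k ^ 3 := ⟨_, rfl⟩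
  have e3 := sum_yArg_cube hm hn p hA1 hC1 hC2
  have e4 := sum_yArg_four hm hn p hA1 hA2 hC1 hC2 hC3
  rw [← hA1, ← hC1, ← hC2] at c
  rw [← hA1, ← hA2, ← hC1, ← hC2, ← hC3] at q
  generalize 3 * A1 * (C2 - C1 ^ 2 / n) / (m * √n) +
    (-3 * C1 * C2 / n + 2 * C1 ^ 3 / n ^ 2) / √m = r3 at c e3
  generalize 6 * ((1 + A2 / m) * (1 + C2 / n - C1 ^ 2 / n ^ 2) - 1) +
        4 * A1 / √n * (C3 - 3 * C1 - 3 * C1 * C2 / n + 2 * C1 ^ 3 / n ^ 2) / (m * √m) +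
        (-4 * C1 * C3 / n + 6 * C1 ^ 2 * (n + C2) / n ^ 2 - 3 * C1 ^ 4 / n ^ 3) / m = r4 at q e4
  have hyE : ∀ i : Fin m × Fin n, |yArg p i.1 i.2| ≤ b / √n := fun i => hp.1 i.1 i.2
  have hs : ‖∑ i : Fin m × Fin n, E (yArg p i.1 i.2)‖ ≤ m * n * η := by
    refine (norm_sum_le _ _).trans ((Finset.sum_le_sum fun i _ => hE _ (hyE i)).trans_eq ?_)
    simp
  have hprod : ∏ i : Fin m × Fin n, κ (yArg p i.1 i.2) =
      Complex.exp (-Complex.I / 3 * (∑ j, ∑ k, yArg p j k ^ 3 : ℝ) +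
        (∑ j, ∑ k, yArg p j k ^ 4 : ℝ) / 4 + ∑ i : Fin m × Fin n, E (yArg p i.1 i.2)) := by
    rw [Finset.prod_congr rfl fun i _ => hκ _ (hyE i), ← Complex.exp_sum, Finset.sum_add_distrib,
      Finset.sum_add_distrib, ← Finset.sum_div, ← Finset.sum_div, ← Finset.mul_sum,
      Fintype.sum_prod_type, Fintype.sum_prod_type]
    push_cast
    congr 3
    ring
  have hphase : (∏ j, cubicPhase n ((n : ℝ) / m) (p.1 j)) * ∏ k, cubicPhase m (-1) (p.2 k) =
      Complex.exp (-Complex.I / 3 *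
        (∑ j, (p.1 j ^ 3 + 3 * ((n : ℝ) / m) * p.1 j) / √n +
          ∑ k, (p.2 k ^ 3 + 3 * (-1) * p.2 k) / √m : ℝ)) := by
    unfold cubicPhase
    rw [← Complex.exp_sum, ← Complex.exp_sum, ← Complex.exp_add, ← Finset.sum_mul,
      ← Finset.sum_mul]
    congr 1
    push_cast
    have f1 : ∀ (x s : ℂ), x / (3 * s) = (1 / 3) * (x / s) := fun x s => by ring
    simp only [f1, Finset.sum_neg_distrib, ← Finset.mul_sum]
    ring
  rw [boxFactor, Set.indicator_of_mem hp, hprod, hphase, e3, e4, ← Complex.exp_add,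
    Complex.ofReal_exp, ← Complex.exp_add]
  set S3 : ℝ := ∑ j, (p.1 j ^ 3 + 3 * ((n : ℝ) / m) * p.1 j) / √n +
          ∑ k, (p.2 k ^ 3 + 3 * (-1) * p.2 k) / √m with hS3
  set D : ℂ := -Complex.I / 3 * r3 + r4 / 4 + ∑ i : Fin m × Fin n, E (yArg p i.1 i.2) with hD
  have hDn : ‖D‖ ≤ δ := by
    rw [hD, hδ]
    refine (norm_add₃_le).trans (add_le_add (add_le_add ?_ ?_) hs)
    · simp only [norm_mul, norm_div, norm_neg, Complex.norm_I, Complex.norm_real, Real.norm_eq_abs,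
        Complex.norm_ofNat]
      linarith
    · simp only [norm_div, Complex.norm_real, Real.norm_eq_abs, Complex.norm_ofNat]
      linarith
  have key : -Complex.I / 3 * ((S3 + r3 : ℝ) : ℂ) +
      ((∑ j, p.1 j ^ 4 / n + ∑ k, p.2 k ^ 4 / m + 6 + r4 : ℝ) : ℂ) / 4 +
        ∑ i : Fin m × Fin n, E (yArg p i.1 i.2) +
      -((∑ j, p.1 j ^ 4 / (4 * n) + ∑ k, p.2 k ^ 4 / (4 * m) : ℝ) : ℂ) =
      ((3 / 2 : ℝ) + -Complex.I / 3 * S3) + D := by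
    have f4 : ∀ x s : ℝ, x / (4 * s) = x / s / 4 := fun x s => by ring
    simp only [f4, ← Finset.sum_div]
    rw [hD]
    push_cast
    ring
  rw [key, Complex.exp_add _ D, ← mul_sub_one, norm_mul]
  have n1 : ‖Complex.exp (((3 / 2 : ℝ) : ℂ) + -Complex.I / 3 * S3)‖ = Real.exp (3 / 2) := by
    rw [Complex.norm_exp]
    congr 1
    simp [Complex.mul_re]
  have n2 := Complex.norm_exp_sub_one_le (hDn.trans hδ1)
  rw [n1]
  have : 0 < Real.exp (3 / 2) := Real.exp_pos _
  nlinarith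

lemma norm_boxFactor_le {κ E : ℝ → ℂ} {m n : ℕ} {b η : ℝ}
    (hE : ∀ y, |y| ≤ b / √n → ‖E y‖ ≤ η)
    (hκ : ∀ y : ℝ, |y| ≤ b / √n →
      κ y = Complex.exp (-Complex.I * y ^ 3 / 3 + y ^ 4 / 4 + E y))
    (p : (Fin m → ℝ) × (Fin n → ℝ)) :
    ‖boxFactor κ m n b p‖ ≤ Real.exp (m * n * ((b / √n) ^ 4 / 4 + η)) := by
  by_cases hp : p ∈ gaussDomain m n (b / √n)
  · rw [boxFactor, Set.indicator_of_mem hp, norm_mul, norm_prod]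
    have h1 : ‖Complex.exp (-((∑ j, p.1 j ^ 4 / (4 * n) + ∑ k, p.2 k ^ 4 / (4 * m) : ℝ) : ℂ))‖
        ≤ 1 := by
      rw [← Complex.ofReal_neg, Complex.norm_exp_ofReal]
      refine Real.exp_le_one_iff.2 (neg_nonpos.2 ?_)
      positivity
    have h2 : ∀ i : Fin m × Fin n, ‖κ (yArg p i.1 i.2)‖ ≤ Real.exp ((b / √n) ^ 4 / 4 + η) := by
      intro i
      have hy : |yArg p i.1 i.2| ≤ b / √n := hp.1 i.1 i.2
      rw [hκ _ hy, Complex.norm_exp]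
      refine Real.exp_le_exp.2 ?_
      have h3 : (E (yArg p i.1 i.2)).re ≤ η := (Complex.re_le_norm _).trans (hE _ hy)
      have h4 : yArg p i.1 i.2 ^ 4 ≤ (b / √n) ^ 4 := by
        rw [← Even.pow_abs (by decide)]; gcongr
      have h5 : (-Complex.I * (yArg p i.1 i.2 : ℂ) ^ 3 / 3 + (yArg p i.1 i.2 : ℂ) ^ 4 / 4).re =
          yArg p i.1 i.2 ^ 4 / 4 := by
        rw [Complex.add_re]
        have g1 : -Complex.I * (yArg p i.1 i.2 : ℂ) ^ 3 / 3 =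
          ((-(yArg p i.1 i.2 ^ 3 / 3) : ℝ) : ℂ) * Complex.I := by push_cast; ring
        have g2 : (yArg p i.1 i.2 : ℂ) ^ 4 / 4 = ((yArg p i.1 i.2 ^ 4 / 4 : ℝ) : ℂ) := by
          push_cast; ring
        rw [g1, g2, Complex.re_ofReal_mul, Complex.ofReal_re]
        simp
      rw [Complex.add_re, h5]
      linarith
    calc _ ≤ (∏ i : Fin m × Fin n, Real.exp ((b / √n) ^ 4 / 4 + η)) * 1 := by
          gcongr with i _
          exact h2 i
      _ = _ := by
          rw [Finset.prod_const, mul_one, ← Real.exp_nat_mul]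
          simp
  · rw [boxFactor, Set.indicator_of_notMem hp, norm_zero]
    positivity

lemma integral_boxFactor {κ E : ℝ → ℂ} {m n : ℕ} {B b T η : ℝ} (hκm : Measurable κ)
    (hη : 0 ≤ η) (hm : QuartOK m B) (hn : QuartOK n B) (hmc : 600 * cD ≤ m) (hnc : 600 * cD ≤ n) (hT : 1 ≤ T)
    (hE : ∀ y, |y| ≤ b / √n → ‖E y‖ ≤ η)
    (hκ : ∀ y : ℝ, |y| ≤ b / √n →
      κ y = Complex.exp (-Complex.I * y ^ 3 / 3 + y ^ 4 / 4 + E y))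
    {δ : ℝ} (hδ : δ = 11 * T ^ 3 / √m / 3 + (73 * T ^ 4 / √m + 12 * T ^ 4 / √n) / 4 + m * n * η)
    (hδ1 : δ ≤ 1) :
    ‖∫ p, boxFactor κ m n b p ∂(refM m n B) - Real.exp (3 / 2) *
      ((∫ z, cubicPhase n ((n : ℝ) / m) z ∂(qG n B)) ^ m *
        (∫ z, cubicPhase m (-1) z ∂(qG m B)) ^ n)‖ ≤
      2 * Real.exp (3 / 2) * δ +
      (Real.exp (m * n * ((b / √n) ^ 4 / 4 + η)) + Real.exp (3 / 2)) *
        (refM m n B).real (badEvent m n T) +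
      Real.exp (3 / 2) * (refM m n B).real (gaussDomain m n (b / √n))ᶜ := by
  have := isProbabilityMeasure_qG hm hmc
  have := isProbabilityMeasure_qG hn hnc
  have hm1 := hm.one_le
  have hn1 := hn.one_le
  have hm0 : 0 < m := by exact_mod_cast (by linarith : (0 : ℝ) < m)
  have hn0 : 0 < n := by exact_mod_cast (by linarith : (0 : ℝ) < n)
  set G := Real.exp (m * n * ((b / √n) ^ 4 / 4 + η))
  set g : (Fin m → ℝ) × (Fin n → ℝ) → ℂ := fun p =>
    (∏ j, cubicPhase n ((n : ℝ) / m) (p.1 j)) * ∏ k, cubicPhase m (-1) (p.2 k) with hg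
  have hgm : Measurable g := by
    refine Measurable.mul ?_ ?_
    · exact Finset.measurable_prod _ fun j _ => (measurable_cubicPhase _ _).comp (by fun_prop)
    · exact Finset.measurable_prod _ fun j _ => (measurable_cubicPhase _ _).comp (by fun_prop)
  have hgn : ∀ p, ‖g p‖ = 1 := fun p => by
    simp only [hg, norm_mul, norm_prod, norm_cubicPhase, Finset.prod_const_one, mul_one]
  have hgi : Integrable g (refM m n B) :=
    Integrable.of_bound hgm.aestronglyMeasurable 1 (.of_forall fun p => (hgn p).le)
  have hfi : Integrable (boxFactor κ m n b) (refM m n B) :=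
    Integrable.of_bound (measurable_boxFactor hκm m n b).aestronglyMeasurable G
      (.of_forall fun p => norm_boxFactor_le hE hκ p)
  have hInt : ∫ p, g p ∂(refM m n B) = (∫ z, cubicPhase n ((n : ℝ) / m) z ∂(qG n B)) ^ m *
        (∫ z, cubicPhase m (-1) z ∂(qG m B)) ^ n := by
    rw [hg, refM, integral_prod_mul (fun x : Fin m → ℝ => ∏ j, cubicPhase n ((n : ℝ) / m) (x j))
      (fun y : Fin n → ℝ => ∏ k, cubicPhase m (-1) (y k))]
    rw [integral_fintype_prod_eq_prod (fun _ => cubicPhase n ((n : ℝ) / m)),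
      integral_fintype_prod_eq_prod (fun _ => cubicPhase m (-1))]
    simp
  rw [← hInt, ← integral_const_mul, ← integral_sub hfi (hgi.const_mul _)]
  have hbm := measurableSet_badEvent m n T
  have hdm := (measurableSet_gaussDomain m n (b / √n)).compl
  have he : 0 < Real.exp (3 / 2) := Real.exp_pos _
  have hG : 0 < G := Real.exp_pos _
  have hδ0 : 0 ≤ δ := by rw [hδ]; positivity
  refine (norm_integral_le_of_norm_le (g := fun p => 2 * Real.exp (3 / 2) * δ +
    (badEvent m n T).indicator (fun _ => G + Real.exp (3 / 2)) p +
    (gaussDomain m n (b / √n))ᶜ.indicator (fun _ => Real.exp (3 / 2)) p) ?_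
    (.of_forall fun p => ?_)).trans_eq ?_
  · exact ((integrable_const _).add ((integrable_const _).indicator hbm)).add
      ((integrable_const _).indicator hdm)
  · have i1 : 0 ≤ (badEvent m n T).indicator (fun _ => G + Real.exp (3 / 2)) p :=
      Set.indicator_nonneg (fun _ _ => by positivity) _
    have i2 : 0 ≤ (gaussDomain m n (b / √n))ᶜ.indicator (fun _ => Real.exp (3 / 2)) p :=
      Set.indicator_nonneg (fun _ _ => by positivity) _
    have i3 : ‖(Real.exp (3 / 2) : ℂ) * g p‖ = Real.exp (3 / 2) := by
      rw [norm_mul, hgn, mul_one, Complex.norm_real, Real.norm_of_nonneg he.le]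
    have i4 : 0 ≤ 2 * Real.exp (3 / 2) * δ := by positivity
    by_cases hp : p ∈ gaussDomain m n (b / √n)
    · by_cases hb : p ∈ badEvent m n T
      · rw [Set.indicator_of_mem hb]
        have := norm_sub_le (boxFactor κ m n b p) (Real.exp (3 / 2) * g p)
        have := norm_boxFactor_le hE hκ p
        linarith
      · have := boxFactor_near hm0 hn0 hT hE hκ hδ hδ1 hp hb
        simp only [hg]
        linarith
    · rw [Set.indicator_of_mem (s := (gaussDomain m n (b / √n))ᶜ) hp]
      rw [boxFactor, Set.indicator_of_notMem hp, zero_sub, norm_neg, i3]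
      linarith
  · rw [integral_add ((integrable_const _).add ((integrable_const _).indicator hbm))
      ((integrable_const _).indicator hdm), integral_add (integrable_const _)
      ((integrable_const _).indicator hbm), integral_indicator_const _ hbm,
      integral_indicator_const _ hdm]
    simp [mul_comm]

end Comparison

section Transfer

open MeasureTheory ProbabilityTheory

lemma abs_le_of_mem_gaussDomain {m n : ℕ} {β : ℝ} (hm : 0 < m) (hn : 0 < n)
    {p : (Fin m → ℝ) × (Fin n → ℝ)} (hp : p ∈ gaussDomain m n β) :
    (∀ j, |p.1 j| ≤ √n * β) ∧ ∀ k, |p.2 k| ≤ 3 * (√m * β) := by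
  have hm0 : (0 : ℝ) < m := by exact_mod_cast hm
  have hn0 : (0 : ℝ) < n := by exact_mod_cast hn
  have sm : 0 < √(m : ℝ) := Real.sqrt_pos.2 hm0
  have sn : 0 < √(n : ℝ) := Real.sqrt_pos.2 hn0
  have hθ : ∀ j, |p.1 j / √n| ≤ β := by
    intro j
    have h1 : ∑ k, (p.1 j / √n + (p.2 k - (∑ k, p.2 k) / n) / √m) = n * (p.1 j / √n) := by
      rw [Finset.sum_add_distrib, ← Finset.sum_div Finset.univ (fun k => p.2 k - (∑ k, p.2 k) / n),
        Finset.sum_sub_distrib]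
      simp only [Finset.sum_const, Finset.card_univ, Fintype.card_fin, nsmul_eq_mul]
      rw [mul_div_cancel₀ _ hn0.ne']
      ring
    have h2 : |(n : ℝ) * (p.1 j / √n)| ≤ n * β := by
      rw [← h1]
      refine (Finset.abs_sum_le_sum_abs _ _).trans
        ((Finset.sum_le_sum fun k _ => hp.1 j k).trans_eq ?_)
      simp
    rw [abs_mul, abs_of_pos hn0] at h2
    exact le_of_mul_le_mul_left h2 hn0
  refine ⟨fun j => ?_, fun k => ?_⟩
  · have := hθ j
    rwa [abs_div, abs_of_pos sn, div_le_iff₀' sn] at this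
  · have h1 := hp.1 ⟨0, hm⟩ k
    have h2 := hθ ⟨0, hm⟩
    have h3 := hp.2
    have h4 : |p.2 k / √m| ≤ 3 * β := by
      rw [sub_div] at h1
      rw [abs_le] at *
      constructor <;> linarith
    rw [abs_div, abs_of_pos sm, div_le_iff₀ sm] at h4
    linarith

lemma integral_gaussDomain_eq {m n : ℕ} {B b : ℝ} (hm : QuartOK m B) (hn : QuartOK n B)
    (hmc : 600 * cD ≤ m) (hnc : 600 * cD ≤ n) (hbB : b ≤ B) (hbB' : 3 * (√m * (b / √n)) ≤ B)
    (κ : ℝ → ℂ) :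
    ∫ p : (Fin m → ℝ) × (Fin n → ℝ), (gaussDomain m n (b / √n)).indicator (fun p =>
        (∏ j, Complex.exp (-(p.1 j : ℂ) ^ 2 / 2)) * (∏ k, Complex.exp (-(p.2 k : ℂ) ^ 2 / 2)) *
        ∏ i : Fin m × Fin n, κ (yArg p i.1 i.2)) p =
      ((√(2 * Real.pi) ^ (m + n) : ℝ) : ℂ) * ((quartZ n B ^ m * quartZ m B ^ n : ℝ) : ℂ) *
        ∫ p, boxFactor κ m n b p ∂(refM m n B) := by
  have hm1 := hm.one_le
  have hn1 := hn.one_le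
  have hm0 : (0 : ℝ) < m := by linarith
  have hn0 : (0 : ℝ) < n := by linarith
  have sn : 0 < √(n : ℝ) := Real.sqrt_pos.2 hn0
  have hZn := one_le_quartZ hn hnc
  have hZm := one_le_quartZ hm hmc
  have hZn0 : quartZ n B ≠ 0 := by linarith
  have hZm0 : quartZ m B ≠ 0 := by linarith
  have hs : √(2 * Real.pi) ≠ 0 := by positivity
  rw [integral_prod_qG hn hm hnc hmc, ← integral_const_mul]
  congr 1
  ext p
  unfold boxFactor
  by_cases hp : p ∈ gaussDomain m n (b / √n)
  · obtain ⟨h1, h2⟩ := abs_le_of_mem_gaussDomain (by exact_mod_cast hm0) (by exact_mod_cast hn0) hp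
    rw [Set.indicator_of_mem hp, Set.indicator_of_mem hp]
    have q1 : ∀ j, qDens n B (p.1 j) = (√(2 * Real.pi))⁻¹ * (quartZ n B)⁻¹ *
        (Real.exp (-p.1 j ^ 2 / 2) * Real.exp (p.1 j ^ 4 / (4 * n))) := by
      intro j
      have : |p.1 j| ≤ B := by
        have := h1 j; rw [mul_div_cancel₀ _ sn.ne'] at this; exact this.trans hbB
      rw [qDens, quartW, if_pos this]; ring
    have q2 : ∀ k, qDens m B (p.2 k) = (√(2 * Real.pi))⁻¹ * (quartZ m B)⁻¹ *
        (Real.exp (-p.2 k ^ 2 / 2) * Real.exp (p.2 k ^ 4 / (4 * m))) := by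
      intro k
      rw [qDens, quartW, if_pos ((h2 k).trans hbB')]; ring
    simp only [q1, q2, Finset.prod_mul_distrib, Finset.prod_const, Finset.card_univ,
      Fintype.card_fin]
    rw [← Real.exp_sum, ← Real.exp_sum, ← Real.exp_sum, ← Real.exp_sum, ← Complex.exp_sum,
      ← Complex.exp_sum]
    have e0 : ∀ x y : ℝ, Complex.exp (-((x + y : ℝ) : ℂ)) =
        (((Real.exp x : ℝ) : ℂ) * ((Real.exp y : ℝ) : ℂ))⁻¹ := fun x y => by
      rw [Complex.exp_neg, Complex.ofReal_add, Complex.exp_add, Complex.ofReal_exp,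
        Complex.ofReal_exp]
    have e1 : Complex.exp (∑ j, -(p.1 j : ℂ) ^ 2 / 2) =
        ((Real.exp (∑ j, -p.1 j ^ 2 / 2) : ℝ) : ℂ) := by push_cast; rfl
    have e2 : Complex.exp (∑ j, -(p.2 j : ℂ) ^ 2 / 2) =
        ((Real.exp (∑ j, -p.2 j ^ 2 / 2) : ℝ) : ℂ) := by push_cast; rfl
    rw [e0, e1, e2]
    have n1 : ∀ x : ℝ, ((Real.exp x : ℝ) : ℂ) ≠ 0 := fun x => by exact_mod_cast (Real.exp_ne_zero x)
    have z1 : (quartZ n B : ℂ) ≠ 0 := by exact_mod_cast hZn0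
    have z2 : (quartZ m B : ℂ) ≠ 0 := by exact_mod_cast hZm0
    have z3 : (√(2 * Real.pi) : ℂ) ≠ 0 := by exact_mod_cast hs
    have n2 := n1 (∑ j, p.1 j ^ 4 / (4 * n))
    have n3 := n1 (∑ k, p.2 k ^ 4 / (4 * m))
    simp only [Complex.ofReal_mul, Complex.ofReal_pow, Complex.ofReal_inv, inv_pow, pow_add]
    generalize ((Real.exp (∑ j, p.1 j ^ 4 / (4 * n)) : ℝ) : ℂ) = x at *
    generalize ((Real.exp (∑ k, p.2 k ^ 4 / (4 * m)) : ℝ) : ℂ) = y at *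
    generalize ((Real.exp (∑ j, -p.1 j ^ 2 / 2) : ℝ) : ℂ) = u at *
    generalize ((Real.exp (∑ k, -p.2 k ^ 2 / 2) : ℝ) : ℂ) = v at *
    generalize (√(2 * Real.pi) : ℂ) = w at *
    generalize (quartZ n B : ℂ) = zn at *
    generalize (quartZ m B : ℂ) = zm at *
    generalize (∏ i : Fin m × Fin n, κ (yArg p i.1 i.2)) = K
    field_simp
  · simp [Set.indicator_of_notMem hp]

lemma exists_pow_eq_exp {w : ℂ} {c N e : ℝ} (hN : 0 < N) (hw : ‖w - (1 + (c : ℂ) / N)‖ ≤ e)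
    (he : |c| / N + e ≤ 1 / 2) (M : ℕ) :
    ∃ ε : ℂ, w ^ M = Complex.exp ((M * (c / N) : ℝ) + ε) ∧
      ‖ε‖ ≤ M * (e + (|c| / N + e) ^ 2) := by
  set z := w - 1 with hz
  have h1 : ‖z‖ ≤ |c| / N + e := by
    have : z = (c : ℂ) / N + (w - (1 + (c : ℂ) / N)) := by rw [hz]; ring
    rw [this]
    refine (norm_add_le _ _).trans (add_le_add ?_ hw)
    rw [norm_div, Complex.norm_real, Complex.norm_real, Real.norm_eq_abs, Real.norm_of_nonneg hN.le]
  have h2 : ‖z‖ ≤ 1 / 2 := h1.trans he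
  have h3 := Complex.norm_log_one_add_sub_self_le (z := z) (by linarith)
  have h4 : ‖Complex.log (1 + z) - z‖ ≤ (|c| / N + e) ^ 2 := by
    refine h3.trans ?_
    have : (1 - ‖z‖)⁻¹ ≤ 2 := by
      rw [inv_le_comm₀ (by linarith) (by norm_num)]; linarith
    calc ‖z‖ ^ 2 * (1 - ‖z‖)⁻¹ / 2 ≤ ‖z‖ ^ 2 * 2 / 2 := by gcongr
      _ = ‖z‖ ^ 2 := by ring
      _ ≤ _ := by gcongr
  have hw1 : w = 1 + z := by rw [hz]; ring
  have hne : 1 + z ≠ 0 := by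
    intro h
    have : z = -1 := by linear_combination h
    rw [this] at h2
    norm_num at h2
  refine ⟨M * (Complex.log (1 + z) - (c / N : ℝ)), ?_, ?_⟩
  · have : ((M * (c / N) : ℝ) : ℂ) + M * (Complex.log (1 + z) - (c / N : ℝ)) =
        M * Complex.log (1 + z) := by push_cast; ring
    rw [this, Complex.exp_nat_mul, Complex.exp_log hne, hw1]
  · rw [norm_mul, Complex.norm_natCast]
    gcongr
    have : Complex.log (1 + z) - (c / N : ℝ) =
        (w - (1 + (c : ℂ) / N)) + (Complex.log (1 + z) - z) := by
      rw [hz]; push_cast; ring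
    rw [this]
    exact (norm_add_le _ _).trans (add_le_add hw h4)

lemma cubic_sum_identity {m n : ℝ} (hm : 0 < m) (hn : 0 < n) :
    3 / 2 + (m * ((-1 / 12 - n / m - (n / m) ^ 2 / 2) / n) +
      n * ((-1 / 12 - (-1) - (-1) ^ 2 / 2) / m)) = 1 / 2 - (n / m + m / n) / 12 := by
  field_simp
  ring

lemma quartZ_pow_le {N B : ℝ} (h : QuartOK N B) (hN : 600 * cD ≤ N) (M : ℕ) :
    quartZ N B ^ M ≤ Real.exp (M * (3 / 4 / N + 400 / N ^ 2 * cD)) := by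
  have h0 := one_le_quartZ h hN
  have h1 := (abs_le.1 (quartZ_sub_le h)).2
  rw [Real.exp_nat_mul]
  have h2 := Real.add_one_le_exp (3 / 4 / N + 400 / N ^ 2 * cD)
  gcongr
  linarith

end Transfer

section BoxAsymptotics

open MeasureTheory ProbabilityTheory

/-- The range of parameters: `l = log n` is large and `m / n` lies between `1 / l` and `l`. -/
structure Regime (m n : ℕ) (l L : ℝ) : Prop where
  log_eq : l = Real.log n
  large : 10000 * cD ≤ l
  pow_le : l ^ 200 ≤ n
  m_le : m ≤ n * l
  n_le : n ≤ m * l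
  le_L : m * n ≤ L

namespace Regime

variable {m n : ℕ} {l L : ℝ}

lemma l_ge (h : Regime m n l L) : 10000 ≤ l := by linarith [one_le_cD, h.large]

lemma n_pos (h : Regime m n l L) : (0 : ℝ) < n :=
  lt_of_lt_of_le (by have := h.l_ge; positivity) h.pow_le

lemma m_pos (h : Regime m n l L) : (0 : ℝ) < m := by
  have h1 := h.n_pos.trans_le h.n_le
  have h2 := h.l_ge
  exact pos_of_mul_pos_left h1 (by linarith)

lemma n_eq_exp (h : Regime m n l L) : (n : ℝ) = Real.exp l := by
  rw [h.log_eq, Real.exp_log h.n_pos]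

lemma sqrt_n_ge (h : Regime m n l L) : l ^ 100 ≤ √n := by
  refine Real.le_sqrt_of_sq_le ?_
  rw [← pow_mul]; exact h.pow_le

lemma sqrt_n_pos (h : Regime m n l L) : 0 < √(n : ℝ) := Real.sqrt_pos.2 h.n_pos

lemma sqrt_m_pos (h : Regime m n l L) : 0 < √(m : ℝ) := Real.sqrt_pos.2 h.m_pos

lemma sqrt_m_le (h : Regime m n l L) : √(m : ℝ) ≤ √n * l := by
  have hl := h.l_ge
  refine Real.sqrt_le_iff.2 ⟨by positivity, ?_⟩
  rw [mul_pow, Real.sq_sqrt h.n_pos.le]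
  have := h.m_le
  have : (n : ℝ) * l ≤ n * l ^ 2 := by
    have := h.n_pos
    gcongr
    exact le_self_pow₀ (by linarith) (by norm_num)
  linarith

lemma sqrt_n_le (h : Regime m n l L) : √(n : ℝ) ≤ √m * l := by
  have hl := h.l_ge
  refine Real.sqrt_le_iff.2 ⟨by positivity, ?_⟩
  rw [mul_pow, Real.sq_sqrt h.m_pos.le]
  have := h.n_le
  have : (m : ℝ) * l ≤ m * l ^ 2 := by
    have := h.m_pos
    gcongr
    exact le_self_pow₀ (by linarith) (by norm_num)
  linarith

lemma L_pos (h : Regime m n l L) : 0 < L :=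
  lt_of_lt_of_le (mul_pos h.m_pos h.n_pos) h.le_L

lemma m_ge (h : Regime m n l L) : l ^ 199 ≤ m := by
  have hl := h.l_ge
  have h1 := h.pow_le.trans h.n_le
  have h2 : l ^ 199 * l ≤ m * l := by rw [← pow_succ]; exact h1
  exact le_of_mul_le_mul_right h2 (by linarith)

lemma quartOK_n (h : Regime m n l L) : QuartOK n (3 * l ^ 4) := by
  have hl := h.l_ge
  have hl1 : 1 ≤ l := by linarith
  refine ⟨(one_le_pow₀ hl1).trans h.pow_le, by positivity, ?_, ?_⟩
  · calc (3 * l ^ 4) ^ 2 = 9 * l ^ 8 := by ring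
      _ ≤ l * l ^ 8 := by gcongr; linarith
      _ = l ^ 9 := by ring
      _ ≤ l ^ 200 := pow_le_pow_right₀ hl1 (by norm_num)
      _ ≤ n := h.pow_le
  · rw [h.n_eq_exp, ← Real.exp_nat_mul]
    refine Real.exp_le_exp.2 ?_
    have : l ^ 1 ≤ l ^ 8 := pow_le_pow_right₀ hl1 (by norm_num)
    push_cast
    nlinarith

lemma quartOK_m (h : Regime m n l L) : QuartOK m (3 * l ^ 4) := by
  have hl := h.l_ge
  have hl1 : 1 ≤ l := by linarith
  refine ⟨(one_le_pow₀ hl1).trans h.m_ge, by positivity, ?_, ?_⟩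
  · calc (3 * l ^ 4) ^ 2 = 9 * l ^ 8 := by ring
      _ ≤ l * l ^ 8 := by gcongr; linarith
      _ = l ^ 9 := by ring
      _ ≤ l ^ 199 := pow_le_pow_right₀ hl1 (by norm_num)
      _ ≤ m := h.m_ge
  · have h1 : (m : ℝ) ≤ Real.exp (2 * l) := by
      refine h.m_le.trans ?_
      rw [h.n_eq_exp, two_mul, Real.exp_add]
      gcongr
      linarith [Real.add_one_le_exp l]
    calc (m : ℝ) ^ 2 ≤ Real.exp (2 * l) ^ 2 := by gcongr
      _ = Real.exp (4 * l) := by rw [← Real.exp_nat_mul]; congr 1; push_cast; ring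
      _ ≤ _ := by
        refine Real.exp_le_exp.2 ?_
        have h2 : l ^ 8 = l * l ^ 7 := by ring
        have h3 : l ^ 1 ≤ l ^ 7 := pow_le_pow_right₀ hl1 (by norm_num)
        nlinarith

lemma cD_le_n (h : Regime m n l L) : 600 * cD ≤ n := by
  have hl := h.l_ge
  have := h.large
  have h1 : l ^ 1 ≤ l ^ 200 := pow_le_pow_right₀ (by linarith) (by norm_num)
  linarith [h.pow_le, one_le_cD]

lemma cD_le_m (h : Regime m n l L) : 600 * cD ≤ m := by
  have hl := h.l_ge
  have := h.large
  have h1 : l ^ 1 ≤ l ^ 199 := pow_le_pow_right₀ (by linarith) (by norm_num)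
  linarith [h.m_ge, one_le_cD]

lemma radius_le (h : Regime m n l L) : 3 * (√m * (l ^ 3 / √n)) ≤ 3 * l ^ 4 := by
  have hl := h.l_ge
  have := h.sqrt_n_pos
  have h1 := h.sqrt_m_le
  gcongr
  calc √m * (l ^ 3 / √n) ≤ (√n * l) * (l ^ 3 / √n) := by gcongr
    _ = l ^ 4 := by field_simp

lemma inv_sqrt_m_le (h : Regime m n l L) : (√(m : ℝ))⁻¹ ≤ l / √n := by
  have h1 := h.sqrt_n_le
  have h2 := h.sqrt_m_pos
  have h3 := h.sqrt_n_pos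
  rw [inv_eq_one_div, div_le_div_iff₀ h2 h3]
  linarith

lemma le_sqrt_L (h : Regime m n l L) : √(n : ℝ) ^ 2 / l ≤ √L := by
  have hl := h.l_ge
  have h1 : √m * √n ≤ √L := by
    rw [← Real.sqrt_mul h.m_pos.le]; exact Real.sqrt_le_sqrt h.le_L
  refine le_trans ?_ h1
  rw [div_le_iff₀ (by linarith)]
  have h2 := h.sqrt_n_le
  have h3 := h.sqrt_n_pos
  nlinarith

lemma exp_neg_le (h : Regime m n l L) : Real.exp (-l) ≤ 1 / √n := by
  rw [Real.exp_neg, ← h.n_eq_exp, inv_eq_one_div]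
  have h1 := h.sqrt_n_pos
  have hl := h.l_ge
  have h2 : 1 ≤ √(n : ℝ) := (one_le_pow₀ (by linarith)).trans h.sqrt_n_ge
  gcongr
  calc √(n : ℝ) = √n * 1 := by ring
    _ ≤ √n * √n := by gcongr
    _ = n := Real.mul_self_sqrt h.n_pos.le

lemma remainder_le (h : Regime m n l L) {y : ℝ} (hy : |y| ≤ l ^ 3 / √n) :
    20 * (|y| ^ 5 + |y| ^ 3 / √L) ≤ 40 * l ^ 15 / √n ^ 5 := by
  have hl := h.l_ge
  have hr := h.sqrt_n_pos
  have hL := h.le_sqrt_L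
  have hl0 : 0 < l := by linarith
  have h1 : |y| ^ 5 ≤ l ^ 15 / √n ^ 5 := by
    calc |y| ^ 5 ≤ (l ^ 3 / √n) ^ 5 := by gcongr
      _ = _ := by rw [div_pow, ← pow_mul]
  have h2 : |y| ^ 3 / √L ≤ l ^ 15 / √n ^ 5 := by
    calc |y| ^ 3 / √L ≤ (l ^ 3 / √n) ^ 3 / (√n ^ 2 / l) := by gcongr
      _ = l ^ 10 / √n ^ 5 := by field_simp
      _ ≤ _ := by gcongr <;> linarith
  calc 20 * (|y| ^ 5 + |y| ^ 3 / √L) ≤ 20 * (l ^ 15 / √n ^ 5 + l ^ 15 / √n ^ 5) := by gcongr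
    _ = _ := by ring

lemma mn_remainder_le (h : Regime m n l L) :
    (m : ℝ) * n * (40 * l ^ 15 / √n ^ 5) ≤ 40 * l ^ 16 / √n := by
  have hl := h.l_ge
  have hr := h.sqrt_n_pos
  have hn : (n : ℝ) = √n ^ 2 := (Real.sq_sqrt h.n_pos.le).symm
  have hm := h.m_le
  rw [hn] at hm
  calc (m : ℝ) * n * (40 * l ^ 15 / √n ^ 5) ≤
      (√n ^ 2 * l) * √n ^ 2 * (40 * l ^ 15 / √n ^ 5) := by
        rw [show (m : ℝ) * n = m * √n ^ 2 by rw [← hn]]; gcongr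
    _ = _ := by field_simp

/-- The error `δ` of the comparison of the box integrand with its main part. -/
lemma delta_le (h : Regime m n l L) :
    11 * (l ^ 20) ^ 3 / √m / 3 + (73 * (l ^ 20) ^ 4 / √m + 12 * (l ^ 20) ^ 4 / √n) / 4 +
      m * n * (40 * l ^ 15 / √n ^ 5) ≤ l ^ 82 / √n := by
  have hl := h.l_ge
  have hr := h.sqrt_n_pos
  have hl1 : 1 ≤ l := by linarith
  have h1 := h.mn_remainder_le
  have h2 := h.inv_sqrt_m_le
  have p1 : l ^ 61 ≤ l ^ 81 := pow_le_pow_right₀ hl1 (by norm_num)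
  have p2 : l ^ 80 ≤ l ^ 81 := pow_le_pow_right₀ hl1 (by norm_num)
  have p3 : l ^ 16 ≤ l ^ 81 := pow_le_pow_right₀ hl1 (by norm_num)
  have e : l ^ 82 = l * l ^ 81 := by ring
  have p0 : 0 < l ^ 81 := by positivity
  calc _ ≤ 11 * (l ^ 20) ^ 3 * (l / √n) / 3 + (73 * (l ^ 20) ^ 4 * (l / √n) +
          12 * (l ^ 20) ^ 4 / √n) / 4 + 40 * l ^ 16 / √n := by
        rw [div_eq_mul_inv _ (√(m : ℝ)), div_eq_mul_inv _ (√(m : ℝ))]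
        gcongr
    _ = (11 / 3 * l ^ 61 + 73 / 4 * l ^ 81 + 3 * l ^ 80 + 40 * l ^ 16) / √n := by ring
    _ ≤ l ^ 82 / √n := by
        gcongr
        nlinarith

lemma delta_le_one (h : Regime m n l L) : l ^ 82 / √n ≤ 1 := by
  have hl := h.l_ge
  rw [div_le_one h.sqrt_n_pos]
  exact (pow_le_pow_right₀ (by linarith) (by norm_num)).trans h.sqrt_n_ge

lemma bad_le (h : Regime m n l L) :
    (Real.exp (m * n * ((l ^ 3 / √n) ^ 4 / 4 + 40 * l ^ 15 / √n ^ 5)) + Real.exp (3 / 2)) *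
      (refM m n (3 * l ^ 4)).real (badEvent m n (l ^ 20)) ≤ 1 / √n := by
  have hl := h.l_ge
  have hl1 : 1 ≤ l := by linarith
  have hr := h.sqrt_n_pos
  have hn0 := h.n_pos
  have hm0 := h.m_pos
  have hc := one_le_cD
  have p4 : l ^ 2 ≤ l ^ 20 := pow_le_pow_right₀ hl1 (by norm_num)
  have t1 : 8 * cD * (m / n) ≤ l ^ 20 := by
    have : (m : ℝ) / n ≤ l := by rw [div_le_iff₀ hn0]; linarith [h.m_le]
    calc 8 * cD * (m / n) ≤ l * l := by gcongr; linarith [h.large]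
      _ = l ^ 2 := by ring
      _ ≤ _ := p4
  have t2 : 8 * cD * (n / m) ≤ l ^ 20 := by
    have : (n : ℝ) / m ≤ l := by rw [div_le_iff₀ hm0]; linarith [h.n_le]
    calc 8 * cD * (n / m) ≤ l * l := by gcongr; linarith [h.large]
      _ = l ^ 2 := by ring
      _ ≤ _ := p4
  have hB : 1 ≤ 3 * l ^ 4 := by have := one_le_pow₀ hl1 (n := 4); linarith
  have hP := refM_badEvent hB h.quartOK_m h.quartOK_n h.cD_le_m h.cD_le_n (T := l ^ 20)
    (by positivity) t1 t2
  have hG : (m : ℝ) * n * ((l ^ 3 / √n) ^ 4 / 4 + 40 * l ^ 15 / √n ^ 5) ≤ l ^ 13 + 1 := by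
    have h1 := h.mn_remainder_le
    have h2 : 40 * l ^ 16 / √n ≤ 1 := by
      rw [div_le_one hr]
      calc 40 * l ^ 16 ≤ l * l ^ 16 := by gcongr; linarith
        _ = l ^ 17 := by ring
        _ ≤ l ^ 100 := pow_le_pow_right₀ hl1 (by norm_num)
        _ ≤ _ := h.sqrt_n_ge
    have h3 : (m : ℝ) * n * ((l ^ 3 / √n) ^ 4 / 4) ≤ l ^ 13 := by
      have hn : (√(n : ℝ)) ^ 4 = n ^ 2 := by
        rw [show (√(n : ℝ)) ^ 4 = (√(n : ℝ) ^ 2) ^ 2 by ring, Real.sq_sqrt hn0.le]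
      rw [div_pow, hn]
      calc (m : ℝ) * n * ((l ^ 3) ^ 4 / n ^ 2 / 4) ≤ (n * l) * n * ((l ^ 3) ^ 4 / n ^ 2 / 4) := by
            have := h.m_le
            gcongr
        _ = l ^ 13 / 4 := by field_simp
        _ ≤ l ^ 13 := by have : 0 ≤ l ^ 13 := by positivity
                         linarith
    rw [mul_add]
    linarith
  have hT : Real.exp (-(l ^ 20) ^ 2 / (32 * (3 * l ^ 4) ^ 6)) ≤ Real.exp (-(l ^ 14)) := by
    refine Real.exp_le_exp.2 ?_
    have : -(l ^ 20) ^ 2 / (32 * (3 * l ^ 4) ^ 6) = -(l ^ 16 / 23328) := by field_simp; norm_num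
    rw [this]
    have : 23328 ≤ l ^ 2 := by nlinarith
    have : l ^ 14 * 23328 ≤ l ^ 14 * l ^ 2 := by gcongr
    have e : l ^ 14 * l ^ 2 = l ^ 16 := by ring
    linarith
  have hE : Real.exp (3 / 2) ≤ Real.exp (l ^ 13 + 1) := by
    refine Real.exp_le_exp.2 ?_
    have := one_le_pow₀ hl1 (n := 13); linarith
  have h20 : (20 : ℝ) ≤ Real.exp 3 := by
    have h1 := Real.exp_one_gt_d9
    have h2 : Real.exp 3 = Real.exp 1 ^ 3 := by rw [← Real.exp_nat_mul]; norm_num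
    rw [h2]
    calc (20 : ℝ) ≤ 2.7182818283 ^ 3 := by norm_num
      _ ≤ _ := by gcongr
  refine le_trans ?_ h.exp_neg_le
  calc _ ≤ (Real.exp (l ^ 13 + 1) + Real.exp (l ^ 13 + 1)) * (10 * Real.exp (-(l ^ 14))) := by
        gcongr
        exact hP.trans (by gcongr)
    _ = 20 * (Real.exp (l ^ 13 + 1) * Real.exp (-(l ^ 14))) := by ring
    _ ≤ Real.exp 3 * (Real.exp (l ^ 13 + 1) * Real.exp (-(l ^ 14))) := by gcongr
    _ = Real.exp (3 + (l ^ 13 + 1 + -(l ^ 14))) := by rw [← Real.exp_add, ← Real.exp_add]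
    _ ≤ Real.exp (-l) := by
        refine Real.exp_le_exp.2 ?_
        have e : l ^ 14 = l * l ^ 13 := by ring
        have e1 : l ^ 1 ≤ l ^ 13 := pow_le_pow_right₀ hl1 (by norm_num)
        nlinarith

lemma compl_le (h : Regime m n l L) :
    Real.exp (3 / 2) * (refM m n (3 * l ^ 4)).real (gaussDomain m n (l ^ 3 / √n))ᶜ ≤ 1 / √n := by
  have hl := h.l_ge
  have hl1 : 1 ≤ l := by linarith
  have hr := h.sqrt_n_pos
  have hn0 := h.n_pos
  have hm0 := h.m_pos
  have hc := one_le_cD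
  have hP := refM_compl_gaussDomain h.quartOK_m h.quartOK_n h.cD_le_m h.cD_le_n
    (b := l ^ 3) (by positivity)
  have p1 : l ^ 5 ≤ l ^ 6 := pow_le_pow_right₀ hl1 (by norm_num)
  have e1 : Real.exp (-(l ^ 3 / 4) ^ 2 / 8) ≤ Real.exp (-(l ^ 5 / 128)) := by
    refine Real.exp_le_exp.2 ?_
    have : -(l ^ 3 / 4) ^ 2 / 8 = -(l ^ 6 / 128) := by ring
    rw [this]; linarith
  have e2 : Real.exp (-(√m * l ^ 3 / (4 * √n)) ^ 2 / 8) ≤ Real.exp (-(l ^ 5 / 128)) := by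
    refine Real.exp_le_exp.2 ?_
    have : -(√m * l ^ 3 / (4 * √n)) ^ 2 / 8 = -(m / n * l ^ 6 / 128) := by
      rw [div_pow, mul_pow, mul_pow, Real.sq_sqrt hm0.le, Real.sq_sqrt hn0.le]
      field_simp; norm_num
    rw [this]
    have h2 : 1 / l ≤ m / n := by
      rw [div_le_div_iff₀ (by linarith) hn0]; linarith [h.n_le]
    have h3 : 1 / l * l ^ 6 ≤ m / n * l ^ 6 := by gcongr
    have h4 : 1 / l * l ^ 6 = l ^ 5 := by field_simp
    linarith
  have hmn := h.m_le
  have hl3 := h.large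
  have hE : 2 * l ^ 2 ≤ Real.exp (2 * l) := by
    have := Real.quadratic_le_exp_of_nonneg (x := 2 * l) (by linarith)
    nlinarith
  refine le_trans ?_ h.exp_neg_le
  calc _ ≤ Real.exp (3 / 2) * ((n * l) * (Real.exp (-(l ^ 5 / 128)) * l) +
          n * (Real.exp (-(l ^ 5 / 128)) * l)) := by
        gcongr
        refine hP.trans ?_
        gcongr <;> linarith
    _ ≤ Real.exp (3 / 2) * ((n * l) * (Real.exp (-(l ^ 5 / 128)) * l) +
          n * l * (Real.exp (-(l ^ 5 / 128)) * l)) := by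
        gcongr
        exact le_mul_of_one_le_right hn0.le hl1
    _ = Real.exp (3 / 2) * (n * ((2 * l ^ 2) * Real.exp (-(l ^ 5 / 128)))) := by ring
    _ ≤ Real.exp (3 / 2) * (Real.exp l * (Real.exp (2 * l) * Real.exp (-(l ^ 5 / 128)))) := by
        rw [← h.n_eq_exp]; gcongr
    _ = Real.exp (3 / 2 + (l + (2 * l + -(l ^ 5 / 128)))) := by
        rw [← Real.exp_add, ← Real.exp_add, ← Real.exp_add]
    _ ≤ Real.exp (-l) := by
        refine Real.exp_le_exp.2 ?_
        have e : l ^ 5 = l * l ^ 4 := by ring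
        have e4 : (10000 : ℝ) ^ 4 ≤ l ^ 4 := by gcongr
        nlinarith

end Regime

end BoxAsymptotics

section BoxMain

open MeasureTheory ProbabilityTheory

namespace Regime

variable {m n : ℕ} {l L : ℝ}

lemma phase_product (h : Regime m n l L) :
    ∃ ε : ℂ, ‖ε‖ ≤ l ^ 7 / √n / 2 ∧ (Real.exp (3 / 2) : ℂ) *
      ((quartZ n (3 * l ^ 4) * ∫ z, cubicPhase n ((n : ℝ) / m) z ∂(qG n (3 * l ^ 4))) ^ m *
        (quartZ m (3 * l ^ 4) * ∫ z, cubicPhase m (-1) z ∂(qG m (3 * l ^ 4))) ^ n) =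
      Complex.exp ((1 / 2 - ((n : ℝ) / m + m / n) / 12 : ℝ) + ε) := by
  have hl := h.l_ge
  have hl1 : 1 ≤ l := by linarith
  have hr := h.sqrt_n_pos
  have hn0 := h.n_pos
  have hm0 := h.m_pos
  have hc := one_le_cD
  have hlc := h.large
  have rle : (n : ℝ) / m ≤ l := by rw [div_le_iff₀ hm0]; linarith [h.n_le]
  have rle' : (m : ℝ) / n ≤ l := by rw [div_le_iff₀ hn0]; linarith [h.m_le]
  have r0 : 0 ≤ (n : ℝ) / m := by positivity
  have a1 := integral_qG_cexp h.quartOK_n h.cD_le_n ((n : ℝ) / m)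
  have a2 := integral_qG_cexp h.quartOK_m h.cD_le_m (-1)
  have inv_m : (m : ℝ)⁻¹ ≤ l / n := by
    rw [inv_eq_one_div, div_le_div_iff₀ hm0 hn0]; linarith [h.n_le]
  have hn2 : l ^ 200 ≤ n := h.pow_le
  have b1 : 400 * (1 + ((n : ℝ) / m) ^ 4) / (n : ℝ) ^ 2 * cD ≤ l ^ 5 / n ^ 2 := by
    have : ((n : ℝ) / m) ^ 4 ≤ l ^ 4 := by gcongr
    have h1 : 1 ≤ l ^ 4 := one_le_pow₀ hl1
    calc 400 * (1 + ((n : ℝ) / m) ^ 4) / (n : ℝ) ^ 2 * cD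
        ≤ 400 * (l ^ 4 + l ^ 4) / (n : ℝ) ^ 2 * cD := by gcongr
      _ = l ^ 4 * (800 * cD) / n ^ 2 := by ring
      _ ≤ l ^ 4 * l / n ^ 2 := by gcongr; linarith
      _ = _ := by ring
  have b2 : 400 * (1 + (-1 : ℝ) ^ 4) / (m : ℝ) ^ 2 * cD ≤ l ^ 5 / n ^ 2 := by
    calc 400 * (1 + (-1 : ℝ) ^ 4) / (m : ℝ) ^ 2 * cD = (800 * cD) * ((m : ℝ)⁻¹) ^ 2 := by
          field_simp; norm_num
      _ ≤ l * (l / n) ^ 2 := by gcongr; linarith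
      _ = l ^ 3 / n ^ 2 := by ring
      _ ≤ _ := by gcongr; linarith
  have c1 : |(-1 / 12 - (n : ℝ) / m - ((n : ℝ) / m) ^ 2 / 2)| / n ≤ 2 * l ^ 2 / n := by
    gcongr
    have : ((n : ℝ) / m) ^ 2 ≤ l ^ 2 := by gcongr
    rw [abs_le]; constructor <;> nlinarith
  have c2 : |(-1 / 12 - (-1 : ℝ) - (-1) ^ 2 / 2)| / (m : ℝ) ≤ 2 * l ^ 2 / n := by
    rw [div_eq_mul_inv]
    calc _ ≤ 1 * (l / n) := by
          gcongr
          rw [abs_le]; constructor <;> norm_num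
      _ ≤ _ := by rw [one_mul]; gcongr; nlinarith
  have d0 : 2 * l ^ 2 / n + l ^ 5 / n ^ 2 ≤ 3 * l ^ 2 / n := by
    have : l ^ 3 ≤ n := (pow_le_pow_right₀ hl1 (by norm_num)).trans hn2
    have e : l ^ 5 / (n : ℝ) ^ 2 ≤ l ^ 2 / n := by
      rw [div_le_div_iff₀ (by positivity) hn0]
      calc l ^ 5 * (n : ℝ) = l ^ 2 * (l ^ 3) * n := by ring
        _ ≤ l ^ 2 * n * n := by gcongr
        _ = _ := by ring
    calc _ ≤ 2 * l ^ 2 / n + l ^ 2 / n := by gcongr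
      _ = _ := by ring
  have d1 : 3 * l ^ 2 / n ≤ 1 / 2 := by
    rw [div_le_iff₀ hn0]
    have : l ^ 3 ≤ n := (pow_le_pow_right₀ hl1 (by norm_num)).trans hn2
    nlinarith [sq_nonneg l]
  obtain ⟨ε1, f1, g1⟩ := exists_pow_eq_exp hn0 (a1.trans b1)
    ((add_le_add c1 le_rfl).trans (d0.trans d1)) m
  obtain ⟨ε2, f2, g2⟩ := exists_pow_eq_exp hm0 (a2.trans b2)
    ((add_le_add c2 le_rfl).trans (d0.trans d1)) n
  have k1 : l ^ 5 / (n : ℝ) ^ 2 + (3 * l ^ 2 / n) ^ 2 ≤ 2 * l ^ 5 / n ^ 2 := by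
    have : 9 * l ^ 4 ≤ l * l ^ 4 := by gcongr; linarith
    calc _ = (l ^ 5 + 9 * l ^ 4) / n ^ 2 := by ring
      _ ≤ _ := by gcongr; linarith [show l * l ^ 4 = l ^ 5 by ring]
  have k2 : (n : ℝ) * l * (2 * l ^ 5 / n ^ 2) ≤ l ^ 7 / √n / 4 := by
    have e1 : (n : ℝ) * l * (2 * l ^ 5 / n ^ 2) = 2 * l ^ 6 / n := by field_simp
    have e2 : √(n : ℝ) ≤ n := by
      have h2 : 1 ≤ √(n : ℝ) := (one_le_pow₀ (by linarith)).trans h.sqrt_n_ge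
      calc √(n : ℝ) = √n * 1 := by ring
        _ ≤ √n * √n := by gcongr
        _ = n := Real.mul_self_sqrt h.n_pos.le
    rw [e1]
    calc 2 * l ^ 6 / n ≤ 2 * l ^ 6 / √n := by gcongr
      _ ≤ (l * l ^ 6 / 4) / √n := by
        gcongr
        have : 0 < l ^ 6 := by positivity
        nlinarith
      _ = _ := by ring
  refine ⟨ε1 + ε2, ?_, ?_⟩
  · have G1 : ‖ε1‖ ≤ l ^ 7 / √n / 4 := by
      refine g1.trans (le_trans ?_ k2)
      gcongr
      · exact h.m_le
      · refine le_trans ?_ k1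
        gcongr
        exact (add_le_add c1 le_rfl).trans d0
    have G2 : ‖ε2‖ ≤ l ^ 7 / √n / 4 := by
      refine g2.trans (le_trans ?_ k2)
      gcongr
      · exact le_mul_of_one_le_right hn0.le hl1
      · refine le_trans ?_ k1
        gcongr
        exact (add_le_add c2 le_rfl).trans d0
    refine (norm_add_le _ _).trans ?_
    linarith
  · unfold cubicPhase
    rw [f1, f2, Complex.ofReal_exp, ← Complex.exp_add, ← Complex.exp_add,
      ← cubic_sum_identity hm0 hn0]
    congr 1
    push_cast
    ring

/-- Asymptotics of the box integral. -/
theorem box_integral (h : Regime m n l L) {κ E : ℝ → ℂ} (hκm : Measurable κ)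
    (hE : ∀ y, |y| ≤ l ^ 3 / √n → ‖E y‖ ≤ 20 * (|y| ^ 5 + |y| ^ 3 / √L))
    (hκ : ∀ y : ℝ, |y| ≤ l ^ 3 / √n →
      κ y = Complex.exp (-Complex.I * y ^ 3 / 3 + y ^ 4 / 4 + E y)) :
    ∃ ε : ℂ, ‖ε‖ ≤ l ^ 84 / √n * Real.exp (5 / 6 * ((n : ℝ) / m + m / n)) ∧
    ∫ p : (Fin m → ℝ) × (Fin n → ℝ), (gaussDomain m n (l ^ 3 / √n)).indicator (fun p =>
        (∏ j, Complex.exp (-(p.1 j : ℂ) ^ 2 / 2)) * (∏ k, Complex.exp (-(p.2 k : ℂ) ^ 2 / 2)) *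
        ∏ i : Fin m × Fin n, κ (yArg p i.1 i.2)) p =
      ((√(2 * Real.pi) ^ (m + n) * Real.exp (1 / 2 - ((n : ℝ) / m + m / n) / 12) : ℝ) : ℂ) *
        (1 + ε) := by
  have hl := h.l_ge
  have hl1 : 1 ≤ l := by linarith
  have hr := h.sqrt_n_pos
  have hn0 := h.n_pos
  have hm0 := h.m_pos
  have hc := one_le_cD
  have hlc := h.large
  have hbB : l ^ 3 ≤ 3 * l ^ 4 := by
    have : l ^ 3 ≤ l ^ 4 := pow_le_pow_right₀ hl1 (by norm_num)
    have : 0 ≤ l ^ 4 := by positivity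
    linarith
  rw [integral_gaussDomain_eq h.quartOK_m h.quartOK_n h.cD_le_m h.cD_le_n hbB h.radius_le]
  have I1 := integral_boxFactor hκm (η := 40 * l ^ 15 / √n ^ 5) (by positivity) h.quartOK_m
    h.quartOK_n h.cD_le_m h.cD_le_n (one_le_pow₀ hl1 (n := 20))
    (fun y hy => (hE y hy).trans (h.remainder_le hy)) hκ rfl (h.delta_le.trans h.delta_le_one)
  have I2 := h.bad_le
  have I3 := h.compl_le
  have I4 := h.delta_le
  obtain ⟨ε, hε, hεq⟩ := h.phase_product
  set S := (n : ℝ) / m + m / n with hS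
  set Z1 := quartZ n (3 * l ^ 4)
  set Z2 := quartZ m (3 * l ^ 4)
  set E1 := ∫ z, cubicPhase n ((n : ℝ) / m) z ∂(qG n (3 * l ^ 4))
  set E2 := ∫ z, cubicPhase m (-1) z ∂(qG m (3 * l ^ 4))
  set F := ∫ p, boxFactor κ m n (l ^ 3) p ∂(refM m n (3 * l ^ 4))
  have e32 : Real.exp (3 / 2) ≤ 5 := by
    have h1 := Real.exp_one_lt_d9
    have h2 : Real.exp (3 / 2) ≤ Real.exp 1 ^ 2 / Real.exp (1 / 2) := by
      rw [← Real.exp_nat_mul, ← Real.exp_sub]; norm_num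
    have h3 : 3 / 2 ≤ Real.exp (1 / 2) := by linarith [Real.add_one_le_exp (1 / 2)]
    calc Real.exp (3 / 2) ≤ Real.exp 1 ^ 2 / Real.exp (1 / 2) := h2
      _ ≤ 2.7182818286 ^ 2 / (3 / 2) := by gcongr
      _ ≤ 5 := by norm_num
  have D1 : ‖F - Real.exp (3 / 2) * (E1 ^ m * E2 ^ n)‖ ≤ l ^ 83 / √n := by
    refine I1.trans ?_
    have p1 : 1 / √(n : ℝ) ≤ l ^ 82 / √n := by gcongr; exact one_le_pow₀ hl1
    have p2 : 0 < l ^ 82 / √n := by positivity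
    have p3 : 12 * (l ^ 82 / √n) ≤ l ^ 83 / √n := by
      have : l ^ 83 / √(n : ℝ) = l * (l ^ 82 / √n) := by ring
      rw [this]; gcongr; linarith
    have p4 : 2 * Real.exp (3 / 2) * (11 * (l ^ 20) ^ 3 / √m / 3 + (73 * (l ^ 20) ^ 4 / √m +
      12 * (l ^ 20) ^ 4 / √n) / 4 + m * n * (40 * l ^ 15 / √n ^ 5)) ≤ 2 * 5 * (l ^ 82 / √n) := by
      gcongr
    linarith
  have D2 : Z1 ^ m * Z2 ^ n ≤ Real.exp (3 / 4 * S + 1) := by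
    have q1 := quartZ_pow_le h.quartOK_n h.cD_le_n m
    have q2 := quartZ_pow_le h.quartOK_m h.cD_le_m n
    have z2 := one_le_quartZ h.quartOK_m h.cD_le_m
    refine (mul_le_mul q1 q2 (by positivity) (by positivity)).trans ?_
    rw [← Real.exp_add]
    refine Real.exp_le_exp.2 ?_
    have rle' : (m : ℝ) / n ≤ l := by rw [div_le_iff₀ hn0]; linarith [h.m_le]
    have rle : (n : ℝ) / m ≤ l := by rw [div_le_iff₀ hm0]; linarith [h.n_le]
    have w1 : (m : ℝ) / n * (400 * cD / n) ≤ 1 / 2 := by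
      calc (m : ℝ) / n * (400 * cD / n) ≤ l * (l / l ^ 200) := by
            gcongr
            · linarith
            · exact h.pow_le
        _ = 1 / l ^ 198 := by field_simp
        _ ≤ 1 / l := by gcongr; exact le_self_pow₀ hl1 (by norm_num)
        _ ≤ 1 / 2 := by gcongr; linarith
    have w2 : (n : ℝ) / m * (400 * cD / m) ≤ 1 / 2 := by
      calc (n : ℝ) / m * (400 * cD / m) ≤ l * (l / l ^ 199) := by
            gcongr
            · linarith
            · exact h.m_ge
        _ = 1 / l ^ 197 := by field_simp
        _ ≤ 1 / l := by gcongr; exact le_self_pow₀ hl1 (by norm_num)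
        _ ≤ 1 / 2 := by gcongr; linarith
    calc _ = 3 / 4 * S + ((m : ℝ) / n * (400 * cD / n) + (n : ℝ) / m * (400 * cD / m)) := by
          rw [hS]; field_simp; ring
      _ ≤ _ := by linarith
  have hε1 : ‖ε‖ ≤ 1 := by
    refine hε.trans ?_
    have : l ^ 7 / √(n : ℝ) ≤ l ^ 82 / √n := by gcongr; norm_num
    linarith [h.delta_le_one]
  have D3 := Complex.norm_exp_sub_one_le hε1
  set A := Real.exp (1 / 2 - S / 12) with hA
  have hA0 : (A : ℂ) ≠ 0 := by exact_mod_cast (Real.exp_ne_zero _)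
  have hZ : (0 : ℝ) ≤ Z1 ^ m * Z2 ^ n := by
    have z1 := one_le_quartZ h.quartOK_n h.cD_le_n
    have z2 := one_le_quartZ h.quartOK_m h.cD_le_m
    positivity
  refine ⟨(Z1 ^ m * Z2 ^ n : ℝ) * (F - Real.exp (3 / 2) * (E1 ^ m * E2 ^ n)) / A +
    (Complex.exp ε - 1), ?_, ?_⟩
  · refine (norm_add_le _ _).trans ?_
    rw [norm_div, norm_mul, Complex.norm_real, Complex.norm_real, Real.norm_of_nonneg hZ,
      Real.norm_of_nonneg (Real.exp_pos _).le]
    have s1 : Z1 ^ m * Z2 ^ n * ‖F - Real.exp (3 / 2) * (E1 ^ m * E2 ^ n)‖ / A ≤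
        2 * Real.exp (5 / 6 * S) * (l ^ 83 / √n) := by
      rw [div_le_iff₀ (Real.exp_pos _)]
      have t1 : Real.exp (3 / 4 * S + 1) ≤ 2 * Real.exp (5 / 6 * S) * A := by
        have : 2 * Real.exp (5 / 6 * S) * A = 2 * Real.exp (1 / 2) * Real.exp (3 / 4 * S) := by
          rw [hA, mul_assoc, mul_assoc, ← Real.exp_add, ← Real.exp_add]; congr 2; ring
        rw [this, Real.exp_add, mul_comm]
        gcongr
        have e1 : Real.exp 1 = Real.exp (1 / 2) * Real.exp (1 / 2) := by
          rw [← Real.exp_add]; norm_num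
        have e2 : Real.exp (1 / 2) ≤ 2 := by
          have h1 := Real.exp_one_lt_d9
          by_contra hc
          push Not at hc
          nlinarith
        rw [e1]
        gcongr
      calc _ ≤ Real.exp (3 / 4 * S + 1) * (l ^ 83 / √n) := by gcongr
        _ ≤ 2 * Real.exp (5 / 6 * S) * A * (l ^ 83 / √n) := by gcongr
        _ = _ := by ring
    have s2 : ‖Complex.exp ε - 1‖ ≤ Real.exp (5 / 6 * S) * (l ^ 83 / √n) := by
      have u1 : 1 ≤ Real.exp (5 / 6 * S) := Real.one_le_exp (by rw [hS]; positivity)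
      have u2 : l ^ 7 / √(n : ℝ) ≤ l ^ 83 / √n := by gcongr; norm_num
      have u3 : 0 ≤ l ^ 83 / √(n : ℝ) := by positivity
      nlinarith
    have s3 : 3 * (l ^ 83 / √(n : ℝ)) ≤ l ^ 84 / √n := by
      have : l ^ 84 / √(n : ℝ) = l * (l ^ 83 / √n) := by ring
      rw [this]; gcongr; linarith
    calc _ ≤ 2 * Real.exp (5 / 6 * S) * (l ^ 83 / √n) + Real.exp (5 / 6 * S) * (l ^ 83 / √n) :=
          add_le_add s1 s2
      _ = 3 * (l ^ 83 / √n) * Real.exp (5 / 6 * S) := by ring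
      _ ≤ _ := by gcongr
  · have hx : ((Z1 ^ m * Z2 ^ n : ℝ) : ℂ) * (Real.exp (3 / 2) * (E1 ^ m * E2 ^ n)) =
        A * Complex.exp ε := by
      have hAε : (A : ℂ) * Complex.exp ε = Complex.exp ((1 / 2 - S / 12 : ℝ) + ε) := by
        rw [hA, Complex.ofReal_exp, ← Complex.exp_add]
      rw [hAε, ← hεq]
      push_cast
      rw [mul_pow, mul_pow]
      ring
    have hy : (A : ℂ) * ((Z1 ^ m * Z2 ^ n : ℝ) * (F - Real.exp (3 / 2) * (E1 ^ m * E2 ^ n)) / A) =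
        (Z1 ^ m * Z2 ^ n : ℝ) * (F - Real.exp (3 / 2) * (E1 ^ m * E2 ^ n)) :=
      mul_div_cancel₀ _ hA0
    rw [mul_assoc, Complex.ofReal_mul _ A, mul_assoc]
    congr 1
    rw [mul_add, mul_add, hy, mul_one]
    linear_combination hx

end Regime

end BoxMain

section TorusBox

open MeasureTheory ProbabilityTheory

lemma integrable_sq_mul_exp {A : ℝ} (hA : 0 < A) :
    Integrable fun u : ℝ => u ^ 2 * Real.exp (-A * u ^ 2 / 2) := by
  have := integrable_rpow_mul_exp_neg_mul_sq (b := A / 2) (by positivity) (s := 2) (by norm_num)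
  refine this.congr (.of_forall fun u => ?_)
  simp only [Real.rpow_two]
  congr 2; ring

lemma integral_sq_mul_exp {A : ℝ} (hA : 0 < A) :
    ∫ u : ℝ, u ^ 2 * Real.exp (-A * u ^ 2 / 2) = √(2 * Real.pi / A) / A := by
  have h1 : ∀ x : ℝ, HasDerivAt (fun u : ℝ => u * Real.exp (-A * u ^ 2 / 2))
      (Real.exp (-A * x ^ 2 / 2) - A * (x ^ 2 * Real.exp (-A * x ^ 2 / 2))) x := by
    intro x
    have h := (hasDerivAt_id' x).mul
      ((((hasDerivAt_pow 2 x).const_mul (-A)).div_const 2).exp)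
    refine h.congr_deriv ?_
    push_cast
    ring
  have i1 : Integrable fun u : ℝ => Real.exp (-A * u ^ 2 / 2) := by
    refine (integrable_exp_neg_mul_sq (b := A / 2) (by positivity)).congr (.of_forall fun u => ?_)
    simp only; congr 1; ring
  have i2 := integrable_sq_mul_exp hA
  have i3 : Integrable fun u : ℝ => u * Real.exp (-A * u ^ 2 / 2) := by
    refine (integrable_mul_exp_neg_mul_sq (b := A / 2) (by positivity)).congr
      (.of_forall fun u => ?_)
    simp only; congr 2; ring
  have h2 := integral_eq_zero_of_hasDerivAt_of_integrable h1 (i1.sub (i2.const_mul A)) i3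
  rw [integral_sub i1 (i2.const_mul A), integral_const_mul] at h2
  have h3 : ∫ u : ℝ, Real.exp (-A * u ^ 2 / 2) = √(2 * Real.pi / A) := by
    have := integral_gaussian (A / 2)
    rw [show Real.pi / (A / 2) = 2 * Real.pi / A by field_simp] at this
    rw [← this]
    congr 1; ext u; congr 1; ring
  rw [h3] at h2
  rw [eq_div_iff hA.ne']
  linarith

lemma gaussian_Icc_bounds {A β : ℝ} (hA : 0 < A) (hβ : 0 < β) :
    (∫ u in Set.Icc (-β) β, Real.exp (-A * u ^ 2 / 2)) ≤ √(2 * Real.pi / A) ∧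
    √(2 * Real.pi / A) * (1 - 1 / (A * β ^ 2)) ≤
      ∫ u in Set.Icc (-β) β, Real.exp (-A * u ^ 2 / 2) := by
  have i1 : Integrable fun u : ℝ => Real.exp (-A * u ^ 2 / 2) := by
    refine (integrable_exp_neg_mul_sq (b := A / 2) (by positivity)).congr (.of_forall fun u => ?_)
    simp only; congr 1; ring
  have h3 : ∫ u : ℝ, Real.exp (-A * u ^ 2 / 2) = √(2 * Real.pi / A) := by
    have := integral_gaussian (A / 2)
    rw [show Real.pi / (A / 2) = 2 * Real.pi / A by field_simp] at this
    rw [← this]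
    congr 1; ext u; congr 1; ring
  have h4 := integral_add_compl (measurableSet_Icc (a := -β) (b := β)) i1
  have h5 : 0 ≤ ∫ u in (Set.Icc (-β) β)ᶜ, Real.exp (-A * u ^ 2 / 2) :=
    integral_nonneg fun u => (Real.exp_pos _).le
  have h6 : ∫ u in (Set.Icc (-β) β)ᶜ, Real.exp (-A * u ^ 2 / 2) ≤
      √(2 * Real.pi / A) / A / β ^ 2 := by
    rw [← integral_sq_mul_exp hA, ← integral_div]
    have i2 := (integrable_sq_mul_exp hA).div_const (β ^ 2)
    refine (setIntegral_mono_on i1.integrableOn i2.integrableOn measurableSet_Icc.compl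
      fun u hu => ?_).trans (setIntegral_le_integral i2 (.of_forall fun u => by positivity))
    have : β ≤ |u| := by
      by_contra hc
      push Not at hc
      exact hu (abs_le.1 hc.le)
    have h7 : β ^ 2 ≤ u ^ 2 := by rw [← sq_abs u]; gcongr
    rw [le_div_iff₀ (by positivity), mul_comm]
    gcongr
  constructor
  · linarith
  · have : √(2 * Real.pi / A) * (1 - 1 / (A * β ^ 2)) =
      √(2 * Real.pi / A) - √(2 * Real.pi / A) / A / β ^ 2 := by field_simp
    linarith

/-- The leading constant of the torus integral. -/
noncomputable def torusConst (m n : ℕ) (L : ℝ) : ℝ :=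
  √(2 * Real.pi) * √m * √n * (√(2 * Real.pi) * √n)⁻¹ ^ m * (√(2 * Real.pi) * √m)⁻¹ ^ n *
    (√L * (√L)⁻¹ ^ (m + n))

lemma torusConst_eq {m n : ℕ} {L : ℝ} (hm : 0 < m) (hn : 0 < n) (hL : 0 < L) :
    torusConst m n L * √(2 * Real.pi / (m * n)) = (2 * Real.pi * √L) *
      (((2 * Real.pi * √L * √n)⁻¹) ^ m * ((2 * Real.pi * √L * √m)⁻¹) ^ n) *
        √(2 * Real.pi) ^ (m + n) := by
  have hm0 : (0 : ℝ) < m := by exact_mod_cast hm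
  have hn0 : (0 : ℝ) < n := by exact_mod_cast hn
  have sm : 0 < √(m : ℝ) := Real.sqrt_pos.2 hm0
  have sn : 0 < √(n : ℝ) := Real.sqrt_pos.2 hn0
  have sL : 0 < √L := Real.sqrt_pos.2 hL
  have sp : 0 < √(2 * Real.pi) := by positivity
  have e : 2 * Real.pi = √(2 * Real.pi) ^ 2 := (Real.sq_sqrt (by positivity)).symm
  rw [torusConst, Real.sqrt_div (by positivity), Real.sqrt_mul hm0.le]
  generalize √(2 * Real.pi) = q at *
  rw [e]
  simp only [mul_inv, mul_pow, inv_pow, pow_add]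
  field_simp
  try ring

/-- The kernel of the torus integral. -/
noncomputable def geomKernel (lam : ℝ) (u : UnitAddCircle) : ℂ :=
  (1 + lam - lam * fourier 1 u)⁻¹

/-- The kernel truncated to a neighbourhood of the origin. -/
noncomputable def truncKernel (lam β : ℝ) : UnitAddCircle → ℂ :=
  {u : UnitAddCircle | ‖u‖ ≤ β}.indicator (geomKernel lam)

/-- The kernel without its Gaussian and linear factors, in the scaled real coordinate. -/
noncomputable def reducedKernel (lam y : ℝ) : ℂ :=
  Complex.exp ((y : ℂ) ^ 2 / 2) * ((1 + lam - lam * Complex.exp ((y / √(lam * (1 + lam)) : ℝ) *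
    Complex.I))⁻¹ * Complex.exp (-(lam * (y / √(lam * (1 + lam)) : ℝ)) * Complex.I))

lemma measurable_geomKernel (lam : ℝ) : Measurable (geomKernel lam) := by
  have := (fourier (T := 1) 1).continuous.measurable
  unfold geomKernel
  fun_prop

lemma measurable_truncKernel (lam β : ℝ) : Measurable (truncKernel lam β) :=
  (measurable_geomKernel lam).indicator (measurableSet_le measurable_norm measurable_const)

lemma measurable_reducedKernel (lam : ℝ) : Measurable (reducedKernel lam) := by
  unfold reducedKernel
  fun_prop

lemma exists_reducedKernel_eq {lam : ℝ} (hlam : 1 ≤ lam) (y : ℝ) (hy : |y| ≤ 1 / 2) :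
    ∃ E : ℂ, ‖E‖ ≤ 20 * (|y| ^ 5 + |y| ^ 3 / √(lam * (1 + lam))) ∧
      reducedKernel lam y = Complex.exp (-Complex.I * y ^ 3 / 3 + y ^ 4 / 4 + E) := by
  have hL : 0 < √(lam * (1 + lam)) := Real.sqrt_pos.2 (by positivity)
  obtain ⟨E, h1, h2⟩ := kernel_expansion (lam := lam) (X := y / √(lam * (1 + lam))) hlam (y := y)
    (by field_simp) hy
  refine ⟨E, h1, ?_⟩
  rw [reducedKernel, h2, ← Complex.exp_add]
  congr 1; ring

lemma truncKernel_coe {lam β : ℝ} (hlam : 0 < lam) (r : ℝ) (hr : |r| ≤ 1 / 2) (hrβ : |r| ≤ β) :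
    truncKernel lam β r = Complex.exp (-(2 * Real.pi * √(lam * (1 + lam)) * r : ℝ) ^ 2 / 2) *
      reducedKernel lam (2 * Real.pi * √(lam * (1 + lam)) * r) *
        Complex.exp (2 * Real.pi * Complex.I * (lam * r)) := by
  have hL : 0 < √(lam * (1 + lam)) := Real.sqrt_pos.2 (by positivity)
  have hn : ‖(r : UnitAddCircle)‖ = |r| := by
    rw [AddCircle.norm_coe_eq_abs_iff 1 one_ne_zero]
    simpa using hr
  have hs : 2 * Real.pi * √(lam * (1 + lam)) * r / √(lam * (1 + lam)) = 2 * Real.pi * r := by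
    field_simp
  rw [truncKernel, Set.indicator_of_mem (by simpa [hn] using hrβ), geomKernel, fourier_coe_apply,
    reducedKernel, hs]
  have e1 : Complex.exp (2 * Real.pi * Complex.I * (1 : ℤ) * r / (1 : ℝ)) =
      Complex.exp ((2 * Real.pi * r : ℝ) * Complex.I) := by
    congr 1; push_cast; ring
  rw [e1]
  generalize (1 + (lam : ℂ) - lam * Complex.exp ((2 * Real.pi * r : ℝ) * Complex.I))⁻¹ = z
  rw [show ∀ a b c d : ℂ, a * (b * (z * c)) * d = z * (a * b * c * d) by intros; ring,
    ← Complex.exp_add, ← Complex.exp_add, ← Complex.exp_add]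
  conv_lhs => rw [← mul_one z, ← Complex.exp_zero]
  congr 2
  push_cast
  ring

end TorusBox

section TorusBoxMain

open MeasureTheory ProbabilityTheory

/-- The torus integral of a kernel supported near the origin is a Gaussian integral. -/
lemma integral_torus_eq_gaussian {m n : ℕ} (hm : 0 < m) (hn : 0 < n) {K : UnitAddCircle → ℂ}
    (hKm : Measurable K) {κ : ℝ → ℂ} {σ β lam : ℝ} (hσ : 0 < σ) (hβ : β / σ < 1 / 4) {s t : ℕ}
    (hst : m * s = n * t) (hlam : lam = s / n)
    (hK : ∀ r : ℝ, |r| ≤ β / σ → K r = Complex.exp (-(σ * r : ℝ) ^ 2 / 2) * κ (σ * r) *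
      Complex.exp (2 * Real.pi * Complex.I * (lam * r)))
    (hK0 : ∀ u, β / σ < ‖u‖ → K u = 0) :
    (∫ p : (Fin m → UnitAddCircle) × (Fin n → UnitAddCircle),
      (∏ i : Fin m × Fin n, K (p.1 i.1 + p.2 i.2)) *
        ((∏ j, fourier (-(s : ℤ)) (p.1 j)) * ∏ k, fourier (-(t : ℤ)) (p.2 k))) *
      ((∫ u in Set.Icc (-β) β, Real.exp (-(m * n) * u ^ 2 / 2) : ℝ) : ℂ) =
    ((σ * (((σ * √n)⁻¹) ^ m * ((σ * √m)⁻¹) ^ n) : ℝ) : ℂ) *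
      ∫ p : (Fin m → ℝ) × (Fin n → ℝ), (gaussDomain m n β).indicator (fun p =>
        (∏ j, Complex.exp (-(p.1 j : ℂ) ^ 2 / 2)) * (∏ k, Complex.exp (-(p.2 k : ℂ) ^ 2 / 2)) *
        ∏ i : Fin m × Fin n, κ (yArg p i.1 i.2)) p := by
  obtain ⟨n, rfl⟩ := Nat.exists_eq_succ_of_ne_zero hn.ne'
  have habs : ∀ r : ℝ, |σ * r| ≤ β ↔ |r| ≤ β / σ := by
    intro r
    rw [abs_mul, abs_of_pos hσ, le_div_iff₀ hσ, mul_comm]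
  have h1 := integral_torus_eq_real (m := m) (n := n) hm K
    (fun r => if |σ * r| ≤ β then Complex.exp (-(σ * r : ℝ) ^ 2 / 2) * κ (σ * r) else 0) hKm hβ s t
    hst (fun r hr => by
      simp only [habs, if_pos hr]
      rw [hK r hr, hlam]
      push_cast
      rfl) hK0 (fun r hr => by
      simp only [habs, if_neg (not_le.2 hr)])
  have h2 := integral_eq_gaussian (m := m) (n := n) hm
    (fun r => if |σ * r| ≤ β then Complex.exp (-(σ * r : ℝ) ^ 2 / 2) * κ (σ * r) else 0) κ hσ
    (fun r => rfl)
  simp only [Nat.succ_eq_add_one] at *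
  rw [h1]
  simp only [yArg]
  push_cast at h2 ⊢
  exact h2

namespace Regime

variable {m n : ℕ} {l L : ℝ}

lemma pi_sqrt_L_pos (h : Regime m n l L) : 0 < 2 * Real.pi * √L := by
  have := Real.sqrt_pos.2 h.L_pos
  positivity

lemma radius_small (h : Regime m n l L) : l ^ 3 / √n ≤ 1 / 2 := by
  have h1 := h.sqrt_n_pos
  have h2 := h.sqrt_n_ge
  have hl := h.l_ge
  rw [div_le_iff₀ h1]
  have : l ^ 100 = l ^ 3 * l ^ 97 := by ring
  have : (2 : ℝ) ≤ l ^ 97 := by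
    calc (2 : ℝ) ≤ l := by linarith
      _ ≤ l ^ 97 := le_self_pow₀ (by linarith) (by norm_num)
  have : l ^ 3 * 2 ≤ l ^ 3 * l ^ 97 := by gcongr
  linarith

lemma torus_radius_lt (h : Regime m n l L) : l ^ 3 / √n / (2 * Real.pi * √L) < 1 / 4 := by
  have h1 := h.radius_small
  have hL : 1 ≤ √L := by
    rw [Real.one_le_sqrt]
    have hm : (1 : ℝ) ≤ m := by exact_mod_cast h.m_pos
    have hn : (1 : ℝ) ≤ n := by exact_mod_cast h.n_pos
    have := h.le_L
    nlinarith
  have h2 : 2 * 3 * 1 ≤ 2 * Real.pi * √L := by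
    have := Real.pi_gt_three
    gcongr
  rw [div_lt_iff₀ h.pi_sqrt_L_pos]
  linarith

theorem torus_box_integral {lam : ℝ} (h : Regime m n l (lam * (1 + lam))) (hlam1 : 1 ≤ lam)
    {s t : ℕ} (hst : m * s = n * t) (hlam : lam = s / n) :
    ∃ ε : ℂ, ‖ε‖ ≤ l ^ 85 / √n * Real.exp (5 / 6 * ((n : ℝ) / m + m / n)) ∧
      ∫ p : (Fin m → UnitAddCircle) × (Fin n → UnitAddCircle),
      (∏ i : Fin m × Fin n, truncKernel lam (l ^ 3 / √n / (2 * Real.pi * √(lam * (1 + lam))))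
        (p.1 i.1 + p.2 i.2)) *
        ((∏ j, fourier (-(s : ℤ)) (p.1 j)) * ∏ k, fourier (-(t : ℤ)) (p.2 k)) =
      ((torusConst m n (lam * (1 + lam)) *
        Real.exp (1 / 2 - ((n : ℝ) / m + m / n) / 12) : ℝ) : ℂ) * (1 + ε) := by
  have hm := h.m_pos
  have hn := h.n_pos
  have hl := h.l_ge
  have hβ := h.torus_radius_lt
  have hr := h.radius_small
  have hσ := h.pi_sqrt_L_pos
  have hL := h.L_pos
  set L := lam * (1 + lam) with hLdef
  set β := l ^ 3 / √(n : ℝ) with hβdef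
  set σ := 2 * Real.pi * √L with hσdef
  have hβ0 : 0 < β := by have := h.sqrt_n_pos; positivity
  have key := integral_torus_eq_gaussian (m := m) (n := n) (by exact_mod_cast hm)
    (by exact_mod_cast hn) (measurable_truncKernel lam (β / σ)) (κ := reducedKernel lam) hσ hβ hst
    hlam (fun r hr => truncKernel_coe (by linarith) r (by linarith) hr)
    (fun u hu => Set.indicator_of_notMem (by simpa using hu) _)
  choose! E hE1 hE2 using fun (y : ℝ) (hy : |y| ≤ β) =>
    exists_reducedKernel_eq hlam1 y (hy.trans hr)
  obtain ⟨ε, hε, hbox⟩ := h.box_integral (measurable_reducedKernel lam) hE1 hE2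
  rw [hbox] at key
  generalize (∫ p : (Fin m → UnitAddCircle) × (Fin n → UnitAddCircle),
      (∏ i : Fin m × Fin n, truncKernel lam (β / σ) (p.1 i.1 + p.2 i.2)) *
        ((∏ j, fourier (-(s : ℤ)) (p.1 j)) * ∏ k, fourier (-(t : ℤ)) (p.2 k))) = I at key ⊢
  have hG := gaussian_Icc_bounds (A := (m : ℝ) * n) (by positivity) hβ0
  generalize (∫ u in Set.Icc (-β) β, Real.exp (-((m : ℝ) * n) * u ^ 2 / 2)) = G at key hG
  have hc := torusConst_eq (m := m) (n := n) (L := L) (by exact_mod_cast hm)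
    (by exact_mod_cast hn) hL
  rw [← hσdef] at hc
  have hg0 : 0 < √(2 * Real.pi / (m * n)) := by positivity
  generalize √(2 * Real.pi / ((m : ℝ) * n)) = g at *
  set S := (n : ℝ) / m + m / n with hS
  have hS0 : 0 ≤ S := by positivity
  have hmn : (m : ℝ) * n * β ^ 2 = m * l ^ 6 := by
    rw [hβdef, div_pow, Real.sq_sqrt hn.le]
    field_simp
  have hsn := h.sqrt_n_pos
  have hm1 : √(n : ℝ) ≤ m := by
    have h1 := h.n_le
    have h2 := h.sqrt_n_ge
    have h3 := Real.sq_sqrt hn.le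
    have h4 : l ≤ l ^ 100 := le_self_pow₀ (by linarith) (by norm_num)
    nlinarith
  set τ := 1 - G / g with hτ
  have hτ0 : 0 ≤ τ := by
    rw [hτ, sub_nonneg, div_le_one hg0]; exact hG.1
  have hτ1 : τ ≤ 1 / √n / 2 := by
    have h1 : 1 - 1 / (m * n * β ^ 2) ≤ G / g := by
      rw [le_div_iff₀ hg0, mul_comm]; exact hG.2
    have h2 : 1 / (m * n * β ^ 2) ≤ 1 / √n / 2 := by
      rw [hmn, div_div]
      apply one_div_le_one_div_of_le (by positivity)
      have : 2 ≤ l ^ 6 := by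
        calc (2 : ℝ) ≤ l := by linarith
          _ ≤ l ^ 6 := le_self_pow₀ (by linarith) (by norm_num)
      gcongr
    linarith
  have hn2 : 1 / √(n : ℝ) ≤ 1 := by
    rw [div_le_one hsn]
    exact (one_le_pow₀ (by linarith)).trans h.sqrt_n_ge
  have hτ2 : τ ≤ 1 / 2 := by linarith
  have hGτ : G = g * (1 - τ) := by rw [hτ]; field_simp; ring
  have hI : I * ((1 - τ : ℝ) : ℂ) =
      ((torusConst m n L * Real.exp (1 / 2 - S / 12) : ℝ) : ℂ) * (1 + ε) := by
    have hg : (g : ℂ) ≠ 0 := by exact_mod_cast hg0.ne'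
    rw [hGτ] at key
    apply mul_left_cancel₀ hg
    have hc' := congrArg (fun x : ℝ => (x : ℂ)) hc
    push_cast at key hc' ⊢
    linear_combination key - Complex.exp (1 / 2 - S / 12) * (1 + ε) * hc'
  have hτc : ((1 - τ : ℝ) : ℂ) ≠ 0 := by
    have : (1 - τ : ℝ) ≠ 0 := by linarith
    exact_mod_cast this
  refine ⟨(ε + τ) / ((1 - τ : ℝ) : ℂ), ?_, ?_⟩
  · rw [norm_div, Complex.norm_real, Real.norm_of_nonneg (by linarith), div_le_iff₀ (by linarith)]
    have h1 : ‖ε + τ‖ ≤ ‖ε‖ + τ := (norm_add_le _ _).trans (by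
      rw [Complex.norm_real, Real.norm_of_nonneg hτ0])
    have he : 1 ≤ Real.exp (5 / 6 * S) := Real.one_le_exp (by positivity)
    have h2 : τ ≤ l ^ 84 / √n * Real.exp (5 / 6 * S) := by
      calc τ ≤ 1 / √n := by linarith [show 0 < 1 / √(n : ℝ) by positivity]
        _ ≤ l ^ 84 / √n * 1 := by
          rw [mul_one]; gcongr; exact one_le_pow₀ (by linarith)
        _ ≤ _ := by gcongr
    have h3 : l ^ 85 / √n * Real.exp (5 / 6 * S) = l * (l ^ 84 / √n * Real.exp (5 / 6 * S)) := by
      ring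
    have h4 : 0 ≤ l ^ 84 / √n * Real.exp (5 / 6 * S) := by positivity
    rw [h3]
    generalize l ^ 84 / √(n : ℝ) * Real.exp (5 / 6 * S) = X at *
    have h5 : 2 ≤ l * (1 - τ) := by nlinarith
    have h6 : X * 2 ≤ X * (l * (1 - τ)) := by gcongr
    linarith
  · apply mul_right_cancel₀ hτc
    rw [hI, mul_assoc]
    congr 1
    rw [add_mul, div_mul_cancel₀ _ hτc]
    push_cast; ring

end Regime

end TorusBoxMain

section NormBox

open MeasureTheory ProbabilityTheory
open scoped NNReal ENNReal

/-- The absolute value of the kernel. -/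
noncomputable def normKernel (lam : ℝ) (u : UnitAddCircle) : ℝ≥0 := ‖geomKernel lam u‖₊

lemma measurable_normKernel (lam : ℝ) : Measurable (normKernel lam) :=
  (measurable_geomKernel lam).nnnorm

lemma norm_sq_denominator (lam : ℝ) (u : UnitAddCircle) :
    ‖1 + (lam : ℂ) - lam * fourier 1 u‖ ^ 2 =
      1 + lam * (1 + lam) * ‖(fourier 1 u : ℂ) - 1‖ ^ 2 := by
  have h := fourier_one_norm u
  have h2 : ‖(fourier 1 u : ℂ)‖ ^ 2 = 1 := by rw [h]; norm_num
  rw [← Complex.normSq_eq_norm_sq, Complex.normSq_apply] at h2 ⊢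
  rw [← Complex.normSq_eq_norm_sq, Complex.normSq_apply]
  simp only [Complex.sub_re, Complex.sub_im, Complex.add_re, Complex.add_im, Complex.mul_re,
    Complex.mul_im, Complex.ofReal_re, Complex.ofReal_im, Complex.one_re, Complex.one_im]
  linear_combination (-lam) * h2

lemma norm_denominator_ge {lam : ℝ} (hlam : 0 ≤ lam) (u : UnitAddCircle) :
    1 ≤ ‖1 + (lam : ℂ) - lam * fourier 1 u‖ := by
  have h := norm_sq_denominator lam u
  have : 0 ≤ lam * (1 + lam) * ‖(fourier 1 u : ℂ) - 1‖ ^ 2 := by positivity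
  nlinarith [norm_nonneg (1 + (lam : ℂ) - lam * fourier 1 u)]

lemma normKernel_le_one {lam : ℝ} (hlam : 0 ≤ lam) (u : UnitAddCircle) :
    normKernel lam u ≤ 1 := by
  rw [← NNReal.coe_le_coe, normKernel, coe_nnnorm, geomKernel, norm_inv, NNReal.coe_one]
  exact inv_le_one_of_one_le₀ (norm_denominator_ge hlam u)

lemma norm_truncKernel_le_one {lam : ℝ} (hlam : 0 ≤ lam) (β : ℝ) (u : UnitAddCircle) :
    ‖truncKernel lam β u‖ ≤ 1 := by
  unfold truncKernel
  refine (norm_indicator_le_norm_self _ _).trans ?_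
  exact_mod_cast normKernel_le_one hlam u

lemma boxInt_normKernel {lam : ℝ} (hlam : 0 ≤ lam) (m n : ℕ) (β : ℝ) :
    boxInt (normKernel lam) m n β =
      ENNReal.ofReal (∫ p : (Fin m → UnitAddCircle) × (Fin n → UnitAddCircle),
        ∏ i : Fin m × Fin n, ‖truncKernel lam β (p.1 i.1 + p.2 i.2)‖) := by
  have hmeas : Measurable fun p : (Fin m → UnitAddCircle) × (Fin n → UnitAddCircle) =>
      ∏ i : Fin m × Fin n, ‖truncKernel lam β (p.1 i.1 + p.2 i.2)‖ := by
    refine Finset.measurable_prod _ fun i _ => ?_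
    exact ((measurable_truncKernel lam β).comp (by fun_prop)).norm
  have h0 : ∀ p : (Fin m → UnitAddCircle) × (Fin n → UnitAddCircle),
      0 ≤ ∏ i : Fin m × Fin n, ‖truncKernel lam β (p.1 i.1 + p.2 i.2)‖ := fun p =>
    Finset.prod_nonneg fun i _ => norm_nonneg _
  have hInt : Integrable fun p : (Fin m → UnitAddCircle) × (Fin n → UnitAddCircle) =>
      ∏ i : Fin m × Fin n, ‖truncKernel lam β (p.1 i.1 + p.2 i.2)‖ := by
    refine Integrable.of_bound hmeas.aestronglyMeasurable 1 (.of_forall fun p => ?_)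
    rw [Real.norm_of_nonneg (h0 p)]
    exact Finset.prod_le_one (fun i _ => norm_nonneg _) fun i _ => norm_truncKernel_le_one hlam β _
  rw [ofReal_integral_eq_lintegral_ofReal hInt (.of_forall h0), boxInt, Measure.volume_eq_prod,
    lintegral_prod _ hmeas.ennreal_ofReal.aemeasurable]
  refine lintegral_congr fun x => lintegral_congr fun y => ?_
  by_cases hp : (x, y) ∈ torusBox m n β
  · rw [Set.indicator_of_mem hp, ENNReal.ofReal_prod_of_nonneg fun i _ => norm_nonneg _,
      Fintype.prod_prod_type]
    refine Finset.prod_congr rfl fun j _ => Finset.prod_congr rfl fun k _ => ?_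
    rw [truncKernel, Set.indicator_of_mem (by exact hp j k), ofReal_norm]
    rfl
  · rw [Set.indicator_of_notMem hp]
    simp only [torusBox, Set.mem_ofPred_eq, not_forall] at hp
    obtain ⟨j, k, hjk⟩ := hp
    rw [Finset.prod_eq_zero (Finset.mem_univ (j, k)), ENNReal.ofReal_zero]
    rw [truncKernel, Set.indicator_of_notMem (by exact hjk), norm_zero]

lemma norm_reducedKernel_le {lam : ℝ} (hlam : 1 ≤ lam) {y b : ℝ} (hy : |y| ≤ b) (hb : b ≤ 1 / 2) :
    ‖reducedKernel lam y‖ ≤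
      Real.exp (y ^ 4 / 4 + 20 * (b ^ 5 + b ^ 3 / √(lam * (1 + lam)))) := by
  obtain ⟨E, h1, h2⟩ := exists_reducedKernel_eq hlam y (hy.trans hb)
  rw [h2, Complex.norm_exp, Real.exp_le_exp]
  have h3 : (-Complex.I * (y : ℂ) ^ 3 / 3 + (y : ℂ) ^ 4 / 4 + E).re = y ^ 4 / 4 + E.re := by
    have : -Complex.I * (y : ℂ) ^ 3 / 3 + (y : ℂ) ^ 4 / 4 + E =
      (((y ^ 4 / 4 : ℝ)) : ℂ) + ((-(y ^ 3 / 3) : ℝ)) * Complex.I + E := by push_cast; ring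
    rw [this]
    simp only [Complex.add_re, Complex.ofReal_re, Complex.re_ofReal_mul, Complex.I_re]
    ring
  rw [h3]
  have h4 : E.re ≤ ‖E‖ := Complex.re_le_norm E
  have h5 : 20 * (|y| ^ 5 + |y| ^ 3 / √(lam * (1 + lam))) ≤
      20 * (b ^ 5 + b ^ 3 / √(lam * (1 + lam))) := by gcongr
  linarith

lemma add_pow_four_le (a b : ℝ) : (a + b) ^ 4 ≤ 8 * (a ^ 4 + b ^ 4) := by
  nlinarith [sq_nonneg (a - b), sq_nonneg (a ^ 2 - b ^ 2), sq_nonneg (a + b),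
    sq_nonneg (a * b - a ^ 2), sq_nonneg (a * b - b ^ 2), mul_nonneg (sq_nonneg (a - b))
      (sq_nonneg (a + b)), sq_nonneg ((a - b) ^ 2)]

lemma sum_centered_four_le {n : ℕ} (hn : 0 < n) (z : Fin n → ℝ) :
    ∑ k, (z k - (∑ i, z i) / n) ^ 4 ≤ 16 * ∑ k, z k ^ 4 := by
  have hn0 : (0 : ℝ) < n := by exact_mod_cast hn
  have h1 : ((∑ i, z i) / n) ^ 4 * n ≤ ∑ k, z k ^ 4 := by
    have h2 : (∑ i, z i) ^ 2 ≤ n * ∑ i, z i ^ 2 := by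
      simpa using sq_sum_le_card_mul_sum_sq (s := Finset.univ) (f := z)
    have h3 : (∑ i, z i ^ 2) ^ 2 ≤ n * ∑ i, z i ^ 4 := by
      have := sq_sum_le_card_mul_sum_sq (s := Finset.univ) (f := fun i => z i ^ 2)
      simp only [← pow_mul, Finset.card_univ, Fintype.card_fin] at this
      exact this
    rw [div_pow, div_mul_eq_mul_div, div_le_iff₀ (by positivity)]
    calc (∑ i, z i) ^ 4 * n = ((∑ i, z i) ^ 2) ^ 2 * n := by ring
      _ ≤ (n * ∑ i, z i ^ 2) ^ 2 * n := by gcongr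
      _ = n ^ 3 * (∑ i, z i ^ 2) ^ 2 := by ring
      _ ≤ n ^ 3 * (n * ∑ i, z i ^ 4) := by gcongr
      _ = _ := by ring
  calc ∑ k, (z k - (∑ i, z i) / n) ^ 4
      ≤ ∑ k, 8 * (z k ^ 4 + ((∑ i, z i) / n) ^ 4) := by
        refine Finset.sum_le_sum fun k _ => ?_
        have := add_pow_four_le (z k) (-((∑ i, z i) / n))
        rw [Even.neg_pow (by decide), ← sub_eq_add_neg] at this
        exact this
    _ = 8 * (∑ k, z k ^ 4 + ((∑ i, z i) / n) ^ 4 * n) := by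
        rw [← Finset.mul_sum, Finset.sum_add_distrib, Finset.sum_const]
        simp [mul_comm]
    _ ≤ _ := by linarith

lemma sum_yArg_four_le {m n : ℕ} (hm : 0 < m) (hn : 0 < n) (p : (Fin m → ℝ) × (Fin n → ℝ)) :
    ∑ i : Fin m × Fin n, yArg p i.1 i.2 ^ 4 / 4 ≤
      ∑ j, 2 * p.1 j ^ 4 / n + ∑ k, 32 * p.2 k ^ 4 / m := by
  have hm0 : (0 : ℝ) < m := by exact_mod_cast hm
  have hn0 : (0 : ℝ) < n := by exact_mod_cast hn
  have s4 : ∀ x : ℝ, 0 ≤ x → √x ^ 4 = x ^ 2 := fun x hx => by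
    rw [show (4 : ℕ) = 2 * 2 by rfl, pow_mul, Real.sq_sqrt hx]
  rw [Fintype.sum_prod_type]
  calc ∑ j, ∑ k, yArg p j k ^ 4 / 4
      ≤ ∑ j, ∑ k, (2 * p.1 j ^ 4 / n ^ 2 + 2 * (p.2 k - (∑ i, p.2 i) / n) ^ 4 / m ^ 2) := by
        refine Finset.sum_le_sum fun j _ => Finset.sum_le_sum fun k _ => ?_
        have := add_pow_four_le (p.1 j / √n) ((p.2 k - (∑ i, p.2 i) / n) / √m)
        rw [div_pow, div_pow, s4 _ hm0.le, s4 _ hn0.le] at this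
        rw [yArg]
        have e : 2 * p.1 j ^ 4 / (n : ℝ) ^ 2 + 2 * (p.2 k - (∑ i, p.2 i) / n) ^ 4 / m ^ 2 =
          8 * (p.1 j ^ 4 / n ^ 2 + (p.2 k - (∑ i, p.2 i) / n) ^ 4 / m ^ 2) / 4 := by ring
        rw [e]
        gcongr
    _ = ∑ j, 2 * p.1 j ^ 4 / n + 2 * (∑ k, (p.2 k - (∑ i, p.2 i) / n) ^ 4) / m := by
        simp only [Finset.sum_add_distrib, Finset.sum_const, Finset.card_univ, Fintype.card_fin,
          nsmul_eq_mul]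
        generalize (∑ i, p.2 i) / (n : ℝ) = c
        rw [Finset.mul_sum, Finset.mul_sum, Finset.sum_div]
        congr 1
        · exact Finset.sum_congr rfl fun j _ => by field_simp
        · exact Finset.sum_congr rfl fun j _ => by field_simp
    _ ≤ ∑ j, 2 * p.1 j ^ 4 / n + 2 * (16 * ∑ k, p.2 k ^ 4) / m := by
        have := sum_centered_four_le hn p.2
        gcongr
    _ = _ := by
        congr 1
        rw [Finset.mul_sum, Finset.mul_sum, Finset.sum_div]
        refine Finset.sum_congr rfl fun j _ => ?_
        ring

lemma integral_trunc_gaussian_le {A N B : ℝ} (hA : 0 ≤ A) (hN : 0 < N) (h : A * B ^ 2 ≤ N / 4) :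
    ∫ z : ℝ, {z : ℝ | |z| ≤ B}.indicator
      (fun z => Real.exp (-z ^ 2 / 2) * Real.exp (A * z ^ 4 / N)) z ≤
      √(2 * Real.pi) * Real.exp (A / N * cD) := by
  have h1 := integral_trunc_exp_quart hA hN h
  rw [integral_stdG_eq] at h1
  have h2 : ∀ z : ℝ, ((√(2 * Real.pi))⁻¹ * Real.exp (-z ^ 2 / 2)) •
      {z : ℝ | |z| ≤ B}.indicator (fun z => Real.exp (A * z ^ 4 / N)) z =
      (√(2 * Real.pi))⁻¹ * {z : ℝ | |z| ≤ B}.indicator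
        (fun z => Real.exp (-z ^ 2 / 2) * Real.exp (A * z ^ 4 / N)) z := by
    intro z
    by_cases hz : |z| ≤ B
    · rw [Set.indicator_of_mem (by exact hz), Set.indicator_of_mem (by exact hz), smul_eq_mul,
        mul_assoc]
    · rw [Set.indicator_of_notMem (by exact hz), Set.indicator_of_notMem (by exact hz), smul_zero,
        mul_zero]
  simp only [h2] at h1
  rw [integral_const_mul, inv_mul_le_iff₀ (by positivity)] at h1
  refine h1.trans ?_
  gcongr
  linarith [Real.add_one_le_exp (A / N * cD)]

lemma integrable_trunc_gaussian (A N B : ℝ) :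
    Integrable ({z : ℝ | |z| ≤ B}.indicator
      (fun z => Real.exp (-z ^ 2 / 2) * Real.exp (A * z ^ 4 / N))) := by
  have h1 : Continuous fun z : ℝ => Real.exp (-z ^ 2 / 2) * Real.exp (A * z ^ 4 / N) := by
    fun_prop
  have h2 : {z : ℝ | |z| ≤ B} = Set.Icc (-B) B := by
    ext z; simp [abs_le]
  rw [h2, integrable_indicator_iff measurableSet_Icc]
  exact h1.continuousOn.integrableOn_Icc

lemma norm_integrand_le {lam : ℝ} (hlam : 1 ≤ lam) {m n : ℕ} (hm : 0 < m) (hn : 0 < n) {b : ℝ}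
    (hb2 : b ≤ 1 / 2)
    (hη : m * n * (20 * (b ^ 5 + b ^ 3 / √(lam * (1 + lam)))) ≤ 1)
    (p : (Fin m → ℝ) × (Fin n → ℝ)) :
    (gaussDomain m n b).indicator (fun p =>
        (∏ j, Real.exp (-(p.1 j) ^ 2 / 2)) * (∏ k, Real.exp (-(p.2 k) ^ 2 / 2)) *
        ∏ i : Fin m × Fin n, ‖reducedKernel lam (yArg p i.1 i.2)‖) p ≤
      Real.exp 1 * ((∏ j, {z : ℝ | |z| ≤ √n * b}.indicator
        (fun z => Real.exp (-z ^ 2 / 2) * Real.exp (2 * z ^ 4 / n)) (p.1 j)) *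
      ∏ k, {z : ℝ | |z| ≤ 3 * (√m * b)}.indicator
        (fun z => Real.exp (-z ^ 2 / 2) * Real.exp (32 * z ^ 4 / m)) (p.2 k)) := by
  by_cases hp : p ∈ gaussDomain m n b
  · obtain ⟨h1, h2⟩ := abs_le_of_mem_gaussDomain hm hn hp
    rw [Set.indicator_of_mem hp, Finset.prod_congr rfl fun j _ =>
      Set.indicator_of_mem (show p.1 j ∈ {z : ℝ | |z| ≤ √n * b} from h1 j) _,
      Finset.prod_congr rfl fun k _ =>
      Set.indicator_of_mem (show p.2 k ∈ {z : ℝ | |z| ≤ 3 * (√m * b)} from h2 k) _]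
    rw [Finset.prod_mul_distrib, Finset.prod_mul_distrib]
    have h3 : ∏ i : Fin m × Fin n, ‖reducedKernel lam (yArg p i.1 i.2)‖ ≤ Real.exp 1 *
        ((∏ j, Real.exp (2 * p.1 j ^ 4 / n)) * ∏ k, Real.exp (32 * p.2 k ^ 4 / m)) := by
      calc ∏ i : Fin m × Fin n, ‖reducedKernel lam (yArg p i.1 i.2)‖
          ≤ ∏ i : Fin m × Fin n, Real.exp (yArg p i.1 i.2 ^ 4 / 4 +
              20 * (b ^ 5 + b ^ 3 / √(lam * (1 + lam)))) :=
            Finset.prod_le_prod (fun i _ => norm_nonneg _) fun i _ =>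
              norm_reducedKernel_le hlam (hp.1 i.1 i.2) hb2
        _ = Real.exp (∑ i : Fin m × Fin n, yArg p i.1 i.2 ^ 4 / 4 +
              m * n * (20 * (b ^ 5 + b ^ 3 / √(lam * (1 + lam))))) := by
            rw [← Real.exp_sum, Finset.sum_add_distrib]
            simp
        _ ≤ Real.exp (1 + (∑ j, 2 * p.1 j ^ 4 / n + ∑ k, 32 * p.2 k ^ 4 / m)) := by
            have := sum_yArg_four_le hm hn p
            rw [Real.exp_le_exp]
            linarith
        _ = _ := by rw [Real.exp_add, Real.exp_add, Real.exp_sum, Real.exp_sum]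
    have h4 : 0 ≤ (∏ j, Real.exp (-(p.1 j) ^ 2 / 2)) * (∏ k, Real.exp (-(p.2 k) ^ 2 / 2)) := by
      positivity
    refine (mul_le_mul_of_nonneg_left h3 h4).trans (le_of_eq ?_)
    ring
  · rw [Set.indicator_of_notMem hp]
    refine mul_nonneg (Real.exp_pos _).le (mul_nonneg ?_ ?_) <;>
    exact Finset.prod_nonneg fun i _ => Set.indicator_nonneg (fun _ _ => by positivity) _

lemma integral_norm_integrand_le {lam : ℝ} (hlam : 1 ≤ lam) {m n : ℕ} (hm : 0 < m) (hn : 0 < n)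
    {b : ℝ} (hb0 : 0 < b) (hb : b ≤ 1 / 40)
    (hη : m * n * (20 * (b ^ 5 + b ^ 3 / √(lam * (1 + lam)))) ≤ 1) :
    ∫ p : (Fin m → ℝ) × (Fin n → ℝ), (gaussDomain m n b).indicator (fun p =>
        (∏ j, Real.exp (-(p.1 j) ^ 2 / 2)) * (∏ k, Real.exp (-(p.2 k) ^ 2 / 2)) *
        ∏ i : Fin m × Fin n, ‖reducedKernel lam (yArg p i.1 i.2)‖) p ≤
      √(2 * Real.pi) ^ (m + n) * Real.exp (1 + (2 * (m : ℝ) / n + 32 * n / m) * cD) := by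
  have hm0 : (0 : ℝ) < m := by exact_mod_cast hm
  have hn0 : (0 : ℝ) < n := by exact_mod_cast hn
  have c1 : (2 : ℝ) * (√n * b) ^ 2 ≤ n / 4 := by
    rw [mul_pow, Real.sq_sqrt hn0.le]
    have : b ^ 2 ≤ (1 / 40) ^ 2 := by gcongr
    nlinarith
  have c2 : (32 : ℝ) * (3 * (√m * b)) ^ 2 ≤ m / 4 := by
    rw [mul_pow, mul_pow, Real.sq_sqrt hm0.le]
    have : b ^ 2 ≤ (1 / 40) ^ 2 := by gcongr
    nlinarith
  have i1 := integrable_trunc_gaussian 2 n (√n * b)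
  have i2 := integrable_trunc_gaussian 32 m (3 * (√m * b))
  have b1 := integral_trunc_gaussian_le (A := 2) (by norm_num) hn0 c1
  have b2 := integral_trunc_gaussian_le (A := 32) (by norm_num) hm0 c2
  have j1 := Integrable.fintype_prod (ι := Fin m) (fun _ => i1)
  have j2 := Integrable.fintype_prod (ι := Fin n) (fun _ => i2)
  refine (integral_mono_of_nonneg (.of_forall fun p => Set.indicator_nonneg
    (fun p _ => by positivity) p) ((j1.mul_prod j2).const_mul (Real.exp 1))
    (.of_forall fun p => norm_integrand_le hlam hm hn (by linarith) hη p)).trans ?_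
  rw [integral_const_mul, integral_prod_mul
    (fun x : Fin m → ℝ => ∏ j, {z : ℝ | |z| ≤ √n * b}.indicator
        (fun z => Real.exp (-z ^ 2 / 2) * Real.exp (2 * z ^ 4 / n)) (x j))
    (fun x : Fin n → ℝ => ∏ k, {z : ℝ | |z| ≤ 3 * (√m * b)}.indicator
        (fun z => Real.exp (-z ^ 2 / 2) * Real.exp (32 * z ^ 4 / m)) (x k)),
    integral_fintype_prod_eq_prod, integral_fintype_prod_eq_prod, Finset.prod_const,
    Finset.prod_const, Finset.card_univ, Finset.card_univ, Fintype.card_fin, Fintype.card_fin]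
  have n1 : 0 ≤ ∫ z : ℝ, {z : ℝ | |z| ≤ √n * b}.indicator
        (fun z => Real.exp (-z ^ 2 / 2) * Real.exp (2 * z ^ 4 / n)) z :=
    integral_nonneg fun z => Set.indicator_nonneg (fun _ _ => by positivity) _
  have n2 : 0 ≤ ∫ z : ℝ, {z : ℝ | |z| ≤ 3 * (√m * b)}.indicator
        (fun z => Real.exp (-z ^ 2 / 2) * Real.exp (32 * z ^ 4 / m)) z :=
    integral_nonneg fun z => Set.indicator_nonneg (fun _ _ => by positivity) _
  calc Real.exp 1 * (_ ^ m * _ ^ n)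
      ≤ Real.exp 1 * ((√(2 * Real.pi) * Real.exp (2 / n * cD)) ^ m *
        (√(2 * Real.pi) * Real.exp (32 / m * cD)) ^ n) := by gcongr
    _ = √(2 * Real.pi) ^ (m + n) * (Real.exp 1 * (Real.exp (m * (2 / n * cD)) *
          Real.exp (n * (32 / m * cD)))) := by
        rw [Real.exp_nat_mul, Real.exp_nat_mul]; ring
    _ = _ := by
        rw [← Real.exp_add, ← Real.exp_add]
        congr 2
        ring

lemma integral_norm_truncKernel_le {lam : ℝ} (hlam : 1 ≤ lam) {m n : ℕ} (hm : 0 < m) (hn : 0 < n)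
    {b : ℝ} (hb0 : 0 < b) (hb : b ≤ 1 / 40)
    (hη : m * n * (20 * (b ^ 5 + b ^ 3 / √(lam * (1 + lam)))) ≤ 1) (hmn : 2 ≤ m * n * b ^ 2)
    (hbσ : b / (2 * Real.pi * √(lam * (1 + lam))) < 1 / 4) :
    ∫ p : (Fin m → UnitAddCircle) × (Fin n → UnitAddCircle), ∏ i : Fin m × Fin n,
      ‖truncKernel lam (b / (2 * Real.pi * √(lam * (1 + lam)))) (p.1 i.1 + p.2 i.2)‖ ≤
    torusConst m n (lam * (1 + lam)) *
      (2 * Real.exp (1 + (2 * (m : ℝ) / n + 32 * n / m) * cD)) := by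
  have hm0 : (0 : ℝ) < m := by exact_mod_cast hm
  have hn0 : (0 : ℝ) < n := by exact_mod_cast hn
  have hL : 0 < lam * (1 + lam) := by positivity
  have hsL := Real.sqrt_pos.2 hL
  set L := lam * (1 + lam) with hLdef
  set σ := 2 * Real.pi * √L with hσdef
  have hσ : 0 < σ := by positivity
  have key := integral_torus_eq_gaussian (m := m) (n := n) hm hn
    (K := fun u => (‖truncKernel lam (b / σ) u‖ : ℂ))
    (Complex.measurable_ofReal.comp (measurable_truncKernel lam (b / σ)).norm)
    (κ := fun y => (‖reducedKernel lam y‖ : ℂ)) (lam := 0) hσ hbσ (s := 0) (t := 0) (by simp)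
    (by simp) (fun r hr => by
      rw [truncKernel_coe (by linarith) r (by linarith) hr, norm_mul, norm_mul]
      have e1 : ‖Complex.exp (2 * Real.pi * Complex.I * (lam * r))‖ = 1 := by
        rw [show 2 * (Real.pi : ℂ) * Complex.I * (lam * r) = (2 * Real.pi * (lam * r) : ℝ) *
          Complex.I by push_cast; ring, Complex.norm_exp_ofReal_mul_I]
      have e2 : ‖Complex.exp (-((σ * r : ℝ) : ℂ) ^ 2 / 2)‖ = Real.exp (-(σ * r) ^ 2 / 2) := by
        rw [← Complex.norm_of_nonneg (Real.exp_pos (-(σ * r) ^ 2 / 2)).le]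
        push_cast
        rfl
      rw [e1, e2, ← hLdef, ← hσdef]
      simp)
    (fun u hu => by
      rw [truncKernel, Set.indicator_of_notMem (by simpa using hu)]
      simp)
  have e1 : (∫ p : (Fin m → UnitAddCircle) × (Fin n → UnitAddCircle),
      (∏ i : Fin m × Fin n, (‖truncKernel lam (b / σ) (p.1 i.1 + p.2 i.2)‖ : ℂ)) *
        ((∏ j, fourier (-((0 : ℕ) : ℤ)) (p.1 j)) * ∏ k, fourier (-((0 : ℕ) : ℤ)) (p.2 k))) =
      ((∫ p : (Fin m → UnitAddCircle) × (Fin n → UnitAddCircle),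
      (∏ i : Fin m × Fin n, ‖truncKernel lam (b / σ) (p.1 i.1 + p.2 i.2)‖) : ℝ) : ℂ) := by
    rw [← integral_complex_ofReal]
    simp
  have e2 : ∫ p : (Fin m → ℝ) × (Fin n → ℝ), (gaussDomain m n b).indicator (fun p =>
        (∏ j, Complex.exp (-(p.1 j : ℂ) ^ 2 / 2)) * (∏ k, Complex.exp (-(p.2 k : ℂ) ^ 2 / 2)) *
        ∏ i : Fin m × Fin n, (‖reducedKernel lam (yArg p i.1 i.2)‖ : ℂ)) p =
      ((∫ p : (Fin m → ℝ) × (Fin n → ℝ), (gaussDomain m n b).indicator (fun p =>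
        (∏ j, Real.exp (-(p.1 j) ^ 2 / 2)) * (∏ k, Real.exp (-(p.2 k) ^ 2 / 2)) *
        ∏ i : Fin m × Fin n, ‖reducedKernel lam (yArg p i.1 i.2)‖) p : ℝ) : ℂ) := by
    rw [← integral_complex_ofReal]
    congr 1
    ext p
    by_cases hp : p ∈ gaussDomain m n b
    · rw [Set.indicator_of_mem hp, Set.indicator_of_mem hp]
      push_cast
      rfl
    · rw [Set.indicator_of_notMem hp, Set.indicator_of_notMem hp]
      simp
  rw [e1, e2] at key
  have hJ := integral_norm_integrand_le hlam hm hn hb0 hb hη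
  generalize (∫ p : (Fin m → ℝ) × (Fin n → ℝ), (gaussDomain m n b).indicator (fun p =>
        (∏ j, Real.exp (-(p.1 j) ^ 2 / 2)) * (∏ k, Real.exp (-(p.2 k) ^ 2 / 2)) *
        ∏ i : Fin m × Fin n, ‖reducedKernel lam (yArg p i.1 i.2)‖) p) = J at key hJ
  generalize (∫ p : (Fin m → UnitAddCircle) × (Fin n → UnitAddCircle),
      (∏ i : Fin m × Fin n, ‖truncKernel lam (b / σ) (p.1 i.1 + p.2 i.2)‖)) = I at key ⊢
  have hG := (gaussian_Icc_bounds (A := (m : ℝ) * n) (by positivity) hb0).2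
  generalize (∫ u in Set.Icc (-b) b, Real.exp (-((m : ℝ) * n) * u ^ 2 / 2)) = G at key hG
  have hc := torusConst_eq (m := m) (n := n) (L := L) hm hn hL
  rw [← hσdef] at hc
  have hg0 : 0 < √(2 * Real.pi / (m * n)) := by positivity
  generalize √(2 * Real.pi / ((m : ℝ) * n)) = g at *
  have key' : I * G = σ * (((σ * √n)⁻¹) ^ m * ((σ * √m)⁻¹) ^ n) * J := by exact_mod_cast key
  have hG2 : g / 2 ≤ G := by
    have : 1 / (m * n * b ^ 2) ≤ 1 / 2 := one_div_le_one_div_of_le (by norm_num) hmn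
    nlinarith
  have hG0 : 0 < G := by linarith
  have hc0 : 0 ≤ σ * (((σ * √n)⁻¹) ^ m * ((σ * √m)⁻¹) ^ n) := by positivity
  have hT0 : 0 ≤ torusConst m n L := by unfold torusConst; positivity
  rw [← mul_le_mul_iff_left₀ hG0, key']
  set X := Real.exp (1 + (2 * (m : ℝ) / n + 32 * n / m) * cD)
  have hX : 0 < X := Real.exp_pos _
  calc σ * (((σ * √n)⁻¹) ^ m * ((σ * √m)⁻¹) ^ n) * J
      ≤ σ * (((σ * √n)⁻¹) ^ m * ((σ * √m)⁻¹) ^ n) * (√(2 * Real.pi) ^ (m + n) * X) := by gcongr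
    _ = torusConst m n L * (2 * X) * (g / 2) := by
        linear_combination (-X) * hc
    _ ≤ torusConst m n L * (2 * X) * G := by gcongr

end NormBox

section NormDecay

open MeasureTheory ProbabilityTheory
open scoped NNReal ENNReal

lemma exists_coe_eq (u : UnitAddCircle) : ∃ y : ℝ, |y| ≤ 1 / 2 ∧ u = y ∧ ‖u‖ = |y| := by
  induction u using QuotientAddGroup.induction_on with
  | _ r =>
  have h1 : ((r - round r : ℝ) : UnitAddCircle) = r := by
    rw [AddCircle.coe_sub, sub_eq_self]
    exact (AddCircle.coe_eq_zero_iff 1).2 ⟨round r, by simp⟩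
  have h2 : |r - round r| ≤ 1 / 2 := abs_sub_round r
  refine ⟨r - round r, h2, h1.symm, ?_⟩
  exact UnitAddCircle.norm_eq

lemma four_mul_abs_le {y : ℝ} (hy : |y| ≤ 1 / 2) :
    4 * |y| ≤ ‖(fourier 1 (y : UnitAddCircle) : ℂ) - 1‖ := by
  have h1 : (fourier 1 (y : UnitAddCircle) : ℂ) = Complex.exp (Complex.I * (2 * Real.pi * y : ℝ)) := by
    rw [fourier_coe_apply]
    congr 1; push_cast; ring
  rw [h1, Complex.norm_exp_I_mul_ofReal_sub_one, norm_mul, Real.norm_eq_abs, Real.norm_eq_abs]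
  have hp := Real.pi_pos
  have h2 := Real.mul_le_sin (x := Real.pi * |y|) (by positivity) (by nlinarith)
  have h3 : 2 / Real.pi * (Real.pi * |y|) = 2 * |y| := by field_simp
  have h4 : Real.sin (Real.pi * |y|) ≤ |Real.sin (2 * Real.pi * y / 2)| := by
    rw [show 2 * Real.pi * y / 2 = Real.pi * y by ring]
    rcases abs_cases y with ⟨h, -⟩ | ⟨h, -⟩
    · rw [h]; exact le_abs_self _
    · rw [h, mul_neg, Real.sin_neg]; exact neg_le_abs _
  rw [abs_two]
  linarith

lemma normKernel_sq (lam : ℝ) (u : UnitAddCircle) :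
    (normKernel lam u : ℝ) ^ 2 =
      (1 + lam * (1 + lam) * ‖(fourier 1 u : ℂ) - 1‖ ^ 2)⁻¹ := by
  rw [normKernel, coe_nnnorm, geomKernel, norm_inv, inv_pow, norm_sq_denominator]

lemma normKernel_coe_sq_le {lam : ℝ} (hlam : 0 ≤ lam) {y : ℝ} (hy : |y| ≤ 1 / 2) :
    (normKernel lam (y : UnitAddCircle) : ℝ) ^ 2 ≤ (1 + 16 * (lam * (1 + lam)) * y ^ 2)⁻¹ := by
  rw [normKernel_sq]
  have h1 := four_mul_abs_le hy
  have h2 : (4 * |y|) ^ 2 ≤ ‖(fourier 1 (y : UnitAddCircle) : ℂ) - 1‖ ^ 2 := by gcongr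
  rw [mul_pow, sq_abs] at h2
  apply inv_anti₀ (by positivity)
  have h3 : lam * (1 + lam) * (4 ^ 2 * y ^ 2) ≤
    lam * (1 + lam) * ‖(fourier 1 (y : UnitAddCircle) : ℂ) - 1‖ ^ 2 := by gcongr
  linarith

lemma normKernel_le_exp {lam d x : ℝ} (hlam : 0 ≤ lam) (hd : 0 ≤ d) (hx : 0 ≤ x) (hx1 : x ≤ 1)
    (hxd : x ≤ 16 * (lam * (1 + lam)) * d ^ 2) (u : UnitAddCircle) (hu : d < ‖u‖) :
    normKernel lam u ≤ (Real.exp (-x / 4)).toNNReal := by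
  obtain ⟨y, hy, rfl, hyn⟩ := exists_coe_eq u
  rw [hyn] at hu
  have h1 := normKernel_coe_sq_le hlam hy
  have h2 : d ^ 2 ≤ y ^ 2 := by rw [← sq_abs y]; gcongr
  have h3 : 1 + x ≤ 1 + 16 * (lam * (1 + lam)) * y ^ 2 := by
    have : 16 * (lam * (1 + lam)) * d ^ 2 ≤ 16 * (lam * (1 + lam)) * y ^ 2 := by gcongr
    linarith
  have h4 : (1 + 16 * (lam * (1 + lam)) * y ^ 2)⁻¹ ≤ Real.exp (-x / 4) ^ 2 := by
    rw [← Real.exp_nat_mul, show ((2 : ℕ) : ℝ) * (-x / 4) = -(x / 2) by push_cast; ring,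
      Real.exp_neg]
    apply inv_anti₀ (Real.exp_pos _)
    have h5 : Real.exp (x / 2) ≤ 1 + x := by
      have := Real.exp_bound' (x := x / 2) (by positivity) (by linarith) (n := 2) (by norm_num)
      norm_num [Finset.sum_range_succ, Nat.factorial] at this
      nlinarith
    linarith
  rw [← NNReal.coe_le_coe, Real.coe_toNNReal _ (Real.exp_pos _).le]
  exact le_of_sq_le_sq (h1.trans h4) (Real.exp_pos _).le

lemma lintegral_normKernel_sq_le {lam : ℝ} (hlam : 0 < lam) :
    ∫⁻ u, (normKernel lam u : ℝ≥0∞) ^ 2 ≤ ENNReal.ofReal (1 / √(lam * (1 + lam))) := by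
  have hL : 0 < lam * (1 + lam) := by positivity
  have hsL := Real.sqrt_pos.2 hL
  rw [← UnitAddCircle.lintegral_preimage (-1 / 2)]
  have hi : Integrable fun x : ℝ => (1 + (4 * √(lam * (1 + lam)) * x) ^ 2)⁻¹ :=
    integrable_inv_one_add_sq.comp_mul_left' (by positivity)
  calc ∫⁻ a in Set.Ioc (-1 / 2 : ℝ) (-1 / 2 + 1), (normKernel lam (a : UnitAddCircle) : ℝ≥0∞) ^ 2
      ≤ ∫⁻ a in Set.Ioc (-1 / 2 : ℝ) (-1 / 2 + 1),
          ENNReal.ofReal ((1 + (4 * √(lam * (1 + lam)) * a) ^ 2)⁻¹) := by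
        refine setLIntegral_mono' measurableSet_Ioc fun x hx => ?_
        have hx' : |x| ≤ 1 / 2 := abs_le.2 ⟨by linarith [hx.1], by linarith [hx.2]⟩
        have h1 := normKernel_coe_sq_le hlam.le hx'
        rw [← ENNReal.coe_pow, ← ENNReal.ofReal_coe_nnreal]
        apply ENNReal.ofReal_le_ofReal
        push_cast
        rw [mul_pow, mul_pow, Real.sq_sqrt hL.le]
        norm_num at h1 ⊢
        exact h1
    _ ≤ ∫⁻ a : ℝ, ENNReal.ofReal ((1 + (4 * √(lam * (1 + lam)) * a) ^ 2)⁻¹) :=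
        setLIntegral_le_lintegral _ _
    _ = ENNReal.ofReal (∫ a : ℝ, (1 + (4 * √(lam * (1 + lam)) * a) ^ 2)⁻¹) :=
        (ofReal_integral_eq_lintegral_ofReal hi (.of_forall fun x => by positivity)).symm
    _ ≤ _ := by
        apply ENNReal.ofReal_le_ofReal
        rw [Measure.integral_comp_mul_left (fun x : ℝ => (1 + x ^ 2)⁻¹),
          integral_univ_inv_one_add_sq, abs_of_pos (by positivity), smul_eq_mul, mul_inv,
          one_div]
        have := Real.pi_le_four
        have h2 : 0 < (√(lam * (1 + lam)))⁻¹ := by positivity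
        nlinarith

end NormDecay

section TailBound

open MeasureTheory ProbabilityTheory
open scoped NNReal ENNReal

lemma sqrt_pow_le_mul_exp {N N' j M : ℕ} {l : ℝ} (hN' : 0 < N') (hN : N = N' + j)
    (hM : (M : ℝ) ≤ 2 * N' * l) : √(N : ℝ) ^ M ≤ √(N' : ℝ) ^ M * Real.exp (j * l) := by
  have h0 : (0 : ℝ) < N' := by exact_mod_cast hN'
  have h1 : √(N : ℝ) ≤ √(N' : ℝ) * Real.exp (j / N' / 2) := by
    rw [Real.exp_half, ← Real.sqrt_mul h0.le]
    apply Real.sqrt_le_sqrt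
    have := Real.add_one_le_exp ((j : ℝ) / N')
    calc (N : ℝ) = N' * (j / N' + 1) := by rw [hN]; push_cast; field_simp; ring
      _ ≤ _ := by gcongr
  calc √(N : ℝ) ^ M ≤ (√(N' : ℝ) * Real.exp (j / N' / 2)) ^ M := by gcongr
    _ = √(N' : ℝ) ^ M * Real.exp (M * (j / N' / 2)) := by rw [mul_pow, Real.exp_nat_mul]
    _ ≤ _ := by
      have : (M : ℝ) * (j / N' / 2) ≤ j * l := by
        calc (M : ℝ) * (j / N' / 2) ≤ 2 * N' * l * (j / N' / 2) := by gcongr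
          _ = _ := by field_simp
      gcongr

lemma inv_le_inv_mul {A B e : ℝ} (hA : 0 < A) (hB : 0 < B) (h : A ≤ B * e) :
    B⁻¹ ≤ A⁻¹ * e := by
  rw [inv_mul_eq_div, le_div_iff₀ hA, inv_mul_le_iff₀ hB]
  exact h

namespace Regime

variable {m n : ℕ} {l L : ℝ}

lemma sqrt_two_pi_le : √(2 * Real.pi) ≤ 3 := by
  rw [Real.sqrt_le_left (by norm_num)]
  linarith [Real.pi_le_four]

lemma sqrt_two_pi_ge : 1 ≤ √(2 * Real.pi) := by
  rw [Real.one_le_sqrt]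
  linarith [Real.pi_gt_three]

lemma three_mul_l_le (h : Regime m n l L) : 3 * l ≤ √n := by
  have hl := h.l_ge
  calc 3 * l ≤ l * l := by gcongr; linarith
    _ = l ^ 2 := by ring
    _ ≤ l ^ 100 := pow_le_pow_right₀ (by linarith) (by norm_num)
    _ ≤ _ := h.sqrt_n_ge

lemma sqrt_two_pi_mul_sqrt_n_le (h : Regime m n l L) : √(2 * Real.pi) * √n ≤ Real.exp l := by
  have hl := h.l_ge
  rw [← h.n_eq_exp]
  have h1 := h.three_mul_l_le
  calc √(2 * Real.pi) * √n ≤ √n * √n := by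
        have := sqrt_two_pi_le
        exact mul_le_mul_of_nonneg_right (by linarith) (Real.sqrt_nonneg _)
    _ = n := Real.mul_self_sqrt h.n_pos.le

lemma sqrt_two_pi_mul_sqrt_m_le (h : Regime m n l L) : √(2 * Real.pi) * √m ≤ Real.exp l := by
  have hl := h.l_ge
  rw [← h.n_eq_exp]
  calc √(2 * Real.pi) * √m ≤ 3 * (√n * l) := by
        have := h.sqrt_m_le
        have := sqrt_two_pi_le
        gcongr
    _ = 3 * l * √n := by ring
    _ ≤ √n * √n := by gcongr; exact h.three_mul_l_le
    _ = n := Real.mul_self_sqrt h.n_pos.le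

lemma torusConst_le (h : Regime m n l L) {m' n' r : ℕ} (hm : m' ≤ m) (hn : n' ≤ n)
    (hr : m' + n' + r = m + n) (h2m : m ≤ 2 * m') (h2n : n ≤ 2 * n') :
    torusConst m' n' L ≤ torusConst m n L * (√L * Real.exp (l ^ 3)) ^ r := by
  obtain ⟨i, rfl⟩ := Nat.exists_eq_add_of_le hm
  obtain ⟨j, rfl⟩ := Nat.exists_eq_add_of_le hn
  obtain rfl : r = i + j := by omega
  have hl := h.l_ge
  have hm0 := h.m_pos
  have hn0 := h.n_pos
  have hm'0 : 0 < m' := by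
    rcases Nat.eq_zero_or_pos m' with rfl | h'
    · exfalso
      have : (0 + i : ℕ) ≠ 0 := by intro h0; rw [h0] at hm0; simp at hm0
      omega
    · exact h'
  have hn'0 : 0 < n' := by
    rcases Nat.eq_zero_or_pos n' with rfl | h'
    · exfalso
      have : (0 + j : ℕ) ≠ 0 := by intro h0; rw [h0] at hn0; simp at hn0
      omega
    · exact h'
  have hm'r : (0 : ℝ) < m' := by exact_mod_cast hm'0
  have hn'r : (0 : ℝ) < n' := by exact_mod_cast hn'0
  have h2m' : ((m' + i : ℕ) : ℝ) ≤ 2 * m' := by exact_mod_cast h2m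
  have h2n' : ((n' + j : ℕ) : ℝ) ≤ 2 * n' := by exact_mod_cast h2n
  have hmle := h.m_le
  have hnle := h.n_le
  have A1 := sqrt_pow_le_mul_exp (N := n' + j) (M := m') (l := l) hn'0 rfl (by
    have : (m' : ℝ) ≤ ((m' + i : ℕ) : ℝ) := by push_cast; linarith [Nat.cast_nonneg (α := ℝ) i]
    have : ((n' + j : ℕ) : ℝ) * l ≤ 2 * n' * l := by gcongr
    linarith)
  have A2 := sqrt_pow_le_mul_exp (N := m' + i) (M := n') (l := l) hm'0 rfl (by
    have : (n' : ℝ) ≤ ((n' + j : ℕ) : ℝ) := by push_cast; linarith [Nat.cast_nonneg (α := ℝ) j]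
    have : ((m' + i : ℕ) : ℝ) * l ≤ 2 * m' * l := by gcongr
    linarith)
  have B1 := h.sqrt_two_pi_mul_sqrt_n_le
  have B2 := h.sqrt_two_pi_mul_sqrt_m_le
  have hP : 0 < √(2 * Real.pi) := by positivity
  have sm := h.sqrt_m_pos
  have sn := h.sqrt_n_pos
  have sL := Real.sqrt_pos.2 h.L_pos
  have sm' := Real.sqrt_pos.2 hm'r
  have sn' := Real.sqrt_pos.2 hn'r
  have smle : √(m' : ℝ) ≤ √((m' + i : ℕ) : ℝ) := by
    apply Real.sqrt_le_sqrt; exact_mod_cast hm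
  have snle : √(n' : ℝ) ≤ √((n' + j : ℕ) : ℝ) := by
    apply Real.sqrt_le_sqrt; exact_mod_cast hn
  have C1 : (√(2 * Real.pi) * √((n' + j : ℕ) : ℝ)) ^ (m' + i) ≤
      (√(2 * Real.pi) * √(n' : ℝ)) ^ m' * Real.exp ((i + j) * l) := by
    rw [pow_add, mul_pow]
    calc √(2 * Real.pi) ^ m' * √((n' + j : ℕ) : ℝ) ^ m' * (√(2 * Real.pi) * √((n' + j : ℕ) : ℝ)) ^ i
        ≤ √(2 * Real.pi) ^ m' * (√(n' : ℝ) ^ m' * Real.exp (j * l)) * Real.exp l ^ i := by gcongr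
      _ = _ := by rw [← Real.exp_nat_mul, add_mul, Real.exp_add]; ring
  have C2 : (√(2 * Real.pi) * √((m' + i : ℕ) : ℝ)) ^ (n' + j) ≤
      (√(2 * Real.pi) * √(m' : ℝ)) ^ n' * Real.exp ((i + j) * l) := by
    rw [pow_add, mul_pow]
    calc √(2 * Real.pi) ^ n' * √((m' + i : ℕ) : ℝ) ^ n' * (√(2 * Real.pi) * √((m' + i : ℕ) : ℝ)) ^ j
        ≤ √(2 * Real.pi) ^ n' * (√(m' : ℝ) ^ n' * Real.exp (i * l)) * Real.exp l ^ j := by gcongr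
      _ = _ := by rw [← Real.exp_nat_mul, add_mul, Real.exp_add]; ring
  have D1 := inv_le_inv_mul (by positivity) (by positivity) C1
  have D2 := inv_le_inv_mul (by positivity) (by positivity) C2
  have hE : Real.exp ((i + j) * l) * Real.exp ((i + j) * l) ≤ Real.exp (l ^ 3) ^ (i + j) := by
    rw [← Real.exp_add, ← Real.exp_nat_mul, Real.exp_le_exp]
    push_cast
    have h1 : 2 * l ≤ l ^ 3 := by
      calc 2 * l ≤ l ^ 2 * l := by gcongr; nlinarith
        _ = l ^ 3 := by ring
    have hij : (0 : ℝ) ≤ i + j := by positivity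
    have h2 : ((i : ℝ) + j) * (2 * l) ≤ (i + j) * l ^ 3 := by gcongr
    linarith
  have hLL : √L * (√L)⁻¹ ^ (m' + n') =
      √L * (√L)⁻¹ ^ (m' + i + (n' + j)) * √L ^ (i + j) := by
    rw [show m' + i + (n' + j) = (m' + n') + (i + j) by ring, pow_add _ (m' + n'), mul_assoc,
      mul_assoc, ← mul_pow, inv_mul_cancel₀ sL.ne', one_pow, mul_one]
  unfold torusConst
  rw [inv_pow (√(2 * Real.pi) * √(n' : ℝ)), inv_pow (√(2 * Real.pi) * √(m' : ℝ)),
    inv_pow (√(2 * Real.pi) * √((n' + j : ℕ) : ℝ)), inv_pow (√(2 * Real.pi) * √((m' + i : ℕ) : ℝ)),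
    hLL, mul_pow (√L)]
  have hx : 0 ≤ ((√(2 * Real.pi) * √(n' : ℝ)) ^ m')⁻¹ := by positivity
  have hy : 0 ≤ ((√(2 * Real.pi) * √(m' : ℝ)) ^ n')⁻¹ := by positivity
  have hX : 0 ≤ ((√(2 * Real.pi) * √((n' + j : ℕ) : ℝ)) ^ (m' + i))⁻¹ := by positivity
  have hY : 0 ≤ ((√(2 * Real.pi) * √((m' + i : ℕ) : ℝ)) ^ (n' + j))⁻¹ := by positivity
  have hQ : 0 ≤ √L * (√L)⁻¹ ^ (m' + i + (n' + j)) := by positivity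
  have hR : 0 ≤ √L ^ (i + j) := by positivity
  have he := Real.exp_pos (((i : ℝ) + j) * l)
  generalize ((√(2 * Real.pi) * √(n' : ℝ)) ^ m')⁻¹ = x at *
  generalize ((√(2 * Real.pi) * √(m' : ℝ)) ^ n')⁻¹ = y at *
  generalize ((√(2 * Real.pi) * √((n' + j : ℕ) : ℝ)) ^ (m' + i))⁻¹ = X at *
  generalize ((√(2 * Real.pi) * √((m' + i : ℕ) : ℝ)) ^ (n' + j))⁻¹ = Y at *
  generalize √L * (√L)⁻¹ ^ (m' + i + (n' + j)) = Q at *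
  generalize √L ^ (i + j) = R at *
  generalize Real.exp (((i : ℝ) + j) * l) = e at *
  generalize Real.exp (l ^ 3) ^ (i + j) = F at *
  calc √(2 * Real.pi) * √(m' : ℝ) * √(n' : ℝ) * x * y * (Q * R)
      ≤ √(2 * Real.pi) * √((m' + i : ℕ) : ℝ) * √((n' + j : ℕ) : ℝ) * (X * e) * (Y * e) *
        (Q * R) := by gcongr
    _ = √(2 * Real.pi) * √((m' + i : ℕ) : ℝ) * √((n' + j : ℕ) : ℝ) * X * Y * Q * R * (e * e) := by
        ring
    _ ≤ √(2 * Real.pi) * √((m' + i : ℕ) : ℝ) * √((n' + j : ℕ) : ℝ) * X * Y * Q * R * F := by gcongr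
    _ = _ := by ring

lemma boxInt_normKernel_le {lam : ℝ} (h : Regime m n l (lam * (1 + lam))) (hlam : 1 ≤ lam)
    {m' n' r : ℕ} (hm : m' ≤ m) (hn : n' ≤ n)
    (hr : m' + n' + r = m + n) (h2m : m ≤ 2 * m') (h2n : n ≤ 2 * n') :
    boxInt (normKernel lam) m' n' (l ^ 3 / √n / (2 * Real.pi * √(lam * (1 + lam)))) ≤
      ENNReal.ofReal (torusConst m n (lam * (1 + lam)) * Real.exp (l ^ 2)) *
        ENNReal.ofReal (√(lam * (1 + lam)) * Real.exp (l ^ 3)) ^ r := by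
  have hl := h.l_ge
  have hm0 := h.m_pos
  have hn0 := h.n_pos
  have hT := h.torusConst_le hm hn hr h2m h2n
  have hβ := h.torus_radius_lt
  have h1 := h.remainder_le (y := l ^ 3 / √n) (by
    have := h.sqrt_n_pos
    rw [abs_of_nonneg (by positivity)])
  have h2 := h.mn_remainder_le
  have hsn := h.sqrt_n_pos
  set L := lam * (1 + lam) with hL
  have hm'0 : 0 < m' := by
    have : 0 < m := by exact_mod_cast hm0
    omega
  have hn'0 : 0 < n' := by
    have : 0 < n := by exact_mod_cast hn0
    omega
  have hm'r : (0 : ℝ) < m' := by exact_mod_cast hm'0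
  have hn'r : (0 : ℝ) < n' := by exact_mod_cast hn'0
  have hmr : (m' : ℝ) ≤ m := by exact_mod_cast hm
  have hnr : (n' : ℝ) ≤ n := by exact_mod_cast hn
  have h2mr : (m : ℝ) ≤ 2 * m' := by exact_mod_cast h2m
  have h2nr : (n : ℝ) ≤ 2 * n' := by exact_mod_cast h2n
  have hpow : l ^ 16 * l ^ 84 ≤ √(n : ℝ) := by rw [← pow_add]; exact h.sqrt_n_ge
  have hl84 : 40 ≤ l ^ 84 := by
    calc (40 : ℝ) ≤ l := by linarith
      _ ≤ l ^ 84 := le_self_pow₀ (by linarith) (by norm_num)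
  have h40 : l ^ 16 * 40 ≤ √(n : ℝ) := le_trans (by gcongr) hpow
  have hb : l ^ 3 / √n ≤ 1 / 40 := by
    rw [div_le_iff₀ hsn]
    have : l ^ 3 ≤ l ^ 16 := pow_le_pow_right₀ (by linarith) (by norm_num)
    linarith
  rw [boxInt_normKernel (by linarith), ← ENNReal.ofReal_pow (by positivity), ← ENNReal.ofReal_mul
    (by unfold torusConst; positivity)]
  apply ENNReal.ofReal_le_ofReal
  refine (integral_norm_truncKernel_le hlam hm'0 hn'0 (by positivity) hb ?_ ?_ hβ).trans ?_
  · rw [abs_of_nonneg (by positivity)] at h1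
    calc (m' : ℝ) * n' * (20 * ((l ^ 3 / √n) ^ 5 + (l ^ 3 / √n) ^ 3 / √L))
        ≤ m * n * (40 * l ^ 15 / √n ^ 5) := by gcongr
      _ ≤ 40 * l ^ 16 / √n := h2
      _ ≤ 1 := by rw [div_le_one hsn]; linarith
  · calc (2 : ℝ) ≤ (m / 2) * (n / 2) * (l ^ 3 / √n) ^ 2 := by
          rw [div_pow, Real.sq_sqrt hn0.le]
          have e : (m : ℝ) / 2 * (n / 2) * ((l ^ 3) ^ 2 / n) = m * l ^ 6 / 4 := by field_simp; ring
          rw [e]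
          have h3 := h.m_ge
          have h4 : 1 ≤ (m : ℝ) := (one_le_pow₀ (by linarith)).trans h3
          have h5 : l ≤ l ^ 6 := le_self_pow₀ (by linarith) (by norm_num)
          nlinarith
      _ ≤ _ := by gcongr <;> linarith
  · have hX : 2 * Real.exp (1 + (2 * (m' : ℝ) / n' + 32 * n' / m') * cD) ≤ Real.exp (l ^ 2) := by
      have hc := h.large
      have hc1 := one_le_cD
      have e1 : (m' : ℝ) / n' ≤ 2 * l := by
        rw [div_le_iff₀ hn'r]
        have := h.m_le
        nlinarith
      have e2 : (n' : ℝ) / m' ≤ 2 * l := by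
        rw [div_le_iff₀ hm'r]
        have := h.n_le
        nlinarith
      have e3 : (2 * (m' : ℝ) / n' + 32 * n' / m') * cD ≤ 68 * l * (l / 10000) := by
        rw [mul_div_assoc, mul_div_assoc]
        gcongr
        · linarith
        · linarith
      have e4 : (2 : ℝ) ≤ Real.exp 1 := by linarith [Real.add_one_le_exp 1]
      calc 2 * Real.exp (1 + (2 * (m' : ℝ) / n' + 32 * n' / m') * cD)
          ≤ Real.exp 1 * Real.exp (1 + (2 * (m' : ℝ) / n' + 32 * n' / m') * cD) := by gcongr
        _ = Real.exp (1 + (1 + (2 * (m' : ℝ) / n' + 32 * n' / m') * cD)) := by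
            rw [← Real.exp_add]
        _ ≤ _ := by rw [Real.exp_le_exp]; nlinarith
    have hT0 : 0 ≤ torusConst m n L := by unfold torusConst; positivity
    calc torusConst m' n' L * (2 * Real.exp (1 + (2 * (m' : ℝ) / n' + 32 * n' / m') * cD))
        ≤ torusConst m n L * (√L * Real.exp (l ^ 3)) ^ r * Real.exp (l ^ 2) := by gcongr
      _ = _ := by ring

end Regime

end TailBound

section OffBoxBound

open MeasureTheory
open scoped NNReal ENNReal

namespace Regime

variable {m n : ℕ} {l L : ℝ}

lemma le_min_mul (h : Regime m n l L) :
    (m : ℝ) ≤ (min m n : ℕ) * l ∧ (n : ℝ) ≤ (min m n : ℕ) * l := by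
  have hl := h.l_ge
  rcases le_total m n with hmn | hmn
  · rw [min_eq_left hmn]
    exact ⟨by nlinarith [h.m_pos], h.n_le⟩
  · rw [min_eq_right hmn]
    exact ⟨h.m_le, by nlinarith [h.n_pos]⟩

lemma le_min (h : Regime m n l L) : l ≤ (min m n : ℕ) := by
  have hl := h.l_ge
  have h1 := h.le_min_mul.1
  have h2 := h.m_ge
  have h3 : l * l ≤ l ^ 199 := by
    rw [← sq]
    exact pow_le_pow_right₀ (by linarith) (by norm_num)
  exact le_of_mul_le_mul_right (by linarith) (by linarith : 0 < l)

lemma crude_le (h : Regime m n l L) :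
    ((m : ℝ) * n) * (1 / √L) ^ (m + n - min m n / 4 - 1) ≤
      torusConst m n L * Real.exp (l ^ 2) * (√L * Real.exp (l ^ 3)) ^ (min m n / 4) := by
  have hl := h.l_ge
  have hμ := h.le_min
  obtain ⟨hm1, hn1⟩ := h.le_min_mul
  have hμ' : 10000 ≤ min m n := by exact_mod_cast (hl.trans hμ)
  have hminm := min_le_left m n
  have hminn := min_le_right m n
  set μ := min m n with hμdef
  set R := μ / 4 with hR
  have hR8 : (μ : ℝ) ≤ 8 * R := by
    have : μ ≤ 8 * R := by omega
    exact_mod_cast this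
  have hLs : 0 < √L := Real.sqrt_pos.2 h.L_pos
  have hexp : m + n = (m + n - R - 1) + R + 1 := by omega
  set k := m + n - R - 1 with hk
  have hP := sqrt_two_pi_ge
  have hnE := h.sqrt_two_pi_mul_sqrt_n_le
  have hmE := h.sqrt_two_pi_mul_sqrt_m_le
  have hm0 := h.sqrt_m_pos
  have hn0 := h.sqrt_n_pos
  have e1 : √L * (√L)⁻¹ ^ (m + n) * √L ^ R = (1 / √L) ^ k := by
    rw [hexp, pow_add, pow_add, one_div]
    have : (√L)⁻¹ ^ R * √L ^ R = 1 := by rw [← mul_pow, inv_mul_cancel₀ hLs.ne', one_pow]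
    calc _ = (√L)⁻¹ ^ k * ((√L)⁻¹ ^ R * √L ^ R) * ((√L)⁻¹ * √L) := by ring
      _ = _ := by rw [this, inv_mul_cancel₀ hLs.ne']; ring
  have e2 : torusConst m n L * Real.exp (l ^ 2) * (√L * Real.exp (l ^ 3)) ^ R =
      (√(2 * Real.pi) * √m * √n * ((√(2 * Real.pi) * √n)⁻¹ ^ m * (√(2 * Real.pi) * √m)⁻¹ ^ n) *
        Real.exp (l ^ 2 + R * l ^ 3)) * (1 / √L) ^ k := by
    rw [← e1, mul_pow, ← Real.exp_nat_mul, Real.exp_add, torusConst]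
    ring
  rw [e2]
  refine mul_le_mul_of_nonneg_right ?_ (by positivity)
  have i1 : Real.exp (-(m * l)) ≤ (√(2 * Real.pi) * √n)⁻¹ ^ m := by
    rw [show -((m : ℝ) * l) = m * (-l) by ring, Real.exp_nat_mul, Real.exp_neg]
    gcongr
  have i2 : Real.exp (-(n * l)) ≤ (√(2 * Real.pi) * √m)⁻¹ ^ n := by
    rw [show -((n : ℝ) * l) = n * (-l) by ring, Real.exp_nat_mul, Real.exp_neg]
    gcongr
  have hmE' : √(m : ℝ) ≤ Real.exp l := le_trans (by nlinarith) hmE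
  have hnE' : √(n : ℝ) ≤ Real.exp l := le_trans (by nlinarith) hnE
  have key : 2 * l ≤ -(m * l) + -(n * l) + (l ^ 2 + R * l ^ 3) := by
    have a1 : (m : ℝ) * l ≤ (μ * l) * l := by gcongr
    have a2 : (n : ℝ) * l ≤ (μ * l) * l := by gcongr
    have a3 : μ * l ^ 2 * 2 ≤ R * l ^ 3 := by
      calc μ * l ^ 2 * 2 ≤ (8 * R) * l ^ 2 * 2 := by gcongr
        _ = R * l ^ 2 * 16 := by ring
        _ ≤ R * l ^ 2 * l := by gcongr; linarith
        _ = _ := by ring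
    nlinarith
  calc (m : ℝ) * n = √m * √n * (√m * √n) := by
        rw [mul_mul_mul_comm, Real.mul_self_sqrt h.m_pos.le, Real.mul_self_sqrt h.n_pos.le]
    _ ≤ (√(2 * Real.pi) * √m * √n) * (Real.exp l * Real.exp l) := by
        gcongr
        nlinarith
    _ = (√(2 * Real.pi) * √m * √n) * Real.exp (2 * l) := by rw [← Real.exp_add]; ring_nf
    _ ≤ (√(2 * Real.pi) * √m * √n) * Real.exp (-(m * l) + -(n * l) + (l ^ 2 + R * l ^ 3)) := by
        gcongr
    _ = (√(2 * Real.pi) * √m * √n) * (Real.exp (-(m * l)) * Real.exp (-(n * l))) *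
        Real.exp (l ^ 2 + R * l ^ 3) := by
        rw [Real.exp_add, Real.exp_add]; ring
    _ ≤ _ := by gcongr

lemma small_le (h : Regime m n l L) {p : ℕ} (hp : min m n ≤ 16 * p) :
    4 * ((m : ℝ) * n) * Real.exp (-(l ^ 6 / (25 * n)) / 4) ^ p * Real.exp (l ^ 3) ≤
      Real.exp (-2 * l - l ^ 2) := by
  have hl := h.l_ge
  obtain ⟨hm1, hn1⟩ := h.le_min_mul
  have hn0 := h.n_pos
  have hp' : ((min m n : ℕ) : ℝ) ≤ 16 * p := by exact_mod_cast hp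
  have hP := sqrt_two_pi_ge
  have hnE := h.sqrt_two_pi_mul_sqrt_n_le
  have hmE := h.sqrt_two_pi_mul_sqrt_m_le
  have hmE' : (m : ℝ) ≤ Real.exp l * Real.exp l := by
    have : √(m : ℝ) ≤ Real.exp l := le_trans (by nlinarith [h.sqrt_m_pos]) hmE
    rw [← Real.mul_self_sqrt h.m_pos.le]
    gcongr
  have h4 : 4 ≤ Real.exp l := by linarith [Real.add_one_le_exp l]
  have hmn : 4 * ((m : ℝ) * n) ≤ Real.exp (4 * l) := by
    calc 4 * ((m : ℝ) * n) ≤ Real.exp l * ((Real.exp l * Real.exp l) * Real.exp l) := by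
          rw [← h.n_eq_exp] at *
          gcongr
      _ = _ := by rw [← Real.exp_add, ← Real.exp_add, ← Real.exp_add]; ring_nf
  have hδ : Real.exp (-(l ^ 6 / (25 * n)) / 4) ^ p ≤ Real.exp (-(l ^ 5 / 1600)) := by
    rw [← Real.exp_nat_mul]
    gcongr
    have : l ^ 5 / 1600 ≤ p * (l ^ 6 / (25 * n)) / 4 := by
      rw [mul_div_assoc', div_div, div_le_div_iff₀ (by norm_num) (by positivity)]
      calc l ^ 5 * (25 * n * 4) ≤ l ^ 5 * (25 * (16 * p * l) * 4) := by
            gcongr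
            exact hn1.trans (by gcongr)
        _ = _ := by ring
    linarith
  calc _ ≤ Real.exp (4 * l) * Real.exp (-(l ^ 5 / 1600)) * Real.exp (l ^ 3) := by gcongr
    _ = Real.exp (4 * l + -(l ^ 5 / 1600) + l ^ 3) := by rw [← Real.exp_add, ← Real.exp_add]
    _ ≤ _ := by
      gcongr
      have h2 : 10000 * 10000 ≤ l ^ 2 := by nlinarith
      have h5 : 10000 * 10000 * l ^ 3 ≤ l ^ 5 := by
        calc 10000 * 10000 * l ^ 3 ≤ l ^ 2 * l ^ 3 := by gcongr
          _ = _ := by ring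
      have h3 : l ^ 2 ≤ l ^ 3 := pow_le_pow_right₀ (by linarith) (by norm_num)
      have h1 : l ≤ l ^ 2 := by nlinarith
      linarith

theorem offBoxInt_normKernel_le {lam : ℝ} (h : Regime m n l (lam * (1 + lam))) (hlam : 1 ≤ lam) :
    offBoxInt (normKernel lam) m n (l ^ 3 / √n / (2 * Real.pi * √(lam * (1 + lam)))) ≤
      ENNReal.ofReal (torusConst m n (lam * (1 + lam)) * Real.exp (-2 * l)) := by
  have hl := h.l_ge
  have hμ := h.le_min
  have hμ' : 10000 ≤ min m n := by exact_mod_cast (hl.trans hμ)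
  have hminm := min_le_left m n
  have hminn := min_le_right m n
  have hn0 := h.n_pos
  set L := lam * (1 + lam) with hL
  have hL0 : 0 < L := h.L_pos
  have hLs : 0 < √L := Real.sqrt_pos.2 hL0
  set β := l ^ 3 / √n / (2 * Real.pi * √L) with hβ
  have hβ0 : 0 ≤ β := by positivity
  have hT0 : 0 ≤ torusConst m n L := by rw [torusConst]; positivity
  have hd3 : β = 3 * (β / 3) := by ring
  set x := l ^ 6 / (25 * n) with hx
  have hx0 : 0 ≤ x := by positivity
  have hx1 : x ≤ 1 := by
    rw [hx, div_le_one (by positivity)]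
    have : l ^ 6 ≤ l ^ 200 := pow_le_pow_right₀ (by linarith) (by norm_num)
    linarith [h.pow_le]
  have hxd : x ≤ 16 * L * (β / 3) ^ 2 := by
    have e : 16 * L * (β / 3) ^ 2 = l ^ 6 / n * (4 / (9 * Real.pi ^ 2)) := by
      rw [hβ]
      have h1 := Real.sq_sqrt hL0.le
      have h2 := Real.sq_sqrt hn0.le
      simp only [div_pow, mul_pow, h1, h2]
      field_simp
      ring
    rw [e, hx]
    have hpi : Real.pi ^ 2 ≤ 10 := by nlinarith [Real.pi_lt_d2, Real.pi_gt_three]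
    have : (1 : ℝ) / 25 ≤ 4 / (9 * Real.pi ^ 2) := by
      rw [div_le_div_iff₀ (by norm_num) (by positivity)]; linarith
    calc l ^ 6 / (25 * n) = l ^ 6 / n * (1 / 25) := by ring
      _ ≤ _ := by gcongr
  obtain ⟨p, hp⟩ : ∃ p, p + 1 = min m n / 8 := ⟨min m n / 8 - 1, by omega⟩
  have hsm := h.small_le (p := p) (by omega)
  have hδ0 := Real.exp_nonneg (-x / 4)
  have hzw : ENNReal.ofReal (1 / √L) * ENNReal.ofReal (√L * Real.exp (l ^ 3)) =
      ENNReal.ofReal (Real.exp (l ^ 3)) := by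
    rw [← ENNReal.ofReal_mul (by positivity)]
    congr 1
    field_simp
  have hsm' : 4 * ((m : ℝ≥0∞) * n) * ((Real.exp (-x / 4)).toNNReal : ℝ≥0∞) ^ p *
      ENNReal.ofReal (1 / √L) * ENNReal.ofReal (√L * Real.exp (l ^ 3)) ≤
      ENNReal.ofReal (Real.exp (-2 * l - l ^ 2)) := by
    rw [mul_assoc, hzw]
    change 4 * ((m : ℝ≥0∞) * n) * (ENNReal.ofReal (Real.exp (-x / 4))) ^ p * _ ≤ _
    have e4 : 4 * ((m : ℝ≥0∞) * n) = ENNReal.ofReal (4 * (m * n)) := by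
      rw [ENNReal.ofReal_mul (by norm_num), ENNReal.ofReal_mul (by positivity)]
      simp
    rw [e4, ← ENNReal.ofReal_pow hδ0, ← ENNReal.ofReal_mul (by positivity),
      ← ENNReal.ofReal_mul (by positivity)]
    exact ENNReal.ofReal_le_ofReal hsm
  have main := offBoxInt_le_of_boxInt_le (measurable_normKernel lam)
    (normKernel_le_one (by linarith)) (d := β / 3) (δ := (Real.exp (-x / 4)).toNNReal)
    (fun u hu => normKernel_le_exp (by linarith) (by positivity) hx0 hx1 hxd u hu)
    (m := m) (n := n) (p := p) (R := min m n / 4) (by omega) (by omega) (by omega)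
    (ENNReal.ofReal (torusConst m n L * Real.exp (l ^ 2)))
    (ENNReal.ofReal (√L * Real.exp (l ^ 3))) (ENNReal.ofReal (1 / √L))
    (lintegral_normKernel_sq_le (by linarith))
    (fun r hr m' n' hm hn hmnr => by
      rw [← hd3]
      exact h.boxInt_normKernel_le hlam hm hn hmnr (by omega) (by omega))
    (by
      have := ENNReal.ofReal_le_ofReal h.crude_le
      rw [ENNReal.ofReal_mul (by positivity), ENNReal.ofReal_mul (by positivity),
        ENNReal.ofReal_pow (by positivity), ENNReal.ofReal_mul (by positivity),
        ENNReal.ofReal_pow (by positivity), ENNReal.ofReal_natCast, ENNReal.ofReal_natCast] at this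
      exact this)
    (hsm'.trans (by
      rw [← ENNReal.ofReal_one]
      apply ENNReal.ofReal_le_ofReal
      rw [Real.exp_le_one_iff]
      nlinarith))
  rw [← hd3] at main
  refine main.trans ((mul_le_mul_left hsm' _).trans ?_)
  rw [← ENNReal.ofReal_mul (Real.exp_nonneg _)]
  apply ENNReal.ofReal_le_ofReal
  rw [mul_left_comm, ← Real.exp_add]
  ring_nf
  exact le_rfl

end Regime

end OffBoxBound

section CountAsymptotics

open MeasureTheory
open scoped NNReal ENNReal

lemma norm_phase (m n : ℕ) (s t : ℤ) (p : (Fin m → UnitAddCircle) × (Fin n → UnitAddCircle)) :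
    ‖(∏ j, (fourier s (p.1 j) : ℂ)) * ∏ k, (fourier t (p.2 k) : ℂ)‖ = 1 := by
  have h1 : ∀ (a : ℤ) (x : UnitAddCircle), ‖(fourier a x : ℂ)‖ = 1 := fun a x => by
    rw [fourier_apply]; exact Circle.norm_coe _
  rw [norm_mul, norm_prod, norm_prod]
  simp only [h1, Finset.prod_const_one, mul_one]

lemma norm_geomKernel_le_one {lam : ℝ} (hlam : 0 ≤ lam) (u : UnitAddCircle) :
    ‖geomKernel lam u‖ ≤ 1 := by
  exact_mod_cast normKernel_le_one hlam u

lemma integrable_prod_mul_phase {K : UnitAddCircle → ℂ} (hK : Measurable K) (hK1 : ∀ u, ‖K u‖ ≤ 1)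
    (m n : ℕ) (s t : ℤ) :
    Integrable fun p : (Fin m → UnitAddCircle) × (Fin n → UnitAddCircle) =>
      (∏ i : Fin m × Fin n, K (p.1 i.1 + p.2 i.2)) *
        ((∏ j, fourier s (p.1 j)) * ∏ k, fourier t (p.2 k)) := by
  refine Integrable.of_bound (Measurable.aestronglyMeasurable ?_) 1 (.of_forall fun p => ?_)
  · refine Measurable.mul (Finset.measurable_prod _ fun i _ => hK.comp (by fun_prop)) ?_
    refine Continuous.measurable ?_
    fun_prop
  · rw [norm_mul, norm_phase, mul_one, norm_prod]
    exact Finset.prod_le_one (fun i _ => norm_nonneg _) fun i _ => hK1 _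

lemma enorm_integral_sub_le_offBoxInt {lam : ℝ} (hlam : 0 ≤ lam) (m n : ℕ) (s t : ℤ) (β : ℝ) :
    ‖(∫ p : (Fin m → UnitAddCircle) × (Fin n → UnitAddCircle),
        (∏ i : Fin m × Fin n, geomKernel lam (p.1 i.1 + p.2 i.2)) *
          ((∏ j, fourier s (p.1 j)) * ∏ k, fourier t (p.2 k))) -
      ∫ p : (Fin m → UnitAddCircle) × (Fin n → UnitAddCircle),
        (∏ i : Fin m × Fin n, truncKernel lam β (p.1 i.1 + p.2 i.2)) *
          ((∏ j, fourier s (p.1 j)) * ∏ k, fourier t (p.2 k))‖ₑ ≤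
      offBoxInt (normKernel lam) m n β := by
  rw [← integral_sub
    (integrable_prod_mul_phase (measurable_geomKernel lam) (norm_geomKernel_le_one hlam) m n s t)
    (integrable_prod_mul_phase (measurable_truncKernel lam β) (norm_truncKernel_le_one hlam β)
      m n s t)]
  refine (enorm_integral_le_lintegral_enorm _).trans ?_
  rw [offBoxInt, Measure.volume_eq_prod, lintegral_prod _ (by
    have h1 := (integrable_prod_mul_phase (measurable_geomKernel lam)
      (norm_geomKernel_le_one hlam) m n s t).aestronglyMeasurable
    have h2 := (integrable_prod_mul_phase (measurable_truncKernel lam β)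
      (norm_truncKernel_le_one hlam β) m n s t).aestronglyMeasurable
    exact (h1.sub h2).enorm)]
  refine lintegral_mono fun x => lintegral_mono fun y => ?_
  dsimp only
  rw [← sub_mul, enorm_mul]
  have hph := norm_phase m n s t (x, y)
  rw [show ‖(∏ j, (fourier s (x j) : ℂ)) * ∏ k, (fourier t (y k) : ℂ)‖ₑ = 1 by
    rw [← ofReal_norm, hph, ENNReal.ofReal_one], mul_one]
  by_cases hp : (x, y) ∈ torusBox m n β
  · have : ∏ i : Fin m × Fin n, geomKernel lam (x i.1 + y i.2) =
        ∏ i : Fin m × Fin n, truncKernel lam β (x i.1 + y i.2) := by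
      refine Finset.prod_congr rfl fun i _ => ?_
      rw [truncKernel, Set.indicator_of_mem (by exact hp i.1 i.2)]
    rw [this, sub_self, enorm_zero]
    exact zero_le
  · rw [Set.indicator_of_mem (by exact hp)]
    simp only [torusBox, Set.mem_ofPred_eq, not_forall] at hp
    obtain ⟨j, k, hjk⟩ := hp
    rw [Finset.prod_eq_zero (f := fun i : Fin m × Fin n => truncKernel lam β (x i.1 + y i.2))
      (Finset.mem_univ (j, k)) (Set.indicator_of_notMem (by exact hjk) _), sub_zero,
      ← ofReal_norm, norm_prod, ENNReal.ofReal_prod_of_nonneg fun i _ => norm_nonneg _,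
      Fintype.prod_prod_type]
    refine le_of_eq (Finset.prod_congr rfl fun j _ => Finset.prod_congr rfl fun k _ => ?_)
    rw [ofReal_norm]
    rfl

lemma matCount_eq_integral {lam : ℝ} (hlam : 0 < lam) (m s n t : ℕ) :
    (matCount m s n t : ℂ) = (((1 + lam) ^ (m * n) * ((1 + lam) / lam) ^ (m * s) : ℝ) : ℂ) *
      ∫ p : (Fin m → UnitAddCircle) × (Fin n → UnitAddCircle),
        (∏ i : Fin m × Fin n, geomKernel lam (p.1 i.1 + p.2 i.2)) *
          ((∏ j, fourier (-(s : ℤ)) (p.1 j)) * ∏ k, fourier (-(t : ℤ)) (p.2 k)) := by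
  have h1 : (1 + (lam : ℂ)) ≠ 0 := by exact_mod_cast (by linarith : 1 + lam ≠ 0)
  have h2 : (lam : ℂ) ≠ 0 := by exact_mod_cast hlam.ne'
  have key := fourier_identity_geom m s n t (lam / (1 + lam)) (by positivity)
    ((div_lt_one (by linarith)).2 (by linarith))
  have e : ∀ u : UnitAddCircle, (1 - ((lam / (1 + lam) : ℝ) : ℂ) * fourier 1 u)⁻¹ =
      (1 + lam) * geomKernel lam u := fun u => by
    rw [geomKernel, ← inv_inj, inv_inv, mul_inv, inv_inv]
    push_cast
    field_simp
  simp only [e, Finset.prod_mul_distrib, Finset.prod_const, Finset.card_univ, Fintype.card_prod,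
    Fintype.card_fin, mul_assoc] at key
  rw [integral_const_mul] at key
  push_cast at key ⊢
  rw [mul_right_comm, key, mul_assoc, ← mul_pow, div_mul_div_comm, mul_comm (lam : ℂ),
    div_self (mul_ne_zero h1 h2), one_pow, mul_one]

namespace Regime

variable {m n : ℕ} {l : ℝ}

theorem matCount_eq {lam : ℝ} (h : Regime m n l (lam * (1 + lam))) (hlam1 : 1 ≤ lam)
    {s t : ℕ} (hst : m * s = n * t) (hlam : lam = s / n)
    (hS : (n : ℝ) / m + m / n ≤ 2 * l) :
    ∃ ε : ℝ, |ε| ≤ 2 * (l ^ 85 / √n * Real.exp (5 / 6 * ((n : ℝ) / m + m / n))) ∧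
      (matCount m s n t : ℝ) = (1 + lam) ^ (m * n) * ((1 + lam) / lam) ^ (m * s) *
        (torusConst m n (lam * (1 + lam)) *
          Real.exp (1 / 2 - ((n : ℝ) / m + m / n) / 12)) * (1 + ε) := by
  have hl := h.l_ge
  have hm0 := h.m_pos
  have hn0 := h.n_pos
  have hsm := h.sqrt_m_pos
  have hsn := h.sqrt_n_pos
  have hL := Real.sqrt_pos.2 h.L_pos
  obtain ⟨ε, hε, hbox⟩ := h.torus_box_integral hlam1 hst hlam
  have hoff := (enorm_integral_sub_le_offBoxInt (by linarith : 0 ≤ lam) m n (-(s : ℤ)) (-(t : ℤ))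
    (l ^ 3 / √n / (2 * Real.pi * √(lam * (1 + lam))))).trans (h.offBoxInt_normKernel_le hlam1)
  have hT : 0 < torusConst m n (lam * (1 + lam)) := by rw [torusConst]; positivity
  rw [hbox] at hoff
  have hM := matCount_eq_integral (by linarith : 0 < lam) m s n t
  set G := ∫ p : (Fin m → UnitAddCircle) × (Fin n → UnitAddCircle),
        (∏ i : Fin m × Fin n, geomKernel lam (p.1 i.1 + p.2 i.2)) *
          ((∏ j, fourier (-(s : ℤ)) (p.1 j)) * ∏ k, fourier (-(t : ℤ)) (p.2 k)) with hG
  set S := (n : ℝ) / m + m / n with hSdef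
  have hS0 : 0 ≤ S := by positivity
  set T := torusConst m n (lam * (1 + lam)) with hTdef
  set B := T * Real.exp (1 / 2 - S / 12) with hB
  have hB0 : 0 < B := by positivity
  set A := (1 + lam) ^ (m * n) * ((1 + lam) / lam) ^ (m * s) with hA
  have hA0 : 0 < A := by positivity
  have hBC : (B : ℂ) ≠ 0 := by exact_mod_cast hB0.ne'
  rw [← ofReal_norm, ENNReal.ofReal_le_ofReal_iff (by positivity)] at hoff
  have hG1 : ‖G / B - 1‖ ≤ 2 * (l ^ 85 / √n * Real.exp (5 / 6 * S)) := by
    have e : G / B - 1 = (G - B * (1 + ε)) / B + ε := by field_simp; ring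
    have h1 : ‖(G - B * (1 + ε)) / B‖ ≤ l ^ 85 / √n * Real.exp (5 / 6 * S) := by
      rw [norm_div, Complex.norm_real, Real.norm_of_nonneg hB0.le, div_le_iff₀ hB0]
      refine hoff.trans ?_
      have h2 : Real.exp (-2 * l) ≤ 1 / √n * Real.exp (1 / 2 - S / 12) := by
        calc Real.exp (-2 * l) ≤ Real.exp (-l + (1 / 2 - S / 12)) := by gcongr; linarith
          _ = Real.exp (-l) * Real.exp (1 / 2 - S / 12) := Real.exp_add _ _
          _ ≤ _ := by gcongr; exact h.exp_neg_le
      have h3 : 1 / √(n : ℝ) ≤ l ^ 85 / √n * Real.exp (5 / 6 * S) := by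
        calc 1 / √(n : ℝ) ≤ l ^ 85 / √n := by
              gcongr; exact one_le_pow₀ (by linarith)
          _ ≤ _ := le_mul_of_one_le_right (by positivity) (Real.one_le_exp (by positivity))
      calc T * Real.exp (-2 * l) ≤ T * (1 / √n * Real.exp (1 / 2 - S / 12)) := by gcongr
        _ = 1 / √n * B := by rw [hB]; ring
        _ ≤ _ := by gcongr
    rw [e, two_mul]
    exact (norm_add_le _ _).trans (add_le_add h1 hε)
  refine ⟨(G / B - 1).re, (Complex.abs_re_le_norm _).trans hG1, ?_⟩
  have e1 : (matCount m s n t : ℂ) = ((A * B : ℝ) : ℂ) * (1 + (G / B - 1)) := by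
    rw [hM]; push_cast; field_simp; ring
  have e2 := congrArg Complex.re e1
  rw [Complex.re_ofReal_mul, Complex.natCast_re, Complex.add_re, Complex.one_re] at e2
  exact e2

end Regime

end CountAsymptotics

section StirlingCorrection

open Filter Topology Stirling

lemma log_stirlingSeq_le {k : ℕ} :
    Real.log (stirlingSeq (k + 1)) ≤ Real.log √Real.pi + 1 / (12 * ((k : ℝ) + 1)) := by
  have hmono : Monotone fun k : ℕ =>
      Real.log (stirlingSeq (k + 1)) - 1 / (12 * ((k : ℝ) + 1)) := by
    refine monotone_nat_of_le_succ fun k => ?_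
    have h := log_stirlingSeq_sdiff_le (k + 1)
    have e : 1 / (12 * ((k : ℝ) + 1)) - 1 / (12 * ((k : ℝ) + 1 + 1)) =
        1 / (12 * ((k : ℝ) + 1) * ((k : ℝ) + 1 + 1)) := by
      field_simp; ring
    push_cast at h ⊢
    linarith
  have hlim : Tendsto (fun k : ℕ => Real.log (stirlingSeq (k + 1)) - 1 / (12 * ((k : ℝ) + 1)))
      atTop (𝓝 (Real.log √Real.pi - 0)) := by
    refine Tendsto.sub ?_ ?_
    · exact ((Real.continuousAt_log (by positivity)).tendsto.comp
        tendsto_stirlingSeq_sqrt_pi).comp (tendsto_add_atTop_nat 1)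
    · have := (tendsto_one_div_add_atTop_nhds_zero_nat (𝕜 := ℝ)).mul_const (1 / 12)
      rw [zero_mul] at this
      refine this.congr fun k => ?_
      field_simp
  have := hmono.ge_of_tendsto hlim k
  linarith

lemma le_log_stirlingSeq {k : ℕ} :
    Real.log √Real.pi + 1 / (12 * ((k : ℝ) + 1) + 1) ≤ Real.log (stirlingSeq (k + 1)) := by
  have hanti : Antitone fun k : ℕ =>
      Real.log (stirlingSeq (k + 1)) - 1 / (12 * ((k : ℝ) + 1) + 1) := by
    refine antitone_nat_of_succ_le fun k => ?_
    have h := (log_stirlingSeq_sdiff_hasSum k).summable.sum_le_tsum (Finset.range 1)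
      (fun i _ => by positivity)
    rw [(log_stirlingSeq_sdiff_hasSum k).tsum_eq, Finset.sum_range_one] at h
    have e : 1 / (12 * ((k : ℝ) + 1) + 1) - 1 / (12 * ((k : ℝ) + 1 + 1) + 1) ≤
        1 / 3 * (1 / (2 * ((k : ℝ) + 1) + 1)) ^ 2 := by
      have : 1 / (12 * ((k : ℝ) + 1) + 1) - 1 / (12 * ((k : ℝ) + 1 + 1) + 1) =
          12 / ((12 * ((k : ℝ) + 1) + 1) * (12 * ((k : ℝ) + 1 + 1) + 1)) := by
        field_simp; ring
      rw [this, div_pow, one_pow, one_div_mul_one_div, div_le_div_iff₀ (by positivity)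
        (by positivity)]
      have hk : (0 : ℝ) ≤ k := k.cast_nonneg
      nlinarith
    norm_num at h
    push_cast
    have e2 : 1 / 3 * (1 / (2 * ((k : ℝ) + 1) + 1)) ^ 2 =
        1 / 3 * ((2 * ((k : ℝ) + 1) + 1) ^ 2)⁻¹ := by
      rw [one_div (2 * ((k : ℝ) + 1) + 1), inv_pow]
    rw [e2] at e
    linarith
  have hlim : Tendsto (fun k : ℕ => Real.log (stirlingSeq (k + 1)) - 1 / (12 * ((k : ℝ) + 1) + 1))
      atTop (𝓝 (Real.log √Real.pi - 0)) := by
    refine Tendsto.sub ?_ ?_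
    · exact ((Real.continuousAt_log (by positivity)).tendsto.comp
        tendsto_stirlingSeq_sqrt_pi).comp (tendsto_add_atTop_nat 1)
    · refine squeeze_zero (fun k => by positivity) (fun k => ?_)
        (tendsto_one_div_add_atTop_nhds_zero_nat (𝕜 := ℝ))
      apply one_div_le_one_div_of_le <;> nlinarith [(k.cast_nonneg : (0 : ℝ) ≤ k)]
  have := hanti.le_of_tendsto hlim k
  linarith

/-- Stirling's formula with its first correction term. -/
lemma abs_log_factorial_sub_le {n : ℕ} (hn : 0 < n) :
    |Real.log n.factorial - (n * Real.log n - n + Real.log (2 * Real.pi) / 2 + Real.log n / 2 +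
      1 / (12 * n))| ≤ 1 / (n : ℝ) ^ 2 := by
  obtain ⟨k, rfl⟩ := Nat.exists_eq_succ_of_ne_zero hn.ne'
  have h1 := log_stirlingSeq_le (k := k)
  have h2 := le_log_stirlingSeq (k := k)
  have hf := log_stirlingSeq_formula (k + 1)
  have hN : (0 : ℝ) < ((k + 1 : ℕ) : ℝ) := by positivity
  rw [← Nat.succ_eq_add_one] at *
  have hN1 : ((k.succ : ℕ) : ℝ) = (k : ℝ) + 1 := by push_cast; ring
  rw [← hN1] at h1 h2
  set N := ((k.succ : ℕ) : ℝ)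
  rw [Real.log_mul (by norm_num) hN.ne', Real.log_div hN.ne' (Real.exp_ne_zero _),
    Real.log_exp] at hf
  rw [Real.log_sqrt Real.pi_pos.le] at h1 h2
  rw [Real.log_mul (by norm_num) Real.pi_ne_zero]
  have e : 1 / (12 * N) - 1 / (12 * N + 1) ≤ 1 / N ^ 2 := by
    have : 1 / (12 * N) - 1 / (12 * N + 1) = 1 / (12 * N * (12 * N + 1)) := by
      field_simp; ring
    rw [this]
    apply one_div_le_one_div_of_le (by positivity)
    nlinarith
  have e0 : 0 ≤ 1 / N ^ 2 := by positivity
  rw [abs_le]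
  constructor <;> nlinarith

end StirlingCorrection

section EntropyExpansion

lemma abs_log_one_add_sub_le {u : ℝ} (hu : 0 < u) (hu1 : u ≤ 1 / 3) :
    |Real.log (1 + u) - (u - u ^ 2 / 2)| ≤ 3 / 2 * u ^ 3 ∧
      |Real.log (1 - u) - (-u - u ^ 2 / 2)| ≤ 3 / 2 * u ^ 3 := by
  have hb : u ^ 3 / (1 - u) ≤ 3 / 2 * u ^ 3 := by
    rw [div_le_iff₀ (by linarith)]
    nlinarith [pow_pos hu 3]
  have h1 := Real.abs_log_sub_add_sum_range_le (x := -u) (by rw [abs_neg, abs_of_pos hu]; linarith) 2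
  have h2 := Real.abs_log_sub_add_sum_range_le (x := u) (by rw [abs_of_pos hu]; linarith) 2
  rw [abs_neg, abs_of_pos hu] at h1
  rw [abs_of_pos hu] at h2
  norm_num [Finset.sum_range_succ] at h1 h2
  constructor
  · refine le_trans (le_of_eq ?_) (h1.trans hb)
    congr 1; ring
  · refine le_trans (le_of_eq ?_) (h2.trans hb)
    congr 1; ring

/-- Comparison of the entropy of the geometric distribution with mean `lam` with
`log (lam + 1 / 2) + 1`. -/
lemma abs_entropy_sub_le {lam : ℝ} (hlam : 1 ≤ lam) :
    |(1 + lam) * Real.log (1 + lam) - lam * Real.log lam - (Real.log (lam + 1 / 2) + 1)| ≤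
      1 / lam ^ 2 ∧
    |Real.log (lam + 1 / 2) - 1 / 2 * Real.log (lam * (1 + lam))| ≤ 1 / lam ^ 2 := by
  set ν := lam + 1 / 2 with hν
  have hν0 : 0 < ν := by linarith
  obtain ⟨u, hu⟩ : ∃ u, u = 1 / (2 * ν) := ⟨_, rfl⟩
  have hu0 : 0 < u := by rw [hu]; positivity
  have hu1 : u ≤ 1 / 3 := by
    rw [hu]; apply one_div_le_one_div_of_le (by norm_num); linarith
  have huν : u * ν = 1 / 2 := by rw [hu]; field_simp
  have hu2 : 4 * u ^ 2 ≤ 1 / lam ^ 2 := by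
    rw [hu, le_div_iff₀ (by positivity)]
    have : lam ^ 2 ≤ ν ^ 2 := by gcongr; linarith
    calc 4 * (1 / (2 * ν)) ^ 2 * lam ^ 2 = lam ^ 2 / ν ^ 2 := by field_simp; ring
      _ ≤ 1 := by rw [div_le_one (by positivity)]; exact this
  have l1 : Real.log (1 + lam) = Real.log ν + Real.log (1 + u) := by
    rw [← Real.log_mul hν0.ne' (by linarith)]
    congr 1; linarith
  have l2 : Real.log lam = Real.log ν + Real.log (1 - u) := by
    rw [← Real.log_mul hν0.ne' (by linarith)]
    congr 1; linarith
  obtain ⟨h1, h2⟩ := abs_log_one_add_sub_le hu0 hu1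
  have hu3 : u ^ 3 ≤ u ^ 2 / 3 := by nlinarith [sq_nonneg u]
  rw [abs_le] at h1 h2
  set x := Real.log (1 + u)
  set y := Real.log (1 - u)
  have hx : ν * x - ν * y - 1 ≤ 3 / 2 * u ^ 2 ∧ -(3 / 2 * u ^ 2) ≤ ν * x - ν * y - 1 := by
    have e : ν * (2 * u) = 1 := by linarith
    have e3 : ν * u ^ 3 = u ^ 2 / 2 := by
      calc ν * u ^ 3 = (u * ν) * u ^ 2 := by ring
        _ = _ := by rw [huν]; ring
    constructor
    · have := mul_le_mul_of_nonneg_left (show x - y ≤ 2 * u + 3 * u ^ 3 by linarith) hν0.le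
      nlinarith
    · have := mul_le_mul_of_nonneg_left (show 2 * u - 3 * u ^ 3 ≤ x - y by linarith) hν0.le
      nlinarith
  constructor
  · have e : (1 + lam) * Real.log (1 + lam) - lam * Real.log lam - (Real.log ν + 1) =
        (ν * x - ν * y - 1) + (x + y) / 2 := by
      rw [l1, l2, show lam = ν - 1 / 2 by rw [hν]; ring]; ring
    rw [e, abs_le]
    constructor <;> linarith
  · rw [Real.log_mul (by linarith) (by linarith), l1, l2, abs_le]
    constructor <;> linarith

end EntropyExpansion

section Assembly

lemma abs_error_sum_le {m n δ X Y Z₁ Z₂ Z₃ D : ℝ} (hm : 1 ≤ m) (hn : 1 ≤ n)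
    (hX : |X| ≤ δ) (hY : |Y| ≤ δ) (hZ₁ : |Z₁| ≤ 1 / m ^ 2) (hZ₂ : |Z₂| ≤ 1 / n ^ 2)
    (hZ₃ : |Z₃| ≤ 1 / (m * n) ^ 2)
    (hD : D = m * n * X + (m + n - 1) * Y + n * Z₁ + m * Z₂ - Z₃ - 1 / (12 * (m * n))) :
    |D| ≤ 2 * (m * n * δ) + (n / m ^ 2 + m / n ^ 2 + 2 / (m * n)) := by
  have hm0 : 0 < m := by linarith
  have hn0 : 0 < n := by linarith
  have hmn0 : 0 < m * n := by positivity
  have hmn1 : 1 ≤ m * n := one_le_mul_of_one_le_of_one_le hm hn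
  have hδ : 0 ≤ δ := (abs_nonneg X).trans hX
  have k1 : |m * n * X| ≤ m * n * δ := by
    rw [abs_mul, abs_of_pos hmn0]
    exact mul_le_mul_of_nonneg_left hX hmn0.le
  have k2 : |(m + n - 1) * Y| ≤ m * n * δ := by
    rw [abs_mul, abs_of_pos (by linarith)]
    exact mul_le_mul (by nlinarith) hY (abs_nonneg _) hmn0.le
  have k3 : |n * Z₁| ≤ n / m ^ 2 := by
    rw [abs_mul, abs_of_pos hn0, ← mul_one_div]
    exact mul_le_mul_of_nonneg_left hZ₁ hn0.le
  have k4 : |m * Z₂| ≤ m / n ^ 2 := by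
    rw [abs_mul, abs_of_pos hm0, ← mul_one_div]
    exact mul_le_mul_of_nonneg_left hZ₂ hm0.le
  have k5 : |Z₃| ≤ 1 / (m * n) :=
    hZ₃.trans (one_div_le_one_div_of_le hmn0 (by nlinarith))
  have k6 : 1 / (12 * (m * n)) ≤ 1 / (m * n) :=
    one_div_le_one_div_of_le hmn0 (by linarith)
  have k7 : 0 ≤ 1 / (12 * (m * n)) := by positivity
  have k8 : 2 / (m * n) = 1 / (m * n) + 1 / (m * n) := by ring
  rw [abs_le] at k1 k2 k3 k4 k5
  rw [hD, abs_le]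
  constructor <;> linarith

lemma log_torusConst {m n : ℕ} (hm : 0 < m) (hn : 0 < n) {L : ℝ} (hL : 0 < L) :
    Real.log (torusConst m n L) =
      Real.log (2 * Real.pi) / 2 + Real.log m / 2 + Real.log n / 2 -
        m * (Real.log (2 * Real.pi) / 2 + Real.log n / 2) -
        n * (Real.log (2 * Real.pi) / 2 + Real.log m / 2) + Real.log L / 2 -
        (m + n) * (Real.log L / 2) := by
  have hsqm : 0 < √(m : ℝ) := Real.sqrt_pos.2 (by exact_mod_cast hm)
  have hsqn : 0 < √(n : ℝ) := Real.sqrt_pos.2 (by exact_mod_cast hn)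
  have hsqL : 0 < √L := Real.sqrt_pos.2 hL
  have hsqP : 0 < √(2 * Real.pi) := Real.sqrt_pos.2 (by positivity)
  rw [torusConst, Real.log_mul (by positivity) (by positivity),
    Real.log_mul (by positivity) (by positivity), Real.log_mul (by positivity) (by positivity),
    Real.log_mul (by positivity) (by positivity), Real.log_mul (by positivity) (by positivity),
    Real.log_mul (by positivity) (by positivity), Real.log_pow, Real.log_pow, Real.log_pow,
    Real.log_inv, Real.log_inv, Real.log_inv, Real.log_mul (by positivity) (by positivity),
    Real.log_mul (by positivity) (by positivity), Real.log_sqrt (by positivity),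
    Real.log_sqrt (by positivity), Real.log_sqrt (by positivity), Real.log_sqrt hL.le]
  push_cast
  ring

/-- The saddle-point approximation, in logarithmic form, agrees with the factorial formula. -/
lemma abs_log_saddle_sub_log_factorial_le {m n s : ℕ} (hm : 0 < m) (hn : 0 < n) {lam : ℝ}
    (hlam1 : 1 ≤ lam) (hlam : lam = s / n) :
    |Real.log ((1 + lam) ^ (m * n) * ((1 + lam) / lam) ^ (m * s) *
        (torusConst m n (lam * (1 + lam)) *
          Real.exp (1 / 2 - ((n : ℝ) / m + m / n) / 12))) -
      Real.log ((lam + 1 / 2) ^ ((m - 1) * (n - 1)) * ((m * n).factorial : ℝ) /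
        ((m.factorial : ℝ) ^ n * (n.factorial : ℝ) ^ m)) - 1 / 2| ≤
      2 * ((m : ℝ) * n / lam ^ 2) + (n / (m : ℝ) ^ 2 + m / (n : ℝ) ^ 2 + 2 / (m * n)) := by
  have hm0 : (0 : ℝ) < m := by exact_mod_cast hm
  have hn0 : (0 : ℝ) < n := by exact_mod_cast hn
  have hm1 : (1 : ℝ) ≤ m := by exact_mod_cast hm
  have hn1 : (1 : ℝ) ≤ n := by exact_mod_cast hn
  have hl0 : 0 < lam := by linarith
  have hl1 : 0 < 1 + lam := by linarith
  have hL0 : 0 < lam * (1 + lam) := by positivity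
  have hs : (s : ℝ) = lam * n := by rw [hlam]; field_simp
  have f3 := abs_log_factorial_sub_le (Nat.mul_pos hm hn)
  obtain ⟨g1, g2⟩ := abs_entropy_sub_le hlam1
  rw [Nat.cast_mul, Real.log_mul hm0.ne' hn0.ne'] at f3
  have hT0 : 0 < torusConst m n (lam * (1 + lam)) := by
    have := Real.sqrt_pos.2 hL0
    rw [torusConst]; positivity
  rw [Real.log_mul (by positivity) (by positivity), Real.log_mul (by positivity) (by positivity),
    Real.log_mul (by positivity) (by positivity), Real.log_exp,
    Real.log_pow, Real.log_pow, Real.log_div hl1.ne' hl0.ne',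
    Real.log_div (by positivity) (by positivity),
    Real.log_mul (by positivity) (by positivity), Real.log_pow,
    Real.log_mul (by positivity) (by positivity), Real.log_pow, Real.log_pow,
    log_torusConst hm hn hL0]
  push_cast [Nat.cast_sub (show 1 ≤ m from hm), Nat.cast_sub (show 1 ≤ n from hn)]
  rw [hs, ← mul_one_div ((m : ℝ) * n) (lam ^ 2)]
  refine abs_error_sum_le hm1 hn1 g1 g2 (abs_log_factorial_sub_le hm)
    (abs_log_factorial_sub_le hn) f3 ?_
  have c1 : (n : ℝ) * (1 / (12 * m)) = n / m / 12 := by field_simp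
  have c2 : (m : ℝ) * (1 / (12 * n)) = m / n / 12 := by field_simp
  linear_combination c1 + c2

/-- For `n` large in terms of the parameters the hypotheses of `Regime` and the final error
estimate hold. -/
lemma eventually_error_small {a b : ℝ} (hab : a + b < 1 / 2) (hb : 0 < b) :
    ∀ᶠ n : ℕ in Filter.atTop, 10000 * cD ≤ Real.log n ∧ Real.log n ^ 200 ≤ n ∧
      Real.log n ^ 85 / √n * (n : ℝ) ^ a ≤ (n : ℝ) ^ (-b) ∧ (n : ℝ) ^ (-b) ≤ 1 / 4 := by
  have hreal : ∀ᶠ x : ℝ in Filter.atTop, 10000 * cD ≤ Real.log x ∧ Real.log x ^ 200 ≤ x ∧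
      Real.log x ^ 85 / √x * x ^ a ≤ x ^ (-b) ∧ x ^ (-b) ≤ 1 / 4 := by
    have h1 := Real.tendsto_log_atTop.eventually_ge_atTop (10000 * cD)
    have h2 := (isLittleO_log_rpow_rpow_atTop 200 one_pos).bound one_pos
    have h3 := (isLittleO_log_rpow_rpow_atTop 85 (sub_pos.2 hab)).bound one_pos
    have h4 := (tendsto_rpow_neg_atTop hb).eventually_le_const (show (0 : ℝ) < 1 / 4 by norm_num)
    filter_upwards [h1, h2, h3, h4, Filter.eventually_ge_atTop 1] with x h1 h2 h3 h4 hx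
    have hx0 : 0 < x := by linarith
    have hl := Real.log_nonneg hx
    have r200 : Real.log x ^ (200 : ℝ) = Real.log x ^ (200 : ℕ) := Real.rpow_ofNat _ _
    have r85 : Real.log x ^ (85 : ℝ) = Real.log x ^ (85 : ℕ) := Real.rpow_ofNat _ _
    rw [Real.rpow_one, Real.norm_of_nonneg (Real.rpow_nonneg hl _), Real.norm_of_nonneg hx0.le,
      one_mul, r200] at h2
    rw [Real.norm_of_nonneg (Real.rpow_nonneg hl _), Real.norm_of_nonneg
      (Real.rpow_nonneg hx0.le _), one_mul, r85] at h3
    refine ⟨h1, h2, ?_, h4⟩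
    calc Real.log x ^ 85 / √x * x ^ a ≤ x ^ (1 / 2 - (a + b)) / √x * x ^ a := by gcongr
      _ = x ^ (-b) := by
        rw [Real.sqrt_eq_rpow, ← Real.rpow_sub hx0, ← Real.rpow_add hx0]
        ring_nf
  exact tendsto_natCast_atTop_atTop.eventually hreal

lemma abs_log_one_add_le {x : ℝ} (hx : |x| ≤ 1 / 2) : |Real.log (1 + x)| ≤ 2 * |x| := by
  have h := Real.abs_log_sub_add_sum_range_le (x := -x) (by rw [abs_neg]; linarith) 0
  simp only [Finset.range_zero, Finset.sum_empty, zero_add, sub_neg_eq_add, pow_one, abs_neg] at h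
  refine h.trans ?_
  rw [div_le_iff₀ (by linarith)]
  nlinarith [abs_nonneg x]

namespace Regime

variable {m n : ℕ} {l L : ℝ}

lemma stirling_error_le (h : Regime m n l L) :
    n / (m : ℝ) ^ 2 + m / (n : ℝ) ^ 2 + 2 / (m * n) ≤ l ^ 85 / √n := by
  have hl := h.l_ge
  have hm0 := h.m_pos
  have hn0 := h.n_pos
  have hs := h.sqrt_n_pos
  have hm1 : (1 : ℝ) ≤ m := by exact_mod_cast (by exact_mod_cast hm0 : 0 < m)
  have hn1 : (1 : ℝ) ≤ n := by exact_mod_cast (by exact_mod_cast hn0 : 0 < n)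
  have hsn : 1 / (n : ℝ) ≤ 1 / √n := by
    apply one_div_le_one_div_of_le hs
    rw [Real.sqrt_le_left hn0.le]; nlinarith
  have e1 : n / (m : ℝ) ^ 2 ≤ l ^ 2 * (1 / n) := by
    rw [mul_one_div, div_le_div_iff₀ (by positivity) hn0]
    calc (n : ℝ) * n ≤ (m * l) * (m * l) := by have := h.n_le; gcongr
      _ = _ := by ring
  have e2 : m / (n : ℝ) ^ 2 ≤ l * (1 / n) := by
    rw [mul_one_div, div_le_div_iff₀ (by positivity) hn0]
    calc (m : ℝ) * n ≤ (n * l) * n := by have := h.m_le; gcongr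
      _ = _ := by ring
  have e3 : 2 / ((m : ℝ) * n) ≤ 2 * (1 / n) := by
    rw [mul_one_div]
    gcongr
    nlinarith
  have h2 : l ^ 3 ≤ l ^ 85 := pow_le_pow_right₀ (by linarith) (by norm_num)
  calc _ ≤ (l ^ 2 + l + 2) * (1 / n) := by linarith
    _ ≤ l ^ 85 * (1 / √n) := by
      gcongr
      nlinarith
    _ = _ := by ring

end Regime

end Assembly

/-- Corollary 1 of the paper: under the hypotheses of Theorem 1, and if furthermore
`mn/λ² ≤ 1` (`λ = s/n = t/m`), then
`M(m,s;n,t) = (λ + 1/2)^{(m−1)(n−1)} (mn)!/(m!^n n!^m) exp(1/2 + O(mn/λ² + n^{−b}))`. -/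
theorem stmt_2 (a b : ℝ) (ha : 0 < a) (hb : 0 < b) (hab : a + b < 1 / 2) :
    ∃ C : ℝ, 0 < C ∧ ∃ N₀ : ℕ, ∀ m s n t : ℕ,
      0 < m → 0 < s → 0 < n → 0 < t → N₀ ≤ m → N₀ ≤ n → m * s = n * t →
      (1 + 2 * ((s : ℝ) / n)) ^ 2 / (4 * ((s : ℝ) / n) * (1 + (s : ℝ) / n))
          * (1 + 5 * (m : ℝ) / (6 * n) + 5 * (n : ℝ) / (6 * m)) ≤ a * Real.log n →
      (m : ℝ) * n / ((s : ℝ) / n) ^ 2 ≤ 1 →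
      ∃ E : ℝ, |E| ≤ C * ((m : ℝ) * n / ((s : ℝ) / n) ^ 2 + (n : ℝ) ^ (-b)) ∧
        (matCount m s n t : ℝ)
          = ((s : ℝ) / n + 1 / 2) ^ ((m - 1) * (n - 1))
              * ((m * n).factorial : ℝ)
              / ((m.factorial : ℝ) ^ n * (n.factorial : ℝ) ^ m)
              * Real.exp (1 / 2 + E) := by
  obtain ⟨N₀, hN₀⟩ := Filter.eventually_atTop.1 (eventually_error_small hab hb)
  refine ⟨5, by norm_num, N₀, ?_⟩
  intro m s n t hm hs hn ht _ hNn hst hdens hmn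
  obtain ⟨hlarge, hpow, herr, hsmall⟩ := hN₀ n hNn
  have hm0 : (0 : ℝ) < m := by exact_mod_cast hm
  have hn0 : (0 : ℝ) < n := by exact_mod_cast hn
  have hs0 : (0 : ℝ) < s := by exact_mod_cast hs
  have hm1 : (1 : ℝ) ≤ m := by exact_mod_cast hm
  have hn1 : (1 : ℝ) ≤ n := by exact_mod_cast hn
  obtain ⟨lam, hlam⟩ : ∃ lam : ℝ, lam = s / n := ⟨_, rfl⟩
  rw [← hlam] at hdens hmn ⊢
  have hlam0 : 0 < lam := by rw [hlam]; positivity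
  obtain ⟨l, hl⟩ : ∃ l, l = Real.log n := ⟨_, rfl⟩
  rw [← hl] at hlarge hpow herr hdens
  have hl0 : 0 < l := by linarith [one_le_cD]
  have hmn' : (m : ℝ) * n ≤ lam ^ 2 := by rwa [div_le_one (by positivity)] at hmn
  have hlam1 : 1 ≤ lam := by
    have : 1 ≤ lam ^ 2 := (one_le_mul_of_one_le_of_one_le hm1 hn1).trans hmn'
    nlinarith
  obtain ⟨S, hS⟩ : ∃ S, S = (n : ℝ) / m + m / n := ⟨_, rfl⟩
  have hS5 : 1 + 5 / 6 * S ≤ a * l := by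
    refine le_trans ?_ hdens
    have h1 : 1 ≤ (1 + 2 * lam) ^ 2 / (4 * lam * (1 + lam)) := by
      rw [one_le_div (by positivity)]; nlinarith
    have h2 : 1 + 5 * (m : ℝ) / (6 * n) + 5 * (n : ℝ) / (6 * m) = 1 + 5 / 6 * S := by
      rw [hS]; field_simp; ring
    rw [h2]
    have : 0 ≤ 1 + 5 / 6 * S := by rw [hS]; positivity
    nlinarith
  have hS1 : S ≤ l := by nlinarith
  have h : Regime m n l (lam * (1 + lam)) :=
    { log_eq := hl
      large := hlarge
      pow_le := hpow
      m_le := by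
        have : (m : ℝ) / n ≤ l := by
          have : 0 ≤ (n : ℝ) / m := by positivity
          linarith
        rwa [div_le_iff₀ hn0, mul_comm] at this
      n_le := by
        have : (n : ℝ) / m ≤ l := by
          have : 0 ≤ (m : ℝ) / n := by positivity
          linarith
        rwa [div_le_iff₀ hm0, mul_comm] at this
      le_L := by nlinarith }
  have hexp : l ^ 85 / √n * Real.exp (5 / 6 * S) ≤ (n : ℝ) ^ (-b) := by
    refine le_trans ?_ herr
    rw [Real.rpow_def_of_pos hn0, ← hl, mul_comm l a]
    exact mul_le_mul_of_nonneg_left (Real.exp_le_exp.2 (by linarith)) (by positivity)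
  obtain ⟨ε, hε, hM⟩ := h.matCount_eq hlam1 hst hlam (by rw [← hS]; linarith)
  have hst' := h.stirling_error_le
  have hcmp := abs_log_saddle_sub_log_factorial_le hm hn hlam1 hlam
  rw [← hS] at hε hM hcmp
  have hS0 : 0 ≤ S := by rw [hS]; positivity
  have hst'' : l ^ 85 / √n ≤ (n : ℝ) ^ (-b) :=
    le_trans (le_mul_of_one_le_right (by positivity) (Real.one_le_exp (by positivity))) hexp
  have hε' : |ε| ≤ 2 * (n : ℝ) ^ (-b) := by linarith
  have hlog := abs_log_one_add_le (x := ε) (by linarith)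
  have hε0 : 0 < 1 + ε := by
    have := abs_le.1 (show |ε| ≤ 1 / 2 by linarith)
    linarith
  have hL0 : 0 < lam * (1 + lam) := by positivity
  have hT0 : 0 < torusConst m n (lam * (1 + lam)) := by
    have := h.sqrt_m_pos
    have := h.sqrt_n_pos
    have := Real.sqrt_pos.2 hL0
    rw [torusConst]; positivity
  set A := (1 + lam) ^ (m * n) * ((1 + lam) / lam) ^ (m * s) *
    (torusConst m n (lam * (1 + lam)) * Real.exp (1 / 2 - S / 12)) with hA
  have hA0 : 0 < A := by positivity
  set Z := (lam + 1 / 2) ^ ((m - 1) * (n - 1)) * ((m * n).factorial : ℝ) /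
    ((m.factorial : ℝ) ^ n * (n.factorial : ℝ) ^ m) with hZ
  have hZ0 : 0 < Z := by positivity
  refine ⟨Real.log A - Real.log Z - 1 / 2 + Real.log (1 + ε), ?_, ?_⟩
  · have hq : 0 ≤ (m : ℝ) * n / lam ^ 2 := by positivity
    refine (abs_add_le _ _).trans ?_
    linarith
  · rw [hM, show 1 / 2 + (Real.log A - Real.log Z - 1 / 2 + Real.log (1 + ε)) =
      Real.log A - Real.log Z + Real.log (1 + ε) by ring, Real.exp_add, Real.exp_sub,
      Real.exp_log hA0, Real.exp_log hZ0, Real.exp_log hε0]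
    field_simp
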